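/- Assume in addition that |f₊'''(x)| ≤ δ₃ x^{λ−1} on [0,l₊] for some δ₃ > 0. Then there exist positive constants δ̃₀ and C₃, both depending only on γ, m, λ, δ₁, δ₂, δ₃, such that if 0 < l₊ ≤ δ̃₀ then there exist Q₊ ∈ C([0,l₊]) with c_* ≤ Q₊ ≤ (c_* + q_max)/2 and a solution Q ∈ C^{1,1}([0,ζ₊]×[0,m]) of the sonic–supersonic problem with data Q₊ satisfying Q₊(x) = A₊⁻¹(Q(Φ₊(x), m)), the first-order bounds −C₂φ^{λ+2} ≤ Q ≤ −C₁φ^{λ+2}, −C₂φ^{λ+1} ≤ Q_φ ≤ −C₁φ^{λ+1}, |Q_ψ| ≤ C₂φ^{3λ/2+1} on (0,ζ₊)×(0,m) for some 0 < C₁ ≤ C₂ depending only on γ, m, λ, δ₁, δ₂, and the second-order bounds |Q_{φφ}(φ,ψ)| ≤ C₃φ^{λ}, |Q_{φψ}(φ,ψ)| ≤ C₃φ^{5λ/4+1/2}, |Q_{ψψ}(φ,ψ)| ≤ C₃φ^{3λ/2+1} on (0,ζ₊)×(0,m). -/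

import Mathlib

open Real Set MeasureTheory Filter

noncomputable section

/-- The density function `ρ(t) = (1 − ((γ−1)/2) t)^{1/(γ−1)}`. -/
def rhoF (γ t : ℝ) : ℝ := (1 - (γ - 1) / 2 * t) ^ ((1 : ℝ) / (γ - 1))

/-- The critical (sonic) speed `c_* = (2/(γ+1))^{1/2}`. -/
def cstar (γ : ℝ) : ℝ := Real.sqrt (2 / (γ + 1))

/-- The maximal speed `q_max = (2/(γ−1))^{1/2}`. -/
def qmaxF (γ : ℝ) : ℝ := Real.sqrt (2 / (γ - 1))

/-- `A(q) = ∫_{c_*}^q (ρ(s²)+2s²ρ'(s²))/(s ρ(s²)²) ds`. -/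
def Afun (γ q : ℝ) : ℝ :=
  ∫ s in (cstar γ)..q,
    (rhoF γ (s ^ 2) + 2 * s ^ 2 * deriv (rhoF γ) (s ^ 2)) / (s * (rhoF γ (s ^ 2)) ^ 2)

/-- `B(q) = ∫_{c_*}^q ρ(s²)/s ds`. -/
def Bfun (γ q : ℝ) : ℝ := ∫ s in (cstar γ)..q, rhoF γ (s ^ 2) / s

/-- Inverse of `A` restricted to `[c_*, q_max)`. -/
def AplusInv (γ : ℝ) : ℝ → ℝ := Function.invFunOn (Afun γ) (Ico (cstar γ) (qmaxF γ))

/-- `K(s) = B(A₊⁻¹(s))`. -/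
def Kfun (γ s : ℝ) : ℝ := Bfun γ (AplusInv γ s)

/-- `b(s) = −K'(s)`. -/
def bfun (γ s : ℝ) : ℝ := -deriv (Kfun γ) s

/-- `p(s) = −K''(s)`. -/
def pfun (γ s : ℝ) : ℝ := -deriv (deriv (Kfun γ)) s

/-- Partial derivative in the first (potential) variable. -/
def pdx (u : ℝ × ℝ → ℝ) (p : ℝ × ℝ) : ℝ := deriv (fun x => u (x, p.2)) p.1

/-- Partial derivative in the second (stream) variable. -/
def pdy (u : ℝ × ℝ → ℝ) (p : ℝ × ℝ) : ℝ := deriv (fun y => u (p.1, y)) p.2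

/-- The Chaplygin equation (⋆) at a point. -/
def chap (γ : ℝ) (q : ℝ × ℝ → ℝ) (p : ℝ × ℝ) : Prop :=
  pdx (pdx fun z => Afun γ (q z)) p + pdy (pdy fun z => Bfun γ (q z)) p = 0

/-- Flow angle on the upper wall of the divergent part. -/
def ThP (f : ℝ → ℝ) (x : ℝ) : ℝ := Real.arctan (deriv f x)

/-- The potential on the upper wall: `Φ₊(x) = ∫₀ˣ Q₊(s)/cos Θ₊(s) ds`. -/
def PhiP (f Qp : ℝ → ℝ) (x : ℝ) : ℝ := ∫ s in (0 : ℝ)..x, Qp s / Real.cos (ThP f s)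

/-- The potential extent `ζ₊ = Φ₊(l₊)`. -/
def zetaP (f Qp : ℝ → ℝ) (l : ℝ) : ℝ := PhiP f Qp l

/-- `X₊ = Φ₊⁻¹`. -/
def XP (f Qp : ℝ → ℝ) (l : ℝ) : ℝ → ℝ := Function.invFunOn (PhiP f Qp) (Icc 0 l)

/-- The geometric hypotheses on the divergent part of the nozzle wall. -/
def NozzlePlus (lamp δ1 δ2 l : ℝ) (f : ℝ → ℝ) : Prop :=
  ContDiff ℝ 3 f ∧ (∀ x ∈ Icc (0 : ℝ) l, 0 < f x) ∧ deriv f 0 = 0 ∧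
  (∀ x ∈ Icc (0 : ℝ) l,
    δ1 * x ^ lamp ≤ deriv (deriv f) x ∧ deriv (deriv f) x ≤ δ2 * x ^ lamp ∧
    0 ≤ deriv (deriv (deriv f)) x)

/-- A weak solution of the sonic–supersonic problem with boundary speed `Q₊`. -/
def SupersonicWeakSol (γ m l : ℝ) (f Qp : ℝ → ℝ) (Q : ℝ × ℝ → ℝ) : Prop :=
  (∃ L : NNReal, LipschitzOnWith L Q (Icc 0 (zetaP f Qp l) ×ˢ Icc 0 m)) ∧
  (∀ p ∈ Icc (0 : ℝ) (zetaP f Qp l) ×ˢ Icc (0 : ℝ) m, Q p ≤ 0) ∧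
  (∀ ψ ∈ Ioo (0 : ℝ) m, Q (0, ψ) = 0) ∧
  ∀ ξ : ℝ × ℝ → ℝ, ContDiff ℝ 1 ξ →
    (∀ ψ ∈ Ioo (0 : ℝ) m, ξ (zetaP f Qp l, ψ) = 0) →
    (∫ p in Ioo (0 : ℝ) (zetaP f Qp l) ×ˢ Ioo (0 : ℝ) m,
        (pdx Q p * pdx ξ p - bfun γ (Q p) * pdy Q p * pdy ξ p))
    - (∫ φ in Ioo (0 : ℝ) (zetaP f Qp l),
        deriv (ThP f) (XP f Qp l φ) * Real.cos (ThP f (XP f Qp l φ)) /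
          AplusInv γ (Q (φ, m)) * ξ (φ, m)) = 0



namespace Nozzle

/-- monotonicity from a nonnegative one-variable derivative on a closed interval. -/
lemma mono_of_deriv {f f' : ℝ → ℝ} {a b : ℝ}
    (h : ∀ t ∈ Icc a b, HasDerivWithinAt f (f' t) (Icc a b) t)
    (h0 : ∀ t ∈ Icc a b, 0 ≤ f' t) : MonotoneOn f (Icc a b) := by
  refine monotoneOn_of_hasDerivWithinAt_nonneg (f' := f') (convex_Icc a b)
    (fun t ht => (h t ht).continuousWithinAt) ?_ ?_
  · intro t ht
    exact (h t (interior_subset ht)).mono interior_subset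
  · intro t ht
    exact h0 t (interior_subset ht)

/-- comparison of increments from comparison of derivatives. -/
lemma incr_le {f f' h h' : ℝ → ℝ} {a b : ℝ} (hab : a ≤ b)
    (hf : ∀ t ∈ Icc a b, HasDerivWithinAt f (f' t) (Icc a b) t)
    (hh : ∀ t ∈ Icc a b, HasDerivWithinAt h (h' t) (Icc a b) t)
    (hle : ∀ t ∈ Icc a b, f' t ≤ h' t) : f b - f a ≤ h b - h a := by
  have := mono_of_deriv (f := fun t => h t - f t) (f' := fun t => h' t - f' t) (a := a) (b := b)
    (fun t ht => (hh t ht).sub (hf t ht)) (fun t ht => sub_nonneg.2 (hle t ht))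
    (left_mem_Icc.2 hab) (right_mem_Icc.2 hab) hab
  simp only at this
  linarith

/-- Hypotheses on the speed field. -/
structure FlowHyp (L m B : ℝ) (S Sx : ℝ → ℝ → ℝ) : Prop where
  hm : 0 < m
  contS : ContinuousOn (fun p : ℝ × ℝ => S p.1 p.2) (Ioo 0 L ×ˢ Icc (-m) m)
  contSx : ContinuousOn (fun p : ℝ × ℝ => Sx p.1 p.2) (Ioo 0 L ×ˢ Icc (-m) m)
  der : ∀ x ∈ Ioo 0 L, ∀ ψ ∈ Icc (-m) m, HasDerivAt (fun x => S x ψ) (Sx x ψ) x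
  Sx_nonneg : ∀ x ∈ Ioo 0 L, ∀ ψ ∈ Icc (-m) m, 0 ≤ Sx x ψ
  Sx_le : ∀ x ∈ Ioo 0 L, ∀ ψ ∈ Icc (-m) m, Sx x ψ ≤ B
  S_pos : ∀ x ∈ Ioo 0 L, ∀ ψ ∈ Icc (-m) m, 0 < S x ψ
  S_le : ∀ x ∈ Ioo 0 L, ∀ ψ ∈ Icc (-m) m, S x ψ ≤ B * x

/-- A characteristic on `[a,b]`. -/
def IsChar (L : ℝ) (S : ℝ → ℝ → ℝ) (a b : ℝ) (Y : ℝ → ℝ) : Prop :=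
  ∀ t ∈ Icc a b, Y t ∈ Ioo 0 L ∧ HasDerivWithinAt Y (S (Y t) t) (Icc a b) t

lemma IsChar.cont {L S a b Y} (h : IsChar L S a b Y) : ContinuousOn Y (Icc a b) :=
  fun t ht => (h t ht).2.continuousWithinAt

lemma IsChar.mono {L S a b a' b' Y} (h : IsChar L S a b Y) (ha : a ≤ a') (hb : b' ≤ b) :
    IsChar L S a' b' Y := fun t ht =>
  ⟨(h t ⟨ha.trans ht.1, ht.2.trans hb⟩).1,
    (h t ⟨ha.trans ht.1, ht.2.trans hb⟩).2.mono (Icc_subset_Icc ha hb)⟩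

namespace FlowHyp
variable {L m B : ℝ} {S Sx : ℝ → ℝ → ℝ}

lemma B_nonneg (h : FlowHyp L m B S Sx) {x : ℝ} (hx : x ∈ Ioo 0 L) : 0 ≤ B :=
  (h.Sx_nonneg x hx 0 ⟨by linarith [h.hm], h.hm.le⟩).trans (h.Sx_le x hx 0 ⟨by linarith [h.hm], h.hm.le⟩)

lemma lip (h : FlowHyp L m B S Sx) {t : ℝ} (ht : t ∈ Icc (-m) m) :
    LipschitzOnWith B.toNNReal (fun x => S x t) (Ioo 0 L) := by
  refine (convex_Ioo 0 L).lipschitzOnWith_of_nnnorm_hasDerivWithin_le (f' := fun x => Sx x t)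
    (fun x hx => (h.der x hx t ht).hasDerivWithinAt) ?_
  intro x hx
  rw [← NNReal.coe_le_coe, coe_nnnorm, Real.coe_toNNReal _ (h.B_nonneg hx), Real.norm_eq_abs,
    abs_of_nonneg (h.Sx_nonneg x hx t ht)]
  exact h.Sx_le x hx t ht

lemma mono_S (h : FlowHyp L m B S Sx) {t x y : ℝ} (ht : t ∈ Icc (-m) m) (hx : x ∈ Ioo 0 L)
    (hy : y ∈ Ioo 0 L) (hxy : x ≤ y) : S x t ≤ S y t := by
  have hsub : Icc x y ⊆ Ioo 0 L := fun z hz => ⟨hx.1.trans_le hz.1, hz.2.trans_lt hy.2⟩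
  exact mono_of_deriv (f := fun x => S x t) (f' := fun x => Sx x t)
    (fun z hz => (h.der z (hsub hz) t ht).hasDerivWithinAt)
    (fun z hz => h.Sx_nonneg z (hsub hz) t ht) (left_mem_Icc.2 hxy) (right_mem_Icc.2 hxy) hxy

/-- existence of the backward characteristic. -/
lemma exists_char (h : FlowHyp L m B S Sx) {x ψ : ℝ} (hx : x ∈ Ioo 0 L) (hψ : ψ ∈ Icc (-m) m) :
    ∃ Y : ℝ → ℝ, Y ψ = x ∧ IsChar L S (-m) ψ Y ∧ ∀ t ∈ Icc (-m) ψ, Y t ≤ x := by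
  have hB := h.B_nonneg hx
  set z0 := Real.log x with hz0
  have hexp : Real.exp z0 = x := exp_log hx.1
  have hmem : ∀ z : ℝ, Real.exp (min z z0) ∈ Ioo 0 L := fun z =>
    ⟨exp_pos _, lt_of_le_of_lt (by rw [← hexp]; exact exp_le_exp.2 (min_le_right _ _)) hx.2⟩
  let G : ℝ → ℝ → ℝ := fun t z => S (Real.exp z) t * Real.exp (-z)
  let F : ℝ → ℝ → ℝ := fun t z => G t (min z z0)
  have hF0 : ∀ t ∈ Icc (-m) m, ∀ z, 0 ≤ F t z := fun t ht z =>
    mul_nonneg (h.S_pos _ (hmem z) t ht).le (exp_pos _).le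
  have hFB : ∀ t ∈ Icc (-m) m, ∀ z, F t z ≤ B := by
    intro t ht z
    have h1 := h.S_le _ (hmem z) t ht
    calc F t z ≤ B * Real.exp (min z z0) * Real.exp (-(min z z0)) :=
          mul_le_mul_of_nonneg_right h1 (exp_pos _).le
      _ = B := by rw [mul_assoc, ← exp_add]; simp
  have hGlip : ∀ t ∈ Icc (-m) m, LipschitzOnWith B.toNNReal (G t) (Iic z0) := by
    intro t ht
    have hm' : ∀ z ∈ Iic z0, Real.exp z ∈ Ioo 0 L := fun z hz => by
      have := hmem z; rwa [min_eq_left hz] at this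
    refine (convex_Iic z0).lipschitzOnWith_of_nnnorm_hasDerivWithin_le
      (f' := fun z => Sx (Real.exp z) t - S (Real.exp z) t * Real.exp (-z)) ?_ ?_
    · intro z hz
      have h1 := (h.der _ (hm' z hz) t ht).comp z (Real.hasDerivAt_exp z)
      have h2 : HasDerivAt (fun z : ℝ => Real.exp (-z)) (-Real.exp (-z)) z := by
        simpa using (hasDerivAt_neg z).exp
      have h3 := h1.mul h2
      refine (h3.congr_deriv ?_).hasDerivWithinAt
      have : Real.exp z * Real.exp (-z) = 1 := by rw [← exp_add]; simp
      simp only [Function.comp]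
      linear_combination Sx (Real.exp z) t * this
    · intro z hz
      rw [← NNReal.coe_le_coe, coe_nnnorm, Real.coe_toNNReal _ hB, Real.norm_eq_abs, abs_le]
      have h1 := h.Sx_nonneg _ (hm' z hz) t ht
      have h2 := h.Sx_le _ (hm' z hz) t ht
      have h3 := hF0 t ht z
      have h4 := hFB t ht z
      simp only [F, G, min_eq_left (show z ≤ z0 from hz)] at h3 h4
      constructor <;> linarith
  have hPL : IsPicardLindelof F (tmin := -m) (tmax := ψ) ⟨ψ, ⟨hψ.1, le_rfl⟩⟩ z0
      (B.toNNReal * (2 * m).toNNReal) 0 B.toNNReal B.toNNReal := by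
    refine ⟨?_, ?_, ?_, ?_⟩
    · intro t ht
      have ht' : t ∈ Icc (-m) m := ⟨ht.1, ht.2.trans hψ.2⟩
      refine LipschitzWith.lipschitzOnWith ?_ |>.mono (subset_univ _)
      rw [← lipschitzOnWith_univ]
      have h1 : LipschitzOnWith 1 (fun z : ℝ => min z z0) univ :=
        (LipschitzWith.id.min_const z0).lipschitzOnWith
      have := (hGlip t ht').comp h1 (fun z _ => min_le_right z z0)
      rw [mul_one] at this
      exact this
    · intro z _
      have : ContinuousOn (fun t => S (Real.exp (min z z0)) t) (Icc (-m) ψ) := by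
        refine h.contS.comp (f := fun t : ℝ => ((Real.exp (min z z0), t) : ℝ × ℝ)) (by fun_prop) ?_
        intro t ht
        exact ⟨hmem z, ht.1, ht.2.trans hψ.2⟩
      exact this.mul continuousOn_const
    · intro t ht z _
      have ht' : t ∈ Icc (-m) m := ⟨ht.1, ht.2.trans hψ.2⟩
      rw [Real.coe_toNNReal _ hB, Real.norm_eq_abs, abs_of_nonneg (hF0 t ht' z)]
      exact hFB t ht' z
    · have h2m : (0 : ℝ) ≤ 2 * m := by linarith [h.hm]
      simp only [NNReal.coe_mul, Real.coe_toNNReal _ hB, Real.coe_toNNReal _ h2m, NNReal.coe_zero,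
        sub_self, sub_zero]
      refine mul_le_mul_of_nonneg_left (max_le h2m ?_) hB
      linarith [hψ.2]
  obtain ⟨α, hα0, hα⟩ := hPL.exists_eq_forall_mem_Icc_hasDerivWithinAt₀
  have hmonoα : MonotoneOn α (Icc (-m) ψ) := mono_of_deriv hα (fun t ht =>
    hF0 t ⟨ht.1, ht.2.trans hψ.2⟩ _)
  have hαle : ∀ t ∈ Icc (-m) ψ, α t ≤ z0 := fun t ht => by
    have := hmonoα ht (right_mem_Icc.2 hψ.1) ht.2
    simpa [hα0] using this.trans_eq hα0
  have hle : ∀ t ∈ Icc (-m) ψ, Real.exp (α t) ≤ x := fun t ht => by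
    rw [← hexp]; exact exp_le_exp.2 (hαle t ht)
  refine ⟨fun t => Real.exp (α t), ?_, ?_, hle⟩
  · rw [← hexp]; exact congrArg Real.exp hα0
  · intro t ht
    refine ⟨⟨exp_pos _, (hle t ht).trans_lt hx.2⟩, ?_⟩
    refine ((hα t ht).exp).congr_deriv ?_
    simp only [F, G, min_eq_left (hαle t ht)]
    have : Real.exp (α t) * Real.exp (-(α t)) = 1 := by rw [← exp_add]; simp
    linear_combination S (Real.exp (α t)) t * this

/-- Uniqueness, backward. -/
lemma char_unique (h : FlowHyp L m B S Sx) {a b : ℝ} {Y Z : ℝ → ℝ} (ha : -m ≤ a) (hb : b ≤ m)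
    (hY : IsChar L S a b Y) (hZ : IsChar L S a b Z) (he : Y b = Z b) : EqOn Y Z (Icc a b) := by
  have key : ∀ {Y : ℝ → ℝ}, IsChar L S a b Y → ∀ t ∈ Ioc a b,
      HasDerivWithinAt Y (S (Y t) t) (Iic t) t := by
    intro Y hY t ht
    refine ((hY t ⟨ht.1.le, ht.2⟩).2).mono_of_mem_nhdsWithin ?_
    refine mem_of_superset (Icc_mem_nhdsLE ht.1) (Icc_subset_Icc_right ht.2)
  exact ODE_solution_unique_of_mem_Icc_left (v := fun t x => S x t) (s := fun _ => Ioo 0 L)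
    (K := B.toNNReal)
    (fun t ht => h.lip ⟨ha.trans ht.1.le, ht.2.trans hb⟩) hY.cont (key hY)
    (fun t ht => (hY t ⟨ht.1.le, ht.2⟩).1) hZ.cont (key hZ)
    (fun t ht => (hZ t ⟨ht.1.le, ht.2⟩).1) he

/-- Uniqueness, forward. -/
lemma char_unique_fwd (h : FlowHyp L m B S Sx) {a b : ℝ} {Y Z : ℝ → ℝ} (ha : -m ≤ a) (hb : b ≤ m)
    (hY : IsChar L S a b Y) (hZ : IsChar L S a b Z) (he : Y a = Z a) : EqOn Y Z (Icc a b) := by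
  have key : ∀ {Y : ℝ → ℝ}, IsChar L S a b Y → ∀ t ∈ Ico a b,
      HasDerivWithinAt Y (S (Y t) t) (Ici t) t := by
    intro Y hY t ht
    refine ((hY t ⟨ht.1, ht.2.le⟩).2).mono_of_mem_nhdsWithin ?_
    refine mem_of_superset (Icc_mem_nhdsGE ht.2) (Icc_subset_Icc_left ht.1)
  exact ODE_solution_unique_of_mem_Icc_right (v := fun t x => S x t) (s := fun _ => Ioo 0 L)
    (K := B.toNNReal)
    (fun t ht => h.lip ⟨ha.trans ht.1, ht.2.le.trans hb⟩) hY.cont (key hY)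
    (fun t ht => (hY t ⟨ht.1, ht.2.le⟩).1) hZ.cont (key hZ)
    (fun t ht => (hZ t ⟨ht.1, ht.2.le⟩).1) he

lemma char_mono (h : FlowHyp L m B S Sx) {a b : ℝ} {Y : ℝ → ℝ} (ha : -m ≤ a) (hb : b ≤ m)
    (hY : IsChar L S a b Y) : MonotoneOn Y (Icc a b) :=
  mono_of_deriv (fun t ht => (hY t ht).2)
    (fun t ht => (h.S_pos _ (hY t ht).1 t ⟨ha.trans ht.1, ht.2.trans hb⟩).le)

/-- Strict ordering of characteristics. -/
lemma char_lt (h : FlowHyp L m B S Sx) {a b : ℝ} {Y Z : ℝ → ℝ} (ha : -m ≤ a) (hb : b ≤ m)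
    (hY : IsChar L S a b Y) (hZ : IsChar L S a b Z) (he : Y b < Z b) :
    ∀ t ∈ Icc a b, Y t < Z t := by
  intro t ht
  by_contra hcon
  push Not at hcon
  have hc : ContinuousOn (fun t => Z t - Y t) (Icc t b) :=
    (hZ.cont.sub hY.cont).mono (Icc_subset_Icc_left ht.1)
  have h0 : (0 : ℝ) ∈ Icc (Z t - Y t) (Z b - Y b) := ⟨by linarith, by linarith⟩
  obtain ⟨c, hcm, hc0⟩ := intermediate_value_Icc ht.2 hc h0
  have hce : Y c = Z c := by simp only at hc0; linarith
  have := h.char_unique_fwd (a := c) (b := b) (ha.trans (ht.1.trans hcm.1)) hb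
    (hY.mono (ht.1.trans hcm.1) le_rfl) (hZ.mono (ht.1.trans hcm.1) le_rfl) hce
    (right_mem_Icc.2 hcm.2)
  linarith

end FlowHyp

end Nozzle

namespace Nozzle

/-- the backward characteristic through `(x,ψ)`. -/
def flowY (L m : ℝ) (S : ℝ → ℝ → ℝ) (x ψ : ℝ) : ℝ → ℝ :=
  Classical.epsilon (fun Y : ℝ → ℝ => Y ψ = x ∧ IsChar L S (-m) ψ Y ∧ ∀ t ∈ Icc (-m) ψ, Y t ≤ x)

/-- foot point on `ψ = -m`. -/
def sig (L m : ℝ) (S : ℝ → ℝ → ℝ) (x ψ : ℝ) : ℝ := flowY L m S x ψ (-m)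

/-- x-derivative of the foot point. -/
def sigx (L m : ℝ) (S Sx : ℝ → ℝ → ℝ) (x ψ : ℝ) : ℝ :=
  Real.exp (-∫ t in (-m)..ψ, Sx (flowY L m S x ψ t) t)

namespace FlowHyp
variable {L m B : ℝ} {S Sx : ℝ → ℝ → ℝ}

lemma flow_spec (h : FlowHyp L m B S Sx) {x ψ : ℝ} (hx : x ∈ Ioo 0 L) (hψ : ψ ∈ Icc (-m) m) :
    flowY L m S x ψ ψ = x ∧ IsChar L S (-m) ψ (flowY L m S x ψ) ∧
      ∀ t ∈ Icc (-m) ψ, flowY L m S x ψ t ≤ x :=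
  Classical.epsilon_spec (h.exists_char hx hψ)

lemma flow_eq (h : FlowHyp L m B S Sx) {b : ℝ} {Y : ℝ → ℝ} (hb : b ∈ Icc (-m) m)
    (hY : IsChar L S (-m) b Y) : EqOn (flowY L m S (Y b) b) Y (Icc (-m) b) := by
  have hs := h.flow_spec (hY b (right_mem_Icc.2 hb.1)).1 hb
  exact h.char_unique le_rfl hb.2 hs.2.1 hY hs.1

lemma flow_semi (h : FlowHyp L m B S Sx) {x ψ t : ℝ} (hx : x ∈ Ioo 0 L) (hψ : ψ ∈ Icc (-m) m)
    (ht : t ∈ Icc (-m) ψ) :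
    EqOn (flowY L m S (flowY L m S x ψ t) t) (flowY L m S x ψ) (Icc (-m) t) :=
  h.flow_eq ⟨ht.1, ht.2.trans hψ.2⟩ ((h.flow_spec hx hψ).2.1.mono le_rfl ht.2)

lemma sig_semi (h : FlowHyp L m B S Sx) {x ψ t : ℝ} (hx : x ∈ Ioo 0 L) (hψ : ψ ∈ Icc (-m) m)
    (ht : t ∈ Icc (-m) ψ) : sig L m S (flowY L m S x ψ t) t = sig L m S x ψ :=
  h.flow_semi hx hψ ht (left_mem_Icc.2 ht.1)

lemma sigx_semi (h : FlowHyp L m B S Sx) {x ψ t : ℝ} (hx : x ∈ Ioo 0 L) (hψ : ψ ∈ Icc (-m) m)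
    (ht : t ∈ Icc (-m) ψ) : sigx L m S Sx (flowY L m S x ψ t) t =
      Real.exp (-∫ r in (-m)..t, Sx (flowY L m S x ψ r) r) := by
  unfold sigx
  congr 2
  refine intervalIntegral.integral_congr ?_
  intro r hr
  rw [uIcc_of_le ht.1] at hr
  simp only
  rw [h.flow_semi hx hψ ht hr]

lemma flow_mem (h : FlowHyp L m B S Sx) {x ψ t : ℝ} (hx : x ∈ Ioo 0 L) (hψ : ψ ∈ Icc (-m) m)
    (ht : t ∈ Icc (-m) ψ) : flowY L m S x ψ t ∈ Ioo 0 L :=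
  ((h.flow_spec hx hψ).2.1 t ht).1

lemma sig_mem (h : FlowHyp L m B S Sx) {x ψ : ℝ} (hx : x ∈ Ioo 0 L) (hψ : ψ ∈ Icc (-m) m) :
    sig L m S x ψ ∈ Ioo 0 L := h.flow_mem hx hψ (left_mem_Icc.2 hψ.1)

lemma sig_le (h : FlowHyp L m B S Sx) {x ψ : ℝ} (hx : x ∈ Ioo 0 L) (hψ : ψ ∈ Icc (-m) m) :
    sig L m S x ψ ≤ x := (h.flow_spec hx hψ).2.2 _ (left_mem_Icc.2 hψ.1)

lemma sig_bot (h : FlowHyp L m B S Sx) {x : ℝ} (hx : x ∈ Ioo 0 L) :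
    sig L m S x (-m) = x := (h.flow_spec hx ⟨le_rfl, by linarith [h.hm]⟩).1

lemma flow_gap (h : FlowHyp L m B S Sx) {x x' ψ : ℝ} (hx : x ∈ Ioo 0 L) (hx' : x' ∈ Ioo 0 L)
    (hψ : ψ ∈ Icc (-m) m) (hlt : x < x') {t : ℝ} (ht : t ∈ Icc (-m) ψ) :
    flowY L m S x ψ t < flowY L m S x' ψ t ∧
      flowY L m S x' ψ t - flowY L m S x ψ t ≤ x' - x := by
  obtain ⟨h1, h2, _⟩ := h.flow_spec hx hψ
  obtain ⟨h1', h2', _⟩ := h.flow_spec hx' hψ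
  have hlt' := h.char_lt le_rfl hψ.2 h2 h2' (by rw [h1, h1']; exact hlt)
  refine ⟨hlt' t ht, ?_⟩
  have hm' := mono_of_deriv (f := fun t => flowY L m S x' ψ t - flowY L m S x ψ t)
    (f' := fun t => S (flowY L m S x' ψ t) t - S (flowY L m S x ψ t) t) (a := -m) (b := ψ)
    (fun t ht => (h2' t ht).2.sub (h2 t ht).2)
    (fun t ht => sub_nonneg.2 (h.mono_S ⟨ht.1, ht.2.trans hψ.2⟩ (h2 t ht).1 (h2' t ht).1 (hlt' t ht).le))
    ht (right_mem_Icc.2 hψ.1) ht.2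
  simp only [h1, h1'] at hm'
  exact hm'

lemma flow_dist (h : FlowHyp L m B S Sx) {x x' ψ : ℝ} (hx : x ∈ Ioo 0 L) (hx' : x' ∈ Ioo 0 L)
    (hψ : ψ ∈ Icc (-m) m) {t : ℝ} (ht : t ∈ Icc (-m) ψ) :
    |flowY L m S x' ψ t - flowY L m S x ψ t| ≤ |x' - x| := by
  rcases lt_trichotomy x x' with hl | hl | hl
  · have := h.flow_gap hx hx' hψ hl ht
    rw [abs_of_pos (sub_pos.2 this.1), abs_of_pos (sub_pos.2 hl)]; exact this.2
  · subst hl; simp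
  · have := h.flow_gap hx' hx hψ hl ht
    rw [abs_sub_comm, abs_sub_comm x', abs_of_pos (sub_pos.2 this.1), abs_of_pos (sub_pos.2 hl)]
    exact this.2

lemma cont_along (h : FlowHyp L m B S Sx) {a b : ℝ} (ha : -m ≤ a) (hb : b ≤ m) {Y : ℝ → ℝ}
    (hY : IsChar L S a b Y) {F : ℝ → ℝ → ℝ}
    (hF : ContinuousOn (fun p : ℝ × ℝ => F p.1 p.2) (Ioo 0 L ×ˢ Icc (-m) m)) :
    ContinuousOn (fun t => F (Y t) t) (Icc a b) := by
  refine hF.comp (f := fun t : ℝ => ((Y t, t) : ℝ × ℝ)) (hY.cont.prodMk continuousOn_id) ?_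
  intro t ht
  exact ⟨(hY t ht).1, ha.trans ht.1, ht.2.trans hb⟩

lemma slope_formula (h : FlowHyp L m B S Sx) {x x' ψ : ℝ} (hx : x ∈ Ioo 0 L) (hx' : x' ∈ Ioo 0 L)
    (hψ : ψ ∈ Icc (-m) m) (hne : x' ≠ x) :
    (sig L m S x' ψ - sig L m S x ψ) / (x' - x) =
      Real.exp (-∫ t in (-m)..ψ, (S (flowY L m S x' ψ t) t - S (flowY L m S x ψ t) t) /
        (flowY L m S x' ψ t - flowY L m S x ψ t)) := by
  obtain ⟨h1, h2, _⟩ := h.flow_spec hx hψ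
  obtain ⟨h1', h2', _⟩ := h.flow_spec hx' hψ
  have hD : ∀ t ∈ Icc (-m) ψ, flowY L m S x' ψ t - flowY L m S x ψ t ≠ 0 := by
    intro t ht
    rcases lt_or_gt_of_ne hne with hl | hl
    · have := (h.flow_gap hx' hx hψ hl ht).1; exact sub_ne_zero.2 this.ne
    · have := (h.flow_gap hx hx' hψ hl ht).1; exact sub_ne_zero.2 this.ne'
  have hpos : 0 < (sig L m S x' ψ - sig L m S x ψ) / (x' - x) := by
    rcases lt_or_gt_of_ne hne with hl | hl
    · have := (h.flow_gap hx' hx hψ hl (left_mem_Icc.2 hψ.1)).1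
      exact div_pos_of_neg_of_neg (sub_neg.2 this) (sub_neg.2 hl)
    · have := (h.flow_gap hx hx' hψ hl (left_mem_Icc.2 hψ.1)).1
      exact div_pos (sub_pos.2 this) (sub_pos.2 hl)
  have hder : ∀ t ∈ Icc (-m) ψ, HasDerivWithinAt
      (fun t => Real.log (flowY L m S x' ψ t - flowY L m S x ψ t))
      ((S (flowY L m S x' ψ t) t - S (flowY L m S x ψ t) t) /
        (flowY L m S x' ψ t - flowY L m S x ψ t)) (Icc (-m) ψ) t :=
    fun t ht => ((h2' t ht).2.sub (h2 t ht).2).log (hD t ht)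
  have hcont : ContinuousOn (fun t => (S (flowY L m S x' ψ t) t - S (flowY L m S x ψ t) t) /
        (flowY L m S x' ψ t - flowY L m S x ψ t)) (Icc (-m) ψ) :=
    ((h.cont_along le_rfl hψ.2 h2' h.contS).sub (h.cont_along le_rfl hψ.2 h2 h.contS)).div
      (h2'.cont.sub h2.cont) hD
  have hint := intervalIntegral.integral_eq_sub_of_hasDeriv_right_of_le hψ.1
    (fun t ht => (hder t ht).continuousWithinAt)
    (fun t ht => ((hder t (Ioo_subset_Icc_self ht)).hasDerivAt
      (Icc_mem_nhds ht.1 ht.2)).hasDerivWithinAt)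
    (hcont.intervalIntegrable_of_Icc hψ.1)
  have hl : Real.log ((sig L m S x' ψ - sig L m S x ψ) / (x' - x)) =
      Real.log (sig L m S x' ψ - sig L m S x ψ) - Real.log (x' - x) :=
    Real.log_div (hD _ (left_mem_Icc.2 hψ.1)) (sub_ne_zero.2 hne)
  rw [hint, h1, h1', ← exp_log hpos, hl]
  congr 1
  simp only [sig]
  ring

lemma hasDerivAt_sig (h : FlowHyp L m B S Sx) {x ψ : ℝ} (hx : x ∈ Ioo 0 L)
    (hψ : ψ ∈ Icc (-m) m) :
    HasDerivAt (fun x => sig L m S x ψ) (sigx L m S Sx x ψ) x := by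
  rw [hasDerivAt_iff_tendsto_slope]
  have hB := h.B_nonneg hx
  have hmem : ∀ᶠ x' in nhdsWithin x {x}ᶜ, x' ∈ Ioo 0 L ∧ x' ≠ x :=
    Filter.Eventually.and (mem_nhdsWithin_of_mem_nhds (Ioo_mem_nhds hx.1 hx.2))
      self_mem_nhdsWithin
  have hev : (fun x' => Real.exp (-∫ t in (-m)..ψ, (S (flowY L m S x' ψ t) t - S (flowY L m S x ψ t) t) /
        (flowY L m S x' ψ t - flowY L m S x ψ t))) =ᶠ[nhdsWithin x {x}ᶜ]
        slope (fun x => sig L m S x ψ) x := by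
    filter_upwards [hmem] with x' hx'
    rw [slope_def_field, h.slope_formula hx hx'.1 hψ hx'.2]
  refine Tendsto.congr' hev ?_
  refine (Real.continuous_exp.tendsto _).comp (Tendsto.neg ?_)
  obtain ⟨h1, h2, _⟩ := h.flow_spec hx hψ
  have hD : ∀ x', x' ∈ Ioo 0 L ∧ x' ≠ x → ∀ t ∈ Icc (-m) ψ,
      flowY L m S x' ψ t - flowY L m S x ψ t ≠ 0 := by
    intro x' hx' t ht
    rcases lt_or_gt_of_ne hx'.2 with hl | hl
    · have := (h.flow_gap hx'.1 hx hψ hl ht).1; exact sub_ne_zero.2 this.ne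
    · have := (h.flow_gap hx hx'.1 hψ hl ht).1; exact sub_ne_zero.2 this.ne'
  refine intervalIntegral.tendsto_integral_filter_of_dominated_convergence (fun _ => B) ?_ ?_ ?_ ?_
  · filter_upwards [hmem] with x' hx'
    obtain ⟨_, h2', _⟩ := h.flow_spec hx'.1 hψ
    have hcont : ContinuousOn (fun t => (S (flowY L m S x' ψ t) t - S (flowY L m S x ψ t) t) /
        (flowY L m S x' ψ t - flowY L m S x ψ t)) (Icc (-m) ψ) :=
      ((h.cont_along le_rfl hψ.2 h2' h.contS).sub (h.cont_along le_rfl hψ.2 h2 h.contS)).div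
        (h2'.cont.sub h2.cont) (hD x' hx')
    rw [uIoc_of_le hψ.1]
    exact (hcont.mono Ioc_subset_Icc_self).aestronglyMeasurable measurableSet_Ioc
  · filter_upwards [hmem] with x' hx'
    refine Eventually.of_forall fun t ht => ?_
    rw [uIoc_of_le hψ.1] at ht
    have ht' := Ioc_subset_Icc_self ht
    have hl := (h.lip (t := t) ⟨ht'.1, ht'.2.trans hψ.2⟩).dist_le_mul _ (h.flow_mem hx'.1 hψ ht')
      _ (h.flow_mem hx hψ ht')
    rw [Real.dist_eq, Real.dist_eq, Real.coe_toNNReal _ hB] at hl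
    rw [Real.norm_eq_abs, abs_div]
    exact (div_le_iff₀ (abs_pos.2 (hD x' hx' t ht'))).2 hl
  · exact intervalIntegrable_const
  · refine Eventually.of_forall fun t ht => ?_
    rw [uIoc_of_le hψ.1] at ht
    have ht' := Ioc_subset_Icc_self ht
    have hd := h.der _ (h.flow_mem hx hψ ht') t ⟨ht'.1, ht'.2.trans hψ.2⟩
    rw [hasDerivAt_iff_tendsto_slope] at hd
    have hto : Tendsto (fun x' => flowY L m S x' ψ t) (nhdsWithin x {x}ᶜ)
        (nhdsWithin (flowY L m S x ψ t) {flowY L m S x ψ t}ᶜ) := by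
      rw [tendsto_nhdsWithin_iff]
      constructor
      · rw [tendsto_iff_dist_tendsto_zero]
        have hz : Tendsto (fun x' => |x' - x|) (nhdsWithin x {x}ᶜ) (nhds 0) := by
          have : Continuous fun x' : ℝ => |x' - x| := by fun_prop
          have h3 := (this.tendsto x).mono_left (nhdsWithin_le_nhds (s := {x}ᶜ))
          simpa using h3
        refine squeeze_zero' (Eventually.of_forall fun _ => dist_nonneg) ?_ hz
        filter_upwards [hmem] with x' hx'
        rw [Real.dist_eq]
        exact h.flow_dist hx hx'.1 hψ ht'
      · filter_upwards [hmem] with x' hx'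
        exact fun heq => hD x' hx' t ht' (sub_eq_zero.2 heq)
    refine (hd.comp hto).congr fun x' => ?_
    simp [slope_def_field]

lemma sigx_pos (x ψ : ℝ) : 0 < sigx L m S Sx x ψ := exp_pos _

lemma sigx_le_one (h : FlowHyp L m B S Sx) {x ψ : ℝ} (hx : x ∈ Ioo 0 L)
    (hψ : ψ ∈ Icc (-m) m) : sigx L m S Sx x ψ ≤ 1 := by
  unfold sigx
  rw [exp_le_one_iff, neg_nonpos]
  refine intervalIntegral.integral_nonneg hψ.1 fun t ht => ?_
  exact h.Sx_nonneg _ (h.flow_mem hx hψ ht) t ⟨ht.1, ht.2.trans hψ.2⟩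

lemma sig_lt (h : FlowHyp L m B S Sx) {x x' ψ : ℝ} (hx : x ∈ Ioo 0 L) (hx' : x' ∈ Ioo 0 L)
    (hψ : ψ ∈ Icc (-m) m) (hlt : x < x') : sig L m S x ψ < sig L m S x' ψ :=
  (h.flow_gap hx hx' hψ hlt (left_mem_Icc.2 hψ.1)).1

end FlowHyp
end Nozzle

namespace Nozzle
namespace FlowHyp
variable {L m B : ℝ} {S Sx : ℝ → ℝ → ℝ}

/-- speed bound for the flow in the backward direction. -/
lemma flow_back_le (h : FlowHyp L m B S Sx) {x ψ t : ℝ} (hx : x ∈ Ioo 0 L) (hψ : ψ ∈ Icc (-m) m)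
    (ht : t ∈ Icc (-m) ψ) : x - flowY L m S x ψ t ≤ B * x * (ψ - t) := by
  obtain ⟨h1, h2, h3⟩ := h.flow_spec hx hψ
  have h2' := h2.mono ht.1 le_rfl
  have := incr_le ht.2 (fun r hr => (h2' r hr).2)
    (h := fun r => B * x * r) (h' := fun _ => B * x)
    (fun r _ => by simpa using ((hasDerivAt_id r).const_mul (B * x)).hasDerivWithinAt)
    (fun r hr => (h.S_le _ (h2' r hr).1 r ⟨ht.1.trans hr.1, hr.2.trans hψ.2⟩).trans
      (mul_le_mul_of_nonneg_left (h3 r ⟨ht.1.trans hr.1, hr.2⟩) (h.B_nonneg hx)))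
  rw [h1] at this
  linarith

lemma flow_right_deriv (h : FlowHyp L m B S Sx) {x ψ : ℝ} (hx : x ∈ Ioo 0 L)
    (hψ : ψ ∈ Ico (-m) m) :
    HasDerivWithinAt (fun ψ' => flowY L m S x ψ' ψ) (-S x ψ) (Ioi ψ) ψ := by
  have hψ' : ψ ∈ Icc (-m) m := ⟨hψ.1, hψ.2.le⟩
  have hB := h.B_nonneg hx
  rw [hasDerivWithinAt_iff_tendsto_slope' (by simp)]
  have hex : ∀ ψ' : ℝ, ψ' ∈ Ioo ψ m → ∃ t, t ∈ Ioo ψ ψ' ∧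
      slope (fun ψ' => flowY L m S x ψ' ψ) ψ ψ' = -S (flowY L m S x ψ' t) t := by
    intro ψ' hp
    have hp' : ψ' ∈ Icc (-m) m := ⟨hψ.1.trans hp.1.le, hp.2.le⟩
    obtain ⟨h1, h2, h3⟩ := h.flow_spec hx hp'
    have h2' := h2.mono hψ.1 le_rfl
    obtain ⟨t, ht, hts⟩ := exists_hasDerivAt_eq_slope (flowY L m S x ψ')
      (fun t => S (flowY L m S x ψ' t) t) hp.1 h2'.cont
      (fun t ht => (h2' t (Ioo_subset_Icc_self ht)).2.hasDerivAt (Icc_mem_nhds ht.1 ht.2))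
    refine ⟨t, ht, ?_⟩
    rw [hts, slope_def_field, h1, (h.flow_spec hx hψ').1, ← neg_div]
    congr 1
    ring
  choose! tt htt using hex
  have hev : ∀ᶠ ψ' in nhdsWithin ψ (Ioi ψ), ψ' ∈ Ioo ψ m := Ioo_mem_nhdsGT hψ.2
  have hid : Tendsto (fun ψ' : ℝ => ψ') (nhdsWithin ψ (Ioi ψ)) (nhds ψ) :=
    tendsto_id.mono_left nhdsWithin_le_nhds
  have htt0 : Tendsto tt (nhdsWithin ψ (Ioi ψ)) (nhds ψ) := by
    refine tendsto_of_tendsto_of_tendsto_of_le_of_le' tendsto_const_nhds hid ?_ ?_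
    · filter_upwards [hev] with ψ' hp using (htt ψ' hp).1.1.le
    · filter_upwards [hev] with ψ' hp using (htt ψ' hp).1.2.le
  have hYt : Tendsto (fun ψ' => flowY L m S x ψ' (tt ψ')) (nhdsWithin ψ (Ioi ψ)) (nhds x) := by
    have hlow : Tendsto (fun ψ' : ℝ => x - B * x * (ψ' - ψ)) (nhdsWithin ψ (Ioi ψ)) (nhds x) := by
      have : Continuous fun ψ' : ℝ => x - B * x * (ψ' - ψ) := by fun_prop
      have h3 := (this.tendsto ψ).mono_left (nhdsWithin_le_nhds (s := Ioi ψ))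
      simpa using h3
    refine tendsto_of_tendsto_of_tendsto_of_le_of_le' hlow tendsto_const_nhds ?_ ?_
    · filter_upwards [hev] with ψ' hp
      have ht := (htt ψ' hp).1
      have h4 := h.flow_back_le (ψ := ψ') (t := tt ψ') hx ⟨hψ.1.trans hp.1.le, hp.2.le⟩
        ⟨hψ.1.trans ht.1.le, ht.2.le⟩
      have : B * x * (ψ' - tt ψ') ≤ B * x * (ψ' - ψ) :=
        mul_le_mul_of_nonneg_left (by linarith [ht.1]) (mul_nonneg hB hx.1.le)
      linarith
    · filter_upwards [hev] with ψ' hp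
      have ht := (htt ψ' hp).1
      exact (h.flow_spec (ψ := ψ') hx ⟨hψ.1.trans hp.1.le, hp.2.le⟩).2.2 _
        ⟨hψ.1.trans ht.1.le, ht.2.le⟩
  have hpair : Tendsto (fun ψ' => ((flowY L m S x ψ' (tt ψ'), tt ψ') : ℝ × ℝ))
      (nhdsWithin ψ (Ioi ψ)) (nhdsWithin (x, ψ) (Ioo 0 L ×ˢ Icc (-m) m)) := by
    rw [tendsto_nhdsWithin_iff]
    refine ⟨hYt.prodMk_nhds htt0, ?_⟩
    filter_upwards [hev] with ψ' hp
    have ht := (htt ψ' hp).1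
    exact ⟨h.flow_mem (ψ := ψ') hx ⟨hψ.1.trans hp.1.le, hp.2.le⟩ ⟨hψ.1.trans ht.1.le, ht.2.le⟩,
      hψ.1.trans ht.1.le, ht.2.le.trans hp.2.le⟩
  have := ((h.contS (x, ψ) ⟨hx, hψ'⟩).tendsto.comp hpair).neg
  refine this.congr' ?_
  filter_upwards [hev] with ψ' hp
  rw [(htt ψ' hp).2]
  rfl

lemma sig_cont_psi (h : FlowHyp L m B S Sx) {x : ℝ} (hx : x ∈ Ioo 0 L) :
    ContinuousOn (sig L m S x) (Icc (-m) m) := by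
  have hB := h.B_nonneg hx
  have key : ∀ ψ ∈ Icc (-m) m, ∀ ψ' ∈ Icc (-m) m, ψ ≤ ψ' →
      |sig L m S x ψ' - sig L m S x ψ| ≤ B * x * (ψ' - ψ) := by
    intro ψ hψ ψ' hψ' hle
    have hmem : ψ ∈ Icc (-m) ψ' := ⟨hψ.1, hle⟩
    have h1 := h.sig_semi hx hψ' hmem
    rw [← h1]
    refine (h.flow_dist hx (h.flow_mem hx hψ' hmem) hψ (left_mem_Icc.2 hψ.1)).trans ?_
    rw [abs_sub_comm, abs_of_nonneg (sub_nonneg.2 ((h.flow_spec hx hψ').2.2 _ hmem))]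
    exact h.flow_back_le hx hψ' hmem
  refine LipschitzOnWith.continuousOn (K := (B * x).toNNReal) ?_
  refine LipschitzOnWith.of_dist_le_mul ?_
  intro ψ hψ ψ' hψ'
  rw [Real.coe_toNNReal _ (mul_nonneg hB hx.1.le), Real.dist_eq, Real.dist_eq]
  rcases le_total ψ ψ' with hl | hl
  · rw [abs_sub_comm, abs_sub_comm ψ, abs_of_nonneg (sub_nonneg.2 hl)]; exact key ψ hψ ψ' hψ' hl
  · rw [abs_of_nonneg (sub_nonneg.2 hl)]; exact key ψ' hψ' ψ hψ hl

end FlowHyp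
end Nozzle

namespace Nozzle

/-- hypotheses on the boundary source. -/
structure SrcHyp (L m : ℝ) (S : ℝ → ℝ → ℝ) (Θ Θ1 c : ℝ → ℝ) (C : ℝ) : Prop where
  hder : ∀ x ∈ Ioo 0 L, HasDerivAt Θ (Θ1 x) x
  Th1_nonneg : ∀ x ∈ Ioo 0 L, 0 ≤ Θ1 x
  Th_nonneg : ∀ x ∈ Ioo 0 L, 0 ≤ Θ x
  Th1_le : ∀ x ∈ Ioo 0 L, Θ1 x ≤ C * c x
  Th_le : ∀ x ∈ Ioo 0 L, Θ x ≤ C * c x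
  c_mono : MonotoneOn c (Ioo 0 L)
  c_nonneg : ∀ x ∈ Ioo 0 L, 0 ≤ c x
  c_le : ∀ x ∈ Ioo 0 L, ∀ ψ ∈ Icc (-m) m, c x ≤ S x ψ
  hC : 0 ≤ C

/-- one full pass. -/
def tau (L m : ℝ) (S : ℝ → ℝ → ℝ) (x : ℝ) : ℝ := sig L m S x m

namespace FlowHyp
variable {L m B : ℝ} {S Sx : ℝ → ℝ → ℝ}

lemma m_mem (h : FlowHyp L m B S Sx) : m ∈ Icc (-m) m := ⟨by linarith [h.hm], le_rfl⟩
lemma nm_mem (h : FlowHyp L m B S Sx) : -m ∈ Icc (-m) m := ⟨le_rfl, by linarith [h.hm]⟩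

lemma tau_mem (h : FlowHyp L m B S Sx) {x : ℝ} (hx : x ∈ Ioo 0 L) : tau L m S x ∈ Ioo 0 L :=
  h.sig_mem hx h.m_mem

lemma tau_iter_mem (h : FlowHyp L m B S Sx) {x : ℝ} (hx : x ∈ Ioo 0 L) (n : ℕ) :
    (tau L m S)^[n] x ∈ Ioo 0 L := by
  induction n with
  | zero => simpa using hx
  | succ n ih => rw [Function.iterate_succ_apply']; exact h.tau_mem ih

lemma tau_lt (h : FlowHyp L m B S Sx) {x : ℝ} (hx : x ∈ Ioo 0 L) : tau L m S x < x := by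
  obtain ⟨h1, h2, h3⟩ := h.flow_spec hx h.m_mem
  have hlt : -m < m := by linarith [h.hm]
  obtain ⟨t, ht, hts⟩ := exists_hasDerivAt_eq_slope (flowY L m S x m)
    (fun t => S (flowY L m S x m t) t) hlt h2.cont
    (fun t ht => (h2 t (Ioo_subset_Icc_self ht)).2.hasDerivAt (Icc_mem_nhds ht.1 ht.2))
  have hp := h.S_pos _ (h2 t (Ioo_subset_Icc_self ht)).1 t (Ioo_subset_Icc_self ht)
  rw [hts, div_pos_iff_of_pos_right (by linarith), h1] at hp
  unfold tau sig
  linarith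

lemma tau_mono (h : FlowHyp L m B S Sx) : MonotoneOn (tau L m S) (Ioo 0 L) := by
  intro x hx y hy hxy
  rcases hxy.eq_or_lt with rfl | hlt
  · exact le_rfl
  · exact (h.sig_lt hx hy h.m_mem hlt).le

lemma tau_iter_mono (h : FlowHyp L m B S Sx) (n : ℕ) :
    MonotoneOn ((tau L m S)^[n]) (Ioo 0 L) := by
  induction n with
  | zero => intro x _ y _ hxy; simpa using hxy
  | succ n ih =>
    intro x hx y hy hxy
    rw [Function.iterate_succ_apply', Function.iterate_succ_apply']
    exact h.tau_mono (h.tau_iter_mem hx n) (h.tau_iter_mem hy n) (ih hx hy hxy)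

lemma tau_tendsto (h : FlowHyp L m B S Sx) {x : ℝ} (hx : x ∈ Ioo 0 L) :
    Tendsto (fun n => (tau L m S)^[n] x) atTop (nhds 0) := by
  have hanti : Antitone (fun n => (tau L m S)^[n] x) := by
    refine antitone_nat_of_succ_le fun n => ?_
    rw [Function.iterate_succ_apply']
    exact (h.tau_lt (h.tau_iter_mem hx n)).le
  have hbdd : BddBelow (range fun n => (tau L m S)^[n] x) :=
    ⟨0, by rintro _ ⟨n, rfl⟩; exact (h.tau_iter_mem hx n).1.le⟩
  have ht := tendsto_atTop_ciInf hanti hbdd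
  set ℓ := ⨅ n, (tau L m S)^[n] x with hℓ
  have h0 : 0 ≤ ℓ := le_ciInf fun n => (h.tau_iter_mem hx n).1.le
  have hle : ℓ ≤ x := by simpa using ciInf_le hbdd 0
  rcases h0.eq_or_lt with h0 | h0
  · rwa [← h0] at ht
  · exfalso
    have hm : ℓ ∈ Ioo 0 L := ⟨h0, hle.trans_lt hx.2⟩
    have hc : ContinuousAt (tau L m S) ℓ := (h.hasDerivAt_sig hm h.m_mem).continuousAt
    have h1 := hc.tendsto.comp ht
    have h2 := (tendsto_add_atTop_iff_nat 1).2 ht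
    have h3 : tau L m S ℓ = ℓ := by
      refine tendsto_nhds_unique h1 (h2.congr fun n => ?_)
      simp [Function.iterate_succ_apply']
    exact (h.tau_lt hm).ne h3

lemma tau_iter_deriv (h : FlowHyp L m B S Sx) {x : ℝ} (hx : x ∈ Ioo 0 L) (n : ℕ) :
    ∃ d, HasDerivAt ((tau L m S)^[n]) d x ∧ 0 ≤ d ∧ d ≤ 1 := by
  induction n with
  | zero => exact ⟨1, by simpa using hasDerivAt_id x, by norm_num, le_rfl⟩
  | succ n ih =>
    obtain ⟨d, hd, h0, h1⟩ := ih
    have hm := h.tau_iter_mem hx n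
    have hs := h.hasDerivAt_sig hm h.m_mem
    refine ⟨_, ?_, mul_nonneg (FlowHyp.sigx_pos _ _).le h0,
      mul_le_one₀ (h.sigx_le_one hm h.m_mem) h0 h1⟩
    rw [Function.iterate_succ']
    exact HasDerivAt.comp x hs hd

end FlowHyp

namespace SrcHyp
variable {L m B C : ℝ} {S Sx : ℝ → ℝ → ℝ} {Θ Θ1 c : ℝ → ℝ}

lemma c_tau (q : SrcHyp L m S Θ Θ1 c C) (h : FlowHyp L m B S Sx) {x : ℝ} (hx : x ∈ Ioo 0 L) :
    2 * m * c (tau L m S x) ≤ x - tau L m S x := by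
  obtain ⟨h1, h2, h3⟩ := h.flow_spec hx h.m_mem
  have hmono := h.char_mono le_rfl le_rfl h2
  have hmm : -m ≤ m := by linarith [h.hm]
  have := incr_le (f := fun t => c (tau L m S x) * t) (f' := fun _ => c (tau L m S x)) hmm
    (fun r _ => by
      simpa using ((hasDerivAt_id r).const_mul (c (tau L m S x))).hasDerivWithinAt)
    (fun r hr => (h2 r hr).2)
    (fun r hr => (q.c_mono (h.tau_mem hx) (h2 r hr).1
      (hmono (left_mem_Icc.2 hmm) hr hr.1)).trans (q.c_le _ (h2 r hr).1 r hr))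
  rw [h1] at this
  unfold tau sig at *
  linarith

lemma sum_c_le (q : SrcHyp L m S Θ Θ1 c C) (h : FlowHyp L m B S Sx) {x : ℝ} (hx : x ∈ Ioo 0 L)
    (n : ℕ) : ∑ i ∈ Finset.range n, c ((tau L m S)^[i + 1] x) ≤ x / (2 * m) := by
  have hm := h.hm
  have key : 2 * m * ∑ i ∈ Finset.range n, c ((tau L m S)^[i + 1] x) ≤ x - (tau L m S)^[n] x := by
    induction n with
    | zero => simp
    | succ n ih =>
      rw [Finset.sum_range_succ, mul_add]
      have := q.c_tau h (h.tau_iter_mem hx n)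
      rw [← Function.iterate_succ_apply' (tau L m S)] at this
      linarith
  rw [le_div_iff₀ (by linarith)]
  linarith [(h.tau_iter_mem hx n).1]

lemma summable_c (q : SrcHyp L m S Θ Θ1 c C) (h : FlowHyp L m B S Sx) {x : ℝ} (hx : x ∈ Ioo 0 L) :
    Summable (fun n => c ((tau L m S)^[n] x)) := by
  rw [← summable_nat_add_iff 1]
  exact summable_of_sum_range_le (fun n => q.c_nonneg _ (h.tau_iter_mem hx _)) (q.sum_c_le h hx)

lemma tsum_c_le (q : SrcHyp L m S Θ Θ1 c C) (h : FlowHyp L m B S Sx) {x : ℝ} (hx : x ∈ Ioo 0 L) :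
    ∑' n, c ((tau L m S)^[n] x) ≤ (B + 1 / (2 * m)) * x := by
  rw [(q.summable_c h hx).tsum_eq_zero_add]
  have h1 : c x ≤ B * x := (q.c_le x hx _ h.m_mem).trans (h.S_le x hx _ h.m_mem)
  have h2 : ∑' n, c ((tau L m S)^[n + 1] x) ≤ x / (2 * m) :=
    Real.tsum_le_of_sum_range_le (fun n => q.c_nonneg _ (h.tau_iter_mem hx _)) (q.sum_c_le h hx)
  simp only [Function.iterate_zero, id]
  calc _ ≤ B * x + x / (2 * m) := add_le_add h1 h2
    _ = _ := by ring

end SrcHyp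

/-- boundary value of the Riemann invariant. -/
def rho0 (L m : ℝ) (S : ℝ → ℝ → ℝ) (Θ : ℝ → ℝ) (x : ℝ) : ℝ :=
  2 * ∑' n, Θ ((tau L m S)^[n] x)

namespace SrcHyp
variable {L m B C : ℝ} {S Sx : ℝ → ℝ → ℝ} {Θ Θ1 c : ℝ → ℝ}

lemma summable_Th (q : SrcHyp L m S Θ Θ1 c C) (h : FlowHyp L m B S Sx) {x : ℝ} (hx : x ∈ Ioo 0 L) :
    Summable (fun n => Θ ((tau L m S)^[n] x)) :=
  Summable.of_nonneg_of_le (fun n => q.Th_nonneg _ (h.tau_iter_mem hx n))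
    (fun n => q.Th_le _ (h.tau_iter_mem hx n)) ((q.summable_c h hx).mul_left C)

lemma exists_rho (q : SrcHyp L m S Θ Θ1 c C) (h : FlowHyp L m B S Sx) :
    ∃ ρ1 : ℝ → ℝ, ∀ x ∈ Ioo 0 L, HasDerivAt (rho0 L m S Θ) (ρ1 x) x ∧ 0 ≤ ρ1 x ∧
      ρ1 x ≤ 2 * (C * ((B + 1 / (2 * m)) * x)) ∧
      0 ≤ rho0 L m S Θ x ∧ rho0 L m S Θ x ≤ 2 * (C * ((B + 1 / (2 * m)) * x)) ∧
      rho0 L m S Θ x = 2 * Θ x + rho0 L m S Θ (tau L m S x) ∧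
      ρ1 x = 2 * Θ1 x + ρ1 (tau L m S x) * sigx L m S Sx x m := by
  choose! d hd hd0 hd1 using fun (n : ℕ) (x : ℝ) (hx : x ∈ Ioo 0 L) => h.tau_iter_deriv hx n
  have hterm : ∀ n, ∀ x ∈ Ioo 0 L, HasDerivAt (fun x => Θ ((tau L m S)^[n] x))
      (Θ1 ((tau L m S)^[n] x) * d n x) x := fun n x hx =>
    (q.hder _ (h.tau_iter_mem hx n)).comp x (hd n x hx)
  have hbd : ∀ n, ∀ x ∈ Ioo 0 L, 0 ≤ Θ1 ((tau L m S)^[n] x) * d n x ∧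
      Θ1 ((tau L m S)^[n] x) * d n x ≤ C * c ((tau L m S)^[n] x) := fun n x hx => by
    have h1 := q.Th1_nonneg _ (h.tau_iter_mem hx n)
    exact ⟨mul_nonneg h1 (hd0 n x hx), (mul_le_of_le_one_right h1 (hd1 n x hx)).trans
      (q.Th1_le _ (h.tau_iter_mem hx n))⟩
  have hD : ∀ x ∈ Ioo 0 L, HasDerivAt (rho0 L m S Θ)
      (2 * ∑' n, Θ1 ((tau L m S)^[n] x) * d n x) x := by
    intro x hx
    set x0 := (x + L) / 2 with hx0d
    have hx0 : x0 ∈ Ioo 0 L := ⟨by linarith [hx.1, hx.2], by linarith [hx.2]⟩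
    have hxx : x ∈ Ioo 0 x0 := ⟨hx.1, by linarith [hx.2]⟩
    have hsub : Ioo 0 x0 ⊆ Ioo 0 L := Ioo_subset_Ioo_right hx0.2.le
    have := hasDerivAt_tsum_of_isPreconnected (u := fun n => C * c ((tau L m S)^[n] x0))
      ((q.summable_c h hx0).mul_left C) isOpen_Ioo isPreconnected_Ioo
      (g := fun n x => Θ ((tau L m S)^[n] x))
      (g' := fun n x => Θ1 ((tau L m S)^[n] x) * d n x)
      (fun n y hy => hterm n y (hsub hy))
      (fun n y hy => by
        have h1 := hbd n y (hsub hy)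
        rw [Real.norm_eq_abs, abs_of_nonneg h1.1]
        refine h1.2.trans (mul_le_mul_of_nonneg_left ?_ q.hC)
        exact q.c_mono (h.tau_iter_mem (hsub hy) n) (h.tau_iter_mem hx0 n)
          (h.tau_iter_mono n (hsub hy) hx0 hy.2.le))
      hxx (q.summable_Th h hx) hxx
    exact this.const_mul 2
  have hfun : ∀ x ∈ Ioo 0 L, rho0 L m S Θ x = 2 * Θ x + rho0 L m S Θ (tau L m S x) := by
    intro x hx
    unfold rho0
    rw [(q.summable_Th h hx).tsum_eq_zero_add, mul_add]
    simp [Function.iterate_succ_apply]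
  refine ⟨fun x => 2 * ∑' n, Θ1 ((tau L m S)^[n] x) * d n x, fun x hx => ?_⟩
  have hsc := q.summable_c h hx
  refine ⟨hD x hx, ?_, ?_, ?_, ?_, hfun x hx, ?_⟩
  · exact mul_nonneg (by norm_num) (tsum_nonneg fun n => (hbd n x hx).1)
  · refine mul_le_mul_of_nonneg_left ?_ (by norm_num)
    refine le_trans ?_ (mul_le_mul_of_nonneg_left (q.tsum_c_le h hx) q.hC)
    rw [← tsum_mul_left]
    exact (Summable.of_nonneg_of_le (fun n => (hbd n x hx).1) (fun n => (hbd n x hx).2)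
      (hsc.mul_left C)).tsum_le_tsum (fun n => (hbd n x hx).2) (hsc.mul_left C)
  · exact mul_nonneg (by norm_num) (tsum_nonneg fun n => q.Th_nonneg _ (h.tau_iter_mem hx n))
  · refine mul_le_mul_of_nonneg_left ?_ (by norm_num)
    refine le_trans ?_ (mul_le_mul_of_nonneg_left (q.tsum_c_le h hx) q.hC)
    rw [← tsum_mul_left]
    exact (q.summable_Th h hx).tsum_le_tsum (fun n => q.Th_le _ (h.tau_iter_mem hx n))
      (hsc.mul_left C)
  · have h1 := hD x hx
    have h2 := ((q.hder x hx).const_mul 2).add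
      ((hD _ (h.tau_mem hx)).comp x (h.hasDerivAt_sig hx h.m_mem))
    refine h1.unique (h2.congr_of_eventuallyEq ?_)
    filter_upwards [Ioo_mem_nhds hx.1 hx.2] with y hy
    exact hfun y hy

/-- The linear transport problem with reflection. -/
theorem exists_transport (q : SrcHyp L m S Θ Θ1 c C) (h : FlowHyp L m B S Sx) :
    ∃ u w : ℝ → ℝ → ℝ,
      (∀ x ∈ Ioo 0 L, ∀ ψ ∈ Icc (-m) m, HasDerivAt (fun x => u x ψ) (w x ψ) x) ∧
      (∀ x ∈ Ioo 0 L, ContinuousOn (u x) (Icc (-m) m)) ∧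
      (∀ x ∈ Ioo 0 L, ∀ ψ ∈ Ico (-m) m,
        HasDerivWithinAt (u x) (-(S x ψ * w x ψ)) (Ioi ψ) ψ) ∧
      (∀ x ∈ Ioo 0 L, ∀ ψ ∈ Icc (-m) m, ∀ t ∈ Icc (-m) ψ,
        HasDerivWithinAt (fun t => w (flowY L m S x ψ t) t)
          (-(Sx (flowY L m S x ψ t) t * w (flowY L m S x ψ t) t)) (Icc (-m) ψ) t) ∧
      (∀ x ∈ Ioo 0 L, u x (-m) = u x m + 2 * Θ x) ∧
      (∀ x ∈ Ioo 0 L, w x (-m) = w x m + 2 * Θ1 x) ∧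
      ∃ C', 0 ≤ C' ∧ ∀ x ∈ Ioo 0 L, ∀ ψ ∈ Icc (-m) m, 0 ≤ w x ψ ∧ w x ψ ≤ C' * x ∧
        0 ≤ u x ψ ∧ u x ψ ≤ C' * x := by
  obtain ⟨ρ1, hρ⟩ := q.exists_rho h
  generalize rho0 L m S Θ = ρ at hρ
  have hbot : ∀ x ∈ Ioo 0 L, sigx L m S Sx x (-m) = 1 := fun x hx => by simp [sigx]
  by_cases hne : (Ioo 0 L).Nonempty
  swap
  · rw [Set.not_nonempty_iff_eq_empty] at hne
    rw [hne]
    exact ⟨fun _ _ => 0, fun _ _ => 0, by simp, by simp, by simp, by simp, by simp, by simp, 0,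
      le_rfl, by simp⟩
  obtain ⟨x1, hx1⟩ := hne
  have hB := h.B_nonneg hx1
  have hC' : 0 ≤ 2 * (C * (B + 1 / (2 * m))) := by
    have := h.hm; have := q.hC; positivity
  refine ⟨fun x ψ => ρ (sig L m S x ψ),
    fun x ψ => ρ1 (sig L m S x ψ) * sigx L m S Sx x ψ, ?_, ?_, ?_, ?_, ?_, ?_,
    2 * (C * (B + 1 / (2 * m))), hC', ?_⟩
  · intro x hx ψ hψ
    exact (hρ _ (h.sig_mem hx hψ)).1.comp x (h.hasDerivAt_sig hx hψ)
  · intro x hx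
    refine ContinuousOn.comp (t := Ioo 0 L)
      (fun y hy => (hρ y hy).1.continuousAt.continuousWithinAt) (h.sig_cont_psi hx)
      (fun ψ hψ => h.sig_mem hx hψ)
  · intro x hx ψ hψ
    have hψ' : ψ ∈ Icc (-m) m := ⟨hψ.1, hψ.2.le⟩
    have hx' : flowY L m S x ψ ψ = x := (h.flow_spec hx hψ').1
    have h1 : HasDerivAt (fun x => ρ (sig L m S x ψ))
        (ρ1 (sig L m S x ψ) * sigx L m S Sx x ψ) x :=
      (hρ _ (h.sig_mem hx hψ')).1.comp x (h.hasDerivAt_sig hx hψ')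
    have h2 : HasDerivWithinAt ((fun x => ρ (sig L m S x ψ)) ∘ (fun ψ' => flowY L m S x ψ' ψ))
        (ρ1 (sig L m S x ψ) * sigx L m S Sx x ψ * -S x ψ) (Ioi ψ) ψ :=
      HasDerivAt.comp_hasDerivWithinAt_of_eq ψ h1 (h.flow_right_deriv hx hψ) hx'.symm
    have h3 : HasDerivWithinAt (fun ψ' => ρ (sig L m S x ψ'))
        (ρ1 (sig L m S x ψ) * sigx L m S Sx x ψ * -S x ψ) (Ioi ψ) ψ := by
      refine h2.congr_of_eventuallyEq ?_ ?_
      · filter_upwards [Ioo_mem_nhdsGT hψ.2] with ψ' hp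
        simp only [Function.comp]
        rw [h.sig_semi hx ⟨hψ.1.trans hp.1.le, hp.2.le⟩ ⟨hψ.1, hp.1.le⟩]
      · simp only [Function.comp]
        rw [hx']
    convert h3 using 1
    ring
  · intro x hx ψ hψ t ht
    have hfun : ∀ r ∈ Icc (-m) ψ, ρ1 (sig L m S (flowY L m S x ψ r) r) *
        sigx L m S Sx (flowY L m S x ψ r) r =
        ρ1 (sig L m S x ψ) * Real.exp (-∫ s in (-m)..r, Sx (flowY L m S x ψ s) s) := by
      intro r hr
      rw [h.sig_semi hx hψ hr, h.sigx_semi hx hψ hr]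
    have hc : ContinuousOn (fun s => Sx (flowY L m S x ψ s) s) (Icc (-m) ψ) :=
      h.cont_along le_rfl hψ.2 (h.flow_spec hx hψ).2.1 h.contSx
    have hI : HasDerivWithinAt (fun r => ∫ s in (-m)..r, Sx (flowY L m S x ψ s) s)
        (Sx (flowY L m S x ψ t) t) (Icc (-m) ψ) t := by
      have : Fact (t ∈ Icc (-m) ψ) := ⟨ht⟩
      refine intervalIntegral.integral_hasDerivWithinAt_right
        ((hc.mono (Icc_subset_Icc_right ht.2)).intervalIntegrable_of_Icc ht.1)
        (s := Icc (-m) ψ) (t := Icc (-m) ψ) ?_ (hc t ht)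
      exact hc.stronglyMeasurableAtFilter_nhdsWithin measurableSet_Icc t
    have h1 := (hI.neg.exp).const_mul (ρ1 (sig L m S x ψ))
    have h2 := h1.congr (fun r hr => hfun r hr) (hfun t ht)
    refine h2.congr_deriv ?_
    simp only [Pi.neg_apply]
    rw [hfun t ht]
    ring
  · intro x hx
    simp only
    rw [h.sig_bot hx, (hρ x hx).2.2.2.2.2.1, add_comm]
    rfl
  · intro x hx
    simp only
    rw [h.sig_bot hx, hbot x hx, (hρ x hx).2.2.2.2.2.2, mul_one, add_comm]
    rfl
  · intro x hx ψ hψ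
    have hs := hρ _ (h.sig_mem hx hψ)
    have h1 := h.sigx_le_one hx hψ
    have hle : 2 * (C * ((B + 1 / (2 * m)) * sig L m S x ψ)) ≤ 2 * (C * (B + 1 / (2 * m))) * x := by
      have := mul_le_mul_of_nonneg_left (h.sig_le hx hψ) hC'
      linarith
    refine ⟨mul_nonneg hs.2.1 (FlowHyp.sigx_pos _ _).le, ?_, hs.2.2.2.1, hs.2.2.2.2.1.trans hle⟩
    exact ((mul_le_of_le_one_right hs.2.1 h1).trans hs.2.2.1).trans hle

end SrcHyp
end Nozzle

namespace Nozzle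

/-- chain rule along a curve, with one-sided second variable. -/
lemma chain_curve {L m : ℝ} {F Fx : ℝ → ℝ → ℝ}
    (hFx : ContinuousOn (fun p : ℝ × ℝ => Fx p.1 p.2) (Ioo 0 L ×ˢ Icc (-m) m))
    (hd : ∀ x ∈ Ioo 0 L, ∀ ψ ∈ Icc (-m) m, HasDerivAt (fun x => F x ψ) (Fx x ψ) x)
    {s : Set ℝ} (hs : s ⊆ Icc (-m) m) {Y : ℝ → ℝ} {t y' d : ℝ} (ht : t ∈ s)
    (hY : Y t ∈ Ioo 0 L) (hYd : HasDerivWithinAt Y y' s t)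
    (hψ : HasDerivWithinAt (F (Y t)) d (Icc (-m) m) t) :
    HasDerivWithinAt (fun r => F (Y r) r) (Fx (Y t) t * y' + d) s t := by
  have h2 : HasDerivWithinAt (fun r => F (Y t) r) d s t := hψ.mono hs
  have h1 : HasDerivWithinAt (fun r => F (Y r) r - F (Y t) r) (Fx (Y t) t * y') s t := by
    have hlin : HasDerivWithinAt (fun r => Fx (Y t) t * (Y r - Y t)) (Fx (Y t) t * y') s t :=
      (hYd.sub_const _).const_mul _
    have hO : (fun r => Y r - Y t) =O[nhdsWithin t s] fun r => r - t :=
      hYd.isBigO_sub.comp_tendsto (k := fun r => (r, t)) (tendsto_id.prodMk tendsto_const_pure)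
    have ho : (fun r => F (Y r) r - F (Y t) r - Fx (Y t) t * (Y r - Y t)) =o[nhdsWithin t s]
        fun r => Y r - Y t := by
      rw [Asymptotics.isLittleO_iff]
      intro e he
      have hc := hFx (Y t, t) ⟨hY, hs ht⟩
      have hc' := Metric.continuousWithinAt_iff.1 hc e he
      obtain ⟨δ, hδ, hc'⟩ := hc'
      obtain ⟨δ', hδ', hball⟩ := Metric.isOpen_iff.1 isOpen_Ioo _ hY
      have hYc := Metric.continuousWithinAt_iff.1 hYd.continuousWithinAt (min δ δ') (lt_min hδ hδ')
      obtain ⟨δ2, hδ2, hYc⟩ := hYc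
      have hev : ∀ᶠ r in nhdsWithin t s, r ∈ s ∧ dist r t < min δ δ2 := by
        refine Filter.Eventually.and eventually_mem_nhdsWithin ?_
        exact mem_nhdsWithin_of_mem_nhds (Metric.ball_mem_nhds t (lt_min hδ hδ2))
      filter_upwards [hev] with r hr
      have hYr := hYc hr.1 (hr.2.trans_le (min_le_right _ _))
      have hsub : Metric.ball (Y t) (min δ δ') ⊆ Ioo 0 L :=
        (Metric.ball_subset_ball (min_le_right _ _)).trans hball
      have := (convex_ball (Y t) (min δ δ')).norm_image_sub_le_of_norm_hasDerivWithin_le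
        (f := fun x => F x r - Fx (Y t) t * x) (f' := fun x => Fx x r - Fx (Y t) t) (C := e)
        (x := Y t) (y := Y r) ?_ ?_ (Metric.mem_ball_self (lt_min hδ hδ')) hYr
      · calc _ = ‖F (Y r) r - Fx (Y t) t * Y r - (F (Y t) r - Fx (Y t) t * Y t)‖ := by
              congr 1; ring
          _ ≤ _ := this
      · intro x hx
        have := (hd x (hsub hx) r (hs hr.1)).sub ((hasDerivAt_id x).const_mul (Fx (Y t) t))
        simp only [mul_one] at this
        exact this.hasDerivWithinAt
      · intro x hx
        have := hc' (x := (x, r)) ⟨hsub hx, hs hr.1⟩ (by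
          rw [Prod.dist_eq]
          exact max_lt (lt_of_lt_of_le hx (min_le_left _ _)) (hr.2.trans_le (min_le_left _ _)))
        exact this.le
    have ho2 := ho.trans_isBigO hO
    have hz : HasDerivWithinAt (fun r => F (Y r) r - F (Y t) r - Fx (Y t) t * (Y r - Y t)) 0 s t := by
      rw [hasDerivWithinAt_iff_isLittleO]
      simpa using ho2
    have := hz.add hlin
    refine (this.congr_deriv (by ring)).congr ?_ ?_
    · intro r _; simp only [Pi.add_apply]; ring
    · simp
  have := h1.add h2
  refine this.congr ?_ ?_
  · intro r _; simp only [Pi.add_apply]; ring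
  · simp

/-- damped ODE estimate. -/
lemma damped {a b : ℝ} (hab : a ≤ b) {D al r N N' : ℝ → ℝ}
    (hD : ∀ t ∈ Icc a b, HasDerivWithinAt D (al t * D t + r t) (Icc a b) t)
    (hal : ∀ t ∈ Icc a b, al t ≤ 0)
    (hN : ∀ t ∈ Icc a b, HasDerivWithinAt N (N' t) (Icc a b) t)
    (hr : ∀ t ∈ Icc a b, |r t| ≤ N' t) : |D b| - |D a| ≤ N b - N a := by
  refine le_of_forall_pos_le_add fun δ hδ => ?_
  have key := incr_le (f := fun t => Real.sqrt (D t ^ 2 + δ ^ 2))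
    (f' := fun t => (2 * D t * (al t * D t + r t)) / (2 * Real.sqrt (D t ^ 2 + δ ^ 2)))
    hab ?_ hN ?_
  · have h1 : |D b| ≤ Real.sqrt (D b ^ 2 + δ ^ 2) := by
      apply Real.abs_le_sqrt; nlinarith
    have h2 : Real.sqrt (D a ^ 2 + δ ^ 2) ≤ |D a| + δ := by
      apply Real.sqrt_le_iff.2
      refine ⟨by positivity, ?_⟩
      have := abs_nonneg (D a)
      nlinarith [sq_abs (D a)]
    linarith
  · intro t ht
    have h1 : HasDerivWithinAt (fun t => D t ^ 2 + δ ^ 2) (2 * D t * (al t * D t + r t)) (Icc a b) t := by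
      have := ((hD t ht).pow 2).add_const (δ ^ 2)
      refine this.congr_deriv ?_
      push_cast; ring
    exact h1.sqrt (by positivity)
  · intro t ht
    have hs : 0 < Real.sqrt (D t ^ 2 + δ ^ 2) := Real.sqrt_pos.2 (by positivity)
    have hle : |D t| ≤ Real.sqrt (D t ^ 2 + δ ^ 2) := by
      apply Real.abs_le_sqrt; nlinarith
    rw [div_le_iff₀ (by positivity)]
    have h1 : D t * r t ≤ |D t| * |r t| := by rw [← abs_mul]; exact le_abs_self _
    have h2 : |D t| * |r t| ≤ Real.sqrt (D t ^ 2 + δ ^ 2) * N' t :=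
      mul_le_mul hle (hr t ht) (abs_nonneg _) hs.le
    have h3 : al t * D t ^ 2 ≤ 0 := mul_nonpos_of_nonpos_of_nonneg (hal t ht) (sq_nonneg _)
    nlinarith

/-- Telescoping: if `f x ≤ f (τ x)` and `f ≤ C x` then `f ≤ 0`. -/
lemma telescope {L m B : ℝ} {S Sx : ℝ → ℝ → ℝ} (h : FlowHyp L m B S Sx)
    {f bd : ℝ → ℝ} (hstep : ∀ x ∈ Ioo 0 L, f x ≤ f (tau L m S x))
    (hbd : ∀ x ∈ Ioo 0 L, f x ≤ bd x) (hbd0 : Tendsto bd (nhdsWithin 0 (Ioi 0)) (nhds 0)) :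
    ∀ x ∈ Ioo 0 L, f x ≤ 0 := by
  intro x hx
  have hmem := fun n => h.tau_iter_mem hx n
  have h1 : ∀ n, f x ≤ f ((tau L m S)^[n] x) := by
    intro n
    induction n with
    | zero => simp
    | succ n ih =>
      rw [Function.iterate_succ_apply']
      exact ih.trans (hstep _ (hmem n))
  have h2 : Tendsto (fun n => bd ((tau L m S)^[n] x)) atTop (nhds 0) := by
    refine hbd0.comp ?_
    rw [tendsto_nhdsWithin_iff]
    exact ⟨h.tau_tendsto hx, Eventually.of_forall fun n => (hmem n).1⟩
  exact ge_of_tendsto' h2 fun n => (h1 n).trans (hbd _ (hmem n))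


/-- Telescoping for pairs. -/
lemma telescope2 {L m B : ℝ} {S Sx : ℝ → ℝ → ℝ} (h : FlowHyp L m B S Sx)
    {f : ℝ → ℝ → ℝ} {bd : ℝ → ℝ}
    (hstep : ∀ x ∈ Ioo 0 L, ∀ x' ∈ Ioo 0 L, x < x' → f x x' ≤ f (tau L m S x) (tau L m S x'))
    (hbd : ∀ x ∈ Ioo 0 L, ∀ x' ∈ Ioo 0 L, x < x' → f x x' ≤ bd x')
    (hbd0 : Tendsto bd (nhdsWithin 0 (Ioi 0)) (nhds 0)) :
    ∀ x ∈ Ioo 0 L, ∀ x' ∈ Ioo 0 L, x < x' → f x x' ≤ 0 := by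
  intro x hx x' hx' hlt
  have hmem := fun n => h.tau_iter_mem hx n
  have hmem' := fun n => h.tau_iter_mem hx' n
  have hlts : ∀ n, (tau L m S)^[n] x < (tau L m S)^[n] x' := by
    intro n
    induction n with
    | zero => simpa using hlt
    | succ n ih =>
      rw [Function.iterate_succ_apply', Function.iterate_succ_apply']
      exact h.sig_lt (hmem n) (hmem' n) h.m_mem ih
  have h1 : ∀ n, f x x' ≤ f ((tau L m S)^[n] x) ((tau L m S)^[n] x') := by
    intro n
    induction n with
    | zero => simp
    | succ n ih =>
      rw [Function.iterate_succ_apply', Function.iterate_succ_apply']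
      exact ih.trans (hstep _ (hmem n) _ (hmem' n) (hlts n))
  have h2 : Tendsto (fun n => bd ((tau L m S)^[n] x')) atTop (nhds 0) := by
    refine hbd0.comp ?_
    rw [tendsto_nhdsWithin_iff]
    exact ⟨h.tau_tendsto hx', Eventually.of_forall fun n => (hmem' n).1⟩
  exact ge_of_tendsto' h2 fun n => (h1 n).trans (hbd _ (hmem n) _ (hmem' n) (hlts n))

end Nozzle

namespace Nozzle

/-- Everything the transport estimates need. -/
structure TD (L m B C κ M' : ℝ) (S Sx j : ℝ → ℝ → ℝ) (Θ Θ1 Θ2 c E E1 R R1 G G1 P : ℝ → ℝ) : Prop where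
  flow : FlowHyp L m B S Sx
  src : SrcHyp L m S Θ Θ1 c C
  dTh1 : ∀ x ∈ Ioo 0 L, HasDerivAt Θ1 (Θ2 x) x
  dpsi : ∀ x ∈ Ioo 0 L, ∀ ψ ∈ Icc (-m) m,
    HasDerivWithinAt (S x) (S x ψ * j x ψ) (Icc (-m) m) ψ
  sym : ∀ x ∈ Ioo 0 L, S x (-m) = S x m
  mono : ∀ x ∈ Ioo 0 L, ∀ ψ ∈ Icc (-m) m, 0 ≤ (Sx x ψ + j x ψ) * Θ1 x + S x ψ * Θ2 x
  dE : ∀ x ∈ Ioo 0 L, HasDerivAt E (E1 x) x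
  E_nonneg : ∀ x ∈ Ioo 0 L, 0 ≤ E x
  jE : ∀ x ∈ Ioo 0 L, ∀ ψ ∈ Icc (-m) m, |j x ψ| ≤ S x ψ * E1 x
  crude : ∀ x ∈ Ioo 0 L, ∀ ψ ∈ Icc (-m) m,
    Real.exp (E x) * (Θ x / m + 2 * (S x ψ * Θ1 x)) ≤ κ * (Θ x / m)
  dR : ∀ x ∈ Ioo 0 L, HasDerivAt R (R1 x) x
  R_nonneg : ∀ x ∈ Ioo 0 L, 0 ≤ R x
  jR : ∀ x ∈ Ioo 0 L, ∀ ψ ∈ Icc (-m) m, |j x ψ| * (κ * (Θ x / m)) ≤ S x ψ * R1 x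
  dG : ∀ x ∈ Ioo 0 L, HasDerivAt G (G1 x) x
  G_nonneg : ∀ x ∈ Ioo 0 L, 0 ≤ G x
  P_nonneg : ∀ x ∈ Ioo 0 L, 0 ≤ P x
  P_mono : MonotoneOn P (Ioo 0 L)
  hM' : 0 ≤ M'
  Dj : ∀ x ∈ Ioo 0 L, ∀ x' ∈ Ioo 0 L, x < x' → ∀ ψ ∈ Icc (-m) m,
    |j x' ψ - j x ψ| * (κ * (Θ x / m)) ≤ (S x' ψ * (M' * G1 x') - P x') * (x' - x)
  jump : ∀ x ∈ Ioo 0 L, ∀ x' ∈ Ioo 0 L, x < x' →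
    |S x' m * Θ1 x' - S x m * Θ1 x| ≤ m * P x' * (x' - x)

/-- Output of the transport problem. -/
structure TrSol (L m C' : ℝ) (S Sx : ℝ → ℝ → ℝ) (Θ Θ1 : ℝ → ℝ) (u w : ℝ → ℝ → ℝ) : Prop where
  du : ∀ x ∈ Ioo 0 L, ∀ ψ ∈ Icc (-m) m, HasDerivAt (fun x => u x ψ) (w x ψ) x
  cu : ∀ x ∈ Ioo 0 L, ContinuousOn (u x) (Icc (-m) m)
  dr : ∀ x ∈ Ioo 0 L, ∀ ψ ∈ Ico (-m) m,
        HasDerivWithinAt (u x) (-(S x ψ * w x ψ)) (Ioi ψ) ψ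
  dw : ∀ x ∈ Ioo 0 L, ∀ ψ ∈ Icc (-m) m, ∀ t ∈ Icc (-m) ψ,
        HasDerivWithinAt (fun t => w (flowY L m S x ψ t) t)
          (-(Sx (flowY L m S x ψ t) t * w (flowY L m S x ψ t) t)) (Icc (-m) ψ) t
  ju : ∀ x ∈ Ioo 0 L, u x (-m) = u x m + 2 * Θ x
  jw : ∀ x ∈ Ioo 0 L, w x (-m) = w x m + 2 * Θ1 x
  hC' : 0 ≤ C'
  w_nonneg : ∀ x ∈ Ioo 0 L, ∀ ψ ∈ Icc (-m) m, 0 ≤ w x ψ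
  w_le : ∀ x ∈ Ioo 0 L, ∀ ψ ∈ Icc (-m) m, w x ψ ≤ C' * x
  u_nonneg : ∀ x ∈ Ioo 0 L, ∀ ψ ∈ Icc (-m) m, 0 ≤ u x ψ
  u_le : ∀ x ∈ Ioo 0 L, ∀ ψ ∈ Icc (-m) m, u x ψ ≤ C' * x

lemma tendsto_lin (C : ℝ) : Tendsto (fun x : ℝ => C * x) (nhdsWithin 0 (Ioi 0)) (nhds 0) := by
  have : Continuous (fun x : ℝ => C * x) := by fun_prop
  have h := (this.tendsto 0).mono_left (nhdsWithin_le_nhds (s := Ioi 0))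
  simpa using h

lemma tendsto_quad (C : ℝ) : Tendsto (fun x : ℝ => C * x * x) (nhdsWithin 0 (Ioi 0)) (nhds 0) := by
  have : Continuous (fun x : ℝ => C * x * x) := by fun_prop
  have h := (this.tendsto 0).mono_left (nhdsWithin_le_nhds (s := Ioi 0))
  simpa using h

namespace TD
variable {L m B C κ M' : ℝ} {S Sx j : ℝ → ℝ → ℝ} {Θ Θ1 Θ2 c E E1 R R1 G G1 P : ℝ → ℝ}
local notation "TDData" => TD L m B C κ M' S Sx j Θ Θ1 Θ2 c E E1 R R1 G G1 P

lemma exists_sol (q : TDData) :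
    ∃ u w C', TrSol L m C' S Sx Θ Θ1 u w := by
  obtain ⟨u, w, h1, h2, h3, h4, h5, h6, C', hC', h7⟩ := q.src.exists_transport q.flow
  exact ⟨u, w, C', h1, h2, h3, h4, h5, h6, hC', fun x hx ψ hψ => (h7 x hx ψ hψ).1,
    fun x hx ψ hψ => (h7 x hx ψ hψ).2.1, fun x hx ψ hψ => (h7 x hx ψ hψ).2.2.1,
    fun x hx ψ hψ => (h7 x hx ψ hψ).2.2.2⟩

/-- derivative of S along a characteristic -/
lemma dS (q : TDData) {a b : ℝ} (ha : -m ≤ a) (hb : b ≤ m)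
    {Y : ℝ → ℝ} (hY : IsChar L S a b Y) : ∀ t ∈ Icc a b,
    HasDerivWithinAt (fun t => S (Y t) t) (S (Y t) t * (Sx (Y t) t + j (Y t) t)) (Icc a b) t := by
  intro t ht
  have hs : Icc a b ⊆ Icc (-m) m := Icc_subset_Icc ha hb
  have := chain_curve q.flow.contSx q.flow.der hs ht (hY t ht).1 (hY t ht).2
    (q.dpsi _ (hY t ht).1 t (hs ht))
  exact this.congr_deriv (by ring)

lemma comp_char {a b : ℝ} {Y : ℝ → ℝ} {F F1 : ℝ → ℝ} (hF : ∀ x ∈ Ioo 0 L, HasDerivAt F (F1 x) x)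
    (hY : IsChar L S a b Y) : ∀ t ∈ Icc a b,
    HasDerivWithinAt (fun t => F (Y t)) (S (Y t) t * F1 (Y t)) (Icc a b) t := by
  intro t ht
  have := (hF _ (hY t ht).1).comp_hasDerivWithinAt t (hY t ht).2
  exact this.congr_deriv (by ring)

/-- `SΘ₁` is nondecreasing along characteristics -/
lemma STh_mono (q : TDData) {a b : ℝ} (ha : -m ≤ a)
    (hb : b ≤ m) {Y : ℝ → ℝ} (hY : IsChar L S a b Y) :
    MonotoneOn (fun t => S (Y t) t * Θ1 (Y t)) (Icc a b) := by
  refine mono_of_deriv (fun t ht => (q.dS ha hb hY t ht).mul (comp_char q.dTh1 hY t ht)) ?_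
  intro t ht
  have ht' : t ∈ Icc (-m) m := ⟨ha.trans ht.1, ht.2.trans hb⟩
  have h1 := q.mono _ (hY t ht).1 t ht'
  have h2 := q.flow.S_pos _ (hY t ht).1 t ht'
  have := mul_nonneg h2.le h1
  nlinarith

/-- along a characteristic, Θ grows between start and end values -/
lemma Th_incr (q : TDData) {a b : ℝ} (hab : a ≤ b)
    (ha : -m ≤ a) (hb : b ≤ m) {Y : ℝ → ℝ} (hY : IsChar L S a b Y) :
    (b - a) * (S (Y a) a * Θ1 (Y a)) ≤ Θ (Y b) - Θ (Y a) ∧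
    Θ (Y b) - Θ (Y a) ≤ (b - a) * (S (Y b) b * Θ1 (Y b)) := by
  have hm := q.STh_mono ha hb hY
  have hl : ∀ k : ℝ, ∀ t ∈ Icc a b, HasDerivWithinAt (fun t => k * t) k (Icc a b) t := by
    intro k t _
    simpa using ((hasDerivAt_id t).const_mul k).hasDerivWithinAt
  constructor
  · have := incr_le hab (hl (S (Y a) a * Θ1 (Y a))) (comp_char q.src.hder hY)
      (fun t ht => hm (left_mem_Icc.2 hab) ht ht.1)
    linarith
  · have := incr_le hab (comp_char q.src.hder hY) (hl (S (Y b) b * Θ1 (Y b)))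
      (fun t ht => hm ht (right_mem_Icc.2 hab) ht.2)
    linarith

lemma STh_nonneg (q : TDData) {x ψ : ℝ} (hx : x ∈ Ioo 0 L)
    (hψ : ψ ∈ Icc (-m) m) : 0 ≤ S x ψ * Θ1 x :=
  mul_nonneg (q.flow.S_pos x hx ψ hψ).le (q.src.Th1_nonneg x hx)

variable {C' : ℝ} {u w : ℝ → ℝ → ℝ}

/-- `v' = j v` along characteristics -/
lemma dv (q : TDData) (o : TrSol L m C' S Sx Θ Θ1 u w)
    {x ψ : ℝ} (hx : x ∈ Ioo 0 L) (hψ : ψ ∈ Icc (-m) m) : ∀ t ∈ Icc (-m) ψ,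
    HasDerivWithinAt (fun t => S (flowY L m S x ψ t) t * w (flowY L m S x ψ t) t)
      (j (flowY L m S x ψ t) t * (S (flowY L m S x ψ t) t * w (flowY L m S x ψ t) t))
      (Icc (-m) ψ) t := by
  intro t ht
  have := (q.dS le_rfl hψ.2 (q.flow.flow_spec hx hψ).2.1 t ht).mul (o.dw x hx ψ hψ t ht)
  exact this.congr_deriv (by ring)

lemma v_nonneg (q : TDData) (o : TrSol L m C' S Sx Θ Θ1 u w)
    {x ψ : ℝ} (hx : x ∈ Ioo 0 L) (hψ : ψ ∈ Icc (-m) m) : 0 ≤ S x ψ * w x ψ :=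
  mul_nonneg (q.flow.S_pos x hx ψ hψ).le (o.w_nonneg x hx ψ hψ)

lemma v_quad (q : TDData) (o : TrSol L m C' S Sx Θ Θ1 u w)
    {x ψ : ℝ} (hx : x ∈ Ioo 0 L) (hψ : ψ ∈ Icc (-m) m) : S x ψ * w x ψ ≤ B * C' * x * x := by
  have h1 := q.flow.S_le x hx ψ hψ
  have h2 := o.w_le x hx ψ hψ
  have := mul_le_mul h1 h2 (o.w_nonneg x hx ψ hψ) ((q.flow.S_pos x hx ψ hψ).le.trans h1)
  linarith

lemma v_jump (q : TDData) (o : TrSol L m C' S Sx Θ Θ1 u w)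
    {x : ℝ} (hx : x ∈ Ioo 0 L) : S x (-m) * w x (-m) = S x m * w x m + 2 * (S x m * Θ1 x) := by
  rw [q.sym x hx, o.jw x hx]; ring

/-- upper barrier argument -/
lemma upper_gen (q : TDData) (o : TrSol L m C' S Sx Θ Θ1 u w)
    {V : ℝ → ℝ → ℝ} (hmon : ∀ x ∈ Ioo 0 L, ∀ ψ ∈ Icc (-m) m, V x ψ ≤ V (sig L m S x ψ) (-m))
    (hV : ∀ x ∈ Ioo 0 L, V x m ≤ S x m * w x m)
    (hjump : ∀ x ∈ Ioo 0 L, V x (-m) ≤ V x m + 2 * (S x m * Θ1 x)) :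
    (∀ x ∈ Ioo 0 L, ∀ ψ ∈ Icc (-m) m, V x ψ ≤ Θ x / m + 2 * (S x ψ * Θ1 x)) := by
  have hm := q.flow.hm
  have key : ∀ x ∈ Ioo 0 L, V x m - Θ x / m ≤ 0 := by
    refine telescope q.flow (bd := fun x => B * C' * x * x) ?_ ?_ (tendsto_quad _)
    · intro x hx
      have h1 := hmon x hx m q.flow.m_mem
      have hτ := q.flow.tau_mem hx
      have h2 := hjump _ hτ
      obtain ⟨e1, e2, e3⟩ := q.flow.flow_spec hx q.flow.m_mem
      have h3 := (q.Th_incr (by linarith) le_rfl le_rfl e2).1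
      rw [e1] at h3
      change _ ≤ V (tau L m S x) (-m) at h1
      change (m - -m) * (S (tau L m S x) (-m) * Θ1 (tau L m S x)) ≤ Θ x - Θ (tau L m S x) at h3
      rw [q.sym _ hτ] at h3
      have h4 : 2 * (S (tau L m S x) m * Θ1 (tau L m S x)) ≤ (Θ x - Θ (tau L m S x)) / m := by
        rw [le_div_iff₀ hm]; linarith
      rw [sub_div] at h4
      linarith
    · intro x hx
      have := q.src.Th_nonneg x hx
      have h1 : 0 ≤ Θ x / m := by positivity
      linarith [hV x hx, q.v_quad o hx q.flow.m_mem]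
  intro x hx ψ hψ
  have h1 := hmon x hx ψ hψ
  have hs := q.flow.sig_mem hx hψ
  obtain ⟨e1, e2, e3⟩ := q.flow.flow_spec hx hψ
  have h3 := q.STh_mono le_rfl hψ.2 e2 (left_mem_Icc.2 hψ.1) (right_mem_Icc.2 hψ.1) hψ.1
  simp only [e1] at h3
  change S (sig L m S x ψ) (-m) * Θ1 (sig L m S x ψ) ≤ _ at h3
  rw [q.sym _ hs] at h3
  have h4 := (q.Th_incr hψ.1 le_rfl hψ.2 e2).1
  rw [e1] at h4
  change (ψ - -m) * (S (sig L m S x ψ) (-m) * Θ1 (sig L m S x ψ)) ≤ Θ x - Θ (sig L m S x ψ) at h4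
  have h5 : Θ (sig L m S x ψ) / m ≤ Θ x / m := by
    apply div_le_div_of_nonneg_right _ hm.le
    have := mul_nonneg (sub_nonneg.2 hψ.1) (q.STh_nonneg hs q.flow.nm_mem)
    linarith
  linarith [key _ hs, hjump _ hs]

lemma v_crude (q : TDData) (o : TrSol L m C' S Sx Θ Θ1 u w) :
    ∀ x ∈ Ioo 0 L, ∀ ψ ∈ Icc (-m) m, S x ψ * w x ψ ≤ κ * (Θ x / m) := by
  have hex : ∀ x ∈ Ioo 0 L, Real.exp (-E x) ≤ 1 := fun x hx => by
    rw [exp_le_one_iff]; linarith [q.E_nonneg x hx]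
  have key := q.upper_gen o (V := fun x ψ => Real.exp (-E x) * (S x ψ * w x ψ)) ?_ ?_ ?_
  · intro x hx ψ hψ
    refine le_trans ?_ (q.crude x hx ψ hψ)
    have h1 := key x hx ψ hψ
    have := mul_le_mul_of_nonneg_left h1 (exp_pos (E x)).le
    rwa [← mul_assoc, ← exp_add, add_neg_cancel, exp_zero, one_mul] at this
  · intro x hx ψ hψ
    obtain ⟨e1, e2, e3⟩ := q.flow.flow_spec hx hψ
    have := incr_le hψ.1 (fun t ht => (((comp_char q.dE e2 t ht).neg.exp).mul (q.dv o hx hψ t ht)))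
      (h := fun _ => (0 : ℝ)) (h' := fun _ => 0) (fun t _ => hasDerivWithinAt_const _ _ _) ?_
    · simp only [Pi.mul_apply, Pi.neg_apply, e1] at this
      change _ - Real.exp (-E (sig L m S x ψ)) * (S (sig L m S x ψ) (-m) * w (sig L m S x ψ) (-m)) ≤ _ at this
      linarith
    · intro t ht
      have ht' : t ∈ Icc (-m) m := ⟨ht.1, ht.2.trans hψ.2⟩
      have hy := (e2 t ht).1
      have h1 := (abs_le.1 (q.jE _ hy t ht')).2
      have h2 := q.v_nonneg o hy ht'
      have h3 := mul_nonneg (exp_pos (-E (flowY L m S x ψ t))).le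
        (mul_nonneg (sub_nonneg.2 h1) h2)
      simp only [Pi.neg_apply]
      linarith
  · intro x hx
    exact mul_le_of_le_one_left (q.v_nonneg o hx q.flow.m_mem) (hex x hx)
  · intro x hx
    rw [q.v_jump o hx, mul_add]
    have := mul_le_of_le_one_left (mul_nonneg zero_le_two (q.STh_nonneg hx q.flow.m_mem)) (hex x hx)
    linarith

lemma v_upper (q : TDData) (o : TrSol L m C' S Sx Θ Θ1 u w) :
    ∀ x ∈ Ioo 0 L, ∀ ψ ∈ Icc (-m) m, S x ψ * w x ψ ≤ Θ x / m + 2 * (S x ψ * Θ1 x) + R x := by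
  have key := q.upper_gen o (V := fun x ψ => S x ψ * w x ψ - R x) ?_ ?_ ?_
  · intro x hx ψ hψ
    linarith [key x hx ψ hψ]
  · intro x hx ψ hψ
    obtain ⟨e1, e2, e3⟩ := q.flow.flow_spec hx hψ
    have := incr_le hψ.1 (q.dv o hx hψ) (comp_char q.dR e2) ?_
    · simp only [e1] at this
      change _ - S (sig L m S x ψ) (-m) * w (sig L m S x ψ) (-m) ≤ R x - R (sig L m S x ψ) at this
      linarith
    · intro t ht
      have ht' : t ∈ Icc (-m) m := ⟨ht.1, ht.2.trans hψ.2⟩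
      have hy := (e2 t ht).1
      refine le_trans ?_ (q.jR _ hy t ht')
      exact mul_le_mul (le_abs_self _) (q.v_crude o _ hy t ht') (q.v_nonneg o hy ht') (abs_nonneg _)
  · intro x hx
    linarith [q.R_nonneg x hx]
  · intro x hx
    rw [q.v_jump o hx]
    linarith

lemma v_lower (q : TDData) (o : TrSol L m C' S Sx Θ Θ1 u w) :
    ∀ x ∈ Ioo 0 L, ∀ ψ ∈ Icc (-m) m, Θ x / m - 2 * (S x ψ * Θ1 x) - R x ≤ S x ψ * w x ψ := by
  have hm := q.flow.hm
  have hmon : ∀ x ∈ Ioo 0 L, ∀ ψ ∈ Icc (-m) m,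
      S (sig L m S x ψ) (-m) * w (sig L m S x ψ) (-m) + R (sig L m S x ψ) ≤ S x ψ * w x ψ + R x := by
    intro x hx ψ hψ
    obtain ⟨e1, e2, e3⟩ := q.flow.flow_spec hx hψ
    have := incr_le hψ.1 (fun t ht => (q.dv o hx hψ t ht).neg) (comp_char q.dR e2) ?_
    · simp only [Pi.neg_apply, e1] at this
      change _ - -(S (sig L m S x ψ) (-m) * w (sig L m S x ψ) (-m)) ≤ R x - R (sig L m S x ψ) at this
      linarith
    · intro t ht
      have ht' : t ∈ Icc (-m) m := ⟨ht.1, ht.2.trans hψ.2⟩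
      have hy := (e2 t ht).1
      refine le_trans ?_ (q.jR _ hy t ht')
      rw [← neg_mul]
      exact mul_le_mul (neg_le_abs _) (q.v_crude o _ hy t ht') (q.v_nonneg o hy ht') (abs_nonneg _)
  have key : ∀ x ∈ Ioo 0 L, Θ x / m - R x - S x (-m) * w x (-m) ≤ 0 := by
    refine telescope q.flow (bd := fun x => (C * B / m) * x) ?_ ?_ (tendsto_lin _)
    · intro x hx
      have h1 := hmon x hx m q.flow.m_mem
      have hτ := q.flow.tau_mem hx
      obtain ⟨e1, e2, e3⟩ := q.flow.flow_spec hx q.flow.m_mem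
      have h3 := (q.Th_incr (by linarith) le_rfl le_rfl e2).2
      rw [e1] at h3
      change S (tau L m S x) (-m) * w (tau L m S x) (-m) + R (tau L m S x) ≤ _ at h1
      change Θ x - Θ (tau L m S x) ≤ _ at h3
      have h4 : (Θ x - Θ (tau L m S x)) / m ≤ 2 * (S x m * Θ1 x) := by
        rw [div_le_iff₀ hm]; linarith
      rw [sub_div] at h4
      rw [q.v_jump o hx]
      linarith
    · intro x hx
      have h1 := q.src.Th_le x hx
      have h2 := mul_le_mul_of_nonneg_left ((q.src.c_le x hx m q.flow.m_mem).trans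
        (q.flow.S_le x hx m q.flow.m_mem)) q.src.hC
      have h3 := div_le_div_of_nonneg_right (h1.trans h2) hm.le
      have h4 := q.v_nonneg o hx q.flow.nm_mem
      have h5 := q.R_nonneg x hx
      have : C * (B * x) / m = C * B / m * x := by ring
      linarith
  intro x hx ψ hψ
  have h1 := hmon x hx ψ hψ
  have hs := q.flow.sig_mem hx hψ
  obtain ⟨e1, e2, e3⟩ := q.flow.flow_spec hx hψ
  have h4 := (q.Th_incr hψ.1 le_rfl hψ.2 e2).2
  rw [e1] at h4
  change Θ x - Θ (sig L m S x ψ) ≤ _ at h4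
  have h6 := q.STh_nonneg hx hψ
  have h5 : (Θ x - Θ (sig L m S x ψ)) / m ≤ 2 * (S x ψ * Θ1 x) := by
    rw [div_le_iff₀ hm]
    have : (ψ - -m) * (S x ψ * Θ1 x) ≤ 2 * m * (S x ψ * Θ1 x) :=
      mul_le_mul_of_nonneg_right (by linarith [hψ.2]) h6
    linarith
  rw [sub_div] at h5
  linarith [key _ hs]

end TD
end Nozzle

namespace Nozzle
namespace TD
variable {L m B C κ M' : ℝ} {S Sx j : ℝ → ℝ → ℝ} {Θ Θ1 Θ2 c E E1 R R1 G G1 P : ℝ → ℝ}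
local notation "TDData" => TD L m B C κ M' S Sx j Θ Θ1 Θ2 c E E1 R R1 G G1 P
variable {C' : ℝ} {u w : ℝ → ℝ → ℝ}

/-- One characteristic pass for the Lipschitz estimate. -/
lemma lip_pass (q : TDData)
    (o : TrSol L m C' S Sx Θ Θ1 u w) {x x' ψ : ℝ} (hx : x ∈ Ioo 0 L) (hx' : x' ∈ Ioo 0 L)
    (hlt : x < x') (hψ : ψ ∈ Icc (-m) m) :
    Real.exp (-E x') * |S x' ψ * w x' ψ - S x ψ * w x ψ| -
      Real.exp (-E (sig L m S x' ψ)) * |S (sig L m S x' ψ) (-m) * w (sig L m S x' ψ) (-m) -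
        S (sig L m S x ψ) (-m) * w (sig L m S x ψ) (-m)| ≤
    M' * G x' * (x' - x) - M' * G (sig L m S x' ψ) * (sig L m S x' ψ - sig L m S x ψ) -
      (ψ + m) * (P (sig L m S x' ψ) * (sig L m S x' ψ - sig L m S x ψ)) := by
  obtain ⟨e1, e2, e3⟩ := q.flow.flow_spec hx hψ
  obtain ⟨e1', e2', e3'⟩ := q.flow.flow_spec hx' hψ
  set Y := flowY L m S x ψ with hYd
  set Y' := flowY L m S x' ψ with hYd'
  have hYlt : ∀ t ∈ Icc (-m) ψ, Y t < Y' t :=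
    q.flow.char_lt le_rfl hψ.2 e2 e2' (by rw [e1, e1']; exact hlt)
  have hgapd : ∀ t ∈ Icc (-m) ψ, HasDerivWithinAt (fun t => Y' t - Y t)
      (S (Y' t) t - S (Y t) t) (Icc (-m) ψ) t := fun t ht => (e2' t ht).2.sub (e2 t ht).2
  have hSm : ∀ t ∈ Icc (-m) ψ, 0 ≤ S (Y' t) t - S (Y t) t := fun t ht =>
    sub_nonneg.2 (q.flow.mono_S ⟨ht.1, ht.2.trans hψ.2⟩ (e2 t ht).1 (e2' t ht).1 (hYlt t ht).le)
  have hgap : MonotoneOn (fun t => Y' t - Y t) (Icc (-m) ψ) := mono_of_deriv hgapd hSm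
  have hYm' : MonotoneOn Y' (Icc (-m) ψ) := q.flow.char_mono le_rfl hψ.2 e2'
  have hleft : -m ∈ Icc (-m) ψ := left_mem_Icc.2 hψ.1
  set p0 := P (Y' (-m)) * (Y' (-m) - Y (-m)) with hp0
  have hD : ∀ t ∈ Icc (-m) ψ, HasDerivWithinAt
      (fun t => Real.exp (-E (Y' t)) * (S (Y' t) t * w (Y' t) t - S (Y t) t * w (Y t) t))
      ((j (Y' t) t - S (Y' t) t * E1 (Y' t)) *
        (Real.exp (-E (Y' t)) * (S (Y' t) t * w (Y' t) t - S (Y t) t * w (Y t) t)) +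
        Real.exp (-E (Y' t)) * ((j (Y' t) t - j (Y t) t) * (S (Y t) t * w (Y t) t)))
      (Icc (-m) ψ) t := by
    intro t ht
    have := ((comp_char q.dE e2' t ht).neg.exp).mul ((q.dv o hx' hψ t ht).sub (q.dv o hx hψ t ht))
    refine this.congr_deriv ?_
    simp only [Pi.neg_apply, Pi.sub_apply]
    ring
  have hN : ∀ t ∈ Icc (-m) ψ, HasDerivWithinAt
      (fun t => M' * G (Y' t) * (Y' t - Y t) - p0 * t)
      (M' * (S (Y' t) t * G1 (Y' t)) * (Y' t - Y t) + M' * G (Y' t) * (S (Y' t) t - S (Y t) t) - p0)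
      (Icc (-m) ψ) t := by
    intro t ht
    have := (((comp_char q.dG e2' t ht).const_mul M').mul (hgapd t ht)).sub
      (((hasDerivAt_id t).const_mul p0).hasDerivWithinAt)
    refine this.congr_deriv ?_
    simp
  have key := damped hψ.1 hD ?_ hN ?_
  · simp only [e1, e1', abs_mul, abs_of_pos (exp_pos _)] at key
    change _ - Real.exp (-E (Y' (-m))) * |S (Y' (-m)) (-m) * w (Y' (-m)) (-m) -
        S (Y (-m)) (-m) * w (Y (-m)) (-m)| ≤
      M' * G x' * (x' - x) - M' * G (Y' (-m)) * (Y' (-m) - Y (-m)) - (ψ + m) * p0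
    linarith
  · intro t ht
    have := (abs_le.1 (q.jE _ (e2' t ht).1 t ⟨ht.1, ht.2.trans hψ.2⟩)).2
    linarith
  · intro t ht
    have ht' : t ∈ Icc (-m) m := ⟨ht.1, ht.2.trans hψ.2⟩
    have hy := (e2 t ht).1
    have hy' := (e2' t ht).1
    rw [abs_mul, abs_mul, abs_of_pos (exp_pos _)]
    have h1 : Real.exp (-E (Y' t)) ≤ 1 := by
      rw [exp_le_one_iff]; linarith [q.E_nonneg _ hy']
    have h2 := q.v_nonneg o hy ht'
    rw [abs_of_nonneg h2]
    have h3 := q.v_crude o _ hy t ht'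
    have h4 := q.Dj _ hy _ hy' (hYlt t ht) t ht'
    have h5 := mul_le_mul_of_nonneg_left h3 (abs_nonneg (j (Y' t) t - j (Y t) t))
    have h6 : Real.exp (-E (Y' t)) * (|j (Y' t) t - j (Y t) t| * (S (Y t) t * w (Y t) t)) ≤
        |j (Y' t) t - j (Y t) t| * (S (Y t) t * w (Y t) t) :=
      mul_le_of_le_one_left (mul_nonneg (abs_nonneg _) h2) h1
    have h7 : p0 ≤ P (Y' t) * (Y' t - Y t) := by
      refine mul_le_mul (q.P_mono (e2' _ hleft).1 hy' (hYm' hleft ht ht.1)) (hgap hleft ht ht.1) ?_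
        (q.P_nonneg _ hy')
      linarith [hYlt _ hleft]
    have h8 := mul_nonneg (mul_nonneg q.hM' (q.G_nonneg _ hy')) (hSm t ht)
    linarith

lemma jump_pair (q : TDData)
    (o : TrSol L m C' S Sx Θ Θ1 u w) {x x' : ℝ} (hx : x ∈ Ioo 0 L) (hx' : x' ∈ Ioo 0 L)
    (hlt : x < x') :
    Real.exp (-E x') * |S x' (-m) * w x' (-m) - S x (-m) * w x (-m)| ≤
      Real.exp (-E x') * |S x' m * w x' m - S x m * w x m| + 2 * m * (P x' * (x' - x)) := by
  have hj := q.jump x hx x' hx' hlt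
  rw [q.v_jump o hx, q.v_jump o hx']
  have h1 : Real.exp (-E x') ≤ 1 := by
    rw [exp_le_one_iff]; linarith [q.E_nonneg _ hx']
  have h0 := (exp_pos (-E x')).le
  have h2 : |S x' m * w x' m + 2 * (S x' m * Θ1 x') - (S x m * w x m + 2 * (S x m * Θ1 x))| ≤
      |S x' m * w x' m - S x m * w x m| + 2 * |S x' m * Θ1 x' - S x m * Θ1 x| := by
    have := abs_add_le (S x' m * w x' m - S x m * w x m) (2 * (S x' m * Θ1 x' - S x m * Θ1 x))
    rw [abs_mul, abs_two] at this
    refine le_trans (le_of_eq ?_) this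
    congr 1; ring
  have h3 := mul_le_mul_of_nonneg_left h2 h0
  rw [mul_add] at h3
  have h4 := mul_le_of_le_one_left (mul_nonneg zero_le_two (abs_nonneg (S x' m * Θ1 x' - S x m * Θ1 x))) h1
  linarith

lemma v_lip (q : TDData)
    (o : TrSol L m C' S Sx Θ Θ1 u w) {x x' ψ : ℝ} (hx : x ∈ Ioo 0 L) (hx' : x' ∈ Ioo 0 L)
    (hlt : x < x') (hψ : ψ ∈ Icc (-m) m) :
    |S x' ψ * w x' ψ - S x ψ * w x ψ| ≤
      Real.exp (E x') * ((M' * G x' + 2 * m * P x') * (x' - x)) := by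
  have hm := q.flow.hm
  have key : ∀ x ∈ Ioo 0 L, ∀ x' ∈ Ioo 0 L, x < x' →
      Real.exp (-E x') * |S x' m * w x' m - S x m * w x m| - M' * G x' * (x' - x) ≤ 0 := by
    refine telescope2 q.flow (bd := fun x => 2 * (B * C') * x * x)
      (f := fun x x' => Real.exp (-E x') * |S x' m * w x' m - S x m * w x m| - M' * G x' * (x' - x))
      ?_ ?_ (tendsto_quad _)
    · intro x hx x' hx' hlt
      have h1 := q.lip_pass o hx hx' hlt q.flow.m_mem
      change _ - Real.exp (-E (tau L m S x')) * |S (tau L m S x') (-m) * w (tau L m S x') (-m) -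
        S (tau L m S x) (-m) * w (tau L m S x) (-m)| ≤ M' * G x' * (x' - x) -
        M' * G (tau L m S x') * (tau L m S x' - tau L m S x) -
        (m + m) * (P (tau L m S x') * (tau L m S x' - tau L m S x)) at h1
      have h2 := q.jump_pair o (q.flow.tau_mem hx) (q.flow.tau_mem hx')
        (q.flow.sig_lt hx hx' q.flow.m_mem hlt)
      linarith
    · intro x hx x' hx' hlt
      have h1 : Real.exp (-E x') ≤ 1 := by
        rw [exp_le_one_iff]; linarith [q.E_nonneg _ hx']
      have h2 := mul_le_of_le_one_left (abs_nonneg (S x' m * w x' m - S x m * w x m)) h1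
      have h3 := mul_nonneg (mul_nonneg q.hM' (q.G_nonneg _ hx')) (sub_nonneg.2 hlt.le)
      have h4 := q.v_quad o hx' q.flow.m_mem
      have h5 := q.v_quad o hx q.flow.m_mem
      have h6 := q.v_nonneg o hx' q.flow.m_mem
      have h7 := q.v_nonneg o hx q.flow.m_mem
      have hBC : 0 ≤ B * C' := mul_nonneg (q.flow.B_nonneg hx) o.hC'
      have h9 : x * x ≤ x' * x' := mul_self_le_mul_self hx.1.le hlt.le
      have h8 : B * C' * (x * x) ≤ B * C' * (x' * x') := mul_le_mul_of_nonneg_left h9 hBC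
      have h10 : 0 ≤ B * C' * (x * x) := mul_nonneg hBC (mul_self_nonneg x)
      have : |S x' m * w x' m - S x m * w x m| ≤ 2 * (B * C') * x' * x' := by
        rw [abs_le]; constructor <;> linarith
      linarith
  have hs := q.flow.sig_mem hx hψ
  have hs' := q.flow.sig_mem hx' hψ
  have hslt := q.flow.sig_lt hx hx' hψ hlt
  have h1 := q.lip_pass o hx hx' hlt hψ
  have h2 := q.jump_pair o hs hs' hslt
  have h3 := key _ hs _ hs' hslt
  have hgap := (q.flow.flow_gap hx hx' hψ hlt (left_mem_Icc.2 hψ.1)).2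
  change sig L m S x' ψ - sig L m S x ψ ≤ x' - x at hgap
  have h4 : P (sig L m S x' ψ) * (sig L m S x' ψ - sig L m S x ψ) ≤ P x' * (x' - x) :=
    mul_le_mul (q.P_mono hs' hx' (q.flow.sig_le hx' hψ)) hgap (by linarith) (q.P_nonneg _ hx')
  have h4' := mul_nonneg (q.P_nonneg _ hs') (sub_nonneg.2 hslt.le)
  have h5 := mul_nonneg (show 0 ≤ ψ + m by linarith [hψ.1]) h4'
  have h6 : Real.exp (-E x') * |S x' ψ * w x' ψ - S x ψ * w x ψ| ≤
      (M' * G x' + 2 * m * P x') * (x' - x) := by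
    have := mul_le_mul_of_nonneg_left h4 (show 0 ≤ 2 * m by linarith)
    linarith
  have := mul_le_mul_of_nonneg_left h6 (exp_pos (E x')).le
  rwa [← mul_assoc, ← exp_add, add_neg_cancel, exp_zero, one_mul] at this

/-- Lipschitz estimate in ψ. -/
lemma v_lip_psi (q : TDData)
    (o : TrSol L m C' S Sx Θ Θ1 u w) {x ψ ψ' a J Λ : ℝ} (hx : x ∈ Ioo 0 L)
    (hψ : ψ ∈ Icc (-m) m) (hψ' : ψ' ∈ Icc (-m) m) (hle : ψ ≤ ψ')
    (ha : ∀ y ∈ Ioc 0 x, ∀ t ∈ Icc (-m) m, S y t ≤ a)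
    (hJ : ∀ y ∈ Ioc 0 x, ∀ t ∈ Icc (-m) m, |j y t| * (κ * (Θ y / m)) ≤ J)
    (hΛ : Real.exp (E x) * (M' * G x + 2 * m * P x) ≤ Λ) :
    |S x ψ' * w x ψ' - S x ψ * w x ψ| ≤ (J + Λ * a) * (ψ' - ψ) := by
  obtain ⟨e1, e2, e3⟩ := q.flow.flow_spec hx hψ'
  set Y := flowY L m S x ψ' with hYd
  have hmem : ψ ∈ Icc (-m) ψ' := ⟨hψ.1, hle⟩
  have hyx := e3 ψ hmem
  have hy := (e2 ψ hmem).1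
  have hsub : Icc ψ ψ' ⊆ Icc (-m) ψ' := Icc_subset_Icc_left hψ.1
  have hlin : ∀ k : ℝ, ∀ t ∈ Icc ψ ψ', HasDerivWithinAt (fun t => k * t) k (Icc ψ ψ') t := by
    intro k t _
    simpa using ((hasDerivAt_id t).const_mul k).hasDerivWithinAt
  have h1 : |S x ψ' * w x ψ' - S (Y ψ) ψ * w (Y ψ) ψ| ≤ J * (ψ' - ψ) := by
    have hb : ∀ t ∈ Icc ψ ψ', |j (Y t) t * (S (Y t) t * w (Y t) t)| ≤ J := by
      intro t ht
      have ht2 := hsub ht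
      have ht' : t ∈ Icc (-m) m := ⟨ht2.1, ht2.2.trans hψ'.2⟩
      have hyt := (e2 t ht2).1
      rw [abs_mul, abs_of_nonneg (q.v_nonneg o hyt ht')]
      exact (mul_le_mul_of_nonneg_left (q.v_crude o _ hyt t ht') (abs_nonneg _)).trans
        (hJ _ ⟨hyt.1, e3 t ht2⟩ t ht')
    have hd : ∀ t ∈ Icc ψ ψ', HasDerivWithinAt (fun t => S (Y t) t * w (Y t) t)
        (j (Y t) t * (S (Y t) t * w (Y t) t)) (Icc ψ ψ') t := fun t ht =>
      (q.dv o hx hψ' t (hsub ht)).mono hsub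
    have i1 := incr_le hle hd (hlin J) (fun t ht => (abs_le.1 (hb t ht)).2)
    have i2 := incr_le hle (hlin (-J)) hd (fun t ht => (abs_le.1 (hb t ht)).1)
    simp only [e1] at i1 i2
    rw [abs_le]
    constructor <;> linarith
  have h2 : x - Y ψ ≤ a * (ψ' - ψ) := by
    have := incr_le hle (fun t ht => ((e2 t (hsub ht)).2.mono hsub)) (hlin a) (fun t ht =>
      ha _ ⟨(e2 t (hsub ht)).1.1, e3 t (hsub ht)⟩ t ⟨(hsub ht).1, (hsub ht).2.trans hψ'.2⟩)
    rw [e1] at this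
    linarith
  have hΛ0 : 0 ≤ Λ := by
    refine le_trans ?_ hΛ
    have := q.G_nonneg x hx
    have := q.P_nonneg x hx
    have := q.hM'
    have := q.flow.hm
    positivity
  have h3 : |S (Y ψ) ψ * w (Y ψ) ψ - S x ψ * w x ψ| ≤ Λ * (x - Y ψ) := by
    rcases hyx.eq_or_lt with he | hlt
    · rw [he]; simp
    · rw [abs_sub_comm]
      refine (q.v_lip o hy hx hlt hψ).trans ?_
      rw [← mul_assoc]
      exact mul_le_mul_of_nonneg_right hΛ (by linarith)
  have h4 := mul_le_mul_of_nonneg_left h2 hΛ0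
  have := abs_add_le (S x ψ' * w x ψ' - S (Y ψ) ψ * w (Y ψ) ψ)
    (S (Y ψ) ψ * w (Y ψ) ψ - S x ψ * w x ψ)
  rw [sub_add_sub_cancel] at this
  linarith

end TD
end Nozzle

namespace Nozzle

lemma lip2_cont {L m A A' : ℝ} {F : ℝ → ℝ → ℝ}
    (h1 : ∀ x ∈ Ioo 0 L, ∀ x' ∈ Ioo 0 L, ∀ ψ ∈ Icc (-m) m, |F x' ψ - F x ψ| ≤ A * |x' - x|)
    (h2 : ∀ x ∈ Ioo 0 L, ∀ ψ ∈ Icc (-m) m, ∀ ψ' ∈ Icc (-m) m, |F x ψ' - F x ψ| ≤ A' * |ψ' - ψ|) :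
    ContinuousOn (fun p : ℝ × ℝ => F p.1 p.2) (Ioo 0 L ×ˢ Icc (-m) m) := by
  rintro ⟨x, ψ⟩ ⟨hx, hψ⟩
  rw [ContinuousWithinAt, tendsto_iff_norm_sub_tendsto_zero]
  have hc : Tendsto (fun p : ℝ × ℝ => A * |p.1 - x| + A' * |p.2 - ψ|)
      (nhdsWithin (x, ψ) (Ioo 0 L ×ˢ Icc (-m) m)) (nhds 0) := by
    have : Continuous (fun p : ℝ × ℝ => A * |p.1 - x| + A' * |p.2 - ψ|) := by fun_prop
    have h := (this.tendsto (x, ψ)).mono_left (nhdsWithin_le_nhds (s := Ioo 0 L ×ˢ Icc (-m) m))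
    simpa using h
  refine squeeze_zero' (Eventually.of_forall fun p => norm_nonneg _) ?_ hc
  filter_upwards [self_mem_nhdsWithin] with p hp
  have e1 := h1 x hx p.1 hp.1 p.2 hp.2
  have e2 := h2 x hx ψ hψ p.2 hp.2
  rw [Real.norm_eq_abs]
  have := abs_add_le (F p.1 p.2 - F x p.2) (F x p.2 - F x ψ)
  rw [sub_add_sub_cancel] at this
  linarith

/-- continuous right derivative gives two-sided derivative. -/
lemma deriv_of_right {a b : ℝ} {f f' : ℝ → ℝ} (hf : ContinuousOn f (Icc a b))
    (hf' : ContinuousOn f' (Icc a b)) (hd : ∀ t ∈ Ico a b, HasDerivWithinAt f (f' t) (Ioi t) t) :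
    ∀ t ∈ Icc a b, HasDerivWithinAt f (f' t) (Icc a b) t := by
  intro t ht
  have hE : ∀ r ∈ Icc a b, f r = f a + ∫ s in a..r, f' s := by
    intro r hr
    have := intervalIntegral.integral_eq_sub_of_hasDeriv_right_of_le hr.1
      (hf.mono (Icc_subset_Icc_right hr.2)) (fun s hs => hd s ⟨hs.1.le, hs.2.trans_le hr.2⟩)
      ((hf'.mono (Icc_subset_Icc_right hr.2)).intervalIntegrable_of_Icc hr.1)
    linarith
  have hI : HasDerivWithinAt (fun r => ∫ s in a..r, f' s) (f' t) (Icc a b) t := by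
    have : Fact (t ∈ Icc a b) := ⟨ht⟩
    refine intervalIntegral.integral_hasDerivWithinAt_right
      ((hf'.mono (Icc_subset_Icc_right ht.2)).intervalIntegrable_of_Icc ht.1)
      (s := Icc a b) (t := Icc a b) ?_ (hf' t ht)
    exact hf'.stronglyMeasurableAtFilter_nhdsWithin measurableSet_Icc t
  exact (hI.const_add (f a)).congr hE (hE t ht)

/-- Gas functions near the sonic state. -/
structure Gas (ε s0 cs ηm : ℝ) (s r qt k : ℝ → ℝ) : Prop where
  hs0 : 0 < s0
  hcs : 0 < cs
  ds : ∀ η ∈ Ioo 0 ηm, HasDerivAt s (s η * r η) η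
  dqt : ∀ η ∈ Ioo 0 ηm, HasDerivAt qt (qt η * k η) η
  s_pos : ∀ η ∈ Ioo 0 ηm, 0 < s η
  qt_pos : ∀ η ∈ Ioo 0 ηm, 0 < qt η
  cr : ContinuousOn r (Ioo 0 ηm)
  ck : ContinuousOn k (Ioo 0 ηm)
  s_cube : ∀ η ∈ Ioo 0 ηm, |s η ^ 3 - s0 ^ 3 * η| ≤ ε / 10 * (s0 ^ 3 * η)
  hr : ∀ η ∈ Ioo 0 ηm, |3 * (η * r η) - 1| ≤ ε / 10
  hk : ∀ η ∈ Ioo 0 ηm, |η * k η| ≤ ε / 100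
  hq : ∀ η ∈ Ioo 0 ηm, |qt η - cs| ≤ ε / 100 * cs
  dr : ∀ η ∈ Ioo 0 ηm, ∀ η' ∈ Ioo 0 ηm, η ≤ η' → |r η' - r η| ≤ 1 / η - 1 / η'

/-- Wall functions. -/
structure Wall (L m c0 ε θ lam n1 cr d2 d3 K M' ηm : ℝ) (g g1 Θ Θ1 Θ2 y z E E1 : ℝ → ℝ) : Prop where
  hm : 0 < m
  hL : L ≤ 1
  hc0 : 0 < c0
  hε : 0 < ε
  hε' : ε ≤ 1 / 20
  hθ0 : 0 < θ
  hlam : 0 < lam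
  hn1 : 1 ≤ n1
  hcr : 1 ≤ cr
  hd2 : 0 < d2
  hd3 : 0 < d3
  hK : 0 < K
  hM' : 0 < M'
  hKθ : 5 * c0 * d2 ≤ K * (1 - θ)
  hn : 20 * ε * cr ≤ n1 / 2
  g_pos : ∀ x ∈ Ioo 0 L, 0 < g x
  g1_pos : ∀ x ∈ Ioo 0 L, 0 < g1 x
  dg : ∀ x ∈ Ioo 0 L, HasDerivAt g (g1 x) x
  g_le : ∀ x ∈ Ioo 0 L, g x ≤ x
  g_eta : ∀ x ∈ Ioo 0 L, (1 + ε) * g x ^ 3 < ηm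
  g1_le : ∀ x ∈ Ioo 0 L, x * g1 x ≤ cr * g x
  y_pos : ∀ x ∈ Ioo 0 L, 0 < y x
  dy : ∀ x ∈ Ioo 0 L, HasDerivAt y (lam * y x / x) x
  z_pos : ∀ x ∈ Ioo 0 L, 0 < z x
  z_le : ∀ x ∈ Ioo 0 L, z x ≤ 1
  dz : ∀ x ∈ Ioo 0 L, HasDerivAt z (n1 * z x / x) x
  hTh : ∀ x ∈ Ioo 0 L, Θ x = 3 * m * c0 * g x ^ 3 * g1 x
  dTh : ∀ x ∈ Ioo 0 L, HasDerivAt Θ (Θ1 x) x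
  dTh1 : ∀ x ∈ Ioo 0 L, HasDerivAt Θ1 (Θ2 x) x
  Th1_nonneg : ∀ x ∈ Ioo 0 L, 0 ≤ Θ1 x
  Th1_le : ∀ x ∈ Ioo 0 L, Θ1 x ≤ d2 * y x
  Th2_le : ∀ x ∈ Ioo 0 L, |Θ2 x| ≤ d3 * y x / x
  Th2_ge : ∀ x ∈ Ioo 0 L, -(Θ2 x) ≤ 1 / 20 * Θ1 x * (g1 x / g x)
  dE : ∀ x ∈ Ioo 0 L, HasDerivAt E (E1 x) x
  E_nonneg : ∀ x ∈ Ioo 0 L, 0 ≤ E x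
  E_le : ∀ x ∈ Ioo 0 L, E x ≤ ε / 10
  hE1 : ∀ x ∈ Ioo 0 L, K * y x ≤ c0 * g x ^ 3 * E1 x
  F1 : ∀ x ∈ Ioo 0 L, K * y x ≤ 3 / 10 * ε * (c0 * g x ^ 2 * g1 x)
  hθ : ∀ x ∈ Ioo 0 L, (1 + 10 * ε) * g1 x ≤ θ * (g1 x + lam * g x / x)
  F2 : ∀ x ∈ Ioo 0 L, 14 * cr ^ 2 * K * y x ≤ M' * n1 * z x * x
  Fj : ∀ x ∈ Ioo 0 L, 5 * (2 * cr * d2 + d3) * y x ≤ m * n1 * M' * (g x * z x)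
  Fm : ∀ x ∈ Ioo 0 L, m * n1 * c0 * g x ≤ ε / 5 * x
  cosT : ∀ x ∈ Ioo 0 L, 1 - ε / 100 ≤ cos (Θ x)
  sinT : ∀ x ∈ Ioo 0 L, |sin (Θ x)| * Θ1 x ≤ ε / 20 * (g1 x / g x)

/-- symmetrization -/
def eta (u : ℝ → ℝ → ℝ) (x ψ : ℝ) : ℝ := (u x ψ + u x (-ψ)) / 2

/-- speed of the characteristics -/
def Sf (m : ℝ) (s qt Θ : ℝ → ℝ) (u : ℝ → ℝ → ℝ) (x ψ : ℝ) : ℝ :=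
  s (eta u x ψ) * (cos (Θ x) / qt (eta u x m))

/-- its x-derivative -/
def Sxf (m : ℝ) (s r qt k Θ Θ1 : ℝ → ℝ) (u w : ℝ → ℝ → ℝ) (x ψ : ℝ) : ℝ :=
  Sf m s qt Θ u x ψ * (r (eta u x ψ) * eta w x ψ - sin (Θ x) * Θ1 x / cos (Θ x)
    - k (eta u x m) * eta w x m)

/-- its logarithmic ψ-derivative -/
def jf (r : ℝ → ℝ) (u v : ℝ → ℝ → ℝ) (x ψ : ℝ) : ℝ :=
  r (eta u x ψ) * ((v x (-ψ) - v x ψ) / 2)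

/-- The iteration class. -/
structure Cls (L m c0 ε n1 K M' : ℝ) (g g1 y z : ℝ → ℝ) (u w v : ℝ → ℝ → ℝ) : Prop where
  du : ∀ x ∈ Ioo 0 L, ∀ ψ ∈ Icc (-m) m, HasDerivAt (fun x => u x ψ) (w x ψ) x
  dpsi : ∀ x ∈ Ioo 0 L, ∀ ψ ∈ Icc (-m) m, HasDerivWithinAt (u x) (-(v x ψ)) (Icc (-m) m) ψ
  cw : ContinuousOn (fun p : ℝ × ℝ => w p.1 p.2) (Ioo 0 L ×ˢ Icc (-m) m)
  c2 : ∀ x ∈ Ioo 0 L, ∀ ψ ∈ Icc (-m) m, |u x ψ - g x ^ 3| ≤ ε * g x ^ 3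
  c3 : ∀ x ∈ Ioo 0 L, ∀ ψ ∈ Icc (-m) m, |w x ψ - 3 * g x ^ 2 * g1 x| ≤ ε * (3 * g x ^ 2 * g1 x)
  c4 : ∀ x ∈ Ioo 0 L, ∀ ψ ∈ Icc (-m) m, ∀ ψ' ∈ Icc (-m) m, |v x ψ' - v x ψ| ≤ K * (g x * y x)
  c5 : ∀ x ∈ Ioo 0 L, ∀ x' ∈ Ioo 0 L, x ≤ x' → ∀ ψ ∈ Icc (-m) m,
    |v x' ψ - v x ψ| ≤ (1 + ε) * M' * (g x' * z x') * (x' - x)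
  c6 : ∀ x ∈ Ioo 0 L, ∀ ψ ∈ Icc (-m) m, ∀ ψ' ∈ Icc (-m) m,
    |v x ψ' - v x ψ| ≤ c0 * M' * (n1 + 2 * (1 + ε)) * (g x ^ 2 * z x) * |ψ' - ψ|

end Nozzle

namespace Nozzle

section
variable {L m c0 ε θ lam n1 cr d2 d3 K M' ηm s0 cs : ℝ} {g g1 Θ Θ1 Θ2 y z E E1 s r qt k : ℝ → ℝ}
  {u w v : ℝ → ℝ → ℝ}
local notation "WallData" => Wall L m c0 ε θ lam n1 cr d2 d3 K M' ηm g g1 Θ Θ1 Θ2 y z E E1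
local notation "ClsData" => Cls L m c0 ε n1 K M' g g1 y z u w v

lemma neg_mem {m ψ : ℝ} (h : ψ ∈ Icc (-m) m) : -ψ ∈ Icc (-m) m := ⟨by linarith [h.2], by linarith [h.1]⟩

/-- pointwise gas bounds -/
lemma Gas.s_near (Gs : Gas ε s0 cs ηm s r qt k) (hε : 0 < ε) (hε' : ε ≤ 1 / 20) {G η : ℝ} (hG : 0 < G)
    (hη : η ∈ Ioo 0 ηm) (h : |η - G ^ 3| ≤ ε * G ^ 3) : |s η - s0 * G| ≤ 2 / 5 * ε * (s0 * G) := by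
  have h0 := Gs.hs0
  have h1 := abs_le.1 (Gs.s_cube η hη)
  have h2 := abs_le.1 h
  have hp := Gs.s_pos η hη
  have hG3 : 0 < s0 ^ 3 * G ^ 3 := by positivity
  have hs3 : 0 < s0 ^ 3 := by positivity
  have e1 : s0 ^ 3 * η ≤ (1 + ε) * (s0 ^ 3 * G ^ 3) := by nlinarith
  have e2 : (1 - ε) * (s0 ^ 3 * G ^ 3) ≤ s0 ^ 3 * η := by nlinarith
  have up : s η ^ 3 ≤ ((1 + 2 / 5 * ε) * (s0 * G)) ^ 3 := by
    have a1 : s η ^ 3 ≤ (1 + ε / 10) * ((1 + ε) * (s0 ^ 3 * G ^ 3)) := by nlinarith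
    have a2 : (1 + ε / 10) * (1 + ε) ≤ (1 + 2 / 5 * ε) ^ 3 := by nlinarith [pow_pos hε 3]
    calc _ ≤ (1 + ε / 10) * (1 + ε) * (s0 ^ 3 * G ^ 3) := by linarith
      _ ≤ (1 + 2 / 5 * ε) ^ 3 * (s0 ^ 3 * G ^ 3) := mul_le_mul_of_nonneg_right a2 hG3.le
      _ = _ := by ring
  have lo : ((1 - 2 / 5 * ε) * (s0 * G)) ^ 3 ≤ s η ^ 3 := by
    have a1 : (1 - ε / 10) * ((1 - ε) * (s0 ^ 3 * G ^ 3)) ≤ s η ^ 3 := by nlinarith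
    have a2 : (1 - 2 / 5 * ε) ^ 3 ≤ (1 - ε / 10) * (1 - ε) := by nlinarith [pow_pos hε 3]
    calc _ = (1 - 2 / 5 * ε) ^ 3 * (s0 ^ 3 * G ^ 3) := by ring
      _ ≤ (1 - ε / 10) * (1 - ε) * (s0 ^ 3 * G ^ 3) := mul_le_mul_of_nonneg_right a2 hG3.le
      _ ≤ _ := by linarith
  have b1 := (pow_le_pow_iff_left₀ hp.le (by positivity) (by norm_num)).1 up
  have b2 := (pow_le_pow_iff_left₀ (mul_nonneg (by linarith) (by positivity)) hp.le (by norm_num)).1 lo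
  rw [abs_le]
  constructor <;> linarith

lemma Gas.r_bd (Gs : Gas ε s0 cs ηm s r qt k) (hε : 0 < ε) (hε' : ε ≤ 1 / 20) {G η : ℝ} (hG : 0 < G)
    (hη : η ∈ Ioo 0 ηm) (h : |η - G ^ 3| ≤ ε * G ^ 3) :
    0 < r η ∧ 3 * G ^ 3 * r η ≤ 1 + 2 * ε ∧ 4 / 5 * (1 + ε) ≤ 3 * G ^ 3 * r η * (1 - ε) + 1 / 5
      ∧ 17 / 20 ≤ 3 * G ^ 3 * r η := by
  have h1 := abs_le.1 (Gs.hr η hη)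
  have h2 := abs_le.1 h
  have hG3 : 0 < G ^ 3 := by positivity
  have hr : 0 < r η := by
    have : 0 < η * r η := by linarith
    exact pos_of_mul_pos_right this hη.1.le
  have e1 : (1 - ε) * (3 * G ^ 3 * r η) ≤ 1 + ε / 10 := by nlinarith
  have e2 : 1 - ε / 10 ≤ (1 + ε) * (3 * G ^ 3 * r η) := by nlinarith
  set T := 3 * G ^ 3 * r η
  have hT : 0 < T := by positivity
  have hl : 17 / 20 ≤ T := by nlinarith
  refine ⟨hr, ?_, ?_, hl⟩
  · by_contra hc
    push Not at hc
    nlinarith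
  · nlinarith

lemma Gas.k_bd (Gs : Gas ε s0 cs ηm s r qt k) (hε : 0 < ε) (hε' : ε ≤ 1 / 20) {G η : ℝ} (hG : 0 < G)
    (hη : η ∈ Ioo 0 ηm) (h : |η - G ^ 3| ≤ ε * G ^ 3) : G ^ 3 * |k η| ≤ ε / 95 := by
  have h1 := Gs.hk η hη
  rw [abs_mul, abs_of_pos hη.1] at h1
  have h2 := abs_le.1 h
  have hG3 : 0 < G ^ 3 := by positivity
  have h3 : (19 / 20) * G ^ 3 ≤ η := by nlinarith
  have := mul_le_mul_of_nonneg_right h3 (abs_nonneg (k η))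
  linarith

lemma Cls.eta_near (U : ClsData) {x ψ : ℝ} (hx : x ∈ Ioo 0 L)
    (hψ : ψ ∈ Icc (-m) m) : |eta u x ψ - g x ^ 3| ≤ ε * g x ^ 3 := by
  have h1 := abs_le.1 (U.c2 x hx ψ hψ)
  have h2 := abs_le.1 (U.c2 x hx (-ψ) (neg_mem hψ))
  unfold eta
  rw [abs_le]; constructor <;> linarith

lemma Cls.etaw_near (U : ClsData) {x ψ : ℝ} (hx : x ∈ Ioo 0 L)
    (hψ : ψ ∈ Icc (-m) m) : |eta w x ψ - 3 * g x ^ 2 * g1 x| ≤ ε * (3 * g x ^ 2 * g1 x) := by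
  have h1 := abs_le.1 (U.c3 x hx ψ hψ)
  have h2 := abs_le.1 (U.c3 x hx (-ψ) (neg_mem hψ))
  unfold eta
  rw [abs_le]; constructor <;> linarith

lemma Cls.eta_mem (U : ClsData)
    (W : WallData) {x ψ : ℝ} (hx : x ∈ Ioo 0 L)
    (hψ : ψ ∈ Icc (-m) m) : eta u x ψ ∈ Ioo 0 ηm := by
  have h := abs_le.1 (U.eta_near hx hψ)
  have hg := W.g_pos x hx
  have : 0 < g x ^ 3 := by positivity
  have h2 := W.g_eta x hx
  have := W.hε'
  constructor
  · nlinarith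
  · nlinarith

lemma Cls.deta (U : ClsData) {x ψ : ℝ} (hx : x ∈ Ioo 0 L)
    (hψ : ψ ∈ Icc (-m) m) : HasDerivAt (fun x => eta u x ψ) (eta w x ψ) x :=
  ((U.du x hx ψ hψ).add (U.du x hx (-ψ) (neg_mem hψ))).div_const 2

lemma Cls.deta_psi (U : ClsData) {x ψ : ℝ} (hx : x ∈ Ioo 0 L)
    (hψ : ψ ∈ Icc (-m) m) :
    HasDerivWithinAt (eta u x) ((v x (-ψ) - v x ψ) / 2) (Icc (-m) m) ψ := by
  have h1 := U.dpsi x hx ψ hψ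
  have h2 := (U.dpsi x hx (-ψ) (neg_mem hψ)).comp ψ (hasDerivAt_neg ψ).hasDerivWithinAt
    (fun t ht => neg_mem ht)
  have := (h1.add h2).div_const 2
  exact this.congr_deriv (by ring)

lemma Wall.mem_of (hx : x ∈ Ioo 0 L) {x' : ℝ} (hx' : x' ∈ Ioo 0 L) {t : ℝ} (ht : t ∈ Icc x x') :
    t ∈ Ioo 0 L := ⟨hx.1.trans_le ht.1, ht.2.trans_lt hx'.2⟩

/-- monotone from nonneg derivative on Ioo -/
lemma monoOn_of {f f1 : ℝ → ℝ} (h : ∀ x ∈ Ioo 0 L, HasDerivAt f (f1 x) x)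
    (h0 : ∀ x ∈ Ioo 0 L, 0 ≤ f1 x) : MonotoneOn f (Ioo 0 L) := by
  intro a ha b hb hab
  have := mono_of_deriv (f := f) (f' := f1) (a := a) (b := b)
    (fun t ht => (h t (Wall.mem_of ha hb ht)).hasDerivWithinAt) (fun t ht => h0 t (Wall.mem_of ha hb ht))
  exact this (left_mem_Icc.2 hab) (right_mem_Icc.2 hab) hab

lemma Wall.g_mono (W : WallData) :
    MonotoneOn g (Ioo 0 L) := monoOn_of W.dg fun x hx => (W.g1_pos x hx).le

lemma Wall.z_mono (W : WallData) :
    MonotoneOn z (Ioo 0 L) := monoOn_of W.dz fun x hx => by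
      have := W.z_pos x hx; have := W.hn1; have := hx.1; positivity

lemma Wall.zx_mono (W : WallData) :
    MonotoneOn (fun x => z x / x) (Ioo 0 L) := by
  refine monoOn_of (f1 := fun x => (n1 * z x / x * x - z x * 1) / x ^ 2)
    (fun x hx => (W.dz x hx).div (hasDerivAt_id x) hx.1.ne') fun x hx => ?_
  have h1 := W.z_pos x hx
  have h2 := W.hn1
  have h3 := hx.1
  apply div_nonneg _ (by positivity)
  rw [div_mul_cancel₀ _ h3.ne']
  nlinarith

lemma Wall.Th_mono (W : WallData) :
    MonotoneOn Θ (Ioo 0 L) := monoOn_of W.dTh W.Th1_nonneg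

lemma Wall.g2zx_mono (W : WallData) :
    MonotoneOn (fun x => g x ^ 2 * (z x / x)) (Ioo 0 L) := by
  intro a ha b hb hab
  have h1 := W.g_mono ha hb hab
  have h2 := W.zx_mono ha hb hab
  have h3 := W.g_pos a ha
  have h4 := W.z_pos a ha
  have h5 := ha.1
  exact mul_le_mul (pow_le_pow_left₀ h3.le h1 2) h2 (by positivity) (by positivity)

lemma Wall.ThM (W : WallData) {x : ℝ}
    (hx : x ∈ Ioo 0 L) : Θ x / m = 3 * c0 * g x ^ 3 * g1 x := by
  rw [W.hTh x hx]; field_simp [W.hm.ne']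

lemma Wall.x_le (W : WallData) {x : ℝ}
    (hx : x ∈ Ioo 0 L) : x ≤ 1 := hx.2.le.trans W.hL

lemma Wall.g_le1 (W : WallData) {x : ℝ}
    (hx : x ∈ Ioo 0 L) : g x ≤ 1 := (W.g_le x hx).trans (W.x_le hx)

lemma Wall.g1_le' (W : WallData) {x : ℝ}
    (hx : x ∈ Ioo 0 L) : g1 x ≤ cr := by
  have h1 := W.g1_le x hx
  have h2 := W.g_le x hx
  have h3 := mul_le_mul_of_nonneg_left h2 (show 0 ≤ cr by linarith [W.hcr])
  have : x * g1 x ≤ x * cr := by linarith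
  exact le_of_mul_le_mul_left this hx.1


lemma Cls.S_near (U : ClsData)
    (W : WallData)
    (Gs : Gas ε s0 cs ηm s r qt k) (hc : c0 * cs = s0) {x ψ : ℝ} (hx : x ∈ Ioo 0 L)
    (hψ : ψ ∈ Icc (-m) m) :
    |Sf m s qt Θ u x ψ - c0 * g x| ≤ ε / 2 * (c0 * g x) := by
  have hε := W.hε
  have hε' := W.hε'
  have hg := W.g_pos x hx
  have hm : m ∈ Icc (-m) m := ⟨by linarith [W.hm], le_rfl⟩
  have h1 := abs_le.1 (Gs.s_near hε hε' hg (U.eta_mem W hx hψ) (U.eta_near hx hψ))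
  have h2 := abs_le.1 (Gs.hq _ (U.eta_mem W hx hm))
  have h3 := W.cosT x hx
  have h4 := Real.cos_le_one (Θ x)
  have hq := Gs.qt_pos _ (U.eta_mem W hx hm)
  have hs := Gs.s_pos _ (U.eta_mem W hx hψ)
  unfold Sf
  set S := s (eta u x ψ)
  set q := qt (eta u x m)
  set c := cos (Θ x)
  have hcs := Gs.hcs
  have hc0 := W.hc0
  rw [← hc] at h1
  have hX : 0 < c0 * g x := by positivity
  set X := c0 * g x with hXd
  have e : c0 * cs * g x = X * cs := by rw [hXd]; ring
  rw [e] at h1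
  have hXc : 0 < X * cs := by positivity
  rw [← mul_div_assoc, abs_le]
  constructor
  · have : (1 - ε / 2) * X ≤ S * c / q := by
      rw [le_div_iff₀ hq]
      have a1 : (1 - ε / 2) * X * q ≤ (1 - ε / 2) * X * ((1 + ε / 100) * cs) :=
        mul_le_mul_of_nonneg_left (by linarith) (mul_nonneg (by linarith) hX.le)
      have a2 : (1 - 2 / 5 * ε) * (X * cs) * (1 - ε / 100) ≤ S * c :=
        mul_le_mul (by linarith) h3 (by linarith) hs.le
      have a3 : (1 - ε / 2) * (1 + ε / 100) ≤ (1 - 2 / 5 * ε) * (1 - ε / 100) := by nlinarith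
      have := mul_le_mul_of_nonneg_right a3 hXc.le
      linarith
    linarith
  · have : S * c / q ≤ (1 + ε / 2) * X := by
      rw [div_le_iff₀ hq]
      have a1 : (1 + ε / 2) * X * ((1 - ε / 100) * cs) ≤ (1 + ε / 2) * X * q :=
        mul_le_mul_of_nonneg_left (by linarith) (by positivity)
      have a2 : S * c ≤ (1 + 2 / 5 * ε) * (X * cs) * 1 :=
        mul_le_mul (by linarith) h4 (by linarith) (by positivity)
      have a3 : (1 + 2 / 5 * ε) ≤ (1 + ε / 2) * (1 - ε / 100) := by nlinarith
      have := mul_le_mul_of_nonneg_right a3 hXc.le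
      linarith
    linarith

lemma Cls.Sx_near (U : ClsData)
    (W : WallData)
    (Gs : Gas ε s0 cs ηm s r qt k) {x ψ : ℝ} (hx : x ∈ Ioo 0 L)
    (hψ : ψ ∈ Icc (-m) m) :
    7 / 10 * (g1 x / g x) ≤ (r (eta u x ψ) * eta w x ψ - sin (Θ x) * Θ1 x / cos (Θ x)
    - k (eta u x m) * eta w x m) ∧ (r (eta u x ψ) * eta w x ψ - sin (Θ x) * Θ1 x / cos (Θ x)
    - k (eta u x m) * eta w x m) ≤ 3 / 2 * (g1 x / g x) := by
  have hε := W.hε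
  have hε' := W.hε'
  have hg := W.g_pos x hx
  have hg1 := W.g1_pos x hx
  have hm : m ∈ Icc (-m) m := ⟨by linarith [W.hm], le_rfl⟩
  obtain ⟨r0, r1, -, r2⟩ := Gs.r_bd hε hε' hg (U.eta_mem W hx hψ) (U.eta_near hx hψ)
  have k1 := Gs.k_bd hε hε' hg (U.eta_mem W hx hm) (U.eta_near hx hm)
  have w1 := abs_le.1 (U.etaw_near hx hψ)
  have w2 := abs_le.1 (U.etaw_near hx hm)
  have h3 := W.cosT x hx
  have hs := W.sinT x hx
  set a := g1 x / g x with had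
  have ha : 0 < a := by positivity
  have e3 : 3 * g x ^ 2 * g1 x = 3 * g x ^ 3 * a := by rw [had]; field_simp
  rw [e3] at w1 w2
  set rr := r (eta u x ψ)
  set ww := eta w x ψ
  set kk := k (eta u x m)
  set w' := eta w x m
  set G := g x ^ 3 with hGd
  have hG : 0 < G := by positivity
  have t1 : rr * ww ≤ (1 + 2 * ε) * (1 + ε) * a := by
    have : rr * ww ≤ rr * ((1 + ε) * (3 * G * a)) := mul_le_mul_of_nonneg_left (by linarith) r0.le
    have := mul_le_mul_of_nonneg_right r1 (show 0 ≤ (1 + ε) * a by positivity)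
    linarith
  have t2 : 17 / 20 * (1 - ε) * a ≤ rr * ww := by
    have : rr * ((1 - ε) * (3 * G * a)) ≤ rr * ww := mul_le_mul_of_nonneg_left (by linarith) r0.le
    have := mul_le_mul_of_nonneg_right r2 (show 0 ≤ (1 - ε) * a from mul_nonneg (by linarith) ha.le)
    linarith
  have t3 : |kk * w'| ≤ ε / 95 * (4 * a) := by
    rw [abs_mul]
    have hw : |w'| ≤ 4 * (G * a) := by
      have : 0 < G * a := by positivity
      rw [abs_le]; constructor <;> nlinarith
    calc |kk| * |w'| ≤ |kk| * (4 * (G * a)) := mul_le_mul_of_nonneg_left hw (abs_nonneg _)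
      _ = G * |kk| * (4 * a) := by ring
      _ ≤ _ := mul_le_mul_of_nonneg_right k1 (by positivity)
  have t4 : |sin (Θ x) * Θ1 x / cos (Θ x)| ≤ ε / 10 * a := by
    have hcp : 0 < cos (Θ x) := by linarith
    rw [abs_div, abs_mul, abs_of_pos hcp, abs_of_nonneg (W.Th1_nonneg x hx), div_le_iff₀ hcp]
    have : 0 < ε * a := by positivity
    nlinarith
  have t3' := abs_le.1 t3
  have t4' := abs_le.1 t4
  have q1 : 17 / 20 * (1 - ε) * a - ε / 10 * a - ε / 95 * (4 * a) ≥ 7 / 10 * a := by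
    have : 7 / 10 ≤ 17 / 20 * (1 - ε) - ε / 10 - ε / 95 * 4 := by linarith
    have := mul_le_mul_of_nonneg_right this ha.le
    linarith
  have q2 : (1 + 2 * ε) * (1 + ε) * a + ε / 10 * a + ε / 95 * (4 * a) ≤ 3 / 2 * a := by
    have : (1 + 2 * ε) * (1 + ε) + ε / 10 + ε / 95 * 4 ≤ 3 / 2 := by nlinarith
    have := mul_le_mul_of_nonneg_right this ha.le
    linarith
  constructor <;> linarith

lemma Cls.j_bd (U : ClsData)
    (W : WallData)
    (Gs : Gas ε s0 cs ηm s r qt k) {x ψ : ℝ} (hx : x ∈ Ioo 0 L)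
    (hψ : ψ ∈ Icc (-m) m) : 6 * g x ^ 2 * |jf r u v x ψ| ≤ (1 + 2 * ε) * (K * y x) := by
  have hε := W.hε
  have hε' := W.hε'
  have hg := W.g_pos x hx
  obtain ⟨r0, r1, -, r2⟩ := Gs.r_bd hε hε' hg (U.eta_mem W hx hψ) (U.eta_near hx hψ)
  have h4 := U.c4 x hx ψ hψ (-ψ) (neg_mem hψ)
  unfold jf
  rw [abs_mul, abs_of_pos r0, abs_div, abs_two]
  set V := |v x (-ψ) - v x ψ|
  set rr := r (eta u x ψ)
  have hy := W.y_pos x hx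
  have hK := W.hK
  have e1 : 6 * g x ^ 2 * (rr * (V / 2)) ≤ 6 * g x ^ 2 * (rr * (K * (g x * y x) / 2)) := by gcongr
  have e2 := mul_le_mul_of_nonneg_right r1 (show 0 ≤ K * y x by positivity)
  have e3 : 6 * g x ^ 2 * (rr * (K * (g x * y x) / 2)) = 3 * g x ^ 3 * rr * (K * y x) := by ring
  linarith

lemma Cls.u_cont (U : ClsData)
    (W : WallData)
    {V : ℝ} (hV : ∀ x ∈ Ioo 0 L, ∀ ψ ∈ Icc (-m) m, |v x ψ| ≤ V) :
    ContinuousOn (fun p : ℝ × ℝ => u p.1 p.2) (Ioo 0 L ×ˢ Icc (-m) m) := by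
  have hm := W.hm
  refine lip2_cont (A := 6 * cr) (A' := V) ?_ ?_
  · have key : ∀ x ∈ Ioo 0 L, ∀ ψ ∈ Icc (-m) m, |w x ψ| ≤ 6 * cr := by
      intro x hx ψ hψ
      have h := abs_le.1 (U.c3 x hx ψ hψ)
      have hg := W.g_pos x hx
      have hg' := W.g_le1 hx
      have h1 := W.g1_pos x hx
      have h2 := W.g1_le' hx
      have hq : 3 * g x ^ 2 * g1 x ≤ 3 * 1 * cr := by
        have : g x ^ 2 ≤ 1 := pow_le_one₀ hg.le hg'
        gcongr
      have hp : 0 < 3 * g x ^ 2 * g1 x := by positivity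
      have := W.hε'
      have := W.hε
      rw [abs_le]; constructor <;> nlinarith
    intro x hx x' hx' ψ hψ
    have := (convex_Ioo 0 L).norm_image_sub_le_of_norm_hasDerivWithin_le (f := fun x => u x ψ)
      (f' := fun x => w x ψ) (C := 6 * cr) (fun t ht => (U.du t ht ψ hψ).hasDerivWithinAt)
      (fun t ht => key t ht ψ hψ) hx hx'
    simpa using this
  · intro x hx ψ hψ ψ' hψ'
    have := (convex_Icc (-m) m).norm_image_sub_le_of_norm_hasDerivWithin_le (f := u x)
      (f' := fun ψ => -v x ψ) (C := V) (fun t ht => U.dpsi x hx t ht)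
      (fun t ht => by rw [norm_neg]; exact hV x hx t ht) hψ hψ'
    simpa using this


lemma Cls.v_bdd (U : ClsData)
    (W : WallData)
    {x : ℝ} (hx : x ∈ Ioo 0 L) {ψ : ℝ} (hψ : ψ ∈ Icc (-m) m) : |v x ψ| ≤ 1 / m + cr * c0 := by
  have hm := W.hm
  have hmm : m ∈ Icc (-m) m := ⟨by linarith, le_rfl⟩
  have hnm : -m ∈ Icc (-m) m := ⟨le_rfl, by linarith⟩
  obtain ⟨t, ht, he⟩ := exists_hasDerivAt_eq_slope (u x) (fun t => -v x t) (show -m < m by linarith)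
    (fun t ht => (U.dpsi x hx t ht).continuousWithinAt)
    (fun t ht => (U.dpsi x hx t ⟨ht.1.le, ht.2.le⟩).hasDerivAt (Icc_mem_nhds ht.1 ht.2))
  have h4 := U.c4 x hx t ⟨ht.1.le, ht.2.le⟩ ψ hψ
  have hg := W.g_pos x hx
  have hg' := W.g_le1 hx
  have h1 := W.g1_pos x hx
  have h2 := W.g1_le' hx
  have hy := W.y_pos x hx
  have hε := W.hε
  have hε' := W.hε'
  have hc0 := W.hc0
  have hK := W.hK
  have hcr := W.hcr
  have hF := W.F1 x hx
  have hg2 : g x ^ 2 ≤ 1 := pow_le_one₀ hg.le hg'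
  have hg3 : g x ^ 3 ≤ 1 := pow_le_one₀ hg.le hg'
  have a1 : K * (g x * y x) ≤ cr * c0 := by
    have e1 : K * (g x * y x) ≤ K * (1 * y x) := by gcongr
    have e2 : c0 * g x ^ 2 * g1 x ≤ c0 * 1 * cr := by gcongr
    have e3 : 0 < c0 * g x ^ 2 * g1 x := by positivity
    nlinarith
  have a2 : |v x t| ≤ 1 / m := by
    rw [← abs_neg, he, abs_div, abs_of_pos (show 0 < m - -m by linarith),
      div_le_div_iff₀ (by linarith) hm]
    have b1 := abs_le.1 (U.c2 x hx m hmm)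
    have b2 := abs_le.1 (U.c2 x hx (-m) hnm)
    have : |u x m - u x (-m)| ≤ 2 := by
      have : 0 < g x ^ 3 := by positivity
      rw [abs_le]; constructor <;> nlinarith
    nlinarith
  have := abs_add_le (v x t) (v x ψ - v x t)
  rw [add_sub_cancel] at this
  linarith

lemma Cls.cu (U : ClsData)
    (W : WallData) :
    ContinuousOn (fun p : ℝ × ℝ => u p.1 p.2) (Ioo 0 L ×ˢ Icc (-m) m) :=
  U.u_cont W fun _ hx _ hψ => U.v_bdd W hx hψ

lemma cont_eta {F : ℝ → ℝ → ℝ} (h : ContinuousOn (fun p : ℝ × ℝ => F p.1 p.2) (Ioo 0 L ×ˢ Icc (-m) m)) :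
    ContinuousOn (fun p : ℝ × ℝ => eta F p.1 p.2) (Ioo 0 L ×ˢ Icc (-m) m) := by
  have h2 : ContinuousOn (fun p : ℝ × ℝ => F p.1 (-p.2)) (Ioo 0 L ×ˢ Icc (-m) m) :=
    h.comp (f := fun p : ℝ × ℝ => (p.1, -p.2)) (by fun_prop) fun p hp => ⟨hp.1, neg_mem hp.2⟩
  exact (h.add h2).div_const 2

lemma cont_eta_m (hm : 0 < m) {F : ℝ → ℝ → ℝ}
    (h : ContinuousOn (fun p : ℝ × ℝ => F p.1 p.2) (Ioo 0 L ×ˢ Icc (-m) m)) :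
    ContinuousOn (fun p : ℝ × ℝ => eta F p.1 m) (Ioo 0 L ×ˢ Icc (-m) m) :=
  (cont_eta h).comp (f := fun p : ℝ × ℝ => (p.1, m)) (by fun_prop)
    fun p hp => ⟨hp.1, by constructor <;> linarith⟩

lemma cont_fst {F F1 : ℝ → ℝ} (h : ∀ x ∈ Ioo 0 L, HasDerivAt F (F1 x) x) :
    ContinuousOn (fun p : ℝ × ℝ => F p.1) (Ioo 0 L ×ˢ Icc (-m) m) :=
  ContinuousOn.comp (t := Ioo 0 L) (g := F) (f := Prod.fst)
    (fun x hx => (h x hx).continuousAt.continuousWithinAt) (by fun_prop) fun p hp => hp.1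

lemma Cls.contS (U : ClsData)
    (W : WallData)
    (Gs : Gas ε s0 cs ηm s r qt k) :
    ContinuousOn (fun p : ℝ × ℝ => Sf m s qt Θ u p.1 p.2) (Ioo 0 L ×ˢ Icc (-m) m) := by
  have hm := W.hm
  have hmm : m ∈ Icc (-m) m := ⟨by linarith, le_rfl⟩
  have c1 := (show ContinuousOn s (Ioo 0 ηm) from fun x hx =>
    (Gs.ds x hx).continuousAt.continuousWithinAt).comp (cont_eta (U.cu W))
    (fun p hp => U.eta_mem W hp.1 hp.2)
  have c2 := (show ContinuousOn qt (Ioo 0 ηm) from fun x hx =>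
    (Gs.dqt x hx).continuousAt.continuousWithinAt).comp (cont_eta_m hm (U.cu W))
    (fun p hp => U.eta_mem W hp.1 hmm)
  exact c1.mul ((Real.continuous_cos.comp_continuousOn (cont_fst W.dTh)).div c2
    fun p hp => (Gs.qt_pos _ (U.eta_mem W hp.1 hmm)).ne')

lemma Cls.contSx (U : ClsData)
    (W : WallData)
    (Gs : Gas ε s0 cs ηm s r qt k) :
    ContinuousOn (fun p : ℝ × ℝ => Sxf m s r qt k Θ Θ1 u w p.1 p.2) (Ioo 0 L ×ˢ Icc (-m) m) := by
  have hm := W.hm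
  have hmm : m ∈ Icc (-m) m := ⟨by linarith, le_rfl⟩
  have c1 := Gs.cr.comp (cont_eta (U.cu W)) (fun p hp => U.eta_mem W hp.1 hp.2)
  have c2 := Gs.ck.comp (cont_eta_m hm (U.cu W)) (fun p hp => U.eta_mem W hp.1 hmm)
  exact (U.contS W Gs).mul (((c1.mul (cont_eta U.cw)).sub
    (((Real.continuous_sin.comp_continuousOn (cont_fst W.dTh)).mul (cont_fst W.dTh1)).div
      (Real.continuous_cos.comp_continuousOn (cont_fst W.dTh)) fun p hp => by
        have := W.cosT p.1 hp.1; have := W.hε'; exact (show 0 < cos (Θ p.1) by linarith).ne')).sub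
    (c2.mul (cont_eta_m hm U.cw)))

lemma Cls.derS (U : ClsData)
    (W : WallData)
    (Gs : Gas ε s0 cs ηm s r qt k) {x ψ : ℝ} (hx : x ∈ Ioo 0 L) (hψ : ψ ∈ Icc (-m) m) :
    HasDerivAt (fun x => Sf m s qt Θ u x ψ) (Sxf m s r qt k Θ Θ1 u w x ψ) x := by
  have hm := W.hm
  have hmm : m ∈ Icc (-m) m := ⟨by linarith, le_rfl⟩
  have h1 := (Gs.ds _ (U.eta_mem W hx hψ)).comp x (U.deta hx hψ)
  have h2 := (Gs.dqt _ (U.eta_mem W hx hmm)).comp x (U.deta hx hmm)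
  have h3 := (W.dTh x hx).cos
  have hq := (Gs.qt_pos _ (U.eta_mem W hx hmm)).ne'
  have hc : cos (Θ x) ≠ 0 := by
    have := W.cosT x hx; have := W.hε'; exact (show 0 < cos (Θ x) by linarith).ne'
  have := h1.mul (h3.div h2 hq)
  refine this.congr_deriv ?_
  unfold Sxf Sf
  simp only [Function.comp, Pi.div_apply]
  field_simp
  ring

lemma Cls.dpsiS (U : ClsData)
    (W : WallData)
    (Gs : Gas ε s0 cs ηm s r qt k) {x ψ : ℝ} (hx : x ∈ Ioo 0 L) (hψ : ψ ∈ Icc (-m) m) :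
    HasDerivWithinAt (Sf m s qt Θ u x) (Sf m s qt Θ u x ψ * jf r u v x ψ) (Icc (-m) m) ψ := by
  have h1 := (Gs.ds _ (U.eta_mem W hx hψ)).comp_hasDerivWithinAt ψ (U.deta_psi hx hψ)
  have := h1.mul_const (cos (Θ x) / qt (eta u x m))
  refine this.congr_deriv ?_
  unfold Sf jf
  ring

lemma Cls.flow (U : ClsData)
    (W : WallData)
    (Gs : Gas ε s0 cs ηm s r qt k) (hc : c0 * cs = s0) :
    FlowHyp L m (3 * c0 * cr) (Sf m s qt Θ u) (Sxf m s r qt k Θ Θ1 u w) := by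
  have hε := W.hε
  have hε' := W.hε'
  have hc0 := W.hc0
  have hcr := W.hcr
  have pos : ∀ x ∈ Ioo 0 L, ∀ ψ ∈ Icc (-m) m, 0 < Sf m s qt Θ u x ψ := by
    intro x hx ψ hψ
    have h1 := abs_le.1 (U.S_near W Gs hc hx hψ)
    have : 0 < c0 * g x := mul_pos hc0 (W.g_pos x hx)
    nlinarith
  refine ⟨W.hm, U.contS W Gs, U.contSx W Gs, fun x hx ψ hψ => U.derS W Gs hx hψ, ?_, ?_, pos, ?_⟩
  · intro x hx ψ hψ
    have := (U.Sx_near W Gs hx hψ).1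
    have h2 : 0 < g1 x / g x := div_pos (W.g1_pos x hx) (W.g_pos x hx)
    exact mul_nonneg (pos x hx ψ hψ).le (le_trans (by positivity) this)
  · intro x hx ψ hψ
    have h0 := (U.Sx_near W Gs hx hψ).2
    have h1 := abs_le.1 (U.S_near W Gs hc hx hψ)
    have hg := W.g_pos x hx
    have hg1 := W.g1_pos x hx
    have h3 : Sf m s qt Θ u x ψ ≤ 2 * (c0 * g x) := by
      have : 0 < c0 * g x := mul_pos hc0 hg
      nlinarith
    have h4 := W.g1_le' hx
    calc _ ≤ Sf m s qt Θ u x ψ * (3 / 2 * (g1 x / g x)) :=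
          mul_le_mul_of_nonneg_left h0 (pos x hx ψ hψ).le
      _ ≤ 2 * (c0 * g x) * (3 / 2 * (g1 x / g x)) := by gcongr
      _ = 3 * c0 * g1 x := by field_simp
      _ ≤ _ := by gcongr
  · intro x hx ψ hψ
    have h1 := abs_le.1 (U.S_near W Gs hc hx hψ)
    have hg := W.g_pos x hx
    have h2 := W.g_le x hx
    have h3 : Sf m s qt Θ u x ψ ≤ 3 * (c0 * g x) := by
      have : 0 < c0 * g x := mul_pos hc0 hg
      nlinarith
    have h5 : c0 * g x ≤ c0 * x := by gcongr
    have h6 : c0 * x ≤ c0 * cr * x := by nlinarith [mul_pos hc0 hx.1]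
    linarith

lemma Cls.src (U : ClsData)
    (W : WallData)
    (Gs : Gas ε s0 cs ηm s r qt k) (hc : c0 * cs = s0) :
    SrcHyp L m (Sf m s qt Θ u) Θ Θ1 (fun x => c0 / 2 * g x) (6 * m * cr + 2 * d2 * cr / K) := by
  have hε := W.hε
  have hε' := W.hε'
  have hc0 := W.hc0
  have hcr := W.hcr
  have hm := W.hm
  have hK := W.hK
  have hd2 := W.hd2
  refine ⟨W.dTh, W.Th1_nonneg, ?_, ?_, ?_, ?_, ?_, ?_, by positivity⟩
  · intro x hx
    have := W.g_pos x hx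
    have := W.g1_pos x hx
    rw [W.hTh x hx]; positivity
  · intro x hx
    have hg := W.g_pos x hx
    have hg1 := W.g1_pos x hx
    have hy := W.y_pos x hx
    have h1 := W.Th1_le x hx
    have h2 := W.F1 x hx
    have h3 : g x ^ 2 ≤ g x := by nlinarith [W.g_le1 hx]
    have h4 := W.g1_le' hx
    have h5 : c0 * g x ^ 2 * g1 x ≤ c0 * g x * cr := by gcongr
    have h6 : K * y x ≤ c0 * g x * cr := by nlinarith [show 0 < c0 * g x * cr by positivity]
    have h7 : y x ≤ c0 * g x * cr / K := by rw [le_div_iff₀ hK]; linarith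
    have h8 := mul_le_mul_of_nonneg_left h7 hd2.le
    have h9 : (6 * m * cr + 2 * d2 * cr / K) * (c0 / 2 * g x) =
      6 * m * cr * (c0 / 2 * g x) + d2 * (c0 * g x * cr / K) := by ring
    rw [h9]
    have : 0 ≤ 6 * m * cr * (c0 / 2 * g x) := by positivity
    linarith
  · intro x hx
    have hg := W.g_pos x hx
    have hg1 := W.g1_pos x hx
    have h3 : g x ^ 3 ≤ g x := by
      have := W.g_le1 hx
      have : g x ^ 2 ≤ 1 := pow_le_one₀ hg.le this
      nlinarith
    have h4 := W.g1_le' hx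
    rw [W.hTh x hx]
    calc 3 * m * c0 * g x ^ 3 * g1 x ≤ 3 * m * c0 * g x * cr := by gcongr
      _ = 6 * m * cr * (c0 / 2 * g x) := by ring
      _ ≤ _ := by
        apply mul_le_mul_of_nonneg_right _ (by positivity)
        have : 0 ≤ 2 * d2 * cr / K := by positivity
        linarith
  · intro a ha b hb hab
    have := W.g_mono ha hb hab
    simp only
    gcongr
  · intro x hx
    have := W.g_pos x hx
    positivity
  · intro x hx ψ hψ
    have h1 := abs_le.1 (U.S_near W Gs hc hx hψ)
    have : 0 < c0 * g x := mul_pos hc0 (W.g_pos x hx)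
    nlinarith


lemma exp_small {e ε : ℝ} (hε : 0 < ε) (hε' : ε ≤ 1 / 20) (h : e ≤ ε / 10) : Real.exp e ≤ 1 + ε / 5 := by
  have h1 : Real.exp e ≤ Real.exp (ε / 10) := exp_le_exp.2 h
  have h2 := exp_bound_div_one_sub_of_interval (x := ε / 10) (by linarith) (by linarith)
  have h3 : 1 / (1 - ε / 10) ≤ 1 + ε / 5 := by
    rw [div_le_iff₀ (by linarith)]; nlinarith
  linarith

lemma Cls.td_mono (U : ClsData)
    (W : WallData)
    (Gs : Gas ε s0 cs ηm s r qt k) (hc : c0 * cs = s0) {x ψ : ℝ} (hx : x ∈ Ioo 0 L)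
    (hψ : ψ ∈ Icc (-m) m) :
    0 ≤ (Sxf m s r qt k Θ Θ1 u w x ψ + jf r u v x ψ) * Θ1 x + Sf m s qt Θ u x ψ * Θ2 x := by
  have hε := W.hε
  have hε' := W.hε'
  have hc0 := W.hc0
  have hg := W.g_pos x hx
  have hg1 := W.g1_pos x hx
  have h1 := abs_le.1 (U.S_near W Gs hc hx hψ)
  have h2 := (U.Sx_near W Gs hx hψ).1
  have h3 := U.j_bd W Gs hx hψ
  have h4 := W.F1 x hx
  have h5 := W.Th2_ge x hx
  have hT := W.Th1_nonneg x hx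
  have hS : 9 / 10 * (c0 * g x) ≤ Sf m s qt Θ u x ψ := by nlinarith [mul_pos hc0 hg]
  have hSp := (U.flow W Gs hc).S_pos x hx ψ hψ
  set S := Sf m s qt Θ u x ψ with hSd
  set a := g1 x / g x with had
  have ha : 0 < a := by positivity
  have hSx : S * (7 / 10 * a) ≤ Sxf m s r qt k Θ Θ1 u w x ψ := mul_le_mul_of_nonneg_left h2 hSp.le
  have hj : |jf r u v x ψ| ≤ 1 / 10 * (c0 * g x * a) := by
    have e : c0 * g x ^ 2 * g1 x = g x ^ 2 * (c0 * g x * a) := by rw [had]; field_simp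
    rw [e] at h4
    have hX : 0 < c0 * g x * a := by positivity
    have h6 : 6 * g x ^ 2 * |jf r u v x ψ| ≤ (1 + 2 * ε) * (3 / 10 * ε * (g x ^ 2 * (c0 * g x * a))) :=
      h3.trans (mul_le_mul_of_nonneg_left h4 (by linarith))
    have h7 : (1 + 2 * ε) * (3 / 10 * ε) ≤ 6 / 10 := by nlinarith
    have h8 := mul_le_mul_of_nonneg_right h7 (show 0 ≤ g x ^ 2 * (c0 * g x * a) by positivity)
    have h9 : g x ^ 2 * |jf r u v x ψ| ≤ g x ^ 2 * (1 / 10 * (c0 * g x * a)) := by linarith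
    exact le_of_mul_le_mul_left h9 (by positivity)
  have hj2 : -(S * (a / 5)) ≤ jf r u v x ψ := by
    have := (abs_le.1 hj).1
    have := mul_le_mul_of_nonneg_right hS ha.le
    have : 0 < c0 * g x * a := by positivity
    linarith
  have q1 : S * (a / 2) ≤ Sxf m s r qt k Θ Θ1 u w x ψ + jf r u v x ψ := by linarith
  have q2 := mul_le_mul_of_nonneg_right q1 hT
  have q3 := mul_le_mul_of_nonneg_left h5 hSp.le
  have q4 : 0 ≤ S * Θ1 x * a := by positivity
  linarith

lemma Cls.STh1 (U : ClsData)
    (W : WallData)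
    (Gs : Gas ε s0 cs ηm s r qt k) (hc : c0 * cs = s0) {x ψ : ℝ} (hx : x ∈ Ioo 0 L)
    (hψ : ψ ∈ Icc (-m) m) :
    2 * (Sf m s qt Θ u x ψ * Θ1 x) ≤ 21 / 10 * (c0 * d2 * (g x * y x)) := by
  have hε' := W.hε'
  have hc0 := W.hc0
  have hg := W.g_pos x hx
  have h1 := abs_le.1 (U.S_near W Gs hc hx hψ)
  have hT := W.Th1_nonneg x hx
  have h2 := W.Th1_le x hx
  have hS : Sf m s qt Θ u x ψ ≤ 21 / 20 * (c0 * g x) := by nlinarith [mul_pos hc0 hg]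
  have := mul_le_mul hS h2 hT (by positivity)
  linarith

lemma Wall.gy (W : WallData) {x : ℝ}
    (hx : x ∈ Ioo 0 L) : 5 * (c0 * d2 * (g x * y x)) ≤ K * (1 - θ) * (g x * y x) ∧
      K * (g x * y x) ≤ ε / 10 * (Θ x / m) := by
  have hg := W.g_pos x hx
  have hy := W.y_pos x hx
  constructor
  · have := mul_le_mul_of_nonneg_right W.hKθ (show 0 ≤ g x * y x by positivity)
    linarith
  · rw [W.ThM hx]
    have := mul_le_mul_of_nonneg_left (W.F1 x hx) hg.le
    linarith

lemma Wall.gy' (W : WallData) {x : ℝ}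
    (hx : x ∈ Ioo 0 L) : 21 / 10 * (c0 * d2 * (g x * y x)) ≤ ε / 20 * (Θ x / m) := by
  have h := W.gy hx
  have hg := W.g_pos x hx
  have hy := W.y_pos x hx
  have : 0 < K * θ * (g x * y x) := mul_pos (mul_pos W.hK W.hθ0) (mul_pos hg hy)
  have h0 : 0 < c0 * d2 * (g x * y x) := mul_pos (mul_pos W.hc0 W.hd2) (mul_pos hg hy)
  nlinarith

lemma Wall.Th_pos (W : WallData) {x : ℝ}
    (hx : x ∈ Ioo 0 L) : 0 < Θ x / m := by
  rw [W.ThM hx]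
  have := W.g_pos x hx
  have := W.g1_pos x hx
  have := W.hc0
  positivity

lemma Cls.td_crude (U : ClsData)
    (W : WallData)
    (Gs : Gas ε s0 cs ηm s r qt k) (hc : c0 * cs = s0) {x ψ : ℝ} (hx : x ∈ Ioo 0 L)
    (hψ : ψ ∈ Icc (-m) m) :
    Real.exp (E x) * (Θ x / m + 2 * (Sf m s qt Θ u x ψ * Θ1 x)) ≤ (1 + ε) * (Θ x / m) := by
  have hε := W.hε
  have hε' := W.hε'
  have h1 := U.STh1 W Gs hc hx hψ
  have h2 := W.gy' hx
  have h3 := W.Th_pos hx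
  have h4 := exp_small hε hε' (W.E_le x hx)
  set T := Θ x / m
  have h5 : T + 2 * (Sf m s qt Θ u x ψ * Θ1 x) ≤ (1 + ε / 20) * T := by linarith
  have h6 : Real.exp (E x) * (T + 2 * (Sf m s qt Θ u x ψ * Θ1 x)) ≤ (1 + ε / 5) * ((1 + ε / 20) * T) :=
    (mul_le_mul_of_nonneg_left h5 (exp_pos _).le).trans
      (mul_le_mul_of_nonneg_right h4 (by positivity))
  have h7 : (1 + ε / 5) * (1 + ε / 20) ≤ 1 + ε := by nlinarith
  have := mul_le_mul_of_nonneg_right h7 h3.le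
  linarith

lemma Cls.td_jR (U : ClsData)
    (W : WallData)
    (Gs : Gas ε s0 cs ηm s r qt k) (hc : c0 * cs = s0) {x ψ : ℝ} (hx : x ∈ Ioo 0 L)
    (hψ : ψ ∈ Icc (-m) m) :
    2 * (|jf r u v x ψ| * ((1 + ε) * (Θ x / m))) ≤ (1 + 4 * ε) * (K * y x * (c0 * g x * g1 x)) ∧
    |jf r u v x ψ| * ((1 + ε) * (Θ x / m)) ≤
      Sf m s qt Θ u x ψ * (1 / 2 * K * θ * (g1 x * y x + g x * (lam * y x / x))) := by
  have hε := W.hε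
  have hε' := W.hε'
  have hc0 := W.hc0
  have hK := W.hK
  have hg := W.g_pos x hx
  have hg1 := W.g1_pos x hx
  have hy := W.y_pos x hx
  have h1 := abs_le.1 (U.S_near W Gs hc hx hψ)
  have h3 := U.j_bd W Gs hx hψ
  have hT := W.ThM hx
  have hθ := W.hθ x hx
  have e1 : 2 * (|jf r u v x ψ| * ((1 + ε) * (Θ x / m))) =
      6 * g x ^ 2 * |jf r u v x ψ| * ((1 + ε) * (c0 * g x * g1 x)) := by rw [hT]; ring
  have e2 := mul_le_mul_of_nonneg_right h3 (show 0 ≤ (1 + ε) * (c0 * g x * g1 x) by positivity)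
  have e3 : (1 + 2 * ε) * (1 + ε) ≤ 1 + 4 * ε := by nlinarith
  have hX : 0 < K * y x * (c0 * g x * g1 x) := by positivity
  have e4 := mul_le_mul_of_nonneg_right e3 hX.le
  have f1 : 2 * (|jf r u v x ψ| * ((1 + ε) * (Θ x / m))) ≤
    (1 + 4 * ε) * (K * y x * (c0 * g x * g1 x)) := by
    rw [e1]; linarith
  refine ⟨f1, ?_⟩
  have f2 : (1 - ε / 2) * (c0 * g x) ≤ Sf m s qt Θ u x ψ := by linarith
  have f3 : (1 + 10 * ε) * (K * y x * g1 x) ≤ K * θ * (g1 x * y x + g x * (lam * y x / x)) := by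
    have := mul_le_mul_of_nonneg_left hθ (show 0 ≤ K * y x by positivity)
    have e : K * θ * (g1 x * y x + g x * (lam * y x / x)) = K * y x * (θ * (g1 x + lam * g x / x)) := by
      ring
    rw [e]; linarith
  have f4 := mul_le_mul f2 f3 (by positivity) (by nlinarith [mul_pos hc0 hg])
  have f5 : 1 + 4 * ε ≤ (1 - ε / 2) * (1 + 10 * ε) := by nlinarith
  have f6 := mul_le_mul_of_nonneg_right f5 hX.le
  linarith

lemma Cls.td_jE (U : ClsData)
    (W : WallData)
    (Gs : Gas ε s0 cs ηm s r qt k) (hc : c0 * cs = s0) {x ψ : ℝ} (hx : x ∈ Ioo 0 L)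
    (hψ : ψ ∈ Icc (-m) m) : |jf r u v x ψ| ≤ Sf m s qt Θ u x ψ * E1 x := by
  have hε := W.hε
  have hε' := W.hε'
  have hc0 := W.hc0
  have hK := W.hK
  have hg := W.g_pos x hx
  have hy := W.y_pos x hx
  have h1 := abs_le.1 (U.S_near W Gs hc hx hψ)
  have h3 := U.j_bd W Gs hx hψ
  have hE := W.hE1 x hx
  have hE1 : 0 < E1 x := by
    have : 0 < c0 * g x ^ 3 * E1 x := lt_of_lt_of_le (by positivity) hE
    exact pos_of_mul_pos_right this (by positivity)
  have a1 : 6 * g x ^ 2 * |jf r u v x ψ| ≤ 6 * g x ^ 2 * (1 / 2 * (c0 * g x) * E1 x) := by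
    nlinarith [show 0 < K * y x by positivity]
  have a2 := le_of_mul_le_mul_left a1 (by positivity)
  have a3 : 1 / 2 * (c0 * g x) ≤ Sf m s qt Θ u x ψ := by nlinarith [mul_pos hc0 hg]
  exact a2.trans (mul_le_mul_of_nonneg_right a3 hE1.le)


lemma aux_eps {ε : ℝ} (hε : 0 < ε) (hε' : ε ≤ 1 / 20) :
    (1 + 2 * ε) * (1 + ε) ^ 2 - (1 - ε / 2) ≤ 5 * ε := by
  have h1 : ε ^ 2 ≤ ε / 20 := by nlinarith
  have h2 : ε ^ 3 ≤ ε / 20 := by nlinarith [pow_pos hε 2]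
  have : (1 + 2 * ε) * (1 + ε) ^ 2 = 1 + 4 * ε + 5 * ε ^ 2 + 2 * ε ^ 3 := by ring
  linarith

lemma Cls.inv_eta (U : ClsData)
    (W : WallData)
    {x x' ψ : ℝ} (hx : x ∈ Ioo 0 L) (hx' : x' ∈ Ioo 0 L) (hxx : x ≤ x')
    (hψ : ψ ∈ Icc (-m) m) :
    eta u x ψ ≤ eta u x' ψ ∧
    1 / eta u x ψ - 1 / eta u x' ψ ≤ 4 * cr / (x * g x ^ 3) * (x' - x) := by
  have hε := W.hε
  have hε' := W.hε'
  have hcr := W.hcr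
  have hpos : ∀ t ∈ Icc x x', 0 < eta u t ψ := fun t ht => (U.eta_mem W (Wall.mem_of hx hx' ht) hψ).1
  have hw : ∀ t ∈ Icc x x', 0 ≤ eta w t ψ := by
    intro t ht
    have htL := Wall.mem_of hx hx' ht
    have h1 := abs_le.1 (U.etaw_near htL hψ)
    have := W.g_pos t htL
    have := W.g1_pos t htL
    have : 0 < 3 * g t ^ 2 * g1 t := by positivity
    nlinarith
  constructor
  · exact mono_of_deriv (f := fun t => eta u t ψ) (f' := fun t => eta w t ψ) (a := x) (b := x')
      (fun t ht => (U.deta (Wall.mem_of hx hx' ht) hψ).hasDerivWithinAt) hw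
      (left_mem_Icc.2 hxx) (right_mem_Icc.2 hxx) hxx
  · have key := incr_le (f := fun t => -(eta u t ψ)⁻¹) (f' := fun t => - (-(eta w t ψ) / eta u t ψ ^ 2))
      (h := fun t => 4 * cr / (x * g x ^ 3) * t) (h' := fun t => 4 * cr / (x * g x ^ 3) * 1) hxx
      (fun t ht => ((U.deta (Wall.mem_of hx hx' ht) hψ).inv (hpos t ht).ne').neg.hasDerivWithinAt)
      (fun t ht => ((hasDerivAt_id t).const_mul _).hasDerivWithinAt) ?_
    · simp only [one_div] at *
      linarith
    · intro t ht
      have htL := Wall.mem_of hx hx' ht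
      have h1 := abs_le.1 (U.etaw_near htL hψ)
      have h2 := abs_le.1 (U.eta_near htL hψ)
      have hgx := W.g_pos x hx
      have hg := W.g_pos t htL
      have hg1 := W.g1_pos t htL
      have hgm := W.g_mono hx htL ht.1
      have hx0 := hx.1
      have ht0 := htL.1
      have hcg := W.g1_le t htL
      rw [neg_div, neg_neg, mul_one]
      have a1 : eta w t ψ ≤ 21 / 20 * (3 * g t ^ 2 * g1 t) := by
        have : 0 < 3 * g t ^ 2 * g1 t := by positivity
        nlinarith
      have a2 : 19 / 20 * g t ^ 3 ≤ eta u t ψ := by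
        have : 0 < g t ^ 3 := by positivity
        nlinarith
      have a3 : (19 / 20 * g t ^ 3) ^ 2 ≤ eta u t ψ ^ 2 := pow_le_pow_left₀ (by positivity) a2 2
      calc eta w t ψ / eta u t ψ ^ 2 ≤ 21 / 20 * (3 * g t ^ 2 * g1 t) / (19 / 20 * g t ^ 3) ^ 2 := by
            gcongr
        _ ≤ 4 * cr / (t * g t ^ 3) := by
            rw [div_le_div_iff₀ (by positivity) (by positivity)]
            have := mul_le_mul_of_nonneg_left hcg (show 0 ≤ 21 / 20 * 3 * g t ^ 5 by positivity)
            have hp : 0 < cr * g t ^ 6 := by positivity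
            nlinarith
        _ ≤ _ := by
            have : g x ^ 3 ≤ g t ^ 3 := pow_le_pow_left₀ hgx.le hgm 3
            have := ht.1
            gcongr

set_option maxHeartbeats 800000 in
lemma Cls.td_Dj (U : ClsData)
    (W : WallData)
    (Gs : Gas ε s0 cs ηm s r qt k) (hc : c0 * cs = s0) {x x' ψ : ℝ} (hx : x ∈ Ioo 0 L)
    (hx' : x' ∈ Ioo 0 L) (hxx : x < x') (hψ : ψ ∈ Icc (-m) m) :
    |jf r u v x' ψ - jf r u v x ψ| * ((1 + ε) * (Θ x / m)) ≤
      (Sf m s qt Θ u x' ψ * (M' * (g1 x' * z x' + g x' * (n1 * z x' / x')))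
        - 1 / 4 * n1 * M' * c0 * (g x' ^ 2 * (z x' / x'))) * (x' - x) := by
  have hε := W.hε
  have hε' := W.hε'
  have hc0 := W.hc0
  have hcr := W.hcr
  have hK := W.hK
  have hM' := W.hM'
  have hn1 := W.hn1
  have hg := W.g_pos x hx
  have hg' := W.g_pos x' hx'
  have hg1 := W.g1_pos x hx
  have hg1' := W.g1_pos x' hx'
  have hy := W.y_pos x hx
  have hz := W.z_pos x hx
  have hz' := W.z_pos x' hx'
  have hx0 := hx.1
  have hx0' := hx'.1
  have hd : 0 < x' - x := by linarith
  obtain ⟨r0, r1, -, r2⟩ := Gs.r_bd hε hε' hg' (U.eta_mem W hx' hψ) (U.eta_near hx' hψ)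
  obtain ⟨i1, i2⟩ := U.inv_eta W hx hx' hxx.le hψ
  have hdr := Gs.dr _ (U.eta_mem W hx hψ) _ (U.eta_mem W hx' hψ) i1
  have hv1 := U.c5 x hx x' hx' hxx.le ψ hψ
  have hv2 := U.c5 x hx x' hx' hxx.le (-ψ) (neg_mem hψ)
  have hv3 := U.c4 x hx ψ hψ (-ψ) (neg_mem hψ)
  have hTm : Θ x / m ≤ Θ x' / m := div_le_div_of_nonneg_right (W.Th_mono hx hx' hxx.le) W.hm.le
  have hTp := W.Th_pos hx
  have hdec : jf r u v x' ψ - jf r u v x ψ = r (eta u x' ψ) * (((v x' (-ψ) - v x (-ψ)) - (v x' ψ - v x ψ)) / 2)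
      + (r (eta u x' ψ) - r (eta u x ψ)) * ((v x (-ψ) - v x ψ) / 2) := by unfold jf; ring
  have b1 : |r (eta u x' ψ) * (((v x' (-ψ) - v x (-ψ)) - (v x' ψ - v x ψ)) / 2)| ≤
      r (eta u x' ψ) * ((1 + ε) * M' * (g x' * z x') * (x' - x)) := by
    rw [abs_mul, abs_of_pos r0, abs_div, abs_two]
    refine mul_le_mul_of_nonneg_left ?_ r0.le
    have := abs_sub (v x' (-ψ) - v x (-ψ)) (v x' ψ - v x ψ)
    linarith
  have b2 : |(r (eta u x' ψ) - r (eta u x ψ)) * ((v x (-ψ) - v x ψ) / 2)| ≤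
      4 * cr / (x * g x ^ 3) * (x' - x) * (K * (g x * y x) / 2) := by
    rw [abs_mul, abs_div, abs_two]
    gcongr
    exact hdr.trans i2
  -- first part
  have p1 : r (eta u x' ψ) * ((1 + ε) * M' * (g x' * z x') * (x' - x)) * ((1 + ε) * (Θ x / m)) ≤
      (1 + 2 * ε) * (1 + ε) ^ 2 * (M' * c0 * (g x' * z x' * g1 x')) * (x' - x) := by
    have e1 : r (eta u x' ψ) * ((1 + ε) * M' * (g x' * z x') * (x' - x)) * ((1 + ε) * (Θ x / m)) ≤
      r (eta u x' ψ) * ((1 + ε) * M' * (g x' * z x') * (x' - x)) * ((1 + ε) * (Θ x' / m)) := by gcongr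
    rw [W.ThM hx'] at e1
    have e2 := mul_le_mul_of_nonneg_right r1
      (show 0 ≤ (1 + ε) ^ 2 * (M' * c0 * (g x' * z x' * g1 x')) * (x' - x) by positivity)
    linarith
  -- second part
  have p2 : 4 * cr / (x * g x ^ 3) * (x' - x) * (K * (g x * y x) / 2) * ((1 + ε) * (Θ x / m)) ≤
      1 / 2 * (M' * c0 * n1) * (g x' ^ 2 * (z x' / x')) * (x' - x) := by
    have e1 : 4 * cr / (x * g x ^ 3) * (x' - x) * (K * (g x * y x) / 2) * ((1 + ε) * (Θ x / m)) =
      6 * (1 + ε) * (cr * K * y x * c0 * g x * (x * g1 x) / x ^ 2) * (x' - x) := by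
      rw [W.ThM hx]; field_simp; ring
    have e2 : cr * K * y x * c0 * g x * (x * g1 x) / x ^ 2 ≤ cr * K * y x * c0 * g x * (cr * g x) / x ^ 2 := by
      have := W.g1_le x hx
      gcongr
    have e3 : 14 * (cr * K * y x * c0 * g x * (cr * g x) / x ^ 2) ≤ M' * c0 * n1 * (g x ^ 2 * (z x / x)) := by
      have := mul_le_mul_of_nonneg_right (W.F2 x hx) (show 0 ≤ c0 * g x ^ 2 / x ^ 2 by positivity)
      have q1 : 14 * cr ^ 2 * K * y x * (c0 * g x ^ 2 / x ^ 2) = 14 * (cr * K * y x * c0 * g x * (cr * g x) / x ^ 2) := by ring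
      have q2 : M' * n1 * z x * x * (c0 * g x ^ 2 / x ^ 2) = M' * c0 * n1 * (g x ^ 2 * (z x / x)) := by
        field_simp
      linarith
    have e4 := W.g2zx_mono hx hx' hxx.le
    have e5 := mul_le_mul_of_nonneg_left e4 (show 0 ≤ M' * c0 * n1 by positivity)
    have hp : 0 ≤ cr * K * y x * c0 * g x * (x * g1 x) / x ^ 2 := by positivity
    have e6 : 6 * (1 + ε) * (cr * K * y x * c0 * g x * (x * g1 x) / x ^ 2) ≤
        1 / 2 * (M' * c0 * n1) * (g x' ^ 2 * (z x' / x')) := by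
      have : 6 * (1 + ε) * (cr * K * y x * c0 * g x * (x * g1 x) / x ^ 2) ≤ 7 * (cr * K * y x * c0 * g x * (x * g1 x) / x ^ 2) := by
        apply mul_le_mul_of_nonneg_right _ hp; linarith
      linarith
    rw [e1]
    exact mul_le_mul_of_nonneg_right e6 hd.le
  -- final
  have f1 : (1 + 2 * ε) * (1 + ε) ^ 2 * (M' * c0 * (g x' * z x' * g1 x')) +
      1 / 2 * (M' * c0 * n1) * (g x' ^ 2 * (z x' / x')) ≤
      Sf m s qt Θ u x' ψ * (M' * (g1 x' * z x' + g x' * (n1 * z x' / x')))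
        - 1 / 4 * n1 * M' * c0 * (g x' ^ 2 * (z x' / x')) := by
    have h1 := abs_le.1 (U.S_near W Gs hc hx' hψ)
    have s1 : (1 - ε / 2) * (c0 * g x') ≤ Sf m s qt Θ u x' ψ := by linarith
    have s2 := mul_le_mul_of_nonneg_right s1
      (show 0 ≤ M' * (g1 x' * z x' + g x' * (n1 * z x' / x')) by positivity)
    have s3 : g1 x' ≤ cr * (g x' / x') := by
      rw [← mul_div_assoc, le_div_iff₀ hx0']; linarith [W.g1_le x' hx']
    set X := M' * c0 * (g x' ^ 2 * (z x' / x')) with hX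
    set Z := M' * c0 * (g x' * z x' * g1 x') with hZ
    have hXp : 0 < X := by positivity
    have hZp : 0 < Z := by positivity
    have s4 : Z ≤ cr * X := by
      have := mul_le_mul_of_nonneg_left s3 (show 0 ≤ M' * c0 * (g x' * z x') by positivity)
      calc Z = M' * c0 * (g x' * z x') * g1 x' := by rw [hZ]; ring
        _ ≤ _ := this
        _ = _ := by rw [hX]; ring
    have s5 : (1 - ε / 2) * (c0 * g x') * (M' * (g1 x' * z x' + g x' * (n1 * z x' / x'))) =
        (1 - ε / 2) * (Z + n1 * X) := by rw [hX, hZ]; ring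
    have s6 : (1 + 2 * ε) * (1 + ε) ^ 2 - (1 - ε / 2) ≤ 5 * ε := aux_eps hε hε'
    have s7 := mul_le_mul_of_nonneg_right s6 hZp.le
    have s8 : 5 * ε * Z ≤ n1 / 8 * X := by
      have := mul_le_mul_of_nonneg_left s4 (show 0 ≤ 5 * ε by positivity)
      have := mul_le_mul_of_nonneg_right W.hn hXp.le
      linarith
    have s9 : ε * (n1 * X) ≤ 1 / 20 * (n1 * X) := mul_le_mul_of_nonneg_right hε' (by positivity)
    have s10 : 0 < n1 * X := by positivity
    have t1 : 1 / 2 * (M' * c0 * n1) * (g x' ^ 2 * (z x' / x')) = 1 / 2 * (n1 * X) := by rw [hX]; ring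
    have t2 : 1 / 4 * n1 * M' * c0 * (g x' ^ 2 * (z x' / x')) = 1 / 4 * (n1 * X) := by rw [hX]; ring
    rw [t1, t2]
    linarith
  have f2 := mul_le_mul_of_nonneg_right f1 hd.le
  rw [hdec]
  have f3 := mul_le_mul_of_nonneg_right ((abs_add_le _ _).trans (add_le_add b1 b2))
    (show 0 ≤ (1 + ε) * (Θ x / m) by positivity)
  linarith

lemma Cls.td_jump (U : ClsData)
    (W : WallData)
    (Gs : Gas ε s0 cs ηm s r qt k) (hc : c0 * cs = s0) {x x' : ℝ} (hx : x ∈ Ioo 0 L)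
    (hx' : x' ∈ Ioo 0 L) (hxx : x < x') :
    |Sf m s qt Θ u x' m * Θ1 x' - Sf m s qt Θ u x m * Θ1 x| ≤
      m * (1 / 4 * n1 * M' * c0 * (g x' ^ 2 * (z x' / x'))) * (x' - x) := by
  have hm := W.hm
  have hmm : m ∈ Icc (-m) m := ⟨by linarith, le_rfl⟩
  have hc0 := W.hc0
  have hM' := W.hM'
  have hn1 := W.hn1
  have hε' := W.hε'
  have hd2 := W.hd2
  have hd3 := W.hd3
  have hcr := W.hcr
  have := (convex_Icc x x').norm_image_sub_le_of_norm_hasDerivWithin_le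
    (f := fun x => Sf m s qt Θ u x m * Θ1 x)
    (f' := fun x => Sxf m s r qt k Θ Θ1 u w x m * Θ1 x + Sf m s qt Θ u x m * Θ2 x)
    (C := m * (1 / 4 * n1 * M' * c0 * (g x' ^ 2 * (z x' / x'))))
    (fun t ht => ((U.derS W Gs (Wall.mem_of hx hx' ht) hmm).mul
      (W.dTh1 t (Wall.mem_of hx hx' ht))).hasDerivWithinAt)
    ?_ (left_mem_Icc.2 hxx.le) (right_mem_Icc.2 hxx.le)
  · simp only [Real.norm_eq_abs] at this
    rwa [abs_of_pos (show 0 < x' - x by linarith)] at this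
  · intro t ht
    have htL := Wall.mem_of hx hx' ht
    have hg := W.g_pos t htL
    have hg1 := W.g1_pos t htL
    have hy := W.y_pos t htL
    have hz := W.z_pos t htL
    have ht0 := htL.1
    have h1 := abs_le.1 (U.S_near W Gs hc htL hmm)
    have h2 := (U.Sx_near W Gs htL hmm).2
    have hS : Sf m s qt Θ u t m ≤ 21 / 20 * (c0 * g t) := by nlinarith [mul_pos hc0 hg]
    have hSp := (U.flow W Gs hc).S_pos t htL m hmm
    have hSxn := (U.flow W Gs hc).Sx_nonneg t htL m hmm
    have hTn := W.Th1_nonneg t htL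
    have hT1 := W.Th1_le t htL
    have hT2 := W.Th2_le t htL
    have hg1l : g1 t ≤ cr * (g t / t) := by
      rw [← mul_div_assoc, le_div_iff₀ ht0]; linarith [W.g1_le t htL]
    have hSx : Sxf m s r qt k Θ Θ1 u w t m ≤ 8 / 5 * (c0 * (cr * (g t / t))) := by
      calc _ ≤ Sf m s qt Θ u t m * (3 / 2 * (g1 t / g t)) := mul_le_mul_of_nonneg_left h2 hSp.le
        _ ≤ 21 / 20 * (c0 * g t) * (3 / 2 * (g1 t / g t)) := by gcongr
        _ = 63 / 40 * (c0 * g1 t) := by field_simp; ring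
        _ ≤ 8 / 5 * (c0 * (cr * (g t / t))) := mul_le_mul (by norm_num) (mul_le_mul_of_nonneg_left hg1l hc0.le) (by positivity) (by norm_num)
    have a1 : Sxf m s r qt k Θ Θ1 u w t m * Θ1 t ≤ 8 / 5 * (c0 * (cr * (g t / t))) * (d2 * y t) :=
      mul_le_mul hSx hT1 hTn (by positivity)
    have a2 : Sf m s qt Θ u t m * |Θ2 t| ≤ 21 / 20 * (c0 * g t) * (d3 * y t / t) :=
      mul_le_mul hS hT2 (abs_nonneg _) (by positivity)
    have a3 : ‖Sxf m s r qt k Θ Θ1 u w t m * Θ1 t + Sf m s qt Θ u t m * Θ2 t‖ ≤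
        Sxf m s r qt k Θ Θ1 u w t m * Θ1 t + Sf m s qt Θ u t m * |Θ2 t| := by
      refine (norm_add_le _ _).trans ?_
      rw [norm_mul, norm_mul, Real.norm_eq_abs, Real.norm_eq_abs, Real.norm_eq_abs, Real.norm_eq_abs,
        abs_of_nonneg hSxn, abs_of_nonneg hTn, abs_of_pos hSp]
    have a4 := mul_le_mul_of_nonneg_left (W.Fj t htL) (show 0 ≤ c0 * (g t / t) by positivity)
    have a5 := mul_le_mul_of_nonneg_left (W.g2zx_mono htL hx' ht.2) (show 0 ≤ m * n1 * M' * c0 by positivity)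
    have e1 : c0 * (g t / t) * (m * n1 * M' * (g t * z t)) = m * n1 * M' * c0 * (g t ^ 2 * (z t / t)) := by ring
    have e2 : 21 / 20 * (c0 * g t) * (d3 * y t / t) = 21 / 20 * (c0 * (g t / t) * (d3 * y t)) := by ring
    have e3 : 8 / 5 * (c0 * (cr * (g t / t))) * (d2 * y t) = 8 / 5 * (c0 * (g t / t) * (cr * d2 * y t)) := by ring
    have p1 : 0 < c0 * (g t / t) * (cr * d2 * y t) := by positivity
    have p2 : 0 < c0 * (g t / t) * (d3 * y t) := by positivity
    rw [e1] at a4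
    rw [e2] at a2
    rw [e3] at a1
    simp only at a5
    linarith

lemma Cls.td (U : ClsData)
    (W : WallData)
    (Gs : Gas ε s0 cs ηm s r qt k) (hc : c0 * cs = s0) :
    TD L m (3 * c0 * cr) (6 * m * cr + 2 * d2 * cr / K) (1 + ε) M' (Sf m s qt Θ u)
      (Sxf m s r qt k Θ Θ1 u w) (jf r u v) Θ Θ1 Θ2 (fun x => c0 / 2 * g x) E E1
      (fun x => 1 / 2 * K * θ * (g x * y x))
      (fun x => 1 / 2 * K * θ * (g1 x * y x + g x * (lam * y x / x)))
      (fun x => g x * z x) (fun x => g1 x * z x + g x * (n1 * z x / x))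
      (fun x => 1 / 4 * n1 * M' * c0 * (g x ^ 2 * (z x / x))) where
  flow := U.flow W Gs hc
  src := U.src W Gs hc
  dTh1 := W.dTh1
  dpsi := fun x hx ψ hψ => U.dpsiS W Gs hx hψ
  sym := by
    intro x hx
    unfold Sf
    have : eta u x (-m) = eta u x m := by unfold eta; rw [neg_neg, add_comm]
    rw [this]
  mono := fun x hx ψ hψ => U.td_mono W Gs hc hx hψ
  dE := W.dE
  E_nonneg := W.E_nonneg
  jE := fun x hx ψ hψ => U.td_jE W Gs hc hx hψ
  crude := fun x hx ψ hψ => U.td_crude W Gs hc hx hψ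
  dR := fun x hx => ((W.dg x hx).mul (W.dy x hx)).const_mul _
  R_nonneg := fun x hx => by
    have := W.hK; have := W.hθ0; have := W.g_pos x hx; have := W.y_pos x hx
    positivity
  jR := fun x hx ψ hψ => (U.td_jR W Gs hc hx hψ).2
  dG := fun x hx => (W.dg x hx).mul (W.dz x hx)
  G_nonneg := fun x hx => (mul_pos (W.g_pos x hx) (W.z_pos x hx)).le
  P_nonneg := fun x hx => by
    have := W.hM'; have := W.hn1; have := W.hc0; have := W.g_pos x hx; have := W.z_pos x hx
    have := hx.1
    positivity
  P_mono := fun a ha b hb hab => by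
    have := W.hM'; have := W.hn1; have := W.hc0
    exact mul_le_mul_of_nonneg_left (W.g2zx_mono ha hb hab) (by positivity)
  hM' := W.hM'.le
  Dj := fun x hx x' hx' h ψ hψ => U.td_Dj W Gs hc hx hx' h hψ
  jump := fun x hx x' hx' h => U.td_jump W Gs hc hx hx' h


lemma nonpos_of_anti {L C : ℝ} {f f1 : ℝ → ℝ} (h : ∀ x ∈ Ioo 0 L, HasDerivAt f (f1 x) x)
    (h0 : ∀ x ∈ Ioo 0 L, f1 x ≤ 0) (hb : ∀ x ∈ Ioo 0 L, f x ≤ C * x) : ∀ x ∈ Ioo 0 L, f x ≤ 0 := by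
  intro x hx
  have hm := monoOn_of (f := fun x => -f x) (f1 := fun x => -f1 x) (fun x hx => (h x hx).neg)
    (fun x hx => by linarith [h0 x hx])
  refine ge_of_tendsto (tendsto_lin C) ?_
  filter_upwards [Ioo_mem_nhdsGT hx.1] with t ht
  have ht' : t ∈ Ioo 0 L := ⟨ht.1, ht.2.trans hx.2⟩
  have := hm ht' hx ht.2.le
  have := hb t ht'
  simp only at *
  linarith

lemma Wall.lamEst (W : WallData) {x : ℝ}
    (hx : x ∈ Ioo 0 L) : Real.exp (E x) * (M' * (g x * z x) + 2 * m *
      (1 / 4 * n1 * M' * c0 * (g x ^ 2 * (z x / x)))) ≤ (1 + ε) * M' * (g x * z x) := by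
  have hε := W.hε
  have hε' := W.hε'
  have hM' := W.hM'
  have hg := W.g_pos x hx
  have hz := W.z_pos x hx
  have hx0 := hx.1
  have h4 := exp_small hε hε' (W.E_le x hx)
  have h5 := mul_le_mul_of_nonneg_right (W.Fm x hx) (show 0 ≤ M' * (g x * z x) / x by positivity)
  have e1 : m * n1 * c0 * g x * (M' * (g x * z x) / x) = 2 * (2 * m *
      (1 / 4 * n1 * M' * c0 * (g x ^ 2 * (z x / x)))) := by ring
  have e2 : ε / 5 * x * (M' * (g x * z x) / x) = ε / 5 * (M' * (g x * z x)) := by field_simp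
  rw [e1, e2] at h5
  set X := M' * (g x * z x) with hX
  have hXp : 0 < X := by positivity
  have h6 : X + 2 * m * (1 / 4 * n1 * M' * c0 * (g x ^ 2 * (z x / x))) ≤ (1 + ε / 10) * X := by linarith
  have h7 := (mul_le_mul_of_nonneg_left h6 (exp_pos (E x)).le).trans
      (mul_le_mul_of_nonneg_right h4 (by positivity))
  have h8 : (1 + ε / 5) * (1 + ε / 10) ≤ 1 + ε := by nlinarith
  have := mul_le_mul_of_nonneg_right h8 hXp.le
  linarith

theorem Cls.step (U : ClsData)
    (W : WallData)
    (Gs : Gas ε s0 cs ηm s r qt k) (hc : c0 * cs = s0) :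
    ∃ u' w', (∃ C', TrSol L m C' (Sf m s qt Θ u) (Sxf m s r qt k Θ Θ1 u w) Θ Θ1 u' w') ∧
      Cls L m c0 ε n1 K M' g g1 y z u' w' (fun x ψ => Sf m s qt Θ u x ψ * w' x ψ) ∧
      ∀ x ∈ Ioo 0 L, ∀ ψ ∈ Icc (-m) m,
        |Sf m s qt Θ u x ψ * w' x ψ - Θ x / m| ≤ 1 / 2 * K * (g x * y x) := by
  have q := U.td W Gs hc
  obtain ⟨u', w', C', o⟩ := q.exists_sol
  have hε := W.hε
  have hε' := W.hε'
  have hM' := W.hM'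
  have hc0 := W.hc0
  have hn1 := W.hn1
  have hcr := W.hcr
  have hm := W.hm
  have hK := W.hK
  have hv : ∀ x ∈ Ioo 0 L, ∀ ψ ∈ Icc (-m) m,
        |Sf m s qt Θ u x ψ * w' x ψ - Θ x / m| ≤ 1 / 2 * K * (g x * y x) := by
    intro x hx ψ hψ
    have h1 := q.v_upper o x hx ψ hψ
    have h2 := q.v_lower o x hx ψ hψ
    have h3 := U.STh1 W Gs hc hx hψ
    have h4 := (W.gy hx).1
    have h5 : 0 < c0 * d2 * (g x * y x) := mul_pos (mul_pos hc0 W.hd2) (mul_pos (W.g_pos x hx) (W.y_pos x hx))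
    rw [abs_le]; constructor <;> linarith
  have c5 : ∀ x ∈ Ioo 0 L, ∀ x' ∈ Ioo 0 L, x ≤ x' → ∀ ψ ∈ Icc (-m) m,
    |Sf m s qt Θ u x' ψ * w' x' ψ - Sf m s qt Θ u x ψ * w' x ψ| ≤
      (1 + ε) * M' * (g x' * z x') * (x' - x) := by
    intro x hx x' hx' hxx ψ hψ
    rcases hxx.eq_or_lt with rfl | hlt
    · simp
    · have h1 := q.v_lip o hx hx' hlt hψ
      have h2 := mul_le_mul_of_nonneg_right (W.lamEst hx') (show 0 ≤ x' - x by linarith)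
      linarith
  have c6' : ∀ x ∈ Ioo 0 L, ∀ ψ ∈ Icc (-m) m, ∀ ψ' ∈ Icc (-m) m, ψ ≤ ψ' →
    |Sf m s qt Θ u x ψ' * w' x ψ' - Sf m s qt Θ u x ψ * w' x ψ| ≤
      c0 * M' * (n1 + 2 * (1 + ε)) * (g x ^ 2 * z x) * (ψ' - ψ) := by
    intro x hx ψ hψ ψ' hψ' hle
    have hg := W.g_pos x hx
    have := q.v_lip_psi o hx hψ hψ' hle (a := 2 * (c0 * g x)) (J := c0 * M' * n1 * (g x ^ 2 * z x))
      (Λ := (1 + ε) * M' * (g x * z x)) ?_ ?_ (W.lamEst hx)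
    · refine this.trans (le_of_eq ?_)
      ring
    · intro t ht τ hτ
      have htL : t ∈ Ioo 0 L := ⟨ht.1, ht.2.trans_lt hx.2⟩
      have h1 := abs_le.1 (U.S_near W Gs hc htL hτ)
      have h2 := mul_le_mul_of_nonneg_left (W.g_mono htL hx ht.2) hc0.le
      nlinarith [mul_pos hc0 (W.g_pos t htL)]
    · intro t ht τ hτ
      have htL : t ∈ Ioo 0 L := ⟨ht.1, ht.2.trans_lt hx.2⟩
      have h1 := (U.td_jR W Gs hc htL hτ).1
      have hgt := W.g_pos t htL
      have hg1 := W.g1_pos t htL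
      have hy := W.y_pos t htL
      have hz := W.z_pos t htL
      have ht0 := htL.1
      have h2 : K * y t * (c0 * g t * g1 t) ≤ 1 / 14 * (c0 * M' * n1 * (g t ^ 2 * z t)) := by
        have a1 := mul_le_mul_of_nonneg_left (W.g1_le t htL) (show 0 ≤ K * y t * (c0 * g t) / t by positivity)
        have a2 := mul_le_mul_of_nonneg_right (W.F2 t htL) (show 0 ≤ c0 * g t ^ 2 / (14 * t) by positivity)
        have e1 : K * y t * (c0 * g t) / t * (t * g1 t) = K * y t * (c0 * g t * g1 t) := by field_simp
        have e2 : 14 * cr ^ 2 * K * y t * (c0 * g t ^ 2 / (14 * t)) = cr * (K * y t * (c0 * g t) / t * (cr * g t)) := by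
          field_simp
        have e3 : M' * n1 * z t * t * (c0 * g t ^ 2 / (14 * t)) = 1 / 14 * (c0 * M' * n1 * (g t ^ 2 * z t)) := by
          field_simp
        rw [e1] at a1
        rw [e2, e3] at a2
        have : 0 ≤ K * y t * (c0 * g t) / t * (cr * g t) := by positivity
        nlinarith
      have h3 : g t ^ 2 * z t ≤ g x ^ 2 * z x :=
        mul_le_mul (pow_le_pow_left₀ hgt.le (W.g_mono htL hx ht.2) 2) (W.z_mono htL hx ht.2) hz.le (by positivity)
      have h4 := mul_le_mul_of_nonneg_left h3 (show 0 ≤ c0 * M' * n1 by positivity)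
      have h5 : 0 < K * y t * (c0 * g t * g1 t) := by positivity
      have h6 : (1 + 4 * ε) * (K * y t * (c0 * g t * g1 t)) ≤ 2 * (K * y t * (c0 * g t * g1 t)) :=
        mul_le_mul_of_nonneg_right (by linarith) h5.le
      have h7 : 0 ≤ c0 * M' * n1 * (g t ^ 2 * z t) := by positivity
      linarith
  have c6 : ∀ x ∈ Ioo 0 L, ∀ ψ ∈ Icc (-m) m, ∀ ψ' ∈ Icc (-m) m,
    |Sf m s qt Θ u x ψ' * w' x ψ' - Sf m s qt Θ u x ψ * w' x ψ| ≤
      c0 * M' * (n1 + 2 * (1 + ε)) * (g x ^ 2 * z x) * |ψ' - ψ| := by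
    intro x hx ψ hψ ψ' hψ'
    rcases le_total ψ ψ' with h | h
    · rw [abs_of_nonneg (show 0 ≤ ψ' - ψ by linarith)]
      exact c6' x hx ψ hψ ψ' hψ' h
    · rw [abs_sub_comm ψ', abs_of_nonneg (show 0 ≤ ψ - ψ' by linarith), abs_sub_comm]
      exact c6' x hx ψ' hψ' ψ hψ h
  have cv : ContinuousOn (fun p : ℝ × ℝ => Sf m s qt Θ u p.1 p.2 * w' p.1 p.2) (Ioo 0 L ×ˢ Icc (-m) m) := by
    refine lip2_cont (F := fun x ψ => Sf m s qt Θ u x ψ * w' x ψ) (A := (1 + ε) * M')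
      (A' := c0 * M' * (n1 + 2 * (1 + ε))) ?_ ?_
    · have key : ∀ x ∈ Ioo 0 L, ∀ x' ∈ Ioo 0 L, x ≤ x' → ∀ ψ ∈ Icc (-m) m,
          |Sf m s qt Θ u x' ψ * w' x' ψ - Sf m s qt Θ u x ψ * w' x ψ| ≤ (1 + ε) * M' * (x' - x) := by
        intro x hx x' hx' hxx ψ hψ
        refine (c5 x hx x' hx' hxx ψ hψ).trans (mul_le_mul_of_nonneg_right ?_ (by linarith))
        have : g x' * z x' ≤ 1 := mul_le_one₀ (W.g_le1 hx') (W.z_pos x' hx').le (W.z_le x' hx')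
        have := mul_le_mul_of_nonneg_left this (show 0 ≤ (1 + ε) * M' by positivity)
        linarith
      intro x hx x' hx' ψ hψ
      rcases le_total x x' with h | h
      · rw [abs_of_nonneg (show 0 ≤ x' - x by linarith)]
        exact key x hx x' hx' h ψ hψ
      · rw [abs_sub_comm x', abs_of_nonneg (show 0 ≤ x - x' by linarith), abs_sub_comm]
        exact key x' hx' x hx h ψ hψ
    · intro x hx ψ hψ ψ' hψ'
      refine (c6 x hx ψ hψ ψ' hψ').trans (mul_le_mul_of_nonneg_right ?_ (abs_nonneg _))
      have : g x ^ 2 * z x ≤ 1 := mul_le_one₀ (pow_le_one₀ (W.g_pos x hx).le (W.g_le1 hx)) (W.z_pos x hx).le (W.z_le x hx)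
      have := mul_le_mul_of_nonneg_left this (show 0 ≤ c0 * M' * (n1 + 2 * (1 + ε)) by positivity)
      linarith
  have c3 : ∀ x ∈ Ioo 0 L, ∀ ψ ∈ Icc (-m) m, |w' x ψ - 3 * g x ^ 2 * g1 x| ≤ ε * (3 * g x ^ 2 * g1 x) := by
    intro x hx ψ hψ
    have hg := W.g_pos x hx
    have hg1 := W.g1_pos x hx
    have h1 := abs_le.1 (hv x hx ψ hψ)
    have h2 := (W.gy hx).2
    have h3 := abs_le.1 (U.S_near W Gs hc hx hψ)
    have hSp := q.flow.S_pos x hx ψ hψ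
    rw [W.ThM hx] at h1 h2
    set X := 3 * g x ^ 2 * g1 x with hX
    set Y := c0 * g x with hY
    have e : 3 * c0 * g x ^ 3 * g1 x = Y * X := by rw [hX, hY]; ring
    rw [e] at h1 h2
    have hXp : 0 < X := by positivity
    have hYp : 0 < Y := by positivity
    have hYX : 0 < Y * X := by positivity
    rw [abs_le]
    constructor
    · have : Sf m s qt Θ u x ψ * ((1 - ε) * X) ≤ Sf m s qt Θ u x ψ * w' x ψ := by
        have a1 : Sf m s qt Θ u x ψ * ((1 - ε) * X) ≤ (1 + ε / 2) * Y * ((1 - ε) * X) :=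
          mul_le_mul_of_nonneg_right (by linarith) (mul_nonneg (by linarith) hXp.le)
        have a2 : (1 + ε / 2) * (1 - ε) ≤ 1 - ε / 20 := by nlinarith
        have := mul_le_mul_of_nonneg_right a2 hYX.le
        linarith
      have := le_of_mul_le_mul_left this hSp
      linarith
    · have : Sf m s qt Θ u x ψ * w' x ψ ≤ Sf m s qt Θ u x ψ * ((1 + ε) * X) := by
        have a1 : (1 - ε / 2) * Y * ((1 + ε) * X) ≤ Sf m s qt Θ u x ψ * ((1 + ε) * X) :=
          mul_le_mul_of_nonneg_right (by linarith) (by positivity)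
        have a2 : 1 + ε / 20 ≤ (1 - ε / 2) * (1 + ε) := by nlinarith
        have := mul_le_mul_of_nonneg_right a2 hYX.le
        linarith
      have := le_of_mul_le_mul_left this hSp
      linarith
  refine ⟨u', w', ⟨C', o⟩, ⟨o.du, ?_, ?_, ?_, c3, ?_, c5, c6⟩, hv⟩
  · intro x hx
    refine deriv_of_right (o.cu x hx) ?_ (o.dr x hx)
    exact (cv.comp (f := fun ψ : ℝ => (x, ψ)) (by fun_prop) fun ψ hψ => ⟨hx, hψ⟩).neg
  · refine (cv.div (U.contS W Gs) fun p hp => (q.flow.S_pos p.1 hp.1 p.2 hp.2).ne').congr fun p hp => ?_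
    have := (q.flow.S_pos p.1 hp.1 p.2 hp.2).ne'
    simp only [Pi.div_apply]
    field_simp
  · intro x hx ψ hψ
    have hd3 : ∀ x ∈ Ioo 0 L, HasDerivAt (fun x => g x ^ 3) (3 * g x ^ 2 * g1 x) x := fun x hx =>
      ((W.dg x hx).pow 3).congr_deriv (by norm_num)
    have hg3 : ∀ x ∈ Ioo 0 L, 0 < g x ^ 3 ∧ g x ^ 3 ≤ x := fun x hx => by
      have h1 := W.g_pos x hx
      have h2 : g x ^ 2 ≤ 1 := pow_le_one₀ h1.le (W.g_le1 hx)
      have h3 := W.g_le x hx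
      exact ⟨by positivity, by nlinarith⟩
    have up := nonpos_of_anti (f := fun x => u' x ψ - (1 + ε) * g x ^ 3)
      (f1 := fun x => w' x ψ - (1 + ε) * (3 * g x ^ 2 * g1 x)) (C := C') (L := L)
      (fun x hx => (o.du x hx ψ hψ).sub ((hd3 x hx).const_mul _))
      (fun x hx => by have := abs_le.1 (c3 x hx ψ hψ); linarith)
      (fun x hx => by
        have h1 := o.u_le x hx ψ hψ
        have := mul_pos (show 0 < 1 + ε by linarith) (hg3 x hx).1
        linarith) x hx
    have lo := nonpos_of_anti (f := fun x => (1 - ε) * g x ^ 3 - u' x ψ)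
      (f1 := fun x => (1 - ε) * (3 * g x ^ 2 * g1 x) - w' x ψ) (C := 1) (L := L)
      (fun x hx => ((hd3 x hx).const_mul _).sub (o.du x hx ψ hψ))
      (fun x hx => by have := abs_le.1 (c3 x hx ψ hψ); linarith)
      (fun x hx => by
        have h1 := o.u_nonneg x hx ψ hψ
        have := hg3 x hx
        nlinarith) x hx
    rw [abs_le]; constructor <;> linarith
  · intro x hx ψ hψ ψ' hψ'
    have h1 := abs_le.1 (hv x hx ψ hψ)
    have h2 := abs_le.1 (hv x hx ψ' hψ')
    rw [abs_le]; constructor <;> linarith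

end
end Nozzle

namespace Nozzle

variable {L m c0 ε θ lam n1 cr d2 d3 K M' ηm s0 cs : ℝ} {g g1 Θ Θ1 Θ2 y z E E1 s r qt k : ℝ → ℝ}
local notation "WallData" => Wall L m c0 ε θ lam n1 cr d2 d3 K M' ηm g g1 Θ Θ1 Θ2 y z E E1

lemma Wall.init (W : WallData) :
    Cls L m c0 ε n1 K M' g g1 y z (fun x _ => g x ^ 3) (fun x _ => 3 * g x ^ 2 * g1 x)
      (fun _ _ => 0) where
  du := fun x hx ψ hψ => by
    have := (W.dg x hx).pow 3
    exact this.congr_deriv (by ring)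
  dpsi := fun x hx ψ hψ => by
    simpa using (hasDerivWithinAt_const ψ (Icc (-m) m) (g x ^ 3))
  cw := by
    have hgc : ContinuousOn g (Ioo 0 L) := fun x hx => (W.dg x hx).continuousAt.continuousWithinAt
    have hTc : ContinuousOn Θ (Ioo 0 L) := fun x hx => (W.dTh x hx).continuousAt.continuousWithinAt
    have h : ContinuousOn (fun x => 3 * g x ^ 2 * g1 x) (Ioo 0 L) := by
      have h2 : ContinuousOn (fun x => Θ x / (m * c0 * g x)) (Ioo 0 L) := by
        refine hTc.div (by fun_prop) fun x hx => ?_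
        have := W.g_pos x hx
        have := W.hm
        have := W.hc0
        positivity
      refine h2.congr fun x hx => ?_
      have := W.g_pos x hx
      have := W.hm
      have := W.hc0
      simp only
      rw [W.hTh x hx]
      field_simp
    exact h.comp continuous_fst.continuousOn fun p hp => hp.1
  c2 := fun x hx ψ hψ => by
    have := W.g_pos x hx
    have := W.hε
    simp; positivity
  c3 := fun x hx ψ hψ => by
    have := W.g_pos x hx
    have := W.g1_pos x hx
    have := W.hε
    simp; positivity
  c4 := fun x hx ψ hψ ψ' hψ' => by
    have := W.g_pos x hx
    have := W.y_pos x hx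
    have := W.hK
    simp; positivity
  c5 := fun x hx x' hx' hxx ψ hψ => by
    have := W.g_pos x' hx'
    have := W.z_pos x' hx'
    have := W.hM'
    have := W.hε
    have : 0 ≤ x' - x := by linarith
    simp; positivity
  c6 := fun x hx ψ hψ ψ' hψ' => by
    have := W.g_pos x hx
    have := W.z_pos x hx
    have := W.hM'
    have := W.hε
    have := W.hc0
    have := W.hn1
    simp; positivity

lemma mv {F F' : ℝ → ℝ} {a b C : ℝ} (h : ∀ t ∈ uIcc a b, HasDerivAt F (F' t) t)
    (hb : ∀ t ∈ uIcc a b, |F' t| ≤ C) : |F b - F a| ≤ C * |b - a| := by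
  have := (convex_uIcc a b).norm_image_sub_le_of_norm_hasDerivWithin_le (f := F) (f' := F') (C := C)
    (fun t ht => (h t ht).hasDerivWithinAt) hb left_mem_uIcc right_mem_uIcc
  simpa [Real.norm_eq_abs] using this

variable {u w v u' w' v' : ℝ → ℝ → ℝ}

lemma Cls.S_diff (U : Cls L m c0 ε n1 K M' g g1 y z u w v) (U' : Cls L m c0 ε n1 K M' g g1 y z u' w' v')
    (W : WallData)
    (Gs : Gas ε s0 cs ηm s r qt k) (hc : c0 * cs = s0) {D x ψ : ℝ} (hx : x ∈ Ioo 0 L)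
    (hψ : ψ ∈ Icc (-m) m) (hD : 0 ≤ D) (hu : ∀ ψ ∈ Icc (-m) m, |u' x ψ - u x ψ| ≤ D * g x ^ 3) :
    |Sf m s qt Θ u' x ψ - Sf m s qt Θ u x ψ| ≤ 9 / 20 * D * (c0 * g x) := by
  have hε := W.hε
  have hε' := W.hε'
  have hg := W.g_pos x hx
  have hg3 : 0 < g x ^ 3 := by positivity
  have hcs := Gs.hcs
  have hc0 := W.hc0
  have hs0 := Gs.hs0
  have hm : m ∈ Icc (-m) m := ⟨by linarith [W.hm], le_rfl⟩
  have he : ∀ ψ ∈ Icc (-m) m, |eta u' x ψ - eta u x ψ| ≤ D * g x ^ 3 := by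
    intro ψ hψ
    have h1 := abs_le.1 (hu ψ hψ)
    have h2 := abs_le.1 (hu (-ψ) (neg_mem hψ))
    unfold eta
    rw [abs_le]; constructor <;> linarith
  have hbox : ∀ ψ ∈ Icc (-m) m, ∀ t ∈ uIcc (eta u x ψ) (eta u' x ψ),
      t ∈ Ioo 0 ηm ∧ |t - g x ^ 3| ≤ ε * g x ^ 3 := by
    intro ψ hψ t ht
    have a1 := abs_le.1 (U.eta_near hx hψ)
    have a2 := abs_le.1 (U'.eta_near hx hψ)
    have b1 := U.eta_mem W hx hψ
    have b2 := U'.eta_mem W hx hψ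
    rcases mem_uIcc.1 ht with h | h
    · exact ⟨⟨b1.1.trans_le h.1, h.2.trans_lt b2.2⟩, abs_le.2 ⟨by linarith, by linarith⟩⟩
    · exact ⟨⟨b2.1.trans_le h.1, h.2.trans_lt b1.2⟩, abs_le.2 ⟨by linarith, by linarith⟩⟩
  have hs : |s (eta u' x ψ) - s (eta u x ψ)| ≤ (102 / 100 * (s0 * g x) * (11 / 30)) * D := by
    have h := mv (F := s) (F' := fun t => s t * r t) (a := eta u x ψ) (b := eta u' x ψ)
      (C := 102 / 100 * (s0 * g x) * (11 / 30) / g x ^ 3)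
      (fun t ht => Gs.ds t (hbox ψ hψ t ht).1) ?_
    · calc _ ≤ _ := h
        _ ≤ 102 / 100 * (s0 * g x) * (11 / 30) / g x ^ 3 * (D * g x ^ 3) := by
            have := he ψ hψ
            gcongr
        _ = _ := by field_simp
    · intro t ht
      obtain ⟨t1, t2⟩ := hbox ψ hψ t ht
      have e1 := abs_le.1 (Gs.s_near hε hε' hg t1 t2)
      obtain ⟨e2, e3, -, -⟩ := Gs.r_bd hε hε' hg t1 t2
      have e4 := Gs.s_pos t t1
      rw [abs_of_pos (mul_pos e4 e2), le_div_iff₀ hg3]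
      have e5 : s t ≤ 102 / 100 * (s0 * g x) := by nlinarith [mul_pos hs0 hg]
      have e6 : r t * g x ^ 3 ≤ 11 / 30 := by linarith
      calc s t * r t * g x ^ 3 = s t * (r t * g x ^ 3) := by ring
        _ ≤ _ := by gcongr
  have hq : |qt (eta u' x m) - qt (eta u x m)| ≤ (cs * (1 / 1000)) * D := by
    have h := mv (F := qt) (F' := fun t => qt t * k t) (a := eta u x m) (b := eta u' x m)
      (C := cs * (1 / 1000) / g x ^ 3)
      (fun t ht => Gs.dqt t (hbox m hm t ht).1) ?_
    · calc _ ≤ _ := h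
        _ ≤ cs * (1 / 1000) / g x ^ 3 * (D * g x ^ 3) := by
            have := he m hm
            gcongr
        _ = _ := by field_simp
    · intro t ht
      obtain ⟨t1, t2⟩ := hbox m hm t ht
      have e1 := abs_le.1 (Gs.hq t t1)
      have e2 := Gs.k_bd hε hε' hg t1 t2
      have e4 := Gs.qt_pos t t1
      rw [abs_mul, abs_of_pos e4, le_div_iff₀ hg3]
      have e5 : qt t ≤ 11 / 10 * cs := by nlinarith
      have e6 : |k t| * g x ^ 3 ≤ 1 / 1900 := by linarith
      calc qt t * |k t| * g x ^ 3 = qt t * (|k t| * g x ^ 3) := by ring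
        _ ≤ 11 / 10 * cs * (1 / 1900) := by gcongr
        _ ≤ _ := by linarith
  have q1 := abs_le.1 (Gs.hq _ (U.eta_mem W hx hm))
  have q2 := abs_le.1 (Gs.hq _ (U'.eta_mem W hx hm))
  have s1 := abs_le.1 (Gs.s_near hε hε' hg (U.eta_mem W hx hψ) (U.eta_near hx hψ))
  have s1p := Gs.s_pos _ (U.eta_mem W hx hψ)
  have q1' : 999 / 1000 * cs ≤ qt (eta u x m) := by nlinarith
  have q2' : 999 / 1000 * cs ≤ qt (eta u' x m) := by nlinarith
  have s1' : s (eta u x ψ) ≤ 102 / 100 * (s0 * g x) := by nlinarith [mul_pos hs0 hg]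
  unfold Sf
  generalize s (eta u' x ψ) = a' at *
  generalize s (eta u x ψ) = a at *
  generalize qt (eta u' x m) = p' at *
  generalize qt (eta u x m) = p at *
  have hp : 0 < p := by linarith
  have hp' : 0 < p' := by linarith
  have hid : a' * (cos (Θ x) / p') - a * (cos (Θ x) / p)
      = cos (Θ x) * ((a' - a) / p' - a * (p' - p) / (p * p')) := by field_simp; ring
  rw [hid, abs_mul]
  have hcos := abs_cos_le_one (Θ x)
  have t1 : |(a' - a) / p'| ≤ 102 / 100 * (c0 * g x) * (11 / 30) * D * (1000 / 999) := by
    rw [abs_div, abs_of_pos hp', div_le_iff₀ hp']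
    refine hs.trans ?_
    have : 0 ≤ 102 / 100 * (c0 * g x) * (11 / 30) * D * (1000 / 999) := by positivity
    calc 102 / 100 * (s0 * g x) * (11 / 30) * D
        = 102 / 100 * (c0 * g x) * (11 / 30) * D * (1000 / 999) * (999 / 1000 * cs) := by
          rw [← hc]; ring
      _ ≤ _ := by gcongr
  have t2 : |a * (p' - p) / (p * p')| ≤ 11 / 10 * (c0 * g x) * (1 / 500) * D := by
    rw [abs_div, abs_of_pos (mul_pos hp hp'), abs_mul, abs_of_pos s1p, div_le_iff₀ (mul_pos hp hp')]
    have h0 : 0 ≤ 11 / 10 * (c0 * g x) * (1 / 500) * D := by positivity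
    calc a * |p' - p| ≤ 102 / 100 * (s0 * g x) * (cs * (1 / 1000) * D) := by gcongr
      _ = (102 / 100) * (c0 * g x) * (1 / 1000) * D * (cs * cs) := by rw [← hc]; ring
      _ ≤ 11 / 10 * (c0 * g x) * (1 / 500) * D * ((999 / 1000 * cs) * (999 / 1000 * cs)) := by
          have : 0 ≤ (c0 * g x) * D * (cs * cs) := by positivity
          nlinarith
      _ ≤ _ := by gcongr
  have t3 := (abs_sub _ _).trans (add_le_add t1 t2)
  have h0 : 0 ≤ (c0 * g x) * D := by positivity
  calc _ ≤ 1 * (102 / 100 * (c0 * g x) * (11 / 30) * D * (1000 / 999) + 11 / 10 * (c0 * g x) * (1 / 500) * D) := by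
        gcongr
    _ ≤ _ := by nlinarith

theorem contr {ua wa va ub wb vb u1 w1 u2 w2 : ℝ → ℝ → ℝ}
    (Ua : Cls L m c0 ε n1 K M' g g1 y z ua wa va) (Ub : Cls L m c0 ε n1 K M' g g1 y z ub wb vb)
    (W : WallData)
    (Gs : Gas ε s0 cs ηm s r qt k) (hc : c0 * cs = s0)
    (U1 : Cls L m c0 ε n1 K M' g g1 y z u1 w1 (fun x ψ => Sf m s qt Θ ua x ψ * w1 x ψ))
    (U2 : Cls L m c0 ε n1 K M' g g1 y z u2 w2 (fun x ψ => Sf m s qt Θ ub x ψ * w2 x ψ))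
    (j1 : ∀ x ∈ Ioo 0 L, u1 x (-m) = u1 x m + 2 * Θ x)
    (j2 : ∀ x ∈ Ioo 0 L, u2 x (-m) = u2 x m + 2 * Θ x)
    {D : ℝ} (hD : 0 ≤ D)
    (hu : ∀ x ∈ Ioo 0 L, ∀ ψ ∈ Icc (-m) m, |ub x ψ - ua x ψ| ≤ D * g x ^ 3) :
    ∀ x ∈ Ioo 0 L, ∀ ψ ∈ Icc (-m) m, |u2 x ψ - u1 x ψ| ≤ D / 2 * g x ^ 3 := by
  have hε := W.hε
  have hε' := W.hε'
  have hc0 := W.hc0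
  have F := Ua.flow W Gs hc
  have hN : ∀ x ∈ Ioo 0 L, HasDerivAt (fun x => D / 2 * g x ^ 3) (D / 2 * (3 * g x ^ 2 * g1 x)) x := by
    intro x hx
    exact (((W.dg x hx).pow 3).const_mul (D / 2)).congr_deriv (by ring)
  have inc : ∀ x ∈ Ioo 0 L, ∀ ψ ∈ Icc (-m) m, ∀ σ, σ = sig L m (Sf m s qt Θ ua) x ψ →
      |u2 x ψ - u1 x ψ| - |u2 σ (-m) - u1 σ (-m)| ≤ D / 2 * g x ^ 3 - D / 2 * g σ ^ 3 := by
    intro x hx ψ hψ σ hσ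
    obtain ⟨e1, e2, e3⟩ := F.flow_spec hx hψ
    set Y := flowY L m (Sf m s qt Θ ua) x ψ with hY
    have hσ' : σ = Y (-m) := hσ
    have hsub : Icc (-m) ψ ⊆ Icc (-m) m := Icc_subset_Icc_right hψ.2
    have key := damped hψ.1 (D := fun t => u2 (Y t) t - u1 (Y t) t) (al := fun _ => 0)
      (r := fun t => (Sf m s qt Θ ua (Y t) t - Sf m s qt Θ ub (Y t) t) * w2 (Y t) t)
      (N := fun t => D / 2 * g (Y t) ^ 3) (N' := fun t => Sf m s qt Θ ua (Y t) t * (D / 2 * (3 * g (Y t) ^ 2 * g1 (Y t))))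
      ?_ (fun t _ => le_rfl) (TD.comp_char hN e2) ?_
    · simp only [e1] at key
      rw [hσ']; exact key
    · intro t ht
      have h1 := chain_curve U1.cw U1.du hsub ht (e2 t ht).1 (e2 t ht).2 (U1.dpsi _ (e2 t ht).1 t (hsub ht))
      have h2 := chain_curve U2.cw U2.du hsub ht (e2 t ht).1 (e2 t ht).2 (U2.dpsi _ (e2 t ht).1 t (hsub ht))
      exact (h2.sub h1).congr_deriv (by ring)
    · intro t ht
      have hy := (e2 t ht).1
      have a1 := Ua.S_diff Ub W Gs hc hy (hsub ht) hD (fun ψ hψ => hu _ hy ψ hψ)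
      have a2 := abs_le.1 (U2.c3 _ hy t (hsub ht))
      have a3 := abs_le.1 (Ua.S_near W Gs hc hy (hsub ht))
      have hg := W.g_pos _ hy
      have hg1 := W.g1_pos _ hy
      rw [abs_sub_comm] at a1
      have hp : 0 < 3 * g (Y t) ^ 2 * g1 (Y t) := by positivity
      have a4 : |w2 (Y t) t| ≤ 21 / 20 * (3 * g (Y t) ^ 2 * g1 (Y t)) := by
        rw [abs_le]; constructor <;> nlinarith
      have a5 : 19 / 20 * (c0 * g (Y t)) ≤ Sf m s qt Θ ua (Y t) t := by nlinarith [mul_pos hc0 hg]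
      rw [abs_mul]
      calc _ ≤ 9 / 20 * D * (c0 * g (Y t)) * (21 / 20 * (3 * g (Y t) ^ 2 * g1 (Y t))) := by gcongr
        _ ≤ 19 / 20 * (c0 * g (Y t)) * (D / 2 * (3 * g (Y t) ^ 2 * g1 (Y t))) := by
          have : 0 ≤ D * ((c0 * g (Y t)) * (3 * g (Y t) ^ 2 * g1 (Y t))) := by positivity
          nlinarith
        _ ≤ _ := by gcongr
  have hjump : ∀ x ∈ Ioo 0 L, u2 x (-m) - u1 x (-m) = u2 x m - u1 x m := by
    intro x hx; rw [j1 x hx, j2 x hx]; ring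
  have tel := telescope F (f := fun x => |u2 x m - u1 x m| - D / 2 * g x ^ 3)
    (bd := fun x => (2 * ε) * x) ?_ ?_ (tendsto_lin _)
  · intro x hx ψ hψ
    have h1 := inc x hx ψ hψ _ rfl
    have hσ := F.sig_mem hx hψ
    rw [hjump _ hσ] at h1
    have := tel _ hσ
    linarith
  · intro x hx
    have h1 := inc x hx m F.m_mem _ rfl
    rw [hjump _ (F.sig_mem hx F.m_mem)] at h1
    change _ ≤ |u2 (sig L m (Sf m s qt Θ ua) x m) m - u1 (sig L m (Sf m s qt Θ ua) x m) m| - D / 2 * g (sig L m (Sf m s qt Θ ua) x m) ^ 3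
    linarith
  · intro x hx
    have a1 := abs_le.1 (U1.c2 x hx m F.m_mem)
    have a2 := abs_le.1 (U2.c2 x hx m F.m_mem)
    have hg := W.g_pos _ hx
    have h3 : |u2 x m - u1 x m| ≤ 2 * ε * g x ^ 3 := by rw [abs_le]; constructor <;> linarith
    have h4 : g x ^ 3 ≤ x := by
      have b1 := W.g_le x hx
      have b2 : g x ≤ 1 := b1.trans (hx.2.le.trans W.hL)
      calc g x ^ 3 = g x * (g x * g x) := by ring
        _ ≤ x * (1 * 1) := by gcongr; exact hx.1.le
        _ = x := by ring
    have h5 : 0 ≤ D / 2 * g x ^ 3 := by positivity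
    have : 2 * ε * g x ^ 3 ≤ 2 * ε * x := by gcongr
    linarith

end Nozzle

namespace Nozzle

lemma taylor1 {a b Λ : ℝ} {f h : ℝ → ℝ} (hd : ∀ t ∈ Icc a b, HasDerivWithinAt f (h t) (Icc a b) t)
    (hl : ∀ t ∈ Icc a b, ∀ t' ∈ Icc a b, |h t' - h t| ≤ Λ * |t' - t|)
    {t t' : ℝ} (ht : t ∈ Icc a b) (ht' : t' ∈ Icc a b) :
    |f t' - f t - h t * (t' - t)| ≤ Λ * |t' - t| * |t' - t| := by
  have hsub : uIcc t t' ⊆ Icc a b := by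
    rw [← uIcc_of_le (ht.1.trans ht.2)]
    exact uIcc_subset_uIcc (by rwa [uIcc_of_le (ht.1.trans ht.2)]) (by rwa [uIcc_of_le (ht.1.trans ht.2)])
  by_cases hΛ : 0 ≤ Λ
  · have := (convex_uIcc t t').norm_image_sub_le_of_norm_hasDerivWithin_le (f := fun r => f r - h t * r)
      (f' := fun r => h r - h t) (C := Λ * |t' - t|) (fun r hr => ?_) (fun r hr => ?_)
      left_mem_uIcc right_mem_uIcc
    · simp only [Real.norm_eq_abs] at this
      calc _ = |f t' - h t * t' - (f t - h t * t)| := by congr 1; ring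
        _ ≤ _ := this
    · have := ((hd r (hsub hr)).mono hsub).sub (((hasDerivAt_id r).const_mul (h t)).hasDerivWithinAt)
      exact this.congr_deriv (by ring)
    · have e1 := hl t ht r (hsub hr)
      have e2 : |r - t| ≤ |t' - t| := abs_sub_left_of_mem_uIcc hr
      rw [Real.norm_eq_abs]
      exact e1.trans (mul_le_mul_of_nonneg_left e2 hΛ)
  · have h1 := hl t ht t' ht'
    have h2 : |t' - t| = 0 := by
      by_contra hne
      have : 0 < |t' - t| := lt_of_le_of_ne (abs_nonneg _) (Ne.symm hne)
      have := abs_nonneg (h t' - h t)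
      nlinarith
    have : t' = t := by rwa [abs_eq_zero, sub_eq_zero] at h2
    subst this; simp

lemma lim_deriv {a b Λ : ℝ} (hab : a < b) {f h : ℕ → ℝ → ℝ}
    (hd : ∀ n, ∀ t ∈ Icc a b, HasDerivWithinAt (f n) (h n t) (Icc a b) t)
    (hl : ∀ n, ∀ t ∈ Icc a b, ∀ t' ∈ Icc a b, |h n t' - h n t| ≤ Λ * |t' - t|)
    {F : ℝ → ℝ} (hF : ∀ t ∈ Icc a b, Tendsto (fun n => f n t) atTop (nhds (F t))) :
    ∃ H : ℝ → ℝ, ∀ t ∈ Icc a b, Tendsto (fun n => h n t) atTop (nhds (H t)) ∧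
      HasDerivWithinAt F (H t) (Icc a b) t := by
  have hΛ : 0 ≤ Λ := by
    have := hl 0 a ⟨le_rfl, hab.le⟩ b ⟨hab.le, le_rfl⟩
    have h2 : 0 < |b - a| := abs_pos.2 (by linarith)
    have := abs_nonneg (h 0 b - h 0 a)
    nlinarith
  have conv : ∀ t ∈ Icc a b, ∃ l, Tendsto (fun n => h n t) atTop (nhds l) := by
    intro t ht
    refine cauchySeq_tendsto_of_complete (Metric.cauchySeq_iff'.2 fun e he => ?_)
    -- choose t'
    obtain ⟨t', ht', hne, hsm⟩ : ∃ t' ∈ Icc a b, t' ≠ t ∧ Λ * |t' - t| ≤ e / 8 := by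
      set d := min ((b - a) / 2) (e / (8 * (Λ + 1))) with hdd
      have hd0 : 0 < d := by
        refine lt_min (by linarith) (by positivity)
      have hd1 : d ≤ (b - a) / 2 := min_le_left _ _
      have hd2 : Λ * d ≤ e / 8 := by
        have : d ≤ e / (8 * (Λ + 1)) := min_le_right _ _
        calc Λ * d ≤ (Λ + 1) * (e / (8 * (Λ + 1))) := by gcongr; linarith
          _ = e / 8 := by field_simp
      by_cases hc : t ≤ (a + b) / 2
      · refine ⟨t + d, ⟨by linarith [ht.1], by linarith⟩, by linarith, ?_⟩
        rw [add_sub_cancel_left, abs_of_pos hd0]; exact hd2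
      · refine ⟨t - d, ⟨by linarith, by linarith [ht.2]⟩, by linarith, ?_⟩
        rw [sub_sub_cancel_left, abs_neg, abs_of_pos hd0]; exact hd2
    have hpos : 0 < |t' - t| := abs_pos.2 (sub_ne_zero.2 hne)
    have hc := ((hF t' ht').sub (hF t ht)).cauchySeq
    obtain ⟨N, hN⟩ := Metric.cauchySeq_iff'.1 hc (e / 4 * |t' - t|) (by positivity)
    refine ⟨N, fun n hn => ?_⟩
    have a1 := taylor1 (hd n) (hl n) ht ht'
    have a2 := taylor1 (hd N) (hl N) ht ht'
    have a3 := hN n hn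
    rw [Real.dist_eq] at a3 ⊢
    have a4 : |(h n t - h N t) * (t' - t)| ≤ 3 / 4 * e * |t' - t| := by
      have e1 : (h n t - h N t) * (t' - t) = (f n t' - f n t - (f N t' - f N t))
        - (f n t' - f n t - h n t * (t' - t)) + (f N t' - f N t - h N t * (t' - t)) := by ring
      rw [e1]
      have b1 := abs_add_le ((f n t' - f n t - (f N t' - f N t))
        - (f n t' - f n t - h n t * (t' - t))) (f N t' - f N t - h N t * (t' - t))
      have b2 := abs_sub (f n t' - f n t - (f N t' - f N t)) (f n t' - f n t - h n t * (t' - t))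
      have b3 : Λ * |t' - t| * |t' - t| ≤ e / 8 * |t' - t| := by gcongr
      nlinarith
    rw [abs_mul] at a4
    have a5 := le_of_mul_le_mul_right a4 hpos
    linarith
  choose! H hH using conv
  refine ⟨H, fun t ht => ⟨hH t ht, ?_⟩⟩
  have hb : ∀ t' ∈ Icc a b, |F t' - F t - H t * (t' - t)| ≤ Λ * |t' - t| * |t' - t| := by
    intro t' ht'
    have T := (((hF t' ht').sub (hF t ht)).sub ((hH t ht).mul_const (t' - t))).abs
    exact le_of_tendsto T (Eventually.of_forall fun n => taylor1 (hd n) (hl n) ht ht')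
  rw [hasDerivWithinAt_iff_isLittleO]
  refine Asymptotics.IsLittleO.of_bound fun c hc => ?_
  have : ∀ᶠ t' in nhdsWithin t (Icc a b), Λ * |t' - t| < c := by
    have hcont : Continuous fun t' : ℝ => Λ * |t' - t| := by fun_prop
    have := (hcont.tendsto t).mono_left (nhdsWithin_le_nhds (s := Icc a b))
    simp only [sub_self, abs_zero, mul_zero] at this
    exact this.eventually (gt_mem_nhds hc)
  filter_upwards [this, self_mem_nhdsWithin] with t' h1 h2
  have := hb t' h2
  simp only [Real.norm_eq_abs, smul_eq_mul]
  rw [mul_comm (t' - t)]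
  exact this.trans (mul_le_mul_of_nonneg_right h1.le (abs_nonneg _))

end Nozzle

namespace Nozzle

variable {L m c0 ε θ lam n1 cr d2 d3 K M' ηm s0 cs : ℝ} {g g1 Θ Θ1 Θ2 y z E E1 s r qt k : ℝ → ℝ}
local notation "WallData" => Wall L m c0 ε θ lam n1 cr d2 d3 K M' ηm g g1 Θ Θ1 Θ2 y z E E1

lemma geom_lim {a : ℕ → ℝ} {D : ℝ} (hD : ∀ n, |a (n + 1) - a n| ≤ D / 2 ^ n) :
    ∃ l, Tendsto a atTop (nhds l) ∧ ∀ n, |a n - l| ≤ 2 * D / 2 ^ n := by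
  have h : ∀ n, dist (a n) (a (n + 1)) ≤ (2 * D) / 2 / 2 ^ n := by
    intro n
    rw [dist_comm, Real.dist_eq]
    convert hD n using 2; ring
  obtain ⟨l, hl⟩ := cauchySeq_tendsto_of_complete (cauchySeq_of_le_geometric_two h)
  refine ⟨l, hl, fun n => ?_⟩
  have := dist_le_of_le_geometric_two_of_tendsto h hl n
  rwa [Real.dist_eq] at this

/-- The iteration. -/
lemma Wall.seq (W : WallData)
    (Gs : Gas ε s0 cs ηm s r qt k) (hc : c0 * cs = s0) :
    ∃ u w v : ℕ → ℝ → ℝ → ℝ, (∀ n, Cls L m c0 ε n1 K M' g g1 y z (u n) (w n) (v n)) ∧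
      (∀ n, v (n + 1) = fun x ψ => Sf m s qt Θ (u n) x ψ * w (n + 1) x ψ) ∧
      (∀ n, ∀ x ∈ Ioo 0 L, u (n + 1) x (-m) = u (n + 1) x m + 2 * Θ x) ∧
      (∀ n, ∀ x ∈ Ioo 0 L, ∀ ψ ∈ Icc (-m) m, |v (n + 1) x ψ - Θ x / m| ≤ 1 / 2 * K * (g x * y x)) ∧
      (∀ n, ∀ x ∈ Ioo 0 L, ∀ ψ ∈ Icc (-m) m,
        |u (n + 1) x ψ - u n x ψ| ≤ (2 * ε * g x ^ 3) / 2 ^ n) := by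
  let T := {p : (ℝ → ℝ → ℝ) × (ℝ → ℝ → ℝ) × (ℝ → ℝ → ℝ) //
    Cls L m c0 ε n1 K M' g g1 y z p.1 p.2.1 p.2.2}
  have hstep : ∀ p : T, ∃ p' : T, (p'.1.2.2 = fun x ψ => Sf m s qt Θ p.1.1 x ψ * p'.1.2.1 x ψ) ∧
      (∀ x ∈ Ioo 0 L, p'.1.1 x (-m) = p'.1.1 x m + 2 * Θ x) ∧
      (∀ x ∈ Ioo 0 L, ∀ ψ ∈ Icc (-m) m, |p'.1.2.2 x ψ - Θ x / m| ≤ 1 / 2 * K * (g x * y x)) := by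
    rintro ⟨⟨u, w, v⟩, U⟩
    obtain ⟨u', w', ⟨C', o⟩, U', hb⟩ := Cls.step U W Gs hc
    exact ⟨⟨⟨u', w', _⟩, U'⟩, rfl, o.ju, hb⟩
  choose F hF1 hF2 hF3 using hstep
  let p : ℕ → T := fun n => Nat.rec ⟨⟨_, _, _⟩, W.init⟩ (fun _ q => F q) n
  have hp : ∀ n, p (n + 1) = F (p n) := fun n => rfl
  refine ⟨fun n => (p n).1.1, fun n => (p n).1.2.1, fun n => (p n).1.2.2, fun n => (p n).2,
    fun n => hF1 (p n), fun n => hF2 (p n), fun n => hF3 (p n), ?_⟩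
  intro n
  induction n with
  | zero =>
    intro x hx ψ hψ
    have a1 := abs_le.1 ((p 0).2.c2 x hx ψ hψ)
    have a2 := abs_le.1 ((p 1).2.c2 x hx ψ hψ)
    rw [pow_zero, div_one, zero_add, abs_le]
    constructor <;> linarith
  | succ n ih =>
    have U1 := (p (n + 1)).2
    have U2 := (p (n + 1 + 1)).2
    have e1 : (p (n + 1)).1.2.2 = _ := hF1 (p n)
    have e2 : (p (n + 1 + 1)).1.2.2 = _ := hF1 (p (n + 1))
    rw [e1] at U1
    rw [e2] at U2
    have := contr (p n).2 (p (n + 1)).2 W Gs hc U1 U2 (hF2 (p n)) (hF2 (p (n + 1)))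
      (D := 2 * ε / 2 ^ n) (by have := W.hε; positivity) ?_
    · intro x hx ψ hψ
      have h := this x hx ψ hψ
      calc _ ≤ _ := h
        _ = _ := by rw [pow_succ]; ring
    · intro x hx ψ hψ
      calc _ ≤ _ := ih x hx ψ hψ
        _ = _ := by ring

lemma wlip {v1 v2 S1 S2 c A B V d : ℝ} (hc : 0 < c) (h1 : c ≤ S1) (h2 : c ≤ S2)
    (hV : |v1| ≤ V) (hv : |v2 - v1| ≤ A * d) (hS : |S2 - S1| ≤ B * d) :
    |v2 / S2 - v1 / S1| ≤ (A / c + V * B / (c * c)) * d := by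
  have p1 : 0 < S1 := hc.trans_le h1
  have p2 : 0 < S2 := hc.trans_le h2
  have hid : v2 / S2 - v1 / S1 = (v2 - v1) / S2 - v1 * (S2 - S1) / (S1 * S2) := by
    field_simp; ring
  rw [hid]
  have hA : 0 ≤ A * d := (abs_nonneg _).trans hv
  have hB : 0 ≤ B * d := (abs_nonneg _).trans hS
  have hV0 : 0 ≤ V := (abs_nonneg _).trans hV
  have t1 : |(v2 - v1) / S2| ≤ A * d / c := by
    rw [abs_div, abs_of_pos p2]
    gcongr
  have t2 : |v1 * (S2 - S1) / (S1 * S2)| ≤ V * (B * d) / (c * c) := by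
    rw [abs_div, abs_of_pos (mul_pos p1 p2), abs_mul]
    gcongr
  calc _ ≤ _ := (abs_sub _ _).trans (add_le_add t1 t2)
    _ = _ := by ring

theorem Wall.exists_fix (W : WallData)
    (Gs : Gas ε s0 cs ηm s r qt k) (hc : c0 * cs = s0) :
    ∃ u w v : ℝ → ℝ → ℝ, Cls L m c0 ε n1 K M' g g1 y z u w v ∧
      (∀ x ∈ Ioo 0 L, ∀ ψ ∈ Icc (-m) m, v x ψ = Sf m s qt Θ u x ψ * w x ψ) ∧
      (∀ x ∈ Ioo 0 L, u x (-m) = u x m + 2 * Θ x) ∧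
      (∀ x ∈ Ioo 0 L, ∀ ψ ∈ Icc (-m) m, |v x ψ - Θ x / m| ≤ 1 / 2 * K * (g x * y x)) := by
  obtain ⟨un, wn, vn, Un, hvn, hjn, hbn, hun⟩ := W.seq Gs hc
  have hm := W.hm
  have hε := W.hε
  have hε' := W.hε'
  have hc0 := W.hc0
  have hmm : m ∈ Icc (-m) m := ⟨by linarith, le_rfl⟩
  have hnm : -m ∈ Icc (-m) m := ⟨le_rfl, by linarith⟩
  have hlim : ∀ x ψ, ∃ l, x ∈ Ioo 0 L → ψ ∈ Icc (-m) m →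
      Tendsto (fun n => un n x ψ) atTop (nhds l) ∧ ∀ n, |un n x ψ - l| ≤ 2 * (2 * ε * g x ^ 3) / 2 ^ n := by
    intro x ψ
    by_cases hx : x ∈ Ioo 0 L
    · by_cases hψ : ψ ∈ Icc (-m) m
      · obtain ⟨l, hl⟩ := geom_lim (a := fun n => un n x ψ) (fun n => hun n x hx ψ hψ)
        exact ⟨l, fun _ _ => hl⟩
      · exact ⟨0, fun _ h => absurd h hψ⟩
    · exact ⟨0, fun h => absurd h hx⟩
  choose u hu using hlim
  have hu1 : ∀ x ∈ Ioo 0 L, ∀ ψ ∈ Icc (-m) m, Tendsto (fun n => un n x ψ) atTop (nhds (u x ψ)) :=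
    fun x hx ψ hψ => (hu x ψ hx hψ).1
  have hv : ∀ x ∈ Ioo 0 L, ∃ H : ℝ → ℝ, ∀ t ∈ Icc (-m) m, Tendsto (fun n => vn n x t) atTop (nhds (H t)) ∧
      HasDerivWithinAt (u x) (-H t) (Icc (-m) m) t := by
    intro x hx
    obtain ⟨H, hH⟩ := lim_deriv (show -m < m by linarith) (f := fun n => un n x)
      (h := fun n t => -vn n x t) (fun n t ht => (Un n).dpsi x hx t ht)
      (Λ := c0 * M' * (n1 + 2 * (1 + ε)) * (g x ^ 2 * z x))
      (fun n t ht t' ht' => by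
        rw [neg_sub_neg, abs_sub_comm]; exact (Un n).c6 x hx t ht t' ht')
      (F := u x) (fun t ht => hu1 x hx t ht)
    refine ⟨fun t => -H t, fun t ht => ⟨?_, ?_⟩⟩
    · simpa using (hH t ht).1.neg
    · simpa using (hH t ht).2
  choose! v hv using hv
  have hv1 : ∀ x ∈ Ioo 0 L, ∀ ψ ∈ Icc (-m) m, Tendsto (fun n => vn n x ψ) atTop (nhds (v x ψ)) :=
    fun x hx ψ hψ => (hv x hx ψ hψ).1
  have c2 : ∀ x ∈ Ioo 0 L, ∀ ψ ∈ Icc (-m) m, |u x ψ - g x ^ 3| ≤ ε * g x ^ 3 := fun x hx ψ hψ =>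
    le_of_tendsto ((hu1 x hx ψ hψ).sub_const _).abs (Eventually.of_forall fun n => (Un n).c2 x hx ψ hψ)
  have emem : ∀ x ∈ Ioo 0 L, ∀ ψ ∈ Icc (-m) m, eta u x ψ ∈ Ioo 0 ηm := by
    intro x hx ψ hψ
    have h1 := abs_le.1 (c2 x hx ψ hψ)
    have h2 := abs_le.1 (c2 x hx (-ψ) (neg_mem hψ))
    have h3 := W.g_eta x hx
    have := W.g_pos x hx
    have : 0 < g x ^ 3 := by positivity
    unfold eta
    constructor <;> nlinarith
  have elim : ∀ x ∈ Ioo 0 L, ∀ ψ ∈ Icc (-m) m,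
      Tendsto (fun n => eta (un n) x ψ) atTop (nhds (eta u x ψ)) := fun x hx ψ hψ =>
    ((hu1 x hx ψ hψ).add (hu1 x hx (-ψ) (neg_mem hψ))).div_const 2
  have Slim : ∀ x ∈ Ioo 0 L, ∀ ψ ∈ Icc (-m) m,
      Tendsto (fun n => Sf m s qt Θ (un n) x ψ) atTop (nhds (Sf m s qt Θ u x ψ)) := by
    intro x hx ψ hψ
    have a1 := (Gs.ds _ (emem x hx ψ hψ)).continuousAt.tendsto.comp (elim x hx ψ hψ)
    have a2 := (Gs.dqt _ (emem x hx m hmm)).continuousAt.tendsto.comp (elim x hx m hmm)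
    exact a1.mul (tendsto_const_nhds.div a2 (Gs.qt_pos _ (emem x hx m hmm)).ne')
  have Snear : ∀ x ∈ Ioo 0 L, ∀ ψ ∈ Icc (-m) m, |Sf m s qt Θ u x ψ - c0 * g x| ≤ ε / 2 * (c0 * g x) :=
    fun x hx ψ hψ => le_of_tendsto ((Slim x hx ψ hψ).sub_const _).abs
      (Eventually.of_forall fun n => (Un n).S_near W Gs hc hx hψ)
  have Spos : ∀ x ∈ Ioo 0 L, ∀ ψ ∈ Icc (-m) m, 0 < Sf m s qt Θ u x ψ := by
    intro x hx ψ hψ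
    have h1 := abs_le.1 (Snear x hx ψ hψ)
    have := mul_pos hc0 (W.g_pos x hx)
    nlinarith
  have Snpos : ∀ n, ∀ x ∈ Ioo 0 L, ∀ ψ ∈ Icc (-m) m, c0 * g x / 2 ≤ Sf m s qt Θ (un n) x ψ := by
    intro n x hx ψ hψ
    have h1 := abs_le.1 ((Un n).S_near W Gs hc hx hψ)
    have := mul_pos hc0 (W.g_pos x hx)
    nlinarith
  have hwn : ∀ n, ∀ x ∈ Ioo 0 L, ∀ ψ ∈ Icc (-m) m, wn (n + 1) x ψ = vn (n + 1) x ψ / Sf m s qt Θ (un n) x ψ := by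
    intro n x hx ψ hψ
    have h1 := Snpos n x hx ψ hψ
    have h2 := mul_pos hc0 (W.g_pos x hx)
    rw [hvn n]
    have : Sf m s qt Θ (un n) x ψ ≠ 0 := by linarith
    field_simp
  have wlim : ∀ x ∈ Ioo 0 L, ∀ ψ ∈ Icc (-m) m,
      Tendsto (fun n => wn (n + 1) x ψ) atTop (nhds (v x ψ / Sf m s qt Θ u x ψ)) := by
    intro x hx ψ hψ
    refine Tendsto.congr (fun n => (hwn n x hx ψ hψ).symm) ?_
    exact ((tendsto_add_atTop_iff_nat 1).2 (hv1 x hx ψ hψ)).div (Slim x hx ψ hψ) (Spos x hx ψ hψ).ne'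
  have gz : ∀ x ∈ Ioo 0 L, g x * z x ≤ 1 := fun x hx =>
    mul_le_one₀ (W.g_le1 hx) (W.z_pos x hx).le (W.z_le x hx)
  have hM' := W.hM'
  have hn1 := W.hn1
  -- x-Lipschitz bounds
  have vlip : ∀ n, ∀ x ∈ Ioo 0 L, ∀ x' ∈ Ioo 0 L, ∀ ψ ∈ Icc (-m) m,
      |vn n x' ψ - vn n x ψ| ≤ (1 + ε) * M' * |x' - x| := by
    intro n
    have key : ∀ x ∈ Ioo 0 L, ∀ x' ∈ Ioo 0 L, x ≤ x' → ∀ ψ ∈ Icc (-m) m,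
      |vn n x' ψ - vn n x ψ| ≤ (1 + ε) * M' * |x' - x| := by
      intro x hx x' hx' hxx ψ hψ
      refine ((Un n).c5 x hx x' hx' hxx ψ hψ).trans ?_
      rw [abs_of_nonneg (by linarith : 0 ≤ x' - x)]
      have h1 := gz x' hx'
      have h2 : 0 ≤ x' - x := by linarith
      calc _ ≤ (1 + ε) * M' * 1 * (x' - x) := by gcongr
        _ = _ := by ring
    intro x hx x' hx' ψ hψ
    rcases le_total x x' with h | h
    · exact key x hx x' hx' h ψ hψ
    · rw [abs_sub_comm, abs_sub_comm x']; exact key x' hx' x hx h ψ hψ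
  have Slip : ∀ n, ∀ x ∈ Ioo 0 L, ∀ x' ∈ Ioo 0 L, ∀ ψ ∈ Icc (-m) m,
      |Sf m s qt Θ (un n) x' ψ - Sf m s qt Θ (un n) x ψ| ≤ 3 * c0 * cr * |x' - x| := by
    intro n x hx x' hx' ψ hψ
    have F := (Un n).flow W Gs hc
    have hsub : uIcc x x' ⊆ Ioo 0 L := (ordConnected_Ioo).uIcc_subset hx hx'
    refine mv (F := fun x => Sf m s qt Θ (un n) x ψ) (fun t ht => F.der t (hsub ht) ψ hψ) fun t ht => ?_
    rw [abs_of_nonneg (F.Sx_nonneg t (hsub ht) ψ hψ)]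
    exact F.Sx_le t (hsub ht) ψ hψ
  have du : ∀ x ∈ Ioo 0 L, ∀ ψ ∈ Icc (-m) m,
      HasDerivAt (fun x => u x ψ) (v x ψ / Sf m s qt Θ u x ψ) x := by
    intro x hx ψ hψ
    obtain ⟨a, ha0, hax⟩ := exists_between hx.1
    obtain ⟨b, hxb, hbL⟩ := exists_between hx.2
    have hsub : Icc a b ⊆ Ioo 0 L := fun t ht => ⟨ha0.trans_le ht.1, ht.2.trans_lt hbL⟩
    have haL : a ∈ Ioo 0 L := hsub ⟨le_rfl, (hax.trans hxb).le⟩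
    have hga := W.g_pos a haL
    obtain ⟨H, hH⟩ := lim_deriv (hax.trans hxb) (f := fun n x => un (n + 1) x ψ)
      (h := fun n x => wn (n + 1) x ψ)
      (fun n t ht => ((Un (n + 1)).du t (hsub ht) ψ hψ).hasDerivWithinAt)
      (Λ := (1 + ε) * M' / (c0 * g a / 2) + (1 / m + cr * c0) * (3 * c0 * cr) / ((c0 * g a / 2) * (c0 * g a / 2)))
      (fun n t ht t' ht' => by
        rw [hwn n t (hsub ht) ψ hψ, hwn n t' (hsub ht') ψ hψ]
        have low : ∀ t ∈ Icc a b, c0 * g a / 2 ≤ Sf m s qt Θ (un n) t ψ := fun t ht => by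
          have h1 := Snpos n t (hsub ht) ψ hψ
          have h2 := W.g_mono haL (hsub ht) ht.1
          have h3 : c0 * g a ≤ c0 * g t := by gcongr
          linarith
        exact wlip (by positivity) (low t ht) (low t' ht') ((Un (n + 1)).v_bdd W (hsub ht) hψ)
          (vlip (n + 1) t (hsub ht) t' (hsub ht') ψ hψ) (Slip n t (hsub ht) t' (hsub ht') ψ hψ))
      (F := fun x => u x ψ) (fun t ht => (tendsto_add_atTop_iff_nat 1).2 (hu1 t (hsub ht) ψ hψ))
    have h1 := hH x ⟨hax.le, hxb.le⟩
    rw [← tendsto_nhds_unique h1.1 (wlim x hx ψ hψ)]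
    exact h1.2.hasDerivAt (Icc_mem_nhds hax hxb)
  have c3 : ∀ x ∈ Ioo 0 L, ∀ ψ ∈ Icc (-m) m,
      |v x ψ / Sf m s qt Θ u x ψ - 3 * g x ^ 2 * g1 x| ≤ ε * (3 * g x ^ 2 * g1 x) := fun x hx ψ hψ =>
    le_of_tendsto ((wlim x hx ψ hψ).sub_const _).abs (Eventually.of_forall fun n => (Un (n + 1)).c3 x hx ψ hψ)
  have c4 : ∀ x ∈ Ioo 0 L, ∀ ψ ∈ Icc (-m) m, ∀ ψ' ∈ Icc (-m) m, |v x ψ' - v x ψ| ≤ K * (g x * y x) :=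
    fun x hx ψ hψ ψ' hψ' => le_of_tendsto ((hv1 x hx ψ' hψ').sub (hv1 x hx ψ hψ)).abs
      (Eventually.of_forall fun n => (Un n).c4 x hx ψ hψ ψ' hψ')
  have c5 : ∀ x ∈ Ioo 0 L, ∀ x' ∈ Ioo 0 L, x ≤ x' → ∀ ψ ∈ Icc (-m) m,
      |v x' ψ - v x ψ| ≤ (1 + ε) * M' * (g x' * z x') * (x' - x) :=
    fun x hx x' hx' hxx ψ hψ => le_of_tendsto ((hv1 x' hx' ψ hψ).sub (hv1 x hx ψ hψ)).abs
      (Eventually.of_forall fun n => (Un n).c5 x hx x' hx' hxx ψ hψ)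
  have c6 : ∀ x ∈ Ioo 0 L, ∀ ψ ∈ Icc (-m) m, ∀ ψ' ∈ Icc (-m) m,
      |v x ψ' - v x ψ| ≤ c0 * M' * (n1 + 2 * (1 + ε)) * (g x ^ 2 * z x) * |ψ' - ψ| :=
    fun x hx ψ hψ ψ' hψ' => le_of_tendsto ((hv1 x hx ψ' hψ').sub (hv1 x hx ψ hψ)).abs
      (Eventually.of_forall fun n => (Un n).c6 x hx ψ hψ ψ' hψ')
  have cu : ContinuousOn (fun p : ℝ × ℝ => u p.1 p.2) (Ioo 0 L ×ˢ Icc (-m) m) := by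
    have hunif : TendstoUniformlyOn (fun n (p : ℝ × ℝ) => un n p.1 p.2) (fun p => u p.1 p.2) atTop
        (Ioo 0 L ×ˢ Icc (-m) m) := by
      rw [Metric.tendstoUniformlyOn_iff]
      intro e he
      have h0 : Tendsto (fun n : ℕ => (4 * ε) * (1 / 2 : ℝ) ^ n) atTop (nhds ((4 * ε) * 0)) :=
        (tendsto_pow_atTop_nhds_zero_of_lt_one (by norm_num) (by norm_num)).const_mul _
      rw [mul_zero] at h0
      filter_upwards [h0.eventually (gt_mem_nhds he)] with n hn p hp
      rw [dist_comm, Real.dist_eq]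
      refine lt_of_le_of_lt ((hu p.1 p.2 hp.1 hp.2).2 n) (lt_of_le_of_lt ?_ hn)
      have hg := W.g_pos _ hp.1
      have : g p.1 ^ 3 ≤ 1 := pow_le_one₀ hg.le (W.g_le1 hp.1)
      rw [one_div, inv_pow, ← div_eq_mul_inv]
      refine div_le_div_of_nonneg_right ?_ (by positivity)
      nlinarith
    exact hunif.continuousOn (Eventually.of_forall fun n => (Un n).cu W).frequently
  have cv : ContinuousOn (fun p : ℝ × ℝ => v p.1 p.2) (Ioo 0 L ×ˢ Icc (-m) m) := by
    refine lip2_cont (A := (1 + ε) * M') (A' := c0 * M' * (n1 + 2 * (1 + ε))) ?_ ?_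
    · intro x hx x' hx' ψ hψ
      exact le_of_tendsto ((hv1 x' hx' ψ hψ).sub (hv1 x hx ψ hψ)).abs
        (Eventually.of_forall fun n => vlip n x hx x' hx' ψ hψ)
    · intro x hx ψ hψ ψ' hψ'
      refine (c6 x hx ψ hψ ψ' hψ').trans ?_
      have h1 := W.g_le1 hx
      have h2 := W.g_pos x hx
      have h3 : g x ^ 2 * z x ≤ 1 := mul_le_one₀ (pow_le_one₀ h2.le h1) (W.z_pos x hx).le (W.z_le x hx)
      calc _ ≤ c0 * M' * (n1 + 2 * (1 + ε)) * 1 * |ψ' - ψ| := by gcongr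
        _ = _ := by ring
  have cS : ContinuousOn (fun p : ℝ × ℝ => Sf m s qt Θ u p.1 p.2) (Ioo 0 L ×ˢ Icc (-m) m) := by
    have c1 := (show ContinuousOn s (Ioo 0 ηm) from fun x hx =>
      (Gs.ds x hx).continuousAt.continuousWithinAt).comp (cont_eta cu)
      (fun p hp => emem _ hp.1 _ hp.2)
    have c2 := (show ContinuousOn qt (Ioo 0 ηm) from fun x hx =>
      (Gs.dqt x hx).continuousAt.continuousWithinAt).comp (cont_eta_m hm cu)
      (fun p hp => emem _ hp.1 _ hmm)
    exact c1.mul ((Real.continuous_cos.comp_continuousOn (cont_fst W.dTh)).div c2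
      fun p hp => (Gs.qt_pos _ (emem _ hp.1 _ hmm)).ne')
  refine ⟨u, fun x ψ => v x ψ / Sf m s qt Θ u x ψ, v, ⟨du, fun x hx ψ hψ => (hv x hx ψ hψ).2, ?_, c2, c3, c4, c5, c6⟩,
    ?_, ?_, ?_⟩
  · exact cv.div cS fun p hp => (Spos _ hp.1 _ hp.2).ne'
  · intro x hx ψ hψ
    have := (Spos x hx ψ hψ).ne'
    field_simp
  · intro x hx
    refine tendsto_nhds_unique ((tendsto_add_atTop_iff_nat 1).2 (hu1 x hx (-m) hnm)) ?_
    refine Tendsto.congr (fun n => (hjn n x hx).symm) ?_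
    exact ((tendsto_add_atTop_iff_nat 1).2 (hu1 x hx m hmm)).add_const _
  · intro x hx ψ hψ
    exact le_of_tendsto (((tendsto_add_atTop_iff_nat 1).2 (hv1 x hx ψ hψ)).sub_const _).abs
      (Eventually.of_forall fun n => hbn n x hx ψ hψ)

end Nozzle

namespace Nozzle

/-- `1 + (γ-1)/2 (1+μ²)` -/
def Nm (γ μ : ℝ) : ℝ := 1 + (γ - 1) / 2 * (1 + μ ^ 2)
/-- speed -/
def qm (γ μ : ℝ) : ℝ := Real.sqrt ((1 + μ ^ 2) / Nm γ μ)
/-- density -/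
def Rm (γ μ : ℝ) : ℝ := Nm γ μ ^ (-((1 : ℝ) / (γ - 1)))
/-- kernel -/
def km (γ μ : ℝ) : ℝ := 1 / ((1 + μ ^ 2) * Nm γ μ)
/-- Prandtl–Meyer function -/
def om (γ μ : ℝ) : ℝ := ∫ t in (0 : ℝ)..μ, t ^ 2 * km γ t

variable {γ : ℝ}

lemma Nm_pos (hγ : 1 < γ) (μ : ℝ) : 0 < Nm γ μ := by
  unfold Nm
  have : 0 < (γ - 1) / 2 := by linarith
  positivity

lemma km_pos (hγ : 1 < γ) (μ : ℝ) : 0 < km γ μ := by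
  have := Nm_pos hγ μ
  unfold km; positivity

lemma Rm_pos (hγ : 1 < γ) (μ : ℝ) : 0 < Rm γ μ := rpow_pos_of_pos (Nm_pos hγ μ) _

lemma qm_sq (hγ : 1 < γ) (μ : ℝ) : qm γ μ ^ 2 = (1 + μ ^ 2) / Nm γ μ := by
  have := Nm_pos hγ μ
  exact Real.sq_sqrt (by positivity)

lemma qm_pos (hγ : 1 < γ) (μ : ℝ) : 0 < qm γ μ := by
  have := Nm_pos hγ μ
  exact Real.sqrt_pos.2 (by positivity)

lemma dNm (μ : ℝ) : HasDerivAt (Nm γ) ((γ - 1) * μ) μ := by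
  have := (((hasDerivAt_pow 2 μ).const_add 1).const_mul ((γ - 1) / 2)).const_add 1
  exact this.congr_deriv (by push_cast; ring)

lemma cNm : Continuous (Nm γ) := by unfold Nm; fun_prop

lemma ckm (hγ : 1 < γ) : Continuous (km γ) := by
  unfold km
  refine continuous_const.div ((by fun_prop : Continuous fun μ : ℝ => 1 + μ ^ 2).mul cNm) fun μ => ?_
  have := Nm_pos hγ μ
  positivity

lemma dRm (hγ : 1 < γ) (μ : ℝ) : HasDerivAt (Rm γ) (-(Rm γ μ * (μ / Nm γ μ))) μ := by
  have hN := Nm_pos hγ μ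
  have := (dNm (γ := γ) μ).rpow_const (p := -((1 : ℝ) / (γ - 1))) (Or.inl hN.ne')
  refine this.congr_deriv ?_
  rw [rpow_sub_one hN.ne']
  unfold Rm
  have : γ - 1 ≠ 0 := by linarith
  field_simp

lemma dqm (hγ : 1 < γ) (μ : ℝ) : HasDerivAt (qm γ) (qm γ μ * (μ * km γ μ)) μ := by
  have hN := Nm_pos hγ μ
  have h1 := (((hasDerivAt_pow 2 μ).const_add 1).div (dNm (γ := γ) μ) hN.ne').sqrt (ne_of_gt (div_pos (by positivity) hN))
  refine h1.congr_deriv ?_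
  have hq := qm_pos hγ μ
  have hq2 := qm_sq hγ μ
  change _ / (2 * qm γ μ) = _
  rw [div_eq_iff (by positivity)]
  have : qm γ μ * (μ * km γ μ) * (2 * qm γ μ) = 2 * (μ * km γ μ) * qm γ μ ^ 2 := by ring
  rw [this, hq2]
  unfold km
  have hN' : Nm γ μ = 1 + (γ - 1) / 2 * (1 + μ ^ 2) := rfl
  field_simp
  rw [hN']; push_cast; ring

lemma cqm (hγ : 1 < γ) : Continuous (qm γ) := continuous_iff_continuousAt.2 fun μ => (dqm hγ μ).continuousAt
lemma cRm (hγ : 1 < γ) : Continuous (Rm γ) := continuous_iff_continuousAt.2 fun μ => (dRm hγ μ).continuousAt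

lemma dom (hγ : 1 < γ) (μ : ℝ) : HasStrictDerivAt (om γ) (μ ^ 2 * km γ μ) μ := by
  have hc : Continuous fun t : ℝ => t ^ 2 * km γ t := (by fun_prop : Continuous fun t : ℝ => t ^ 2).mul (ckm hγ)
  exact intervalIntegral.integral_hasStrictDerivAt_right (hc.intervalIntegrable _ _)
    (hc.stronglyMeasurableAtFilter _ _) hc.continuousAt

lemma com (hγ : 1 < γ) : Continuous (om γ) :=
  continuous_iff_continuousAt.2 fun μ => (dom hγ μ).hasDerivAt.continuousAt

lemma om0 : om γ 0 = 0 := by simp [om]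

lemma om_mono (hγ : 1 < γ) : StrictMonoOn (om γ) (Ici 0) := by
  refine strictMonoOn_of_deriv_pos (convex_Ici 0) (com hγ).continuousOn fun x hx => ?_
  rw [interior_Ici] at hx
  rw [(dom hγ x).hasDerivAt.deriv]
  have := km_pos hγ x
  have : 0 < x := hx
  positivity

lemma qm_mono (hγ : 1 < γ) : StrictMonoOn (qm γ) (Ici 0) := by
  refine strictMonoOn_of_deriv_pos (convex_Ici 0) (cqm hγ).continuousOn fun x hx => ?_
  rw [interior_Ici] at hx
  rw [(dqm hγ x).deriv]
  have := km_pos hγ x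
  have := qm_pos hγ x
  have : 0 < x := hx
  positivity

lemma km_le (hγ : 1 < γ) (μ : ℝ) : km γ μ ≤ 2 / (γ + 1) := by
  unfold km
  rw [div_le_div_iff₀ (mul_pos (by positivity) (Nm_pos hγ μ)) (by linarith)]
  unfold Nm
  nlinarith [sq_nonneg μ, mul_nonneg (sq_nonneg μ) (by linarith : 0 ≤ γ - 1),
    mul_nonneg (sq_nonneg (μ ^ 2)) (by linarith : 0 ≤ γ - 1)]

lemma km_ge (hγ : 1 < γ) (μ : ℝ) : 2 / (γ + 1) / (1 + μ ^ 2) ^ 2 ≤ km γ μ := by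
  unfold km
  rw [div_div, div_le_div_iff₀ (by have : 0 < γ + 1 := by linarith
                                   positivity) (mul_pos (by positivity) (Nm_pos hγ μ))]
  have h : 2 * Nm γ μ ≤ (γ + 1) * (1 + μ ^ 2) := by
    unfold Nm; nlinarith [sq_nonneg μ]
  have h2 : 0 < 1 + μ ^ 2 := by positivity
  nlinarith

lemma om_le (hγ : 1 < γ) {μ : ℝ} (h : 0 ≤ μ) : om γ μ ≤ 2 / (γ + 1) * (μ ^ 3 / 3) := by
  have := incr_le (f := om γ) (h := fun μ => 2 / (γ + 1) * (μ ^ 3 / 3)) (h' := fun μ => 2 / (γ + 1) * μ ^ 2) h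
    (fun t _ => (dom hγ t).hasDerivAt.hasDerivWithinAt)
    (fun t _ => by
      have := (((hasDerivAt_pow 3 t).div_const 3).const_mul (2 / (γ + 1))).hasDerivWithinAt (s := Icc 0 μ)
      exact this.congr_deriv (by push_cast; ring))
    (fun t _ => by nlinarith [km_le hγ t, sq_nonneg t])
  rw [om0] at this
  norm_num at this
  linarith

lemma om_ge (hγ : 1 < γ) {μ : ℝ} (h : 0 ≤ μ) : 2 / (γ + 1) / (1 + μ ^ 2) ^ 2 * (μ ^ 3 / 3) ≤ om γ μ := by
  set c := 2 / (γ + 1) / (1 + μ ^ 2) ^ 2 with hc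
  have := incr_le (h := om γ) (f := fun μ => c * (μ ^ 3 / 3)) (f' := fun μ => c * μ ^ 2) h
    (fun t _ => by
      have := (((hasDerivAt_pow 3 t).div_const 3).const_mul c).hasDerivWithinAt (s := Icc 0 μ)
      exact this.congr_deriv (by push_cast; ring))
    (fun t _ => (dom hγ t).hasDerivAt.hasDerivWithinAt)
    (fun t ht => by
      have h1 := km_ge hγ t
      have h2 : c ≤ 2 / (γ + 1) / (1 + t ^ 2) ^ 2 := by
        have : 0 < 2 / (γ + 1) := div_pos (by norm_num) (by linarith)
        have := ht.1
        have := ht.2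
        rw [hc]; gcongr
      nlinarith [sq_nonneg t])
  rw [om0] at this
  norm_num at this
  linarith


lemma cstar_eq : cstar γ = qm γ 0 := by
  unfold cstar qm Nm
  congr 1
  rw [show (1 : ℝ) + (γ - 1) / 2 * (1 + 0 ^ 2) = (γ + 1) / 2 by ring]
  norm_num

lemma cstar_sq (hγ : 1 < γ) : cstar γ ^ 2 = 2 / (γ + 1) :=
  Real.sq_sqrt (div_pos (by norm_num) (by linarith)).le

lemma cstar_pos (hγ : 1 < γ) : 0 < cstar γ := Real.sqrt_pos.2 (div_pos (by norm_num) (by linarith))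

lemma qmax_sq (hγ : 1 < γ) : qmaxF γ ^ 2 = 2 / (γ - 1) :=
  Real.sq_sqrt (div_pos (by norm_num) (by linarith)).le

lemma qmax_pos (hγ : 1 < γ) : 0 < qmaxF γ := Real.sqrt_pos.2 (div_pos (by norm_num) (by linarith))

lemma qm_lt (hγ : 1 < γ) (μ : ℝ) : qm γ μ < qmaxF γ := by
  refine lt_of_pow_lt_pow_left₀ 2 (qmax_pos hγ).le ?_
  rw [qm_sq hγ, qmax_sq hγ, div_lt_div_iff₀ (Nm_pos hγ μ) (by linarith)]
  unfold Nm
  nlinarith [sq_nonneg μ]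

lemma qm_mem (hγ : 1 < γ) {μ : ℝ} (h : 0 ≤ μ) : qm γ μ ∈ Ico (cstar γ) (qmaxF γ) :=
  ⟨by rw [cstar_eq]; exact (qm_mono hγ).monotoneOn (mem_Ici.2 le_rfl) h h, qm_lt hγ μ⟩

lemma sound_pos (hγ : 1 < γ) {q : ℝ} (h : q ∈ Ioo 0 (qmaxF γ)) : 0 < 1 - (γ - 1) / 2 * q ^ 2 := by
  have h1 : q ^ 2 < 2 / (γ - 1) := by
    rw [← qmax_sq hγ]
    exact pow_lt_pow_left₀ h.2 h.1.le (by norm_num)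
  rw [lt_div_iff₀ (by linarith)] at h1
  linarith

lemma drho (hγ : 1 < γ) {t : ℝ} (h : 0 < 1 - (γ - 1) / 2 * t) :
    HasDerivAt (rhoF γ) (-(1 / 2) * rhoF γ t / (1 - (γ - 1) / 2 * t)) t := by
  have h0 := ((hasDerivAt_id t).const_mul ((γ - 1) / 2)).const_sub 1
  have h1 : HasDerivAt (fun t : ℝ => 1 - (γ - 1) / 2 * t) (-((γ - 1) / 2)) t := by
    simpa using h0
  have := h1.rpow_const (p := (1 : ℝ) / (γ - 1)) (Or.inl h.ne')
  refine this.congr_deriv ?_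
  rw [rpow_sub_one h.ne']
  unfold rhoF
  have : γ - 1 ≠ 0 := by linarith
  field_simp

/-- simplified integrand of `A` -/
def aF (γ q : ℝ) : ℝ := rhoF γ (q ^ 2) * (1 - q ^ 2 / (1 - (γ - 1) / 2 * q ^ 2)) / (q * (rhoF γ (q ^ 2)) ^ 2)

lemma aF_eq (hγ : 1 < γ) {q : ℝ} (h : q ∈ Ioo 0 (qmaxF γ)) :
    (rhoF γ (q ^ 2) + 2 * q ^ 2 * deriv (rhoF γ) (q ^ 2)) / (q * (rhoF γ (q ^ 2)) ^ 2) = aF γ q := by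
  rw [(drho hγ (sound_pos hγ h)).deriv]
  unfold aF
  congr 1
  ring

lemma rho_pos (hγ : 1 < γ) {q : ℝ} (h : q ∈ Ioo 0 (qmaxF γ)) : 0 < rhoF γ (q ^ 2) :=
  rpow_pos_of_pos (sound_pos hγ h) _

lemma crho (hγ : 1 < γ) : ContinuousOn (fun q => rhoF γ (q ^ 2)) (Ioo 0 (qmaxF γ)) := by
  refine ContinuousOn.rpow_const (by fun_prop) fun q hq => Or.inl (sound_pos hγ hq).ne'

lemma caF (hγ : 1 < γ) : ContinuousOn (aF γ) (Ioo 0 (qmaxF γ)) := by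
  have h1 := crho hγ
  unfold aF
  refine ContinuousOn.div (h1.mul (continuousOn_const.sub (ContinuousOn.div (by fun_prop) (by fun_prop)
    fun q hq => (sound_pos hγ hq).ne'))) ((continuousOn_id).mul (h1.pow 2)) fun q hq => ?_
  have := rho_pos hγ hq
  have := hq.1
  exact mul_ne_zero this.ne' (by positivity)

lemma caF' (hγ : 1 < γ) : ContinuousOn (fun q => (rhoF γ (q ^ 2) + 2 * q ^ 2 * deriv (rhoF γ) (q ^ 2)) /
    (q * (rhoF γ (q ^ 2)) ^ 2)) (Ioo 0 (qmaxF γ)) :=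
  (caF hγ).congr fun _ hq => aF_eq hγ hq

lemma strict_int {F : ℝ → ℝ} {a b c q : ℝ} (hF : ContinuousOn F (Ioo a b)) (hc : c ∈ Ioo a b)
    (hq : q ∈ Ioo a b) : HasStrictDerivAt (fun x => ∫ t in c..x, F t) (F q) q := by
  refine intervalIntegral.integral_hasStrictDerivAt_right ?_
    (hF.stronglyMeasurableAtFilter isOpen_Ioo q hq) (hF.continuousAt (isOpen_Ioo.mem_nhds hq))
  exact (hF.mono (ordConnected_Ioo.uIcc_subset hc hq)).intervalIntegrable

lemma cstar_lt (hγ : 1 < γ) : cstar γ < qmaxF γ := by rw [cstar_eq]; exact qm_lt hγ 0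

lemma dA (hγ : 1 < γ) {q : ℝ} (h : q ∈ Ioo 0 (qmaxF γ)) : HasStrictDerivAt (Afun γ) (aF γ q) q := by
  have := strict_int (caF' hγ) ⟨cstar_pos hγ, cstar_lt hγ⟩ h
  rw [aF_eq hγ h] at this
  exact this

lemma dB (hγ : 1 < γ) {q : ℝ} (h : q ∈ Ioo 0 (qmaxF γ)) : HasStrictDerivAt (Bfun γ) (rhoF γ (q ^ 2) / q) q := by
  refine strict_int (F := fun q => rhoF γ (q ^ 2) / q) ?_ ⟨cstar_pos hγ, cstar_lt hγ⟩ h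
  exact (crho hγ).div continuousOn_id fun q hq => hq.1.ne'

lemma aF_neg (hγ : 1 < γ) {q : ℝ} (h : q ∈ Ioo (cstar γ) (qmaxF γ)) : aF γ q < 0 := by
  have hq : q ∈ Ioo 0 (qmaxF γ) := ⟨(cstar_pos hγ).trans h.1, h.2⟩
  have h0 := sound_pos hγ hq
  have h1 := rho_pos hγ hq
  have h2 := hq.1
  unfold aF
  refine div_neg_of_neg_of_pos (mul_neg_of_pos_of_neg h1 ?_) (by positivity)
  have h3 : 2 / (γ + 1) < q ^ 2 := by
    rw [← cstar_sq hγ]; exact pow_lt_pow_left₀ h.1 (cstar_pos hγ).le (by norm_num)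
  rw [div_lt_iff₀ (by linarith)] at h3
  rw [sub_neg, lt_div_iff₀ h0]
  linarith

lemma A_anti (hγ : 1 < γ) : StrictAntiOn (Afun γ) (Ico (cstar γ) (qmaxF γ)) := by
  refine strictAntiOn_of_deriv_neg (convex_Ico _ _) (fun q hq => ?_) fun q hq => ?_
  · exact (dA hγ ⟨(cstar_pos hγ).trans_le hq.1, hq.2⟩).hasDerivAt.continuousAt.continuousWithinAt
  · rw [interior_Ico] at hq
    rw [(dA hγ ⟨(cstar_pos hγ).trans hq.1, hq.2⟩).hasDerivAt.deriv]
    exact aF_neg hγ hq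

lemma AInv_A (hγ : 1 < γ) {q : ℝ} (h : q ∈ Ico (cstar γ) (qmaxF γ)) : AplusInv γ (Afun γ q) = q :=
  (A_anti hγ).injOn.leftInvOn_invFunOn h

lemma A_cstar : Afun γ (cstar γ) = 0 := by simp [Afun]

lemma rho_qm (hγ : 1 < γ) (μ : ℝ) : 1 - (γ - 1) / 2 * qm γ μ ^ 2 = (Nm γ μ)⁻¹ ∧ rhoF γ (qm γ μ ^ 2) = Rm γ μ := by
  have hN := Nm_pos hγ μ
  have h : 1 - (γ - 1) / 2 * qm γ μ ^ 2 = (Nm γ μ)⁻¹ := by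
    rw [qm_sq hγ]
    have hN' : Nm γ μ = 1 + (γ - 1) / 2 * (1 + μ ^ 2) := rfl
    field_simp
    rw [hN']; ring
  refine ⟨h, ?_⟩
  unfold rhoF Rm
  rw [h, rpow_neg hN.le, Real.inv_rpow hN.le]

lemma aF_qm (hγ : 1 < γ) (μ : ℝ) : aF γ (qm γ μ) = -(μ ^ 2 / (qm γ μ * Rm γ μ)) := by
  have h := rho_qm hγ μ
  have hN := Nm_pos hγ μ
  have hq := qm_pos hγ μ
  have hR := Rm_pos hγ μ
  unfold aF
  rw [h.1, h.2, qm_sq hγ]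
  field_simp
  ring

lemma dAqm (hγ : 1 < γ) (μ : ℝ) : HasDerivAt (fun μ => Afun γ (qm γ μ)) (-(μ ^ 3 * km γ μ / Rm γ μ)) μ := by
  have := (dA hγ ⟨qm_pos hγ μ, qm_lt hγ μ⟩).hasDerivAt.comp μ (dqm hγ μ)
  refine this.congr_deriv ?_
  rw [aF_qm hγ]
  have hq := qm_pos hγ μ
  have hR := Rm_pos hγ μ
  field_simp

lemma bfun_qm (hγ : 1 < γ) {μ : ℝ} (h : 0 < μ) : bfun γ (Afun γ (qm γ μ)) = Rm γ μ ^ 2 / μ ^ 2 := by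
  set q := qm γ μ with hqd
  have hq : q ∈ Ioo (cstar γ) (qmaxF γ) :=
    ⟨by rw [cstar_eq]; exact qm_mono hγ (mem_Ici.2 le_rfl) h.le h, qm_lt hγ μ⟩
  have hq0 : q ∈ Ioo 0 (qmaxF γ) := ⟨(cstar_pos hγ).trans hq.1, hq.2⟩
  have hI : HasStrictDerivAt (AplusInv γ) (aF γ q)⁻¹ (Afun γ q) := by
    refine (dA hγ hq0).to_local_left_inverse (aF_neg hγ hq).ne ?_
    filter_upwards [isOpen_Ioo.mem_nhds hq] with p hp
    exact AInv_A hγ ⟨hp.1.le, hp.2⟩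
  have hI0 := AInv_A hγ ⟨hq.1.le, hq.2⟩
  have hB : HasDerivAt (Bfun γ) (rhoF γ (q ^ 2) / q) (AplusInv γ (Afun γ q)) := by
    rw [hI0]; exact (dB hγ hq0).hasDerivAt
  have hK : HasDerivAt (Kfun γ) _ (Afun γ q) := hB.comp _ hI.hasDerivAt
  unfold bfun
  rw [hK.deriv, (rho_qm hγ μ).2, aF_qm hγ]
  have hq := qm_pos hγ μ
  have hR := Rm_pos hγ μ
  rw [← hqd] at *
  field_simp


/-- inverse Prandtl–Meyer function -/
def mu (γ : ℝ) : ℝ → ℝ := Function.invFunOn (om γ) (Icc 0 1)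
/-- logarithmic derivative of s -/
def rm (γ μ : ℝ) : ℝ := (γ + 1) / 2 * (1 + μ ^ 2) ^ 2 / μ ^ 3

lemma mu_om (hγ : 1 < γ) {μ : ℝ} (h : μ ∈ Icc (0 : ℝ) 1) : mu γ (om γ μ) = μ :=
  ((om_mono hγ).mono Icc_subset_Ici_self).injOn.leftInvOn_invFunOn h

lemma mu_spec (hγ : 1 < γ) {μm η : ℝ} (hm0 : 0 < μm) (hm : μm ≤ 1) (hη : η ∈ Ico 0 (om γ μm)) :
    mu γ η ∈ Ico 0 μm ∧ om γ (mu γ η) = η := by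
  obtain ⟨μ, h1, h2⟩ := intermediate_value_Icc hm0.le (com hγ).continuousOn
    (show η ∈ Icc (om γ 0) (om γ μm) by rw [om0]; exact ⟨hη.1, hη.2.le⟩)
  rw [← h2, mu_om hγ ⟨h1.1, h1.2.trans hm⟩]
  refine ⟨⟨h1.1, lt_of_le_of_ne h1.2 ?_⟩, rfl⟩
  rintro rfl
  exact hη.2.ne h2.symm

lemma mu_pos (hγ : 1 < γ) {μm η : ℝ} (hm0 : 0 < μm) (hm : μm ≤ 1) (hη : η ∈ Ioo 0 (om γ μm)) :
    mu γ η ∈ Ioo 0 μm := by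
  have h := mu_spec hγ hm0 hm ⟨hη.1.le, hη.2⟩
  refine ⟨lt_of_le_of_ne h.1.1 fun h0 => ?_, h.1.2⟩
  rw [← h0, om0] at h
  exact hη.1.ne h.2

lemma dmu (hγ : 1 < γ) {μm η : ℝ} (hm0 : 0 < μm) (hm : μm ≤ 1) (hη : η ∈ Ioo 0 (om γ μm)) :
    HasDerivAt (mu γ) (mu γ η ^ 2 * km γ (mu γ η))⁻¹ η := by
  have h := mu_spec hγ hm0 hm ⟨hη.1.le, hη.2⟩
  have h0 := mu_pos hγ hm0 hm hη
  have hk := km_pos hγ (mu γ η)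
  have := (dom hγ (mu γ η)).to_local_left_inverse (g := mu γ)
    (by have := h0.1; positivity) (by
      filter_upwards [isOpen_Ioo.mem_nhds h0] with p hp
      exact mu_om hγ ⟨hp.1.le, hp.2.le.trans hm⟩)
  rw [h.2] at this
  exact this.hasDerivAt

lemma mu_zero (hγ : 1 < γ) : mu γ 0 = 0 := by
  have := mu_om hγ (μ := 0) (by simp)
  rwa [om0] at this

lemma cmu (hγ : 1 < γ) {μm : ℝ} (hm0 : 0 < μm) (hm : μm ≤ 1) : ContinuousOn (mu γ) (Ico 0 (om γ μm)) := by
  intro η hη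
  rcases eq_or_lt_of_le hη.1 with h | h
  · subst h
    rw [Metric.continuousWithinAt_iff]
    intro e he
    have hp : 0 < min e μm := lt_min he hm0
    refine ⟨om γ (min e μm), ?_, fun x hx hd => ?_⟩
    · have := om_mono hγ (mem_Ici.2 le_rfl) (mem_Ici.2 hp.le) hp
      rwa [om0] at this
    · rw [Real.dist_eq, sub_zero, abs_of_nonneg hx.1] at hd
      have := mu_spec hγ hp ((min_le_right _ _).trans hm) ⟨hx.1, hd⟩
      rw [mu_zero hγ, Real.dist_eq, sub_zero, abs_of_nonneg this.1.1]
      exact this.1.2.trans_le (min_le_left _ _)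
  · exact (dmu hγ hm0 hm ⟨h, hη.2⟩).continuousAt.continuousWithinAt

lemma rm_diff (hγ : 1 < γ) {μ μ' : ℝ} (h0 : 0 < μ) (h : μ ≤ μ') (h1 : μ' ≤ 1 / 2) :
    |rm γ μ' - rm γ μ| ≤ 1 / om γ μ - 1 / om γ μ' := by
  have hn : 0 < γ + 1 := by linarith
  have hd : ∀ t, 0 < t → HasDerivAt (rm γ) ((γ + 1) / 2 * ((1 + t ^ 2) * (t ^ 2 - 3)) / t ^ 4) t := by
    intro t ht
    have := (((((hasDerivAt_pow 2 t).const_add 1).pow 2).const_mul ((γ + 1) / 2))).div (hasDerivAt_pow 3 t)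
      (by positivity)
    refine this.congr_deriv ?_
    simp only [Pi.pow_apply]
    field_simp
    push_cast
    ring
  have hom : ∀ t, 0 < t → 0 < om γ t := fun t ht => by
    have := om_mono hγ (mem_Ici.2 le_rfl) (mem_Ici.2 ht.le) ht
    rwa [om0] at this
  have hb : ∀ t ∈ Icc μ μ', 0 < t ∧ t ≤ 1 / 2 := fun t ht => ⟨h0.trans_le ht.1, ht.2.trans h1⟩
  have e1 := incr_le (f := rm γ) (h := fun _ => (0 : ℝ)) (h' := fun _ => 0) h
    (fun t ht => (hd t (hb t ht).1).hasDerivWithinAt) (fun t _ => hasDerivWithinAt_const _ _ _)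
    (fun t ht => by
      have := hb t ht
      have h3 : t ^ 2 - 3 ≤ 0 := by nlinarith
      have h4 : 0 < t := this.1
      refine div_nonpos_of_nonpos_of_nonneg ?_ (by positivity)
      exact mul_nonpos_of_nonneg_of_nonpos (by positivity) (mul_nonpos_of_nonneg_of_nonpos (by positivity) h3))
  have e2 := incr_le (f := fun t => -(rm γ t)) (h := fun t => -(om γ t)⁻¹)
    (h' := fun t => t ^ 2 * km γ t / om γ t ^ 2) h
    (fun t ht => (hd t (hb t ht).1).neg.hasDerivWithinAt) (fun t ht => by
      have := ((dom hγ t).hasDerivAt.inv (hom t (hb t ht).1).ne').neg.hasDerivWithinAt (s := Icc μ μ')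
      exact this.congr_deriv (by ring))
    (fun t ht => by
      obtain ⟨ht0, ht1⟩ := hb t ht
      have ho := hom t ht0
      have ho2 := om_le hγ ht0.le
      have hk := km_ge hγ t
      rw [le_div_iff₀ (by positivity)]
      have hc : (1 + t ^ 2) ^ 3 * (3 - t ^ 2) ≤ 9 := by
        have a1 : t ^ 2 ≤ 1 / 4 := by nlinarith
        have a2 : (1 + t ^ 2) ^ 3 ≤ (1 + 1 / 4) ^ 3 := by gcongr
        have a3 : 0 ≤ (1 + t ^ 2) ^ 3 := by positivity
        nlinarith [sq_nonneg t]
      have o2 : om γ t ^ 2 ≤ (2 / (γ + 1) * (t ^ 3 / 3)) ^ 2 := by gcongr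
      have hX : 0 ≤ -((γ + 1) / 2 * ((1 + t ^ 2) * (t ^ 2 - 3)) / t ^ 4) := by
        have h3 : t ^ 2 - 3 ≤ 0 := by nlinarith
        rw [neg_nonneg]
        refine div_nonpos_of_nonpos_of_nonneg ?_ (by positivity)
        exact mul_nonpos_of_nonneg_of_nonpos (by positivity) (mul_nonpos_of_nonneg_of_nonpos (by positivity) h3)
      calc -((γ + 1) / 2 * ((1 + t ^ 2) * (t ^ 2 - 3)) / t ^ 4) * om γ t ^ 2
          ≤ -((γ + 1) / 2 * ((1 + t ^ 2) * (t ^ 2 - 3)) / t ^ 4) * (2 / (γ + 1) * (t ^ 3 / 3)) ^ 2 :=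
            mul_le_mul_of_nonneg_left o2 hX
        _ = t ^ 2 * (2 / (γ + 1) / (1 + t ^ 2) ^ 2) * ((1 + t ^ 2) ^ 3 * (3 - t ^ 2) / 9) := by
            field_simp
            ring
        _ ≤ t ^ 2 * (2 / (γ + 1) / (1 + t ^ 2) ^ 2) * 1 := by
            refine mul_le_mul_of_nonneg_left (by linarith) (by positivity)
        _ ≤ t ^ 2 * km γ t := by rw [mul_one]; gcongr)
  rw [abs_of_nonpos (by linarith), one_div, one_div]
  linarith


/-- gas data together with its link to the frozen functions -/
structure GasX (γ ε s0 ηm : ℝ) (s r qt k Qf : ℝ → ℝ) : Prop where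
  gas : Gas ε s0 (cstar γ) ηm s r qt k
  hηm : 0 < ηm
  cqt : ContinuousOn qt (Ico 0 ηm)
  cQ : ContinuousOn Qf (Ico 0 ηm)
  qt0 : qt 0 = cstar γ
  Q0 : Qf 0 = 0
  dQ : ∀ η ∈ Ioo 0 ηm, HasDerivAt Qf (-(s η)) η
  inv : ∀ η ∈ Ico 0 ηm, AplusInv γ (Qf η) = qt η
  qt_ge : ∀ η ∈ Ico 0 ηm, cstar γ ≤ qt η
  qt_le : ∀ η ∈ Ico 0 ηm, qt η ≤ (cstar γ + qmaxF γ) / 2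
  hb : ∀ η ∈ Ioo 0 ηm, bfun γ (Qf η) = 1 / s η ^ 2

/-- sonic constant -/
def s0c (γ : ℝ) : ℝ := (3 * ((γ + 1) / 2)) ^ ((1 : ℝ) / 3) / Rm γ 0

lemma s0_pos (hγ : 1 < γ) : 0 < s0c γ :=
  div_pos (rpow_pos_of_pos (by linarith) _) (Rm_pos hγ 0)

lemma s0_cube (hγ : 1 < γ) : s0c γ ^ 3 = 3 * ((γ + 1) / 2) / Rm γ 0 ^ 3 := by
  unfold s0c
  rw [div_pow, ← rpow_natCast, ← rpow_mul (by linarith)]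
  norm_num

lemma exists_gas (hγ : 1 < γ) {ε : ℝ} (hε : 0 < ε) :
    ∃ ηm s r qt k Qf, GasX γ ε (s0c γ) ηm s r qt k Qf := by
  have hR0 := Rm_pos hγ 0
  have hc := cstar_pos hγ
  have hcl := cstar_lt hγ
  -- choice of the range
  have E1 : ∀ᶠ μ in nhds (0 : ℝ), |(1 + μ ^ 2) ^ 2 * (Rm γ 0 / Rm γ μ) ^ 3 - 1| < ε / 10 := by
    have hcont : Continuous fun μ : ℝ => |(1 + μ ^ 2) ^ 2 * (Rm γ 0 / Rm γ μ) ^ 3 - 1| := by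
      have : Continuous fun μ : ℝ => Rm γ 0 / Rm γ μ := continuous_const.div (cRm hγ) fun μ => (Rm_pos hγ μ).ne'
      fun_prop
    have := hcont.tendsto 0
    refine this.eventually_lt_const ?_
    rw [div_self hR0.ne']
    norm_num; linarith
  have E2 : ∀ᶠ μ in nhds (0 : ℝ), |(Rm γ 0 / Rm γ μ) ^ 3 - 1| < ε / 10 := by
    have hcont : Continuous fun μ : ℝ => |(Rm γ 0 / Rm γ μ) ^ 3 - 1| := by
      have : Continuous fun μ : ℝ => Rm γ 0 / Rm γ μ := continuous_const.div (cRm hγ) fun μ => (Rm_pos hγ μ).ne'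
      fun_prop
    have := hcont.tendsto 0
    refine this.eventually_lt_const ?_
    rw [div_self hR0.ne']
    norm_num; linarith
  have E3 : ∀ᶠ μ in nhds (0 : ℝ), |qm γ μ - cstar γ| < ε / 100 * cstar γ := by
    have hcont : Continuous fun μ : ℝ => |qm γ μ - cstar γ| := ((cqm hγ).sub continuous_const).abs
    refine (hcont.tendsto 0).eventually_lt_const ?_
    rw [← cstar_eq]; simp; positivity
  have E4 : ∀ᶠ μ in nhds (0 : ℝ), qm γ μ < (cstar γ + qmaxF γ) / 2 := by
    refine ((cqm hγ).tendsto 0).eventually_lt_const ?_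
    rw [← cstar_eq]; linarith
  have E5 : ∀ᶠ μ in nhds (0 : ℝ), μ ^ 2 < ε / 100 := by
    refine ((by fun_prop : Continuous fun μ : ℝ => μ ^ 2).tendsto 0).eventually_lt_const ?_
    norm_num; positivity
  obtain ⟨d, hd, hE⟩ := Metric.eventually_nhds_iff.1 (E1.and (E2.and (E3.and (E4.and E5))))
  set μm := min d (1 / 2) with hμm
  have hm0 : 0 < μm := lt_min hd (by norm_num)
  have hm2 : μm ≤ 1 / 2 := min_le_right _ _
  have hm1 : μm ≤ 1 := hm2.trans (by norm_num)
  have hE' : ∀ μ, 0 ≤ μ → μ < μm → _ := fun μ h0 h1 => hE (y := μ) (by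
    rw [Real.dist_eq, sub_zero, abs_of_nonneg h0]
    exact h1.trans_le (min_le_left _ _))
  have hn : 0 < γ + 1 := by linarith
  have hωm : 0 < om γ μm := by
    have := om_mono hγ (mem_Ici.2 le_rfl) (mem_Ici.2 hm0.le) hm0
    rwa [om0] at this
  have hs3 := s0_cube hγ
  refine ⟨om γ μm, fun η => mu γ η / Rm γ (mu γ η), fun η => rm γ (mu γ η), fun η => qm γ (mu γ η),
    fun η => 1 / mu γ η, fun η => Afun γ (qm γ (mu γ η)), ?_⟩
  have hmu := cmu hγ hm0 hm1
  have hmu' := hmu.mono Ioo_subset_Ico_self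
  have hp : ∀ η ∈ Ioo 0 (om γ μm), mu γ η ∈ Ioo 0 μm := fun η hη => mu_pos hγ hm0 hm1 hη
  have hsp : ∀ η ∈ Ioo 0 (om γ μm), om γ (mu γ η) = η := fun η hη =>
    (mu_spec hγ hm0 hm1 ⟨hη.1.le, hη.2⟩).2
  refine { gas := ?_, hηm := hωm, cqt := (cqm hγ).comp_continuousOn hmu, cQ := ?_,
           qt0 := by simp only [mu_zero hγ, cstar_eq], Q0 := ?_, dQ := ?_, inv := ?_,
           qt_ge := ?_, qt_le := ?_, hb := ?_ }
  · refine { hs0 := s0_pos hγ, hcs := hc, ds := ?_, dqt := ?_, s_pos := ?_,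
             qt_pos := fun η _ => qm_pos hγ _, cr := ?_, ck := ?_, s_cube := ?_, hr := ?_, hk := ?_,
             hq := ?_, dr := ?_ }
    · intro η hη
      have h0 := (hp η hη).1
      have hR := Rm_pos hγ (mu γ η)
      have hN := Nm_pos hγ (mu γ η)
      have h1 := dmu hγ hm0 hm1 hη
      have h2 := h1.div ((dRm hγ (mu γ η)).comp η h1) hR.ne'
      refine h2.congr_deriv ?_
      unfold rm km
      simp only [Function.comp_apply]
      have hN' : Nm γ (mu γ η) + mu γ η ^ 2 = (γ + 1) / 2 * (1 + mu γ η ^ 2) := by unfold Nm; ring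
      generalize mu γ η = μ at *
      generalize Nm γ μ = N at *
      generalize Rm γ μ = R at *
      field_simp
      linear_combination 2 * hN'
    · intro η hη
      have h0 := (hp η hη).1
      have hk := km_pos hγ (mu γ η)
      have h1 := dmu hγ hm0 hm1 hη
      refine ((dqm hγ (mu γ η)).comp η h1).congr_deriv ?_
      field_simp
    · intro η hη
      exact div_pos (hp η hη).1 (Rm_pos hγ _)
    · unfold rm
      refine ContinuousOn.div (by fun_prop) (by fun_prop) fun η hη => ?_
      have := (hp η hη).1
      positivity
    · exact continuousOn_const.div hmu' fun η hη => (hp η hη).1.ne'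
    · intro η hη
      have h0 := hp η hη
      obtain ⟨e1, e2, -⟩ := hE' _ h0.1.le h0.2
      have ho := hsp η hη
      have l1 := om_le hγ h0.1.le
      have l2 := om_ge hγ h0.1.le
      rw [ho] at l1 l2
      have hR := Rm_pos hγ (mu γ η)
      rw [hs3]
      have h00 := h0.1
      generalize mu γ η = μ at *
      generalize hQ : Rm γ 0 / Rm γ μ = q at *
      have hR' : Rm γ μ = Rm γ 0 / q := by rw [← hQ]; field_simp
      have hq : 0 < q := by rw [← hQ]; positivity
      rw [hR']
      generalize Rm γ 0 = R0 at *
      have i1 : (μ / (R0 / q)) ^ 3 = q ^ 3 * (μ ^ 3 / R0 ^ 3) := by field_simp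
      have i2 : 3 * ((γ + 1) / 2) * η ≤ μ ^ 3 := by
        rw [div_mul_eq_mul_div, le_div_iff₀ hn] at l1
        linarith
      have i3 : μ ^ 3 ≤ 3 * ((γ + 1) / 2) * η * (1 + μ ^ 2) ^ 2 := by
        rw [div_div, div_mul_eq_mul_div, div_le_iff₀ (by positivity)] at l2
        linarith
      rw [i1]
      have i4 : 3 * ((γ + 1) / 2) / R0 ^ 3 * η = 3 * ((γ + 1) / 2) * η / R0 ^ 3 := by ring
      rw [i4]
      set a := 3 * ((γ + 1) / 2) * η with ha
      have ha0 : 0 < a := by have := hη.1; positivity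
      have hq3 : 0 < q ^ 3 := by positivity
      have : q ^ 3 * (μ ^ 3 / R0 ^ 3) - a / R0 ^ 3 = (q ^ 3 * μ ^ 3 - a) / R0 ^ 3 := by ring
      rw [this, abs_div, abs_of_pos (by positivity : 0 < R0 ^ 3), ← mul_div_assoc]
      refine div_le_div_of_nonneg_right ?_ (by positivity)
      rw [abs_le]
      rw [abs_lt] at e1 e2
      constructor
      · nlinarith [mul_le_mul_of_nonneg_left i2 hq3.le]
      · nlinarith [mul_le_mul_of_nonneg_left i3 hq3.le]
    · intro η hη
      have h0 := hp η hη
      obtain ⟨-, -, -, -, e5⟩ := hE' _ h0.1.le h0.2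
      have ho := hsp η hη
      have l1 := om_le hγ h0.1.le
      have l2 := om_ge hγ h0.1.le
      rw [ho] at l1 l2
      unfold rm
      have h00 := h0.1
      have h01 := h0.2
      generalize mu γ η = μ at *
      have i2 : 3 * ((γ + 1) / 2) * η ≤ μ ^ 3 := by
        rw [div_mul_eq_mul_div, le_div_iff₀ hn] at l1
        linarith
      have i3 : μ ^ 3 ≤ 3 * ((γ + 1) / 2) * η * (1 + μ ^ 2) ^ 2 := by
        rw [div_div, div_mul_eq_mul_div, div_le_iff₀ (by positivity)] at l2
        linarith
      have i4 : 3 * (η * ((γ + 1) / 2 * (1 + μ ^ 2) ^ 2 / μ ^ 3)) =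
        3 * ((γ + 1) / 2) * η * (1 + μ ^ 2) ^ 2 / μ ^ 3 := by ring
      rw [i4]
      have i5 : 1 ≤ 3 * ((γ + 1) / 2) * η * (1 + μ ^ 2) ^ 2 / μ ^ 3 := by
        rw [le_div_iff₀ (by positivity)]; linarith
      have i6 : 3 * ((γ + 1) / 2) * η * (1 + μ ^ 2) ^ 2 / μ ^ 3 ≤ (1 + μ ^ 2) ^ 2 := by
        rw [div_le_iff₀ (by positivity), mul_comm]
        exact mul_le_mul_of_nonneg_left i2 (by positivity)
      rw [abs_of_nonneg (by linarith)]
      have : μ ^ 2 ≤ 1 := by nlinarith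
      nlinarith [sq_nonneg μ]
    · intro η hη
      have h0 := hp η hη
      obtain ⟨-, -, -, -, e5⟩ := hE' _ h0.1.le h0.2
      have ho := hsp η hη
      have l1 := om_le hγ h0.1.le
      rw [ho] at l1
      have h00 := h0.1
      have h01 := hη.1
      generalize mu γ η = μ at *
      rw [abs_of_pos (by positivity), mul_one_div, div_le_iff₀ h00]
      have i1 : 2 / (γ + 1) ≤ 1 := by rw [div_le_one hn]; linarith
      have i2 : 2 / (γ + 1) * (μ ^ 3 / 3) ≤ 1 * (μ ^ 3 / 3) := by gcongr
      have i3 : 0 < μ ^ 3 := by positivity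
      nlinarith
    · intro η hη
      have h0 := hp η hη
      exact (hE' _ h0.1.le h0.2).2.2.1.le
    · intro η hη η' hη' hle
      have h0 := hp η hη
      have h0' := hp η' hη'
      have ho := hsp η hη
      have ho' := hsp η' hη'
      have hl : mu γ η ≤ mu γ η' := by
        by_contra hcon
        push Not at hcon
        have := om_mono hγ (mem_Ici.2 h0'.1.le) (mem_Ici.2 h0.1.le) hcon
        rw [ho, ho'] at this
        linarith
      have := rm_diff hγ h0.1 hl (h0'.2.le.trans hm2)
      rwa [ho, ho'] at this
  · intro η hη
    have h1 := (dAqm hγ (mu γ η)).continuousAt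
    exact ContinuousAt.comp_continuousWithinAt (g := fun μ => Afun γ (qm γ μ)) h1 (hmu η hη)
  · simp only [mu_zero hγ]
    rw [← cstar_eq, A_cstar]
  · intro η hη
    have h0 := (hp η hη).1
    have hR := Rm_pos hγ (mu γ η)
    have hk := km_pos hγ (mu γ η)
    refine ((dAqm hγ (mu γ η)).comp η (dmu hγ hm0 hm1 hη)).congr_deriv ?_
    field_simp
  · intro η hη
    exact AInv_A hγ (qm_mem hγ (mu_spec hγ hm0 hm1 hη).1.1)
  · intro η hη
    exact (qm_mem hγ (mu_spec hγ hm0 hm1 hη).1.1).1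
  · intro η hη
    have h0 := (mu_spec hγ hm0 hm1 hη).1
    exact (hE' _ h0.1 h0.2).2.2.2.1.le
  · intro η hη
    have h0 := (hp η hη).1
    have hR := Rm_pos hγ (mu γ η)
    rw [bfun_qm hγ h0]
    field_simp

end Nozzle

namespace Nozzle

/-- hypotheses on the wall on a slightly larger interval -/
structure WH (lam a b d σ L : ℝ) (f : ℝ → ℝ) : Prop where
  cd : ContDiff ℝ 3 f
  f0 : deriv f 0 = 0
  lo : ∀ x ∈ Ico 0 L, a * x ^ lam ≤ deriv (deriv f) x
  hi : ∀ x ∈ Ico 0 L, deriv (deriv f) x ≤ b * x ^ lam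
  d3 : ∀ x ∈ Ico 0 L, |deriv (deriv (deriv f)) x| ≤ d * x ^ (lam - 1)
  d3' : ∀ x ∈ Ico 0 L, -(σ * x ^ (lam - 1)) ≤ deriv (deriv (deriv f)) x

/-- derivative of the angle -/
def Th1 (f : ℝ → ℝ) (x : ℝ) : ℝ := deriv (deriv f) x / (1 + deriv f x ^ 2)
/-- second derivative of the angle -/
def Th2 (f : ℝ → ℝ) (x : ℝ) : ℝ := deriv (deriv (deriv f)) x / (1 + deriv f x ^ 2)
  - 2 * deriv f x * deriv (deriv f) x ^ 2 / (1 + deriv f x ^ 2) ^ 2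
/-- integrated angle -/
def GW (f : ℝ → ℝ) (x : ℝ) : ℝ := ∫ t in (0 : ℝ)..x, ThP f t

variable {f : ℝ → ℝ}

lemma cd_d1 (h : ContDiff ℝ 3 f) : ContDiff ℝ 2 (deriv f) :=
  (contDiff_succ_iff_deriv.1 (show ContDiff ℝ (2 + 1) f by norm_num; exact h)).2.2
lemma cd_d2 (h : ContDiff ℝ 3 f) : ContDiff ℝ 1 (deriv (deriv f)) :=
  (contDiff_succ_iff_deriv.1 (show ContDiff ℝ (1 + 1) (deriv f) by norm_num; exact cd_d1 h)).2.2
lemma cd_d3 (h : ContDiff ℝ 3 f) : Continuous (deriv (deriv (deriv f))) :=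
  (cd_d2 h).continuous_deriv le_rfl

lemma hd1 (h : ContDiff ℝ 3 f) (x : ℝ) : HasDerivAt (deriv f) (deriv (deriv f) x) x :=
  ((cd_d1 h).differentiable (by norm_num) x).hasDerivAt
lemma hd2 (h : ContDiff ℝ 3 f) (x : ℝ) : HasDerivAt (deriv (deriv f)) (deriv (deriv (deriv f)) x) x :=
  ((cd_d2 h).differentiable (by norm_num) x).hasDerivAt

lemma dThP (h : ContDiff ℝ 3 f) (x : ℝ) : HasDerivAt (ThP f) (Th1 f x) x := by
  refine (hd1 h x).arctan.congr_deriv ?_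
  unfold Th1; ring

lemma dTh1 (h : ContDiff ℝ 3 f) (x : ℝ) : HasDerivAt (Th1 f) (Th2 f x) x := by
  have h2 : 0 < 1 + deriv f x ^ 2 := by positivity
  refine ((hd2 h x).div (((hd1 h x).pow 2).const_add 1) h2.ne').congr_deriv ?_
  unfold Th2
  simp only [Pi.pow_apply]
  field_simp
  push_cast
  ring

lemma cThP (h : ContDiff ℝ 3 f) : Continuous (ThP f) :=
  continuous_iff_continuousAt.2 fun x => (dThP h x).continuousAt

lemma dGW (h : ContDiff ℝ 3 f) (x : ℝ) : HasDerivAt (GW f) (ThP f x) x :=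
  intervalIntegral.integral_hasDerivAt_right ((cThP h).intervalIntegrable _ _)
    ((cThP h).stronglyMeasurableAtFilter _ _) (cThP h).continuousAt

/-- integrate power bounds -/
lemma pow_int {F F' : ℝ → ℝ} {a b p x : ℝ} (hp : 0 < p) (hx : 0 ≤ x) (hF : ∀ t ∈ Icc 0 x, HasDerivAt F (F' t) t)
    (h0 : F 0 = 0) (ha : ∀ t ∈ Icc 0 x, a * t ^ p ≤ F' t) (hb : ∀ t ∈ Icc 0 x, F' t ≤ b * t ^ p) :
    a / (p + 1) * x ^ (p + 1) ≤ F x ∧ F x ≤ b / (p + 1) * x ^ (p + 1) := by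
  have hD : ∀ c : ℝ, ∀ t ∈ Icc 0 x, HasDerivWithinAt (fun t : ℝ => c / (p + 1) * t ^ (p + 1)) (c * t ^ p) (Icc 0 x) t := by
    intro c t _
    have := (Real.hasDerivAt_rpow_const (x := t) (p := p + 1) (Or.inr (by linarith))).const_mul (c / (p + 1))
    refine (this.congr_deriv ?_).hasDerivWithinAt
    rw [add_sub_cancel_right]
    field_simp
  have e1 := incr_le hx (hD a) (fun t ht => (hF t ht).hasDerivWithinAt) ha
  have e2 := incr_le hx (fun t ht => (hF t ht).hasDerivWithinAt) (hD b) hb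
  rw [h0, Real.zero_rpow (by linarith)] at e1 e2
  constructor <;> linarith

variable {lam a b d σ L : ℝ}

lemma WH.basic (H : WH lam a b d σ L f) (hlam : 0 < lam) (ha : 0 < a) (hb : 0 < b) (hL : L ≤ 1)
    (hbL : b / (lam + 1) * L ≤ 1) {x : ℝ} (hx : x ∈ Ico 0 L) :
    0 ≤ deriv f x ∧ deriv f x ≤ b / (lam + 1) * x ^ (lam + 1) ∧ deriv f x ≤ 1 ∧
    a / 2 * x ^ lam ≤ Th1 f x ∧ Th1 f x ≤ b * x ^ lam := by
  have h1 := pow_int hlam hx.1 (fun t _ => hd1 H.cd t) H.f0 (fun t ht => H.lo t ⟨ht.1, ht.2.trans_lt hx.2⟩)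
    (fun t ht => H.hi t ⟨ht.1, ht.2.trans_lt hx.2⟩)
  have hx0 := hx.1
  have hp : 0 ≤ x ^ (lam + 1) := by positivity
  have h2 : 0 ≤ deriv f x := le_trans (by positivity) h1.1
  have hx1 : x ^ (lam + 1) ≤ x := by
    have := rpow_le_rpow_of_exponent_ge' hx0 (hx.2.le.trans hL) (by norm_num : (0 : ℝ) ≤ 1) (by linarith : 1 ≤ lam + 1)
    rwa [rpow_one] at this
  have h3 : deriv f x ≤ 1 := by
    refine h1.2.trans (le_trans ?_ hbL)
    gcongr
    exact hx1.trans hx.2.le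
  have h4 := H.lo x hx
  have h5 := H.hi x hx
  have hp' : 0 ≤ x ^ lam := by positivity
  refine ⟨h2, h1.2, h3, ?_, ?_⟩
  · unfold Th1
    rw [le_div_iff₀ (by positivity)]
    have : 0 ≤ a * x ^ lam := by positivity
    have h6 : deriv f x ^ 2 ≤ 1 := by nlinarith
    nlinarith
  · unfold Th1
    rw [div_le_iff₀ (by positivity)]
    have : 0 ≤ b * x ^ lam := by positivity
    nlinarith [sq_nonneg (deriv f x)]

lemma ThP0 (H : WH lam a b d σ L f) : ThP f 0 = 0 := by unfold ThP; rw [H.f0, Real.arctan_zero]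

lemma WH.Th (H : WH lam a b d σ L f) (hlam : 0 < lam) (ha : 0 < a) (hb : 0 < b) (hL : L ≤ 1)
    (hbL : b / (lam + 1) * L ≤ 1) {x : ℝ} (hx : x ∈ Ico 0 L) :
    a / 2 / (lam + 1) * x ^ (lam + 1) ≤ ThP f x ∧ ThP f x ≤ b / (lam + 1) * x ^ (lam + 1) :=
  pow_int hlam hx.1 (fun t _ => dThP H.cd t) (ThP0 H)
    (fun t ht => (H.basic hlam ha hb hL hbL ⟨ht.1, ht.2.trans_lt hx.2⟩).2.2.2.1)
    (fun t ht => (H.basic hlam ha hb hL hbL ⟨ht.1, ht.2.trans_lt hx.2⟩).2.2.2.2)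

lemma WH.G (H : WH lam a b d σ L f) (hlam : 0 < lam) (ha : 0 < a) (hb : 0 < b) (hL : L ≤ 1)
    (hbL : b / (lam + 1) * L ≤ 1) {x : ℝ} (hx : x ∈ Ico 0 L) :
    a / 2 / (lam + 1) / (lam + 2) * x ^ (lam + 2) ≤ GW f x ∧ GW f x ≤ b / (lam + 1) / (lam + 2) * x ^ (lam + 2) := by
  have := pow_int (by linarith : 0 < lam + 1) hx.1 (fun t _ => dGW H.cd t) (by simp [GW])
    (fun t ht => (H.Th hlam ha hb hL hbL ⟨ht.1, ht.2.trans_lt hx.2⟩).1)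
    (fun t ht => (H.Th hlam ha hb hL hbL ⟨ht.1, ht.2.trans_lt hx.2⟩).2)
  rw [show lam + 1 + 1 = lam + 2 by ring] at this
  exact this

/-- extension past the end of the nozzle -/
lemma WH.ofNozzle {δ1 δ2 δ3 l : ℝ} (hlam : 2 < lam) (hδ1 : 0 < δ1) (hδ12 : δ1 ≤ δ2) (hδ3 : 0 < δ3) (hσ : 0 < σ)
    (hl : 0 < l) (H : NozzlePlus lam δ1 δ2 l f)
    (H3 : ∀ x ∈ Icc (0 : ℝ) l, |deriv (deriv (deriv f)) x| ≤ δ3 * x ^ (lam - 1)) :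
    ∃ L, l < L ∧ L ≤ 2 * l ∧ WH lam (δ1 / 2) (2 * δ2) (2 * δ3) σ L f := by
  obtain ⟨cd, -, f0, hb⟩ := H
  have c2 := (cd_d2 cd).continuous
  have c3 := cd_d3 cd
  have cp : ∀ p : ℝ, ContinuousAt (fun x : ℝ => x ^ p) l := fun p => Real.continuousAt_rpow_const _ _ (Or.inl hl.ne')
  have hl' : l ∈ Icc 0 l := ⟨hl.le, le_rfl⟩
  have hp : 0 < l ^ lam := by positivity
  have hp' : 0 < l ^ (lam - 1) := by positivity
  have e1 : ∀ᶠ x in nhds l, δ1 / 2 * x ^ lam < deriv (deriv f) x :=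
    (continuousAt_const.mul (cp lam)).eventually_lt c2.continuousAt (by
      have := (hb l hl').1
      show δ1 / 2 * l ^ lam < _
      nlinarith)
  have e2 : ∀ᶠ x in nhds l, deriv (deriv f) x < 2 * δ2 * x ^ lam :=
    c2.continuousAt.eventually_lt (continuousAt_const.mul (cp lam)) (by
      have := (hb l hl').2.1
      have : 0 < δ2 * l ^ lam := by have : 0 < δ2 := by linarith
                                    positivity
      nlinarith)
  have e3 : ∀ᶠ x in nhds l, |deriv (deriv (deriv f)) x| < 2 * δ3 * x ^ (lam - 1) :=
    c3.abs.continuousAt.eventually_lt (continuousAt_const.mul (cp (lam - 1))) (by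
      have := H3 l hl'
      have : 0 < δ3 * l ^ (lam - 1) := by positivity
      nlinarith)
  have e4 : ∀ᶠ x in nhds l, -(σ * x ^ (lam - 1)) < deriv (deriv (deriv f)) x :=
    (continuousAt_const.mul (cp (lam - 1))).neg.eventually_lt c3.continuousAt (by
      have := (hb l hl').2.2
      have : 0 < σ * l ^ (lam - 1) := by positivity
      show -(σ * l ^ (lam - 1)) < _
      linarith)
  obtain ⟨r, hr, hE⟩ := Metric.eventually_nhds_iff.1 (e1.and (e2.and (e3.and e4)))
  have hdist : ∀ x ∈ Ico 0 (l + min r l), l < x → dist x l < r := by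
    intro x hx hlx
    rw [Real.dist_eq, abs_of_pos (by linarith)]
    have := hx.2
    have := min_le_left r l
    linarith
  refine ⟨l + min r l, by have := lt_min hr hl; linarith, by have := min_le_right r l; linarith, cd, f0, ?_, ?_, ?_, ?_⟩
  all_goals
    intro x hx
    have q1 : 0 ≤ x ^ lam := rpow_nonneg hx.1 _
    have q2 : 0 ≤ x ^ (lam - 1) := rpow_nonneg hx.1 _
    rcases le_or_gt x l with h | h
  · have := (hb x ⟨hx.1, h⟩).1; nlinarith
  · exact (hE (hdist x hx h)).1.le
  · have := (hb x ⟨hx.1, h⟩).2.1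
    have : 0 < δ2 := by linarith
    nlinarith
  · exact (hE (hdist x hx h)).2.1.le
  · have := H3 x ⟨hx.1, h⟩; nlinarith
  · exact (hE (hdist x hx h)).2.2.1.le
  · have := (hb x ⟨hx.1, h⟩).2.2; nlinarith
  · exact (hE (hdist x hx h)).2.2.2.le

end Nozzle

namespace Nozzle

/-- model solution -/
def gW (κ : ℝ) (f : ℝ → ℝ) (x : ℝ) : ℝ := (κ * GW f x) ^ ((1 : ℝ) / 4)
/-- its derivative -/
def g1W (κ : ℝ) (f : ℝ → ℝ) (x : ℝ) : ℝ := gW κ f x * (ThP f x / (4 * GW f x))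

lemma fourth {t : ℝ} (h : 0 ≤ t) : (t ^ ((1 : ℝ) / 4)) ^ 4 = t := by
  rw [← rpow_natCast, ← rpow_mul h]; norm_num

lemma pow_e {lam x : ℝ} (hx : 0 < x) (n : ℕ) (p : ℝ) (hp : p = lam - 2 + n) :
    x ^ p = (x ^ ((lam - 2) / 4)) ^ 4 * x ^ n := by
  rw [hp, rpow_add hx, rpow_natCast, ← rpow_natCast (x ^ ((lam - 2) / 4)), ← rpow_mul hx.le]
  norm_num

variable {f : ℝ → ℝ} {lam a b d σ L κ : ℝ}

lemma WH.gb (H : WH lam a b d σ L f) (hlam : 2 < lam) (ha : 0 < a) (hb : 0 < b) (hL : L ≤ 1)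
    (hbL : b / (lam + 1) * L ≤ 1) (hκ : 0 < κ) {x : ℝ} (hx : x ∈ Ioo 0 L) :
    0 < gW κ f x ∧ 0 < g1W κ f x ∧ HasDerivAt (gW κ f) (g1W κ f x) x ∧
    (κ * (a / 2 / (lam + 1) / (lam + 2))) ^ ((1 : ℝ) / 4) * (x ^ ((lam - 2) / 4) * x) ≤ gW κ f x ∧
    gW κ f x ≤ (κ * (b / (lam + 1) / (lam + 2))) ^ ((1 : ℝ) / 4) * (x ^ ((lam - 2) / 4) * x) ∧
    (a / 2 * (lam + 2) / (4 * b)) * gW κ f x ≤ x * g1W κ f x ∧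
    x * g1W κ f x ≤ (b * (lam + 2) / (4 * (a / 2))) * gW κ f x ∧
    ThP f x = 3 / (3 * (κ / 4)) * gW κ f x ^ 3 * g1W κ f x := by
  have hx0 := hx.1
  have hx' : x ∈ Ico 0 L := ⟨hx.1.le, hx.2⟩
  have hl1 : 0 < lam + 1 := by linarith
  have hl2 : 0 < lam + 2 := by linarith
  have h1 := H.Th (by linarith) ha hb hL hbL hx'
  have h2 := H.G (by linarith) ha hb hL hbL hx'
  rw [pow_e hx0 3 (lam + 1) (by push_cast; ring)] at h1
  rw [pow_e hx0 4 (lam + 2) (by push_cast; ring)] at h2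
  set e := x ^ ((lam - 2) / 4) with he
  have he0 : 0 < e := by positivity
  have hT : 0 < ThP f x := lt_of_lt_of_le (by positivity) h1.1
  have hG : 0 < GW f x := lt_of_lt_of_le (by positivity) h2.1
  have hg : 0 < gW κ f x := by unfold gW; positivity
  have hg4 : gW κ f x ^ 4 = κ * GW f x := fourth (by positivity)
  have hg1 : 0 < g1W κ f x := by unfold g1W; positivity
  refine ⟨hg, hg1, ?_, ?_, ?_, ?_, ?_, ?_⟩
  · have := ((dGW H.cd x).const_mul κ).rpow_const (p := (1 : ℝ) / 4) (Or.inl (by positivity))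
    refine this.congr_deriv ?_
    rw [rpow_sub_one (by positivity)]
    unfold g1W gW
    field_simp
  · refine (pow_le_pow_iff_left₀ (by positivity) hg.le (by norm_num : 4 ≠ 0)).1 ?_
    rw [mul_pow, fourth (by positivity), hg4, mul_assoc]
    refine mul_le_mul_of_nonneg_left ?_ hκ.le
    rw [mul_pow]; exact h2.1
  · refine (pow_le_pow_iff_left₀ hg.le (by positivity) (by norm_num : 4 ≠ 0)).1 ?_
    rw [mul_pow, fourth (by positivity), hg4, mul_assoc]
    refine mul_le_mul_of_nonneg_left ?_ hκ.le
    rw [mul_pow]; exact h2.2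
  · unfold g1W
    rw [mul_left_comm, mul_comm _ (gW κ f x)]
    refine mul_le_mul_of_nonneg_left ?_ hg.le
    rw [← mul_div_assoc, div_le_div_iff₀ (by positivity) (by positivity)]
    have i1 : a / 2 / (lam + 1) * (e ^ 4 * x ^ 3) * x ≤ ThP f x * x := by gcongr; exact h1.1
    have i2 : a / 2 * (lam + 2) * (4 * GW f x) ≤ a / 2 * (lam + 2) * (4 * (b / (lam + 1) / (lam + 2) * (e ^ 4 * x ^ 4))) := by
      gcongr; exact h2.2
    have i3 : a / 2 * (lam + 2) * (4 * (b / (lam + 1) / (lam + 2) * (e ^ 4 * x ^ 4))) =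
      a / 2 / (lam + 1) * (e ^ 4 * x ^ 3) * x * (4 * b) := by field_simp
    rw [i3] at i2
    refine i2.trans ?_
    rw [mul_comm x]
    gcongr
  · unfold g1W
    rw [mul_left_comm, mul_comm _ (gW κ f x)]
    refine mul_le_mul_of_nonneg_left ?_ hg.le
    rw [← mul_div_assoc, div_le_div_iff₀ (by positivity) (by positivity)]
    have i1 : x * ThP f x * (4 * (a / 2)) ≤ x * (b / (lam + 1) * (e ^ 4 * x ^ 3)) * (4 * (a / 2)) := by gcongr; exact h1.2
    refine i1.trans ?_
    have i2 : b * (lam + 2) * (4 * (a / 2 / (lam + 1) / (lam + 2) * (e ^ 4 * x ^ 4))) ≤ b * (lam + 2) * (4 * GW f x) := by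
      gcongr; exact h2.1
    refine le_trans (le_of_eq ?_) i2
    field_simp
  · have : 3 / (3 * (κ / 4)) * gW κ f x ^ 3 * g1W κ f x = 3 / (3 * (κ / 4)) * (gW κ f x ^ 4) * (ThP f x / (4 * GW f x)) := by
      unfold g1W; ring
    rw [this, hg4]
    field_simp

lemma ev_e {w : ℝ} (hw : 0 < w) (C : ℝ) {D : ℝ} (hD : 0 < D) :
    ∀ᶠ x in nhdsWithin (0 : ℝ) (Ioi 0), C * x ^ w ≤ D := by
  have h1 : ContinuousAt (fun x : ℝ => C * x ^ w) 0 :=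
    continuousAt_const.mul (Real.continuousAt_rpow_const _ _ (Or.inr hw.le))
  have h2 := h1.tendsto.mono_left (nhdsWithin_le_nhds (s := Ioi 0))
  simp only [Real.zero_rpow hw.ne', mul_zero] at h2
  exact h2.eventually_le_const hD

end Nozzle

namespace Nozzle

lemma th2_a {e x F1 F2 F3 b b1 d : ℝ} (hx0 : 0 < x) (x1 : x ≤ 1) (e0 : 0 < e) (e1 : e ≤ 1) (hb : 0 < b) (hb1 : 0 < b1)
    (F2p : 0 ≤ F2) (p1 : 0 ≤ F1) (hd : 0 < d) (h3 : |F3| ≤ d * (e ^ 4 * x)) (p2 : F1 ≤ b1 * (e ^ 4 * x ^ 3))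
    (hhi : F2 ≤ b * (e ^ 4 * x ^ 2)) :
    |F3 / (1 + F1 ^ 2) - 2 * F1 * F2 ^ 2 / (1 + F1 ^ 2) ^ 2| ≤ (d + 2 * b1 * b ^ 2) * (e ^ 4 * x) := by
  have j1 : |F3 / (1 + F1 ^ 2)| ≤ d * (e ^ 4 * x) := by
    rw [abs_div, abs_of_pos (by positivity : 0 < 1 + F1 ^ 2), div_le_iff₀ (by positivity)]
    have : 0 ≤ d * (e ^ 4 * x) := by positivity
    nlinarith [sq_nonneg F1]
  have j2 : |2 * F1 * F2 ^ 2 / (1 + F1 ^ 2) ^ 2| ≤ 2 * b1 * b ^ 2 * (e ^ 4 * x) := by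
    rw [abs_of_nonneg (by positivity), div_le_iff₀ (by positivity)]
    have k1 : 2 * F1 * F2 ^ 2 ≤ 2 * (b1 * (e ^ 4 * x ^ 3)) * (b * (e ^ 4 * x ^ 2)) ^ 2 := by gcongr
    have k2 : 2 * (b1 * (e ^ 4 * x ^ 3)) * (b * (e ^ 4 * x ^ 2)) ^ 2 = 2 * b1 * b ^ 2 * (e ^ 4 * x) * (e ^ 8 * x ^ 6) := by ring
    have k3 : e ^ 8 * x ^ 6 ≤ 1 := mul_le_one₀ (pow_le_one₀ e0.le e1) (by positivity) (pow_le_one₀ hx0.le x1)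
    have k4 : 0 ≤ 2 * b1 * b ^ 2 * (e ^ 4 * x) := by positivity
    have k5 : 1 ≤ (1 + F1 ^ 2) ^ 2 := one_le_pow₀ (by nlinarith [sq_nonneg F1])
    calc 2 * F1 * F2 ^ 2 ≤ 2 * b1 * b ^ 2 * (e ^ 4 * x) * (e ^ 8 * x ^ 6) := by rw [← k2]; exact k1
      _ ≤ 2 * b1 * b ^ 2 * (e ^ 4 * x) * 1 := mul_le_mul_of_nonneg_left k3 k4
      _ ≤ _ := mul_le_mul_of_nonneg_left k5 k4
  refine (abs_sub _ _).trans ?_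
  linarith

lemma th2_b {e x F1 F2 F3 b b1 σ : ℝ} (hx0 : 0 < x) (x1 : x ≤ 1) (e0 : 0 < e) (e1 : e ≤ 1) (hb : 0 < b) (hb1 : 0 < b1)
    (F2p : 0 ≤ F2) (p1 : 0 ≤ F1) (hσ : 0 < σ) (h3 : -(σ * (e ^ 4 * x)) ≤ F3) (p2 : F1 ≤ b1 * (e ^ 4 * x ^ 3))
    (hhi : F2 ≤ b * (e ^ 4 * x ^ 2)) (s8 : 2 * b1 * b ^ 2 * x ≤ σ) :
    -(F3 / (1 + F1 ^ 2) - 2 * F1 * F2 ^ 2 / (1 + F1 ^ 2) ^ 2) ≤ 2 * σ * (e ^ 4 * x) := by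
  have j1 : -(σ * (e ^ 4 * x)) ≤ F3 / (1 + F1 ^ 2) := by
    rw [le_div_iff₀ (by positivity)]
    have : 0 ≤ σ * (e ^ 4 * x) := by positivity
    nlinarith [sq_nonneg F1]
  have j2 : 2 * F1 * F2 ^ 2 / (1 + F1 ^ 2) ^ 2 ≤ σ * (e ^ 4 * x) := by
    rw [div_le_iff₀ (by positivity)]
    have k1 : 2 * F1 * F2 ^ 2 ≤ 2 * (b1 * (e ^ 4 * x ^ 3)) * (b * (e ^ 4 * x ^ 2)) ^ 2 := by gcongr
    have k2 : 2 * (b1 * (e ^ 4 * x ^ 3)) * (b * (e ^ 4 * x ^ 2)) ^ 2 = 2 * b1 * b ^ 2 * x * (e ^ 4 * x) * (e ^ 8 * x ^ 5) := by ring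
    have k3 : e ^ 8 * x ^ 5 ≤ 1 := mul_le_one₀ (pow_le_one₀ e0.le e1) (by positivity) (pow_le_one₀ hx0.le x1)
    have k4 : 0 ≤ 2 * b1 * b ^ 2 * x * (e ^ 4 * x) := by positivity
    have k5 : 1 ≤ (1 + F1 ^ 2) ^ 2 := one_le_pow₀ (by nlinarith [sq_nonneg F1])
    calc 2 * F1 * F2 ^ 2 ≤ 2 * b1 * b ^ 2 * x * (e ^ 4 * x) * (e ^ 8 * x ^ 5) := by rw [← k2]; exact k1
      _ ≤ 2 * b1 * b ^ 2 * x * (e ^ 4 * x) * 1 := mul_le_mul_of_nonneg_left k3 k4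
      _ ≤ σ * (e ^ 4 * x) * 1 := by gcongr
      _ ≤ _ := mul_le_mul_of_nonneg_left k5 (by positivity)
  linarith

lemma hE1_a {K c0 α w e x g : ℝ} (hK : 0 < K) (hc0 : 0 < c0) (hα : 0 < α) (hw : 0 < w) (e0 : 0 < e) (hx0 : 0 < x)
    (q1 : α * (e * x) ≤ g) : K * (e ^ 4 * x ^ 2) ≤ c0 * g ^ 3 * (K / (c0 * α ^ 3 * w) * (w * (e / x))) := by
  have : c0 * (α * (e * x)) ^ 3 * (K / (c0 * α ^ 3 * w) * (w * (e / x))) ≤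
    c0 * g ^ 3 * (K / (c0 * α ^ 3 * w) * (w * (e / x))) := by gcongr
  refine le_trans (le_of_eq ?_) this
  field_simp

lemma F1_a {K c0 α cm ε e x g g1 : ℝ} (hε : 0 < ε) (hc0 : 0 < c0) (hα : 0 < α) (hcm : 0 < cm) (e0 : 0 < e) (hx0 : 0 < x)
    (q0 : 0 < g) (q1 : α * (e * x) ≤ g) (q3 : cm * g ≤ x * g1) (s2 : K * e ≤ 3 / 10 * ε * c0 * cm * α ^ 3) :
    K * (e ^ 4 * x ^ 2) ≤ 3 / 10 * ε * (c0 * g ^ 2 * g1) := by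
  have h1 : cm * g / x ≤ g1 := by rw [div_le_iff₀ hx0]; linarith
  have h2 : 3 / 10 * ε * (c0 * g ^ 2 * (cm * g / x)) ≤ 3 / 10 * ε * (c0 * g ^ 2 * g1) := by gcongr
  refine le_trans ?_ h2
  have h3 : 3 / 10 * ε * (c0 * cm * ((α * (e * x)) ^ 3 / x)) ≤ 3 / 10 * ε * (c0 * cm * (g ^ 3 / x)) := by gcongr
  calc K * (e ^ 4 * x ^ 2) = K * e * (e ^ 3 * x ^ 2) := by ring
    _ ≤ 3 / 10 * ε * c0 * cm * α ^ 3 * (e ^ 3 * x ^ 2) := by gcongr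
    _ = 3 / 10 * ε * (c0 * cm * ((α * (e * x)) ^ 3 / x)) := by field_simp
    _ ≤ _ := h3
    _ = _ := by ring

lemma hθ_a {ε h θ lam cr x g g1 : ℝ} (hx0 : 0 < x) (hh : 0 < h) (hθ0 : 0 < θ) (hθ1 : θ * (1 + h) = 1)
    (hε3 : ε * (10 * (1 + h)) ≤ h) (q0' : 0 < g1) (q5 : x * g1 ≤ cr * g) (hhd : 2 * h * cr = lam) :
    (1 + 10 * ε) * g1 ≤ θ * (g1 + lam * g / x) := by
  have i1 : (1 + 10 * ε) * (1 + h) ≤ 1 + 2 * h := by linarith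
  have i2 : 2 * h * g1 ≤ lam * g / x := by
    rw [le_div_iff₀ hx0, ← hhd]
    nlinarith
  have i3 : (1 + 10 * ε) * (1 + h) * g1 ≤ g1 + lam * g / x := by nlinarith
  calc (1 + 10 * ε) * g1 = (θ * (1 + h)) * ((1 + 10 * ε) * g1) := by rw [hθ1, one_mul]
    _ = θ * ((1 + 10 * ε) * (1 + h) * g1) := by ring
    _ ≤ _ := mul_le_mul_of_nonneg_left i3 hθ0.le

lemma F2_a {A B e x : ℝ} (hx0 : 0 < x) (e0 : 0 < e) (e1 : e ≤ 1) (hA : 0 < A) (h1 : A ≤ B) :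
    A * (e ^ 4 * x ^ 2) ≤ B * (e ^ 3 * x) * x := by
  have hB : 0 < B := hA.trans_le h1
  calc A * (e ^ 4 * x ^ 2) = A * (e ^ 3 * x ^ 2) * e := by ring
    _ ≤ B * (e ^ 3 * x ^ 2) * 1 := by gcongr
    _ = _ := by ring

lemma Fj_a {A B α e x g : ℝ} (hx0 : 0 < x) (e0 : 0 < e) (hB : 0 < B) (h1 : A ≤ α * B) (q1 : α * (e * x) ≤ g) :
    A * (e ^ 4 * x ^ 2) ≤ B * (g * (e ^ 3 * x)) := by
  calc A * (e ^ 4 * x ^ 2) ≤ α * B * (e ^ 4 * x ^ 2) := by gcongr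
    _ = B * ((α * (e * x)) * (e ^ 3 * x)) := by ring
    _ ≤ _ := by gcongr

set_option maxHeartbeats 1000000 in
lemma exists_wall {m c0 lam a b : ℝ} (hm : 0 < m) (hc0 : 0 < c0) (hlam : 2 < lam) (ha : 0 < a) (hb : 0 < b) :
    ∃ ε θ cr cm α β K : ℝ, 0 < ε ∧ ε ≤ 1 / 20 ∧ 1 ≤ cr ∧ 0 < cm ∧ 0 < α ∧ 0 < β ∧ 0 < K ∧
    ∀ d ηm : ℝ, 0 < d → 0 < ηm → ∃ d3 M' L0 : ℝ, 0 < M' ∧ 0 < L0 ∧ L0 ≤ 1 ∧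
    ∀ L : ℝ, 0 < L → L ≤ L0 → ∀ f : ℝ → ℝ, WH lam a b d (a * cm / 80) L f →
    ∃ g g1 E E1 : ℝ → ℝ, Wall L m c0 ε θ lam ((3 * lam - 2) / 4) cr b d3 K M' ηm g g1
      (ThP f) (Th1 f) (Th2 f) (fun x => x ^ lam) (fun x => x ^ ((3 * lam - 2) / 4)) E E1 ∧
      ∀ x ∈ Ioo 0 L, α * (x ^ ((lam - 2) / 4) * x) ≤ g x ∧ g x ≤ β * (x ^ ((lam - 2) / 4) * x) ∧
        cm * g x ≤ x * g1 x ∧ 0 ≤ ThP f x ∧ ThP f x ≤ 1 := by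
  obtain ⟨κ, hκd⟩ : ∃ κ, κ = 4 / (3 * m * c0) := ⟨_, rfl⟩
  have hκ : 0 < κ := by rw [hκd]; positivity
  have hl1 : 0 < lam + 1 := by linarith
  have hl2 : 0 < lam + 2 := by linarith
  obtain ⟨n1, hn1d⟩ : ∃ n1, n1 = (3 * lam - 2) / 4 := ⟨_, rfl⟩
  have hn1 : 1 ≤ n1 := by rw [hn1d]; linarith
  obtain ⟨w, hwd⟩ : ∃ w, w = (lam - 2) / 4 := ⟨_, rfl⟩
  have hw : 0 < w := by rw [hwd]; linarith
  rw [← hn1d, ← hwd]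
  obtain ⟨b1, hb1d⟩ : ∃ b1, b1 = b / (lam + 1) := ⟨_, rfl⟩
  have hb1 : 0 < b1 := by rw [hb1d]; positivity
  obtain ⟨cr, hcrd⟩ : ∃ cr, cr = max 1 (b * (lam + 2) / (4 * (a / 2))) := ⟨_, rfl⟩
  have hcr : 1 ≤ cr := by rw [hcrd]; exact le_max_left _ _
  have hcr' : b * (lam + 2) / (4 * (a / 2)) ≤ cr := by rw [hcrd]; exact le_max_right _ _
  obtain ⟨cm, hcmd⟩ : ∃ cm, cm = a / 2 * (lam + 2) / (4 * b) := ⟨_, rfl⟩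
  have hcm : 0 < cm := by rw [hcmd]; positivity
  obtain ⟨α, hα⟩ : ∃ α, α = (κ * (a / 2 / (lam + 1) / (lam + 2))) ^ ((1 : ℝ) / 4) := ⟨_, rfl⟩
  obtain ⟨β, hβ⟩ : ∃ β, β = (κ * (b / (lam + 1) / (lam + 2))) ^ ((1 : ℝ) / 4) := ⟨_, rfl⟩
  have hα0 : 0 < α := by rw [hα]; positivity
  have hβ0 : 0 < β := by rw [hβ]; positivity
  have hcr0 : 0 < cr := by linarith
  obtain ⟨h, hhd⟩ : ∃ h, h = lam / (2 * cr) := ⟨_, rfl⟩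
  have hh : 0 < h := by rw [hhd]; apply div_pos <;> linarith
  obtain ⟨ε, hεd⟩ : ∃ ε, ε = min (1 / 20) (min (1 / (40 * cr)) (h / (10 * (1 + h)))) := ⟨_, rfl⟩
  have hε : 0 < ε := by rw [hεd]; positivity
  have hε1 : ε ≤ 1 / 20 := by rw [hεd]; exact min_le_left _ _
  have hε2 : ε ≤ 1 / (40 * cr) := by rw [hεd]; exact (min_le_right _ _).trans (min_le_left _ _)
  have hε3 : ε ≤ h / (10 * (1 + h)) := by rw [hεd]; exact (min_le_right _ _).trans (min_le_right _ _)
  rw [le_div_iff₀ (by positivity)] at hε3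
  rw [le_div_iff₀ (by positivity)] at hε2
  obtain ⟨θ, hθd⟩ : ∃ θ, θ = 1 / (1 + h) := ⟨_, rfl⟩
  have hθ0 : 0 < θ := by rw [hθd]; positivity
  have hθ1 : θ * (1 + h) = 1 := by rw [hθd]; field_simp
  have h1θ : 0 < 1 - θ := by
    rw [sub_pos, hθd, div_lt_one (by positivity)]; linarith
  obtain ⟨K, hKd⟩ : ∃ K, K = 5 * c0 * b / (1 - θ) := ⟨_, rfl⟩
  have hK : 0 < K := by rw [hKd]; positivity
  have h2h : 2 * h * cr = lam := by rw [hhd]; field_simp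
  have hKθ : 5 * c0 * b ≤ K * (1 - θ) := by rw [hKd, div_mul_cancel₀ _ h1θ.ne']
  clear hKd hθd hεd hcrd
  refine ⟨ε, θ, cr, cm, α, β, K, hε, hε1, hcr, hcm, hα0, hβ0, hK, ?_⟩
  intro d ηm hd hηm
  obtain ⟨d3, hd3d⟩ : ∃ d3, d3 = d + 2 * b1 * b ^ 2 := ⟨_, rfl⟩
  have hd3 : 0 < d3 := by rw [hd3d]; positivity
  have hn0 : 0 < n1 := by linarith
  obtain ⟨M', hM'd⟩ : ∃ M', M' = 14 * cr ^ 2 * K / n1 + 5 * (2 * cr * b + d3) / (m * n1 * α) := ⟨_, rfl⟩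
  have hM' : 0 < M' := by rw [hM'd]; positivity
  have hM1 : 14 * cr ^ 2 * K ≤ M' * n1 := by
    rw [hM'd, add_mul, div_mul_cancel₀ _ (by positivity)]
    have : 0 ≤ 5 * (2 * cr * b + d3) / (m * n1 * α) * n1 := by positivity
    linarith
  have hM2 : 5 * (2 * cr * b + d3) ≤ α * (m * n1 * M') := by
    have h1 : α * (m * n1 * M') = α * m * (14 * cr ^ 2 * K) + 5 * (2 * cr * b + d3) := by
      rw [hM'd]; field_simp
    rw [h1]
    have : 0 ≤ α * m * (14 * cr ^ 2 * K) := by positivity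
    linarith
  clear hM'd
  obtain ⟨CE, hCEd⟩ : ∃ CE, CE = K / (c0 * α ^ 3 * w) := ⟨_, rfl⟩
  have hCE : 0 < CE := by rw [hCEd]; positivity
  obtain ⟨u, hu, hS⟩ := mem_nhdsGT_iff_exists_Ioo_subset.1
    ((ev_e hw CE (by positivity : 0 < ε / 10)).and ((ev_e hw K (by positivity : 0 < 3 / 10 * ε * c0 * cm * α ^ 3)).and
    ((ev_e hw β (by positivity : (0:ℝ) < 1)).and ((ev_e hw (m * n1 * c0 * β) (by positivity : 0 < ε / 5)).and
    ((ev_e one_pos 3 hηm).and ((ev_e one_pos b1 (by positivity : 0 < ε / 50)).and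
    ((ev_e one_pos (b1 * b) (by positivity : 0 < ε / 20 * cm)).and
    (ev_e one_pos (2 * b1 * b ^ 2) (by positivity : 0 < a * cm / 80)))))))))
  refine ⟨d3, M', min u (min 1 (1 / b1)), hM', lt_min hu (by positivity),
    (min_le_right _ _).trans (min_le_left _ _), ?_⟩
  intro L hL0 hLL f H
  have hL1 : L ≤ 1 := hLL.trans ((min_le_right _ _).trans (min_le_left _ _))
  have hLb : b1 * L ≤ 1 := by
    have : L ≤ 1 / b1 := hLL.trans ((min_le_right _ _).trans (min_le_right _ _))
    rw [le_div_iff₀ hb1] at this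
    linarith
  have hLb' := hLb
  rw [hb1d] at hLb'
  have hLu : L ≤ u := hLL.trans (min_le_left _ _)
  have hsm : ∀ x ∈ Ioo 0 L, CE * x ^ w ≤ ε / 10 ∧ K * x ^ w ≤ 3 / 10 * ε * c0 * cm * α ^ 3 ∧ β * x ^ w ≤ 1 ∧
      m * n1 * c0 * β * x ^ w ≤ ε / 5 ∧ 3 * x ≤ ηm ∧ b1 * x ≤ ε / 50 ∧ b1 * b * x ≤ ε / 20 * cm ∧
      2 * b1 * b ^ 2 * x ≤ a * cm / 80 := fun x hx => by
    have := hS (⟨hx.1, hx.2.trans_le hLu⟩ : x ∈ Ioo 0 u)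
    simpa only [mem_ofPred_eq, rpow_one] using this
  have hgb : ∀ x ∈ Ioo 0 L, 0 < gW κ f x ∧ 0 < g1W κ f x ∧ HasDerivAt (gW κ f) (g1W κ f x) x ∧
      α * (x ^ w * x) ≤ gW κ f x ∧ gW κ f x ≤ β * (x ^ w * x) ∧
      cm * gW κ f x ≤ x * g1W κ f x ∧ x * g1W κ f x ≤ (b * (lam + 2) / (4 * (a / 2))) * gW κ f x ∧
      ThP f x = 3 / (3 * (κ / 4)) * gW κ f x ^ 3 * g1W κ f x := fun x hx => by
    rw [hα, hβ, hcmd, hwd]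
    exact H.gb hlam ha hb hL1 hLb' hκ hx
  have hcc : 3 / (3 * (κ / 4)) = 3 * m * c0 := by rw [hκd]; field_simp
  rw [hcc] at hgb
  have hgc : ∀ x ∈ Ioo 0 L, x * g1W κ f x ≤ cr * gW κ f x := fun x hx => by
    obtain ⟨q0, -, -, -, -, -, q, -⟩ := hgb x hx
    exact q.trans (mul_le_mul_of_nonneg_right hcr' q0.le)
  have hx01 : ∀ x ∈ Ioo 0 L, 0 < x ∧ x ≤ 1 ∧ 0 < x ^ w ∧ x ^ w ≤ 1 := fun x hx =>
    ⟨hx.1, hx.2.le.trans hL1, rpow_pos_of_pos hx.1 _, rpow_le_one hx.1.le (hx.2.le.trans hL1) hw.le⟩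
  have hpe : ∀ x ∈ Ioo 0 L, ∀ (n : ℕ) (p : ℝ), p = lam - 2 + n → x ^ p = (x ^ w) ^ 4 * x ^ n := fun x hx n p hp => by
    rw [hwd]; exact pow_e hx.1 n p hp
  have hye : ∀ x ∈ Ioo 0 L, x ^ lam = (x ^ w) ^ 4 * x ^ 2 := fun x hx =>
    hpe x hx 2 lam (by push_cast; ring)
  have hze : ∀ x ∈ Ioo 0 L, x ^ n1 = (x ^ w) ^ 3 * x := fun x hx => by
    rw [← rpow_natCast, ← rpow_mul hx.1.le, show n1 = w * (3 : ℕ) + 1 by rw [hn1d, hwd]; push_cast; ring,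
      rpow_add hx.1, rpow_one]
  have hbas := fun x (hx : x ∈ Ioo 0 L) => H.basic (by linarith) ha hb hL1 hLb' ⟨hx.1.le, hx.2⟩
  have hTh := fun x (hx : x ∈ Ioo 0 L) => H.Th (by linarith) ha hb hL1 hLb' ⟨hx.1.le, hx.2⟩
  rw [← hb1d] at hbas hTh
  have hThle : ∀ x ∈ Ioo 0 L, 0 ≤ ThP f x ∧ ThP f x ≤ b1 * x := fun x hx => by
    have h1 := hTh x hx
    have h2 := hx01 x hx
    have h3 : x ^ (lam + 1) ≤ x := by
      have := rpow_le_rpow_of_exponent_ge' h2.1.le h2.2.1 (by norm_num : (0 : ℝ) ≤ 1) (by linarith : 1 ≤ lam + 1)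
      rwa [rpow_one] at this
    have := rpow_pos_of_pos h2.1 (lam + 1)
    exact ⟨le_trans (by positivity) h1.1, h1.2.trans (mul_le_mul_of_nonneg_left h3 hb1.le)⟩
  have hylt : ∀ x ∈ Ioo 0 L, x ^ lam ≤ 1 := fun x hx =>
    rpow_le_one hx.1.le (hx.2.le.trans hL1) (by linarith)
  have hT1 : ∀ x ∈ Ioo 0 L, 0 ≤ Th1 f x := fun x hx => by
    have := rpow_pos_of_pos hx.1 lam
    exact le_trans (by positivity) (hbas x hx).2.2.2.1
  have hF2 : ∀ x ∈ Ioo 0 L, 0 ≤ deriv (deriv f) x := fun x hx => by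
    have := rpow_pos_of_pos hx.1 lam
    exact le_trans (by positivity) (H.lo x ⟨hx.1.le, hx.2⟩)
  have hgx : ∀ x ∈ Ioo 0 L, gW κ f x ≤ x := fun x hx => by
    obtain ⟨-, -, -, -, q2, -, -, -⟩ := hgb x hx
    obtain ⟨-, -, s3, -⟩ := hsm x hx
    have := mul_le_mul_of_nonneg_right s3 hx.1.le
    linarith
  have jr : ∀ x ∈ Ioo 0 L, cm / x ≤ g1W κ f x / gW κ f x := fun x hx => by
    obtain ⟨q0, -, -, -, -, q3, -, -⟩ := hgb x hx
    rw [div_le_div_iff₀ hx.1 q0]; linarith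
  refine ⟨gW κ f, g1W κ f, fun x => CE * x ^ w, fun x => CE * (w * x ^ (w - 1)), ?_, ?_⟩
  swap
  · intro x hx
    obtain ⟨-, -, -, q1, q2, q3, -, -⟩ := hgb x hx
    obtain ⟨-, -, -, -, -, s6, -, -⟩ := hsm x hx
    have := hThle x hx
    exact ⟨q1, q2, q3, this.1, by linarith⟩
  refine { hm := hm, hL := hL1, hc0 := hc0, hε := hε, hε' := hε1, hθ0 := hθ0, hlam := by linarith, hn1 := hn1,
           hcr := hcr, hd2 := hb, hd3 := hd3, hK := hK, hM' := hM', hKθ := hKθ, hn := by linarith,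
           g_pos := fun x hx => (hgb x hx).1, g1_pos := fun x hx => (hgb x hx).2.1, dg := fun x hx => (hgb x hx).2.2.1,
           g_le := hgx, g_eta := ?_, g1_le := hgc, y_pos := fun x hx => rpow_pos_of_pos hx.1 _, dy := ?_,
           z_pos := fun x hx => rpow_pos_of_pos hx.1 _,
           z_le := fun x hx => rpow_le_one hx.1.le (hx.2.le.trans hL1) (by linarith), dz := ?_,
           hTh := fun x hx => (hgb x hx).2.2.2.2.2.2.2, dTh := fun x _ => dThP H.cd x, dTh1 := fun x _ => dTh1 H.cd x, Th1_nonneg := hT1,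
           Th1_le := fun x hx => (hbas x hx).2.2.2.2, Th2_le := ?_, Th2_ge := ?_, dE := ?_, E_nonneg := ?_, E_le := ?_,
           hE1 := ?_, F1 := ?_, hθ := ?_, F2 := ?_, Fj := ?_, Fm := ?_, cosT := ?_,sinT := ?_ }
  · intro x hx
    obtain ⟨q0, -, -, -, q2, -, -, -⟩ := hgb x hx
    obtain ⟨-, -, s3, -, s5, -⟩ := hsm x hx
    have hx0 := hx.1
    have h1 := hgx x hx
    have h2 : gW κ f x ^ 3 ≤ x := by
      have h3 : gW κ f x ^ 3 ≤ x ^ 3 := pow_le_pow_left₀ q0.le h1 3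
      have := (hx01 x hx).2.1
      have : x ^ 3 ≤ x := pow_le_of_le_one hx0.le this (by norm_num)
      linarith
    have h4 : 0 < gW κ f x ^ 3 := pow_pos q0 3
    have h5 : ε * gW κ f x ^ 3 ≤ 1 / 20 * gW κ f x ^ 3 := mul_le_mul_of_nonneg_right hε1 h4.le
    linarith
  · intro x hx
    refine (Real.hasDerivAt_rpow_const (Or.inl hx.1.ne')).congr_deriv ?_
    rw [rpow_sub_one hx.1.ne']; ring
  · intro x hx
    refine (Real.hasDerivAt_rpow_const (Or.inl hx.1.ne')).congr_deriv ?_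
    rw [rpow_sub_one hx.1.ne']; ring
  · intro x hx
    have hx0 := hx.1
    obtain ⟨p1, p2, p3, p4, p5⟩ := hbas x hx
    have h3 := H.d3 x ⟨hx.1.le, hx.2⟩
    have hhi := H.hi x ⟨hx.1.le, hx.2⟩
    rw [hpe x hx 1 (lam - 1) (by push_cast; ring), pow_one] at h3
    rw [hpe x hx 3 (lam + 1) (by push_cast; ring)] at p2
    show _ ≤ d3 * x ^ lam / x
    rw [hye x hx] at hhi ⊢
    obtain ⟨-, x1, e0, e1⟩ := hx01 x hx
    rw [show d3 * ((x ^ w) ^ 4 * x ^ 2) / x = d3 * ((x ^ w) ^ 4 * x) by field_simp, hd3d]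
    exact th2_a hx0 x1 e0 e1 hb hb1 (hF2 x hx) p1 hd h3 p2 hhi
  · intro x hx
    have hx0 := hx.1
    obtain ⟨p1, p2, p3, p4, p5⟩ := hbas x hx
    have h3 := H.d3' x ⟨hx.1.le, hx.2⟩
    have hhi := H.hi x ⟨hx.1.le, hx.2⟩
    obtain ⟨-, -, -, -, -, -, -, s8⟩ := hsm x hx
    rw [hpe x hx 1 (lam - 1) (by push_cast; ring), pow_one] at h3
    rw [hpe x hx 3 (lam + 1) (by push_cast; ring)] at p2
    rw [hye x hx] at hhi p4
    obtain ⟨-, x1, e0, e1⟩ := hx01 x hx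
    have jr2 : 1 / 20 * (a / 2 * ((x ^ w) ^ 4 * x ^ 2)) * (cm / x) ≤ 1 / 20 * Th1 f x * (g1W κ f x / gW κ f x) :=
      mul_le_mul (mul_le_mul_of_nonneg_left p4 (by norm_num)) (jr x hx) (by positivity)
        (mul_nonneg (by norm_num) (hT1 x hx))
    refine le_trans ?_ jr2
    rw [show 1 / 20 * (a / 2 * ((x ^ w) ^ 4 * x ^ 2)) * (cm / x) = 2 * (a * cm / 80) * ((x ^ w) ^ 4 * x) by field_simp; ring]
    exact th2_b hx0 x1 e0 e1 hb hb1 (hF2 x hx) p1 (by positivity) (by linarith) p2 hhi s8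
  · intro x hx
    exact (Real.hasDerivAt_rpow_const (Or.inl hx.1.ne')).const_mul CE
  · intro x hx
    exact mul_nonneg hCE.le (hx01 x hx).2.2.1.le
  · intro x hx
    exact (hsm x hx).1
  · intro x hx
    have hx0 := hx.1
    obtain ⟨q0, -, -, q1, -, -, -, -⟩ := hgb x hx
    obtain ⟨-, x1, e0, e1⟩ := hx01 x hx
    show K * x ^ lam ≤ _
    rw [hye x hx, rpow_sub_one hx0.ne', hCEd]
    exact hE1_a hK hc0 hα0 hw e0 hx0 q1
  · intro x hx
    obtain ⟨q0, q0', -, q1, -, q3, -, -⟩ := hgb x hx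
    obtain ⟨-, s2, -⟩ := hsm x hx
    obtain ⟨hx0, x1, e0, e1⟩ := hx01 x hx
    show K * x ^ lam ≤ _
    rw [hye x hx]
    exact F1_a hε hc0 hα0 hcm e0 hx0 q0 q1 q3 s2
  · intro x hx
    exact hθ_a hx.1 hh hθ0 hθ1 hε3 (hgb x hx).2.1 (hgc x hx) h2h
  · intro x hx
    obtain ⟨hx0, x1, e0, e1⟩ := hx01 x hx
    show _ * x ^ lam ≤ M' * n1 * x ^ n1 * x
    rw [hye x hx, hze x hx]
    exact F2_a hx0 e0 e1 (by positivity) hM1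
  · intro x hx
    obtain ⟨q0, -, -, q1, -, -, -, -⟩ := hgb x hx
    obtain ⟨hx0, x1, e0, e1⟩ := hx01 x hx
    show _ * x ^ lam ≤ m * n1 * M' * (_ * x ^ n1)
    rw [hye x hx, hze x hx]
    exact Fj_a hx0 e0 (by positivity) hM2 q1
  · intro x hx
    obtain ⟨q0, -, -, -, q2, -, -, -⟩ := hgb x hx
    obtain ⟨-, -, -, s4, -⟩ := hsm x hx
    have h1 : m * n1 * c0 * gW κ f x ≤ m * n1 * c0 * (β * (x ^ w * x)) :=
      mul_le_mul_of_nonneg_left q2 (by positivity)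
    have h2 := mul_le_mul_of_nonneg_right s4 hx.1.le
    linarith
  · intro x hx
    obtain ⟨-, -, -, -, -, s6, -⟩ := hsm x hx
    have h1 := hThle x hx
    have h2 := Real.one_sub_sq_div_two_le_cos (x := ThP f x)
    have h3 : ThP f x ^ 2 ≤ ThP f x := pow_le_of_le_one h1.1 (by linarith) (by norm_num)
    linarith
  · intro x hx
    obtain ⟨-, -, -, -, -, -, s7, -⟩ := hsm x hx
    obtain ⟨hx0, x1, e0, e1⟩ := hx01 x hx
    have h1 := hThle x hx
    have h2 : |sin (ThP f x)| ≤ b1 * x := (Real.abs_sin_le_abs).trans (by rw [abs_of_nonneg h1.1]; exact h1.2)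
    have h3 : Th1 f x ≤ b := (hbas x hx).2.2.2.2.trans (by nlinarith [hylt x hx])
    have jr' : cm ≤ cm / x := by
      rw [le_div_iff₀ hx0]; nlinarith
    calc |sin (ThP f x)| * Th1 f x ≤ b1 * x * b := mul_le_mul h2 h3 (hT1 x hx) (by positivity)
      _ = b1 * b * x := by ring
      _ ≤ ε / 20 * cm := s7
      _ ≤ _ := mul_le_mul_of_nonneg_left (jr'.trans (jr x hx)) (by positivity)

end Nozzle

namespace Nozzle

/-- The flow in physical wall coordinate `x` and stream function. -/
structure Sol (γ lam L m a1 a2 K2 : ℝ) (f qm : ℝ → ℝ) (q V R T Tx : ℝ → ℝ → ℝ) : Prop where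
  cqm : ContinuousOn qm (Ioo 0 L)
  qm0 : Tendsto qm (nhdsWithin 0 (Ioi 0)) (nhds (cstar γ))
  qm_ge : ∀ x ∈ Ioo 0 L, cstar γ ≤ qm x
  qm_le : ∀ x ∈ Ioo 0 L, qm x ≤ (cstar γ + qmaxF γ) / 2
  qm_le' : ∀ x ∈ Ioo 0 L, qm x ≤ 3 / 2 * cstar γ
  cosT : ∀ x ∈ Ioo 0 L, 3 / 4 ≤ cos (ThP f x)
  inv : ∀ x ∈ Ioo 0 L, AplusInv γ (q x m) = qm x
  q_le : ∀ x ∈ Ioo 0 L, ∀ ψ ∈ Icc 0 m, q x ψ ≤ 0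
  q0 : ∀ ψ ∈ Icc 0 m, Tendsto (fun x => q x ψ) (nhdsWithin 0 (Ioi 0)) (nhds 0)
  dqx : ∀ x ∈ Ioo 0 L, ∀ ψ ∈ Icc 0 m, HasDerivAt (fun x => q x ψ) (-(V x ψ) * (qm x / cos (ThP f x))) x
  dqy : ∀ x ∈ Ioo 0 L, ∀ ψ ∈ Icc 0 m, HasDerivWithinAt (q x) (R x ψ) (Icc 0 m) ψ
  V_ge : ∀ x ∈ Ioo 0 L, ∀ ψ ∈ Icc 0 m, a1 * x ^ (lam + 1) ≤ V x ψ
  V_le : ∀ x ∈ Ioo 0 L, ∀ ψ ∈ Icc 0 m, V x ψ ≤ a2 * x ^ (lam + 1)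
  R_le : ∀ x ∈ Ioo 0 L, ∀ ψ ∈ Icc 0 m, |R x ψ| ≤ a2 * x ^ (3 * lam / 2 + 1)
  Vx : ∀ x ∈ Ioo 0 L, ∀ x' ∈ Ioo 0 L, x ≤ x' → ∀ ψ ∈ Icc 0 m, |V x' ψ - V x ψ| ≤ K2 * x' ^ lam * (x' - x)
  Vy : ∀ x ∈ Ioo 0 L, ∀ ψ ∈ Icc 0 m, ∀ ψ' ∈ Icc 0 m, |V x ψ' - V x ψ| ≤ K2 * x ^ (5 * lam / 4 + 1 / 2) * |ψ' - ψ|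
  Rx : ∀ x ∈ Ioo 0 L, ∀ x' ∈ Ioo 0 L, x ≤ x' → ∀ ψ ∈ Icc 0 m,
    |R x' ψ - R x ψ| ≤ K2 * x' ^ (5 * lam / 4 + 1 / 2) * (x' - x)
  Ry : ∀ x ∈ Ioo 0 L, ∀ ψ ∈ Icc 0 m, ∀ ψ' ∈ Icc 0 m, |R x ψ' - R x ψ| ≤ K2 * x ^ (3 * lam / 2 + 1) * |ψ' - ψ|
  hb : ∀ x ∈ Ioo 0 L, ∀ ψ ∈ Icc 0 m, bfun γ (q x ψ) * R x ψ = -(Tx x ψ * (cos (ThP f x) / qm x))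
  dTx : ∀ x ∈ Ioo 0 L, ∀ ψ ∈ Icc 0 m, HasDerivAt (fun x => T x ψ) (Tx x ψ) x
  dTy : ∀ x ∈ Ioo 0 L, ∀ ψ ∈ Icc 0 m, HasDerivWithinAt (T x) (V x ψ) (Icc 0 m) ψ
  T0 : ∀ x ∈ Ioo 0 L, T x 0 = 0
  Tm : ∀ x ∈ Ioo 0 L, T x m = ThP f x
  cTx : ContinuousOn (fun p : ℝ × ℝ => Tx p.1 p.2) (Ioo 0 L ×ˢ Icc 0 m)
  Tx_le : ∀ x ∈ Ioo 0 L, ∀ ψ ∈ Icc 0 m, |Tx x ψ| ≤ K2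
  T_le : ∀ x ∈ Ioo 0 L, ∀ ψ ∈ Icc 0 m, |T x ψ| ≤ K2 * x

lemma pow_g {w x : ℝ} (hx : 0 < x) (n k : ℕ) (p : ℝ) (hp : p = w * n + k) :
    x ^ p = (x ^ w) ^ n * x ^ k := by
  rw [hp, rpow_add hx, rpow_natCast, ← rpow_natCast (x ^ w), ← rpow_mul hx.le]

/-- model growth: pointwise consequences -/
lemma gw1 {α β cm cr g g1 e x c : ℝ} (hx : 0 < x) (he : 0 < e) (hα : 0 < α) (hcm : 0 < cm) (hcr : 0 < cr) (hc : 0 < c)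
    (h1 : α * (e * x) ≤ g) (h2 : g ≤ β * (e * x)) (h3 : cm * g ≤ x * g1) (h4 : x * g1 ≤ cr * g) :
    3 * c * cm * α ^ 4 * (e ^ 4 * x ^ 3) ≤ 3 * c * g ^ 3 * g1 ∧
    3 * c * g ^ 3 * g1 ≤ 3 * c * cr * β ^ 4 * (e ^ 4 * x ^ 3) := by
  have hg : 0 < g := lt_of_lt_of_le (by positivity) h1
  have h3' : cm * g / x ≤ g1 := by rw [div_le_iff₀ hx]; linarith
  have h4' : g1 ≤ cr * g / x := by rw [le_div_iff₀ hx]; linarith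
  constructor
  · calc 3 * c * cm * α ^ 4 * (e ^ 4 * x ^ 3) = 3 * c * cm * ((α * (e * x)) ^ 4 / x) := by field_simp
      _ ≤ 3 * c * cm * (g ^ 4 / x) := by gcongr
      _ = 3 * c * g ^ 3 * (cm * g / x) := by ring
      _ ≤ _ := by gcongr
  · calc 3 * c * g ^ 3 * g1 ≤ 3 * c * g ^ 3 * (cr * g / x) := by gcongr
      _ = 3 * c * cr * (g ^ 4 / x) := by ring
      _ ≤ 3 * c * cr * ((β * (e * x)) ^ 4 / x) := by gcongr
      _ = _ := by field_simp

lemma gw2 {A B s0 K β g g' e y : ℝ} (hs : 0 < s0) (hK : 0 < K) (hg : 0 < g) (hg' : 0 < g') (hy : 0 < y) (h2 : g ≤ β * e)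
    (h2' : g' ≤ β * e) (hA : |A| ≤ 2 * s0 * g) (hB : |B| ≤ K * (g' * y)) :
    |A * B| ≤ 2 * s0 * K * β ^ 2 * (e ^ 2 * y) := by
  rw [abs_mul]
  have hb : 0 < β * e := hg.trans_le h2
  calc |A| * |B| ≤ (2 * s0 * g) * (K * (g' * y)) := mul_le_mul hA hB (abs_nonneg _) (by positivity)
    _ ≤ (2 * s0 * (β * e)) * (K * (β * e * y)) := by gcongr
    _ = _ := by ring

/-- bound for r -/
lemma rr_bd {G r ε : ℝ} (hG : 0 < G) (hε' : ε ≤ 1 / 20) (h0 : 0 < r) (h : 3 * G ^ 3 * r ≤ 1 + 2 * ε) : |r| ≤ 1 / 2 / G ^ 3 := by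
  rw [abs_of_pos h0, le_div_iff₀ (by positivity)]
  linarith

lemma srn {s r N s0 g g1 cr x β e : ℝ} (hs0 : 0 < s0) (hg : 0 < g) (hx : 0 < x) (hcr : 0 < cr) (hs : |s| ≤ 2 * s0 * g)
    (hr : |r| ≤ 1 / 2 / g ^ 3) (hg1 : 0 < g1)
    (hN : |N| ≤ 6 * g ^ 2 * g1) (h4 : x * g1 ≤ cr * g) (h2 : g ≤ β * (e * x)) : |s * r * N| ≤ 6 * s0 * cr * β * e := by
  rw [abs_mul, abs_mul]
  have h4' : g1 ≤ cr * g / x := by rw [le_div_iff₀ hx]; linarith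
  calc |s| * |r| * |N| ≤ (2 * s0 * g) * (1 / 2 / g ^ 3) * (6 * g ^ 2 * g1) :=
        mul_le_mul (mul_le_mul hs hr (abs_nonneg _) (by positivity)) hN (abs_nonneg _) (by positivity)
    _ = 6 * s0 * g1 := by field_simp
    _ ≤ 6 * s0 * (cr * (β * (e * x)) / x) := by
        refine mul_le_mul_of_nonneg_left (h4'.trans ?_) (by positivity)
        gcongr
    _ = _ := by field_simp

lemma srd {s r D s0 g K y x α e : ℝ} (hs0 : 0 < s0) (hx : 0 < x) (he : 0 < e) (hα : 0 < α) (hK : 0 < K) (hs : |s| ≤ 2 * s0 * g)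
    (hr : |r| ≤ 1 / 2 / g ^ 3) (hy : y = e ^ 4 * x ^ 2)
    (hD : |D| ≤ K * (g * y)) (h1 : α * (e * x) ≤ g) : |s * r * D| ≤ s0 * K / α * (e ^ 3 * x) := by
  rw [abs_mul, abs_mul]
  have hg : 0 < g := lt_of_lt_of_le (by positivity) h1
  have hy0 : 0 < y := by rw [hy]; positivity
  calc |s| * |r| * |D| ≤ (2 * s0 * g) * (1 / 2 / g ^ 3) * (K * (g * y)) :=
        mul_le_mul (mul_le_mul hs hr (abs_nonneg _) (by positivity)) hD (abs_nonneg _) (by positivity)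
    _ = s0 * K * y * (1 / g) := by field_simp
    _ ≤ s0 * K * y * (1 / (α * (e * x))) := by gcongr
    _ = _ := by rw [hy]; field_simp

lemma rx_bd {s0 K cr β M' ds s d d' g g' z e x h : ℝ} (hs0 : 0 < s0) (hK : 0 < K) (hcr : 0 < cr) (hM : 0 < M') (hx : 0 < x)
    (he : 0 < e) (he1 : e ≤ 1) (hβ : 0 < β) (hh : 0 ≤ h) (hg : 0 < g) (hgg : g ≤ g') (h2 : g' ≤ β * (e * x)) (hz : z = e ^ 3 * x)
    (h1 : |ds| ≤ 6 * s0 * cr * β * e * h) (hs : |s| ≤ 2 * s0 * g) (hd : |d'| ≤ K * (g' * (e ^ 4 * x ^ 2)))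
    (hdd : |d' - d| ≤ 2 * M' * (g' * z) * h) :
    |ds * d' + s * (d' - d)| ≤ (6 * s0 * cr * β ^ 2 * K + 4 * s0 * M' * β ^ 2) * (e ^ 5 * x ^ 3) * h := by
  have hg' := hg.trans_le hgg
  have k1 : |ds * d'| ≤ 6 * s0 * cr * β ^ 2 * K * (e ^ 5 * x ^ 3) * h := by
    rw [abs_mul]
    calc |ds| * |d'| ≤ (6 * s0 * cr * β * e * h) * (K * (g' * (e ^ 4 * x ^ 2))) :=
          mul_le_mul h1 hd (abs_nonneg _) (by positivity)
      _ ≤ (6 * s0 * cr * β * e * h) * (K * (β * (e * x) * (e ^ 4 * x ^ 2))) := by gcongr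
      _ = 6 * s0 * cr * β ^ 2 * K * (e ^ 5 * x ^ 3) * h * e := by ring
      _ ≤ 6 * s0 * cr * β ^ 2 * K * (e ^ 5 * x ^ 3) * h * 1 := by gcongr
      _ = _ := by ring
  have k2 : |s * (d' - d)| ≤ 4 * s0 * M' * β ^ 2 * (e ^ 5 * x ^ 3) * h := by
    rw [abs_mul]
    calc |s| * |d' - d| ≤ (2 * s0 * g) * (2 * M' * (g' * z) * h) := mul_le_mul hs hdd (abs_nonneg _) (by positivity)
      _ ≤ (2 * s0 * (β * (e * x))) * (2 * M' * (β * (e * x) * z) * h) := by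
        have := hgg.trans h2
        have : 0 < z := by rw [hz]; positivity
        gcongr
      _ = _ := by rw [hz]; ring
  refine (abs_add_le _ _).trans ?_
  linarith

lemma ry_bd {s0 K α β C6 ds s d d' g z e x h : ℝ} (hs0 : 0 < s0) (hK : 0 < K) (hα : 0 < α) (hC : 0 < C6) (hx : 0 < x)
    (he : 0 < e) (he1 : e ≤ 1) (hβ : 0 < β) (hh : 0 ≤ h) (hg : 0 < g) (h2 : g ≤ β * (e * x)) (hz : z = e ^ 3 * x)
    (h1 : |ds| ≤ s0 * K / α * (e ^ 3 * x) * h) (hs : |s| ≤ 2 * s0 * g) (hd : |d'| ≤ K * (g * (e ^ 4 * x ^ 2)))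
    (hdd : |d' - d| ≤ C6 * (g ^ 2 * z) * h) :
    |ds * d' + s * (d' - d)| ≤ (s0 * K / α * K * β + 2 * s0 * C6 * β ^ 3) * (e ^ 6 * x ^ 4) * h := by
  have k1 : |ds * d'| ≤ s0 * K / α * K * β * (e ^ 6 * x ^ 4) * h := by
    rw [abs_mul]
    calc |ds| * |d'| ≤ (s0 * K / α * (e ^ 3 * x) * h) * (K * (g * (e ^ 4 * x ^ 2))) :=
          mul_le_mul h1 hd (abs_nonneg _) (by positivity)
      _ ≤ (s0 * K / α * (e ^ 3 * x) * h) * (K * (β * (e * x) * (e ^ 4 * x ^ 2))) := by gcongr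
      _ = s0 * K / α * K * β * (e ^ 6 * x ^ 4) * h * e ^ 2 := by ring
      _ ≤ s0 * K / α * K * β * (e ^ 6 * x ^ 4) * h * 1 := by gcongr; exact pow_le_one₀ he.le he1
      _ = _ := by ring
  have k2 : |s * (d' - d)| ≤ 2 * s0 * C6 * β ^ 3 * (e ^ 6 * x ^ 4) * h := by
    rw [abs_mul]
    calc |s| * |d' - d| ≤ (2 * s0 * g) * (C6 * (g ^ 2 * z) * h) := mul_le_mul hs hdd (abs_nonneg _) (by positivity)
      _ ≤ (2 * s0 * (β * (e * x))) * (C6 * ((β * (e * x)) ^ 2 * z) * h) := by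
        have : 0 < z := by rw [hz]; positivity
        gcongr
      _ = _ := by rw [hz]; ring
  refine (abs_add_le _ _).trans ?_
  linarith

end Nozzle

namespace Nozzle

variable {γ L m c0 ε θ lam n1 cr d2 d3 K M' ηm s0 : ℝ} {g g1 Θ Θ1 Θ2 y z E E1 : ℝ → ℝ} {s r qt k Qf : ℝ → ℝ}
  {u w v : ℝ → ℝ → ℝ}
local notation "WallData" => Wall L m c0 ε θ lam n1 cr d2 d3 K M' ηm g g1 Θ Θ1 Θ2 y z E E1

lemma GasX.Q_le (GX : GasX γ ε s0 ηm s r qt k Qf) {η : ℝ} (h : η ∈ Ioo 0 ηm) : Qf η ≤ 0 := by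
  have h1 : AntitoneOn Qf (Ico 0 ηm) := by
    refine antitoneOn_of_deriv_nonpos (convex_Ico _ _) GX.cQ ?_ ?_
    · rw [interior_Ico]; intro t ht; exact (GX.dQ t ht).differentiableAt.differentiableWithinAt
    · rw [interior_Ico]; intro t ht; rw [(GX.dQ t ht).deriv]; linarith [GX.gas.s_pos t ht]
  rw [← GX.Q0]
  exact h1 ⟨le_rfl, GX.hηm⟩ ⟨h.1.le, h.2⟩ h.1.le

lemma Cls.eta_tendsto (U : Cls L m c0 ε n1 K M' g g1 y z u w v)
    (W : WallData) (hL : 0 < L) {ψ : ℝ} (hψ : ψ ∈ Icc (-m) m) :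
    Tendsto (fun x => eta u x ψ) (nhdsWithin 0 (Ioi 0)) (nhdsWithin 0 (Ico 0 ηm)) := by
  have hmem : ∀ᶠ x in nhdsWithin (0 : ℝ) (Ioi 0), x ∈ Ioo 0 L := Ioo_mem_nhdsGT hL
  refine tendsto_nhdsWithin_iff.2 ⟨?_, hmem.mono fun x hx => Ioo_subset_Ico_self (U.eta_mem W hx hψ)⟩
  have h2 : Tendsto (fun x : ℝ => 2 * x) (nhdsWithin 0 (Ioi 0)) (nhds 0) := by
    have : Tendsto (fun x : ℝ => 2 * x) (nhds 0) (nhds (2 * 0)) := (continuous_const.mul continuous_id).tendsto 0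
    rw [mul_zero] at this
    exact this.mono_left nhdsWithin_le_nhds
  refine tendsto_of_tendsto_of_tendsto_of_le_of_le' tendsto_const_nhds h2
    (hmem.mono fun x hx => (U.eta_mem W hx hψ).1.le) (hmem.mono fun x hx => ?_)
  have h3 := (abs_le.1 (U.eta_near hx hψ)).2
  have h4 := W.g_le x hx
  have h5 := W.g_pos x hx
  have h6 : g x ^ 3 ≤ g x := pow_le_of_le_one h5.le (h4.trans (hx.2.le.trans W.hL)) (by norm_num)
  have h7 : ε * g x ^ 3 ≤ 1 / 20 * g x ^ 3 := mul_le_mul_of_nonneg_right W.hε' (by positivity)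
  linarith [hx.1]

/-- half difference -/
def hd (F : ℝ → ℝ → ℝ) (x ψ : ℝ) : ℝ := (F x (-ψ) - F x ψ) / 2

lemma hd_le {F : ℝ → ℝ → ℝ} {x ψ C : ℝ} (h : |F x (-ψ) - F x ψ| ≤ C) : |hd F x ψ| ≤ C := by
  unfold hd
  rw [abs_div, abs_of_pos (by norm_num : (0 : ℝ) < 2)]
  linarith [abs_nonneg (F x (-ψ) - F x ψ)]

lemma half_sub {a b a' b' C : ℝ} (h1 : |a' - a| ≤ C) (h2 : |b' - b| ≤ C) : |(a' - b') / 2 - (a - b) / 2| ≤ C := by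
  rw [abs_le] at *
  constructor <;> linarith

lemma half_add {a b a' b' C : ℝ} (h1 : |a' - a| ≤ C) (h2 : |b' - b| ≤ C) : |(a' + b') / 2 - (a + b) / 2| ≤ C := by
  rw [abs_le] at *
  constructor <;> linarith

lemma Icc_sub {m ψ : ℝ} (hm : 0 < m) (h : ψ ∈ Icc 0 m) : ψ ∈ Icc (-m) m := ⟨by linarith [h.1], h.2⟩

lemma Cls.s_le (U : Cls L m c0 ε n1 K M' g g1 y z u w v)
    (W : WallData) (GX : GasX γ ε s0 ηm s r qt k Qf)
    {x ψ : ℝ} (hx : x ∈ Ioo 0 L) (hψ : ψ ∈ Icc (-m) m) :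
    |s (eta u x ψ)| ≤ 2 * s0 * g x ∧ |r (eta u x ψ)| ≤ 1 / 2 / g x ^ 3 := by
  have hη := U.eta_mem W hx hψ
  have hn := U.eta_near hx hψ
  have hg := W.g_pos x hx
  obtain ⟨h1, h2, -, -⟩ := GX.gas.r_bd W.hε W.hε' hg hη hn
  refine ⟨?_, rr_bd hg W.hε' h1 h2⟩
  have h3 := (abs_le.1 (GX.gas.s_near W.hε W.hε' hg hη hn)).2
  have h4 : 0 < s0 * g x := mul_pos GX.gas.hs0 hg
  rw [abs_of_pos (GX.gas.s_pos _ hη)]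
  have h5 : 2 / 5 * ε * (s0 * g x) ≤ 1 * (s0 * g x) := mul_le_mul_of_nonneg_right (by linarith [W.hε']) h4.le
  linarith

lemma Cls.w_le (U : Cls L m c0 ε n1 K M' g g1 y z u w v)
    (W : WallData)
    {x ψ : ℝ} (hx : x ∈ Ioo 0 L) (hψ : ψ ∈ Icc (-m) m) :
    |w x ψ| ≤ 6 * g x ^ 2 * g1 x ∧ |eta w x ψ| ≤ 6 * g x ^ 2 * g1 x ∧ |u x ψ| ≤ 2 * g x ^ 3 := by
  have hg := W.g_pos x hx
  have hg1 := W.g1_pos x hx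
  have hp : 0 < g x ^ 2 * g1 x := by positivity
  have hp3 : 0 < g x ^ 3 := by positivity
  have he : ε * (3 * g x ^ 2 * g1 x) ≤ 1 * (3 * g x ^ 2 * g1 x) :=
    mul_le_mul_of_nonneg_right (by linarith [W.hε']) (by positivity)
  have he' : ε * g x ^ 3 ≤ 1 * g x ^ 3 :=
    mul_le_mul_of_nonneg_right (by linarith [W.hε']) (by positivity)
  have h1 := abs_le.1 (U.c3 x hx ψ hψ)
  have h2 := abs_le.1 (U.etaw_near hx hψ)
  have h3 := abs_le.1 (U.c2 x hx ψ hψ)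
  refine ⟨?_, ?_, ?_⟩ <;> rw [abs_le] <;> constructor <;> linarith

/-- the product `g² g1` is bounded -/
lemma g2g1 {g g1 x cr : ℝ} (hg : 0 < g) (hx : 0 < x) (hgx : g ≤ x) (hx1 : x ≤ 1) (hcr : 0 < cr) (h4 : x * g1 ≤ cr * g) (h1 : 0 < g1) :
    6 * g ^ 2 * g1 ≤ 6 * cr := by
  have h4' : g1 ≤ cr * g / x := by rw [le_div_iff₀ hx]; linarith
  have h5 : g / x ≤ 1 := by rw [div_le_one hx]; exact hgx
  have h6 : cr * g / x ≤ cr := by rw [mul_div_assoc]; nlinarith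
  have h7 : g ^ 2 ≤ 1 := pow_le_one₀ hg.le (hgx.trans hx1)
  have := h4'.trans h6
  calc 6 * g ^ 2 * g1 ≤ 6 * 1 * cr := by gcongr
    _ = _ := by ring

end Nozzle

namespace Nozzle

/-- all the data of the constructed flow -/
structure Bun (γ L m c0 ε θ lam cr d2 d3 K M' ηm s0 α β cm : ℝ) (f g g1 E E1 s r qt k Qf : ℝ → ℝ)
    (u w v : ℝ → ℝ → ℝ) : Prop where
  W : Wall L m c0 ε θ lam ((3 * lam - 2) / 4) cr d2 d3 K M' ηm g g1 (ThP f) (Th1 f) (Th2 f) (fun x => x ^ lam)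
    (fun x => x ^ ((3 * lam - 2) / 4)) E E1
  GX : GasX γ ε s0 ηm s r qt k Qf
  U : Cls L m c0 ε ((3 * lam - 2) / 4) K M' g g1 (fun x => x ^ lam) (fun x => x ^ ((3 * lam - 2) / 4)) u w v
  hv : ∀ x ∈ Ioo 0 L, ∀ ψ ∈ Icc (-m) m, v x ψ = Sf m s qt (ThP f) u x ψ * w x ψ
  hbd : ∀ x ∈ Ioo 0 L, u x (-m) = u x m + 2 * ThP f x
  hvT : ∀ x ∈ Ioo 0 L, ∀ ψ ∈ Icc (-m) m, |v x ψ - ThP f x / m| ≤ 1 / 2 * K * (g x * x ^ lam)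
  hlam : 2 < lam
  hα : 0 < α
  hβ : 0 < β
  hcm : 0 < cm
  hL : 0 < L
  gr : ∀ x ∈ Ioo 0 L, α * (x ^ ((lam - 2) / 4) * x) ≤ g x ∧ g x ≤ β * (x ^ ((lam - 2) / 4) * x) ∧ cm * g x ≤ x * g1 x

variable {γ L m c0 ε θ lam cr d2 d3 K M' ηm s0 α β cm : ℝ} {f g g1 E E1 s r qt k Qf : ℝ → ℝ} {u w v : ℝ → ℝ → ℝ}
local notation "BunData" => Bun γ L m c0 ε θ lam cr d2 d3 K M' ηm s0 α β cm f g g1 E E1 s r qt k Qf u w v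

lemma Bun.pw (B : BunData) {x : ℝ} (hx : x ∈ Ioo 0 L) :
    ∃ e, 0 < e ∧ e ≤ 1 ∧ x ^ lam = e ^ 4 * x ^ 2 ∧ x ^ ((3 * lam - 2) / 4) = e ^ 3 * x ∧ x ^ (lam + 1) = e ^ 4 * x ^ 3 ∧
      x ^ (5 * lam / 4 + 1 / 2) = e ^ 5 * x ^ 3 ∧ x ^ (3 * lam / 2 + 1) = e ^ 6 * x ^ 4 ∧
      α * (e * x) ≤ g x ∧ g x ≤ β * (e * x) ∧ cm * g x ≤ x * g1 x := by
  have h0 := hx.1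
  have hl := B.hlam
  refine ⟨x ^ ((lam - 2) / 4), rpow_pos_of_pos h0 _, rpow_le_one h0.le (hx.2.le.trans B.W.hL) (by linarith),
    pow_g h0 4 2 _ (by push_cast; ring), ?_, pow_g h0 4 3 _ (by push_cast; ring), pow_g h0 5 3 _ (by push_cast; ring),
    pow_g h0 6 4 _ (by push_cast; ring), B.gr x hx⟩
  have := pow_g (w := (lam - 2) / 4) h0 3 1 ((3 * lam - 2) / 4) (by push_cast; ring)
  rw [this, pow_one]

lemma Bun.c_qm (B : BunData) :
    ContinuousOn (fun x => qt (eta u x m)) (Ioo 0 L) := by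
  have hm := B.W.hm
  have hmm : m ∈ Icc (-m) m := ⟨by linarith, le_rfl⟩
  intro x hx
  have h1 := (B.U.deta hx hmm).continuousAt
  have h2 := (B.GX.gas.dqt _ (B.U.eta_mem B.W hx hmm)).continuousAt
  exact (ContinuousAt.comp (f := fun x => eta u x m) h2 h1).continuousWithinAt

lemma Bun.Vb (B : BunData) {x ψ : ℝ}
    (hx : x ∈ Ioo 0 L) (hψ : ψ ∈ Icc (-m) m) :
    3 / 2 * c0 * cm * α ^ 4 * x ^ (lam + 1) ≤ eta v x ψ ∧ eta v x ψ ≤ 6 * c0 * cr * β ^ 4 * x ^ (lam + 1) := by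
  obtain ⟨e, he, he1, -, -, p1, -, -, h1, h2, h3⟩ := B.pw hx
  have W := B.W
  have h4 := W.g1_le x hx
  have hcr : 0 < cr := by linarith [W.hcr]
  have k1 := gw1 hx.1 he B.hα B.hcm hcr W.hc0 h1 h2 h3 h4
  rw [← W.ThM hx] at k1
  have k2 := (W.gy hx).2
  have k3 := abs_le.1 (B.hvT x hx ψ hψ)
  have k4 := abs_le.1 (B.hvT x hx (-ψ) (neg_mem hψ))
  have hT : 0 ≤ ThP f x / m := (mul_nonneg (by have := W.hc0; have := B.hcm; have := B.hα; have := hx.1; positivity)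
      (by have := hx.1; positivity) : (0 : ℝ) ≤ 3 * c0 * cm * α ^ 4 * (e ^ 4 * x ^ 3)).trans k1.1
  have k5 : ε / 10 * (ThP f x / m) ≤ 1 * (ThP f x / m) := mul_le_mul_of_nonneg_right (by linarith [W.hε']) hT
  have k6 : K * (g x * x ^ lam) ≤ ThP f x / m := by
    have : K * (g x * x ^ lam) ≤ ε / 10 * (ThP f x / m) := k2
    linarith
  unfold eta
  rw [p1]
  constructor <;> linarith

lemma Bun.Dl (B : BunData) {x ψ : ℝ}
    (hx : x ∈ Ioo 0 L) (hψ : ψ ∈ Icc (-m) m) : |hd v x ψ| ≤ K * (g x * x ^ lam) :=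
  hd_le (B.U.c4 x hx ψ hψ (-ψ) (neg_mem hψ))

lemma Bun.Rl (B : BunData) {x ψ : ℝ}
    (hx : x ∈ Ioo 0 L) (hψ : ψ ∈ Icc (-m) m) :
    |s (eta u x ψ) * hd v x ψ| ≤ 2 * s0 * K * β ^ 2 * x ^ (3 * lam / 2 + 1) := by
  obtain ⟨e, he, he1, p0, -, -, -, p1, h1, h2, h3⟩ := B.pw hx
  have hg := B.W.g_pos x hx
  have := gw2 B.GX.gas.hs0 B.W.hK hg hg (B.W.y_pos x hx) h2 h2 (B.U.s_le B.W B.GX hx hψ).1 (B.Dl hx hψ)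
  rw [p1]
  refine this.trans (le_of_eq ?_)
  rw [p0]; ring

lemma Bun.vx (B : BunData) {x x' ψ : ℝ}
    (hx : x ∈ Ioo 0 L) (hx' : x' ∈ Ioo 0 L) (hxx : x ≤ x') (hψ : ψ ∈ Icc (-m) m) :
    |v x' ψ - v x ψ| ≤ 2 * M' * (g x' * x' ^ ((3 * lam - 2) / 4)) * (x' - x) := by
  refine (B.U.c5 x hx x' hx' hxx ψ hψ).trans ?_
  have h1 := B.W.hM'
  have h2 := B.W.g_pos x' hx'
  have h3 := rpow_pos_of_pos hx'.1 ((3 * lam - 2) / 4)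
  have h4 : 0 ≤ x' - x := by linarith
  have h5 : 1 + ε ≤ 2 := by linarith [B.W.hε']
  gcongr

lemma Bun.Vx (B : BunData) {x x' ψ : ℝ}
    (hx : x ∈ Ioo 0 L) (hx' : x' ∈ Ioo 0 L) (hxx : x ≤ x') (hψ : ψ ∈ Icc (-m) m) :
    |eta v x' ψ - eta v x ψ| ≤ 2 * M' * β * x' ^ lam * (x' - x) := by
  obtain ⟨e, he, he1, p0, p1, -, -, -, h1, h2, h3⟩ := B.pw hx'
  refine (half_add (B.vx hx hx' hxx hψ) (B.vx hx hx' hxx (neg_mem hψ))).trans ?_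
  have hM := B.W.hM'
  have h4 : 0 ≤ x' - x := by linarith
  have hx0 := hx'.1
  rw [p0, p1]
  calc 2 * M' * (g x' * (e ^ 3 * x')) * (x' - x) ≤ 2 * M' * (β * (e * x') * (e ^ 3 * x')) * (x' - x) := by gcongr
    _ = _ := by ring

lemma Bun.Vy (B : BunData) {x ψ ψ' : ℝ}
    (hx : x ∈ Ioo 0 L) (hψ : ψ ∈ Icc (-m) m) (hψ' : ψ' ∈ Icc (-m) m) :
    |v x ψ' - v x ψ| ≤ c0 * M' * ((3 * lam - 2) / 4 + 2 * (1 + ε)) * β ^ 2 * x ^ (5 * lam / 4 + 1 / 2) * |ψ' - ψ| := by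
  obtain ⟨e, he, he1, -, p1, -, p2, -, h1, h2, h3⟩ := B.pw hx
  refine (B.U.c6 x hx ψ hψ ψ' hψ').trans ?_
  have hM := B.W.hM'
  have hx0 := hx.1
  have h5 := B.W.hc0
  have h6 := B.hlam
  have h7 := B.W.hε
  have hg := B.W.g_pos x hx
  rw [p2]
  have h8 : 0 < (3 * lam - 2) / 4 + 2 * (1 + ε) := by linarith
  show c0 * M' * ((3 * lam - 2) / 4 + 2 * (1 + ε)) * (g x ^ 2 * x ^ ((3 * lam - 2) / 4)) * |ψ' - ψ| ≤ _
  rw [p1]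
  calc _ ≤ c0 * M' * ((3 * lam - 2) / 4 + 2 * (1 + ε)) * ((β * (e * x)) ^ 2 * (e ^ 3 * x)) * |ψ' - ψ| := by gcongr
    _ = _ := by ring

lemma Bun.Rx (B : BunData) {x x' ψ : ℝ}
    (hx : x ∈ Ioo 0 L) (hx' : x' ∈ Ioo 0 L) (hxx : x ≤ x') (hψ : ψ ∈ Icc (-m) m) :
    |s (eta u x' ψ) * hd v x' ψ - s (eta u x ψ) * hd v x ψ| ≤
      (6 * s0 * cr * β ^ 2 * K + 4 * s0 * M' * β ^ 2) * x' ^ (5 * lam / 4 + 1 / 2) * (x' - x) := by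
  obtain ⟨e, he, he1, p0, p1, -, p2, -, h1, h2, h3⟩ := B.pw hx'
  have W := B.W
  have hcr : 0 < cr := by linarith [W.hcr]
  have hsub : ∀ t ∈ uIcc x x', t ∈ Ioo 0 L ∧ t ≤ x' := by
    intro t ht; rw [uIcc_of_le hxx] at ht; exact ⟨⟨hx.1.trans_le ht.1, ht.2.trans_lt hx'.2⟩, ht.2⟩
  have ks : |s (eta u x' ψ) - s (eta u x ψ)| ≤ 6 * s0 * cr * β * e * (x' - x) := by
    have := mv (F := fun t => s (eta u t ψ)) (F' := fun t => s (eta u t ψ) * r (eta u t ψ) * eta w t ψ) (a := x) (b := x')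
      (C := 6 * s0 * cr * β * e) (fun t ht => ?_) (fun t ht => ?_)
    · rwa [abs_of_nonneg (show 0 ≤ x' - x by linarith)] at this
    · have ht' := (hsub t ht).1
      exact (B.GX.gas.ds _ (B.U.eta_mem W ht' hψ)).comp t (B.U.deta ht' hψ)
    · obtain ⟨ht', htx⟩ := hsub t ht
      obtain ⟨q1, q2⟩ := B.U.s_le W B.GX ht' hψ
      have hgr := (B.gr t ht').2.1
      have := srn B.GX.gas.hs0 (W.g_pos t ht') ht'.1 hcr q1 q2 (W.g1_pos t ht') (B.U.w_le W ht' hψ).2.1 (W.g1_le t ht') hgr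
      refine this.trans ?_
      have hee : t ^ ((lam - 2) / 4) ≤ x' ^ ((lam - 2) / 4) := rpow_le_rpow ht'.1.le htx (by linarith [B.hlam])
      have hee' : x' ^ ((lam - 2) / 4) = e := by
        have q3 : x' ^ lam = (x' ^ ((lam - 2) / 4)) ^ 4 * x' ^ 2 := pow_g hx'.1 4 2 _ (by push_cast; ring)
        rw [q3] at p0
        have q4 := mul_right_cancel₀ (pow_ne_zero 2 hx'.1.ne') p0
        exact (pow_left_inj₀ (rpow_pos_of_pos hx'.1 _).le he.le (by norm_num)).1 q4
      rw [hee'] at hee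
      have := B.GX.gas.hs0
      have := B.hβ
      gcongr
  have hD := B.Dl hx' hψ
  rw [p0] at hD
  have hdd : |hd v x' ψ - hd v x ψ| ≤ 2 * M' * (g x' * x' ^ ((3 * lam - 2) / 4)) * (x' - x) :=
    half_sub (B.vx hx hx' hxx (neg_mem hψ)) (B.vx hx hx' hxx hψ)
  have := rx_bd B.GX.gas.hs0 W.hK hcr W.hM' hx'.1 he he1 B.hβ (by linarith : 0 ≤ x' - x) (W.g_pos x hx)
    (W.g_mono hx hx' hxx) h2 p1 ks (B.U.s_le W B.GX hx hψ).1 hD hdd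
  rw [p2]
  refine le_trans (le_of_eq ?_) this
  congr 1; ring

lemma Bun.Ry (B : BunData) {x ψ ψ' : ℝ}
    (hx : x ∈ Ioo 0 L) (hψ : ψ ∈ Icc (-m) m) (hψ' : ψ' ∈ Icc (-m) m) :
    |s (eta u x ψ') * hd v x ψ' - s (eta u x ψ) * hd v x ψ| ≤
      (s0 * K / α * K * β + 2 * s0 * (c0 * M' * ((3 * lam - 2) / 4 + 2 * (1 + ε))) * β ^ 3) * x ^ (3 * lam / 2 + 1) *
        |ψ' - ψ| := by
  obtain ⟨e, he, he1, p0, p1, -, -, p2, h1, h2, h3⟩ := B.pw hx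
  have W := B.W
  have ks : |s (eta u x ψ') - s (eta u x ψ)| ≤ s0 * K / α * (e ^ 3 * x) * |ψ' - ψ| := by
    have := (convex_Icc (-m) m).norm_image_sub_le_of_norm_hasDerivWithin_le (f := fun t => s (eta u x t))
      (f' := fun t => s (eta u x t) * r (eta u x t) * hd v x t) (C := s0 * K / α * (e ^ 3 * x)) (fun t ht => ?_) (fun t ht => ?_) hψ hψ'
    · simpa [Real.norm_eq_abs] using this
    · exact (B.GX.gas.ds _ (B.U.eta_mem W hx ht)).comp_hasDerivWithinAt t (B.U.deta_psi hx ht)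
    · obtain ⟨q1, q2⟩ := B.U.s_le W B.GX hx ht
      exact srd B.GX.gas.hs0 hx.1 he B.hα W.hK q1 q2 p0 (B.Dl hx ht) h1
  have hD := B.Dl hx hψ'
  rw [p0] at hD
  have hdd : |hd v x ψ' - hd v x ψ| ≤ c0 * M' * ((3 * lam - 2) / 4 + 2 * (1 + ε)) * (g x ^ 2 * x ^ ((3 * lam - 2) / 4)) * |ψ' - ψ| := by
    refine half_sub ?_ (B.U.c6 x hx ψ hψ ψ' hψ')
    have := B.U.c6 x hx (-ψ) (neg_mem hψ) (-ψ') (neg_mem hψ')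
    rwa [show -ψ' - -ψ = -(ψ' - ψ) by ring, abs_neg] at this
  have hC : 0 < c0 * M' * ((3 * lam - 2) / 4 + 2 * (1 + ε)) :=
    mul_pos (mul_pos W.hc0 W.hM') (by linarith [B.hlam, W.hε])
  have := ry_bd B.GX.gas.hs0 W.hK B.hα hC hx.1 he he1 B.hβ (abs_nonneg (ψ' - ψ)) (W.g_pos x hx)
    h2 p1 ks (B.U.s_le W B.GX hx hψ).1 hD hdd
  rw [p2]
  refine le_trans (le_of_eq ?_) this
  congr 1; ring

lemma Bun.qmb (B : BunData) {x : ℝ}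
    (hx : x ∈ Ioo 0 L) : 0 < qt (eta u x m) ∧ qt (eta u x m) ≤ 3 / 2 * cstar γ ∧ 3 / 4 ≤ cos (ThP f x) := by
  have hmm : m ∈ Icc (-m) m := ⟨by linarith [B.W.hm], le_rfl⟩
  have hη := B.U.eta_mem B.W hx hmm
  refine ⟨B.GX.gas.qt_pos _ hη, ?_, ?_⟩
  · have h1 := (abs_le.1 (B.GX.gas.hq _ hη)).2
    have h2 : ε / 100 * cstar γ ≤ 1 / 2 * cstar γ := mul_le_mul_of_nonneg_right (by linarith [B.W.hε']) B.GX.gas.hcs.le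
    linarith
  · linarith [B.W.cosT x hx, B.W.hε']

lemma Bun.dqx (B : BunData) {x ψ : ℝ}
    (hx : x ∈ Ioo 0 L) (hψ : ψ ∈ Icc (-m) m) :
    HasDerivAt (fun x => Qf (eta u x ψ)) (-(eta v x ψ) * (qt (eta u x m) / cos (ThP f x))) x := by
  have h1 := (B.GX.dQ _ (B.U.eta_mem B.W hx hψ)).comp x (B.U.deta hx hψ)
  obtain ⟨h2, -, h3⟩ := B.qmb hx
  refine h1.congr_deriv ?_
  have h4 : eta v x ψ = s (eta u x ψ) * (cos (ThP f x) / qt (eta u x m)) * eta w x ψ := by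
    have e1 : eta u x (-ψ) = eta u x ψ := by unfold eta; rw [neg_neg]; ring
    have e2 := B.hv x hx ψ hψ
    have e3 := B.hv x hx (-ψ) (neg_mem hψ)
    unfold Sf at e2 e3
    rw [e1] at e3
    have : eta v x ψ = (v x ψ + v x (-ψ)) / 2 := rfl
    rw [this, e2, e3]; unfold eta; ring
  rw [h4]
  have : cos (ThP f x) ≠ 0 := by linarith
  field_simp

lemma Bun.hdv (B : BunData) {x ψ : ℝ}
    (hx : x ∈ Ioo 0 L) (hψ : ψ ∈ Icc (-m) m) :
    hd v x ψ = s (eta u x ψ) * (cos (ThP f x) / qt (eta u x m)) * hd w x ψ := by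
  have e1 : eta u x (-ψ) = eta u x ψ := by unfold eta; rw [neg_neg]; ring
  have e2 := B.hv x hx ψ hψ
  have e3 := B.hv x hx (-ψ) (neg_mem hψ)
  unfold Sf at e2 e3
  rw [e1] at e3
  have : hd v x ψ = (v x (-ψ) - v x ψ) / 2 := rfl
  rw [this, e2, e3]; unfold hd; ring

lemma Bun.dqy (B : BunData) {x ψ : ℝ}
    (hx : x ∈ Ioo 0 L) (hψ : ψ ∈ Icc 0 m) :
    HasDerivWithinAt (fun ψ => Qf (eta u x ψ)) (-(s (eta u x ψ) * hd v x ψ)) (Icc 0 m) ψ := by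
  have hψ' := Icc_sub B.W.hm hψ
  have h0 : HasDerivWithinAt (eta u x) (hd v x ψ) (Icc 0 m) ψ :=
    (B.U.deta_psi hx hψ').mono (s := Icc 0 m) (fun t ht => Icc_sub B.W.hm ht)
  have h1 := (B.GX.dQ _ (B.U.eta_mem B.W hx hψ')).comp_hasDerivWithinAt ψ h0
  exact h1.congr_deriv (by ring)

lemma Bun.dTy (B : BunData) {x ψ : ℝ}
    (hx : x ∈ Ioo 0 L) (hψ : ψ ∈ Icc 0 m) : HasDerivWithinAt (hd u x) (eta v x ψ) (Icc 0 m) ψ := by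
  have hψ' := Icc_sub B.W.hm hψ
  have h1 := B.U.dpsi x hx ψ hψ'
  have h2 : HasDerivWithinAt (fun ψ => u x (-ψ)) (-(v x (-ψ)) * (-1)) (Icc (-m) m) ψ :=
    (B.U.dpsi x hx (-ψ) (neg_mem hψ')).comp ψ (hasDerivAt_neg ψ).hasDerivWithinAt (fun t ht => neg_mem ht)
  have h3 : HasDerivWithinAt (hd u x) ((-(v x (-ψ)) * (-1) - -(v x ψ)) / 2) (Icc (-m) m) ψ := (h2.sub h1).div_const 2
  refine (h3.mono (s := Icc 0 m) (fun t ht => Icc_sub B.W.hm ht)).congr_deriv ?_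
  unfold eta; ring

set_option maxHeartbeats 800000 in
lemma Bun.toSol (B : BunData) {a1 a2 K2 : ℝ}
    (ha1 : a1 = 3 / 2 * c0 * cm * α ^ 4) (ha2 : 6 * c0 * cr * β ^ 4 ≤ a2) (ha2' : 2 * s0 * K * β ^ 2 ≤ a2)
    (k1 : 2 * M' * β ≤ K2) (k2 : c0 * M' * ((3 * lam - 2) / 4 + 2 * (1 + ε)) * β ^ 2 ≤ K2)
    (k3 : 6 * s0 * cr * β ^ 2 * K + 4 * s0 * M' * β ^ 2 ≤ K2)
    (k4 : s0 * K / α * K * β + 2 * s0 * (c0 * M' * ((3 * lam - 2) / 4 + 2 * (1 + ε))) * β ^ 3 ≤ K2)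
    (k5 : 6 * cr ≤ K2) (k6 : 2 ≤ K2) :
    Sol γ lam L m a1 a2 K2 f (fun x => qt (eta u x m)) (fun x ψ => Qf (eta u x ψ)) (eta v)
      (fun x ψ => -(s (eta u x ψ) * hd v x ψ)) (hd u) (hd w) := by
  have W := B.W
  have hm := W.hm
  have hmm : m ∈ Icc (-m) m := ⟨by linarith, le_rfl⟩
  have hI := fun {ψ : ℝ} (h : ψ ∈ Icc 0 m) => Icc_sub hm h
  have hη := fun {x : ℝ} (hx : x ∈ Ioo 0 L) {ψ : ℝ} (h : ψ ∈ Icc 0 m) => B.U.eta_mem W hx (hI h)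
  have hηm := fun {x : ℝ} (hx : x ∈ Ioo 0 L) => Ioo_subset_Ico_self (B.U.eta_mem W hx hmm)
  have hp := fun {x : ℝ} (hx : x ∈ Ioo 0 L) (p : ℝ) => (rpow_pos_of_pos hx.1 p).le
  refine { cqm := B.c_qm, qm0 := ?_,
           qm_ge := fun x hx => B.GX.qt_ge _ (hηm hx),
           qm_le := fun x hx => B.GX.qt_le _ (hηm hx),
           qm_le' := fun x hx => (B.qmb hx).2.1,
           cosT := fun x hx => (B.qmb hx).2.2,
           inv := fun x hx => B.GX.inv _ (hηm hx),
           q_le := fun x hx ψ hψ => B.GX.Q_le (hη hx hψ),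
           q0 := ?_,
           dqx := fun x hx ψ hψ => B.dqx hx (hI hψ),
           dqy := ?_, V_ge := ?_, V_le := ?_, R_le := ?_, Vx := ?_, Vy := ?_, Rx := ?_, Ry := ?_, hb := ?_, dTx := ?_, dTy := ?_,
           T0 := ?_, Tm := ?_, cTx := ?_, Tx_le := ?_, T_le := ?_ }
  · have h1 := B.GX.cqt 0 ⟨le_rfl, B.GX.hηm⟩
    unfold ContinuousWithinAt at h1
    rw [B.GX.qt0] at h1
    exact h1.comp (B.U.eta_tendsto W B.hL hmm)
  · intro ψ hψ
    have h1 := B.GX.cQ 0 ⟨le_rfl, B.GX.hηm⟩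
    unfold ContinuousWithinAt at h1
    rw [B.GX.Q0] at h1
    exact h1.comp (B.U.eta_tendsto W B.hL (hI hψ))
  · intro x hx ψ hψ
    exact B.dqy hx hψ
  · intro x hx ψ hψ
    rw [ha1]
    exact (B.Vb hx (hI hψ)).1
  · intro x hx ψ hψ
    exact (B.Vb hx (hI hψ)).2.trans (mul_le_mul_of_nonneg_right ha2 (hp hx _))
  · intro x hx ψ hψ
    rw [abs_neg]
    exact (B.Rl hx (hI hψ)).trans (mul_le_mul_of_nonneg_right ha2' (hp hx _))
  · intro x hx x' hx' hxx ψ hψ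
    exact (B.Vx hx hx' hxx (hI hψ)).trans (mul_le_mul_of_nonneg_right (mul_le_mul_of_nonneg_right k1 (hp hx' _)) (by linarith))
  · intro x hx ψ hψ ψ' hψ'
    have h1 := B.Vy hx (hI hψ) (hI hψ')
    have h2 := B.Vy hx (neg_mem (hI hψ)) (neg_mem (hI hψ'))
    rw [show -ψ' - -ψ = -(ψ' - ψ) by ring, abs_neg] at h2
    exact (half_add h1 h2).trans (mul_le_mul_of_nonneg_right (mul_le_mul_of_nonneg_right k2 (hp hx _)) (abs_nonneg _))
  · intro x hx x' hx' hxx ψ hψ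
    rw [show ∀ a b : ℝ, -a - -b = -(a - b) by intros; ring, abs_neg]
    exact (B.Rx hx hx' hxx (hI hψ)).trans (mul_le_mul_of_nonneg_right (mul_le_mul_of_nonneg_right k3 (hp hx' _)) (by linarith))
  · intro x hx ψ hψ ψ' hψ'
    rw [show ∀ a b : ℝ, -a - -b = -(a - b) by intros; ring, abs_neg]
    exact (B.Ry hx (hI hψ) (hI hψ')).trans (mul_le_mul_of_nonneg_right (mul_le_mul_of_nonneg_right k4 (hp hx _)) (abs_nonneg _))
  · intro x hx ψ hψ
    have h1 := B.GX.gas.s_pos _ (hη hx hψ)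
    have h2 := (B.qmb hx).1
    show bfun γ (Qf (eta u x ψ)) * -(s (eta u x ψ) * hd v x ψ) = _
    rw [B.GX.hb _ (hη hx hψ), B.hdv hx (hI hψ)]
    field_simp
  · intro x hx ψ hψ
    exact ((B.U.du x hx (-ψ) (neg_mem (hI hψ))).sub (B.U.du x hx ψ (hI hψ))).div_const 2
  · intro x hx ψ hψ
    exact B.dTy hx hψ
  · intro x hx
    unfold hd; simp
  · intro x hx
    unfold hd; rw [B.hbd x hx]; ring
  · have h2 : ContinuousOn (fun p : ℝ × ℝ => w p.1 (-p.2)) (Ioo 0 L ×ˢ Icc (-m) m) :=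
      B.U.cw.comp (f := fun p : ℝ × ℝ => (p.1, -p.2)) (by fun_prop) fun p hp => ⟨hp.1, neg_mem hp.2⟩
    exact ((h2.sub B.U.cw).div_const 2).mono (prod_mono subset_rfl fun t ht => hI ht)
  · intro x hx ψ hψ
    have h1 := abs_le.1 (B.U.w_le W hx (hI hψ)).1
    have h2 := abs_le.1 (B.U.w_le W hx (neg_mem (hI hψ))).1
    have h3 := g2g1 (W.g_pos x hx) hx.1 (W.g_le x hx) (W.x_le hx) (by linarith [W.hcr]) (W.g1_le x hx) (W.g1_pos x hx)
    unfold hd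
    rw [abs_le]
    constructor <;> linarith
  · intro x hx ψ hψ
    have h1 := abs_le.1 (B.U.w_le W hx (hI hψ)).2.2
    have h2 := abs_le.1 (B.U.w_le W hx (neg_mem (hI hψ))).2.2
    have h3 : g x ^ 3 ≤ x := (pow_le_of_le_one (W.g_pos x hx).le ((W.g_le x hx).trans (W.x_le hx)) (by norm_num)).trans (W.g_le x hx)
    have h4 : 2 * x ≤ K2 * x := mul_le_mul_of_nonneg_right k6 hx.1.le
    unfold hd
    rw [abs_le]
    constructor <;> linarith

end Nozzle

namespace Nozzle

lemma exists_sol {γ m lam δ1 δ2 : ℝ} (hγ : 1 < γ) (hm : 0 < m) (hlam : 2 < lam) (hδ1 : 0 < δ1) (hδ12 : δ1 ≤ δ2) :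
    ∃ a1 a2 : ℝ, 0 < a1 ∧ 0 < a2 ∧ ∀ δ3 : ℝ, 0 < δ3 → ∃ L0 K2 : ℝ, 0 < L0 ∧ 0 < K2 ∧
    ∀ l : ℝ, 0 < l → l ≤ L0 → ∀ f : ℝ → ℝ, NozzlePlus lam δ1 δ2 l f →
    (∀ x ∈ Icc (0 : ℝ) l, |deriv (deriv (deriv f)) x| ≤ δ3 * x ^ (lam - 1)) →
    ∃ L, l < L ∧ L ≤ 1 ∧ ∃ (qm : ℝ → ℝ) (q V R T Tx : ℝ → ℝ → ℝ), Sol γ lam L m a1 a2 K2 f qm q V R T Tx := by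
  have hs0 := s0_pos hγ
  have hcs := cstar_pos hγ
  have hc0 : 0 < s0c γ / cstar γ := div_pos hs0 hcs
  have hc : s0c γ / cstar γ * cstar γ = s0c γ := div_mul_cancel₀ _ hcs.ne'
  obtain ⟨c0, hc0d⟩ : ∃ c0, c0 = s0c γ / cstar γ := ⟨_, rfl⟩
  rw [← hc0d] at hc0 hc
  obtain ⟨ε, θ, cr, cm, α, β, K, hε, hε', hcr, hcm, hα, hβ, hK, HW⟩ :=
    exists_wall hm hc0 hlam (show 0 < δ1 / 2 by linarith) (show 0 < 2 * δ2 by linarith)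
  obtain ⟨ηm, s, r, qt, k, Qf, GX⟩ := exists_gas hγ hε
  have hcr0 : 0 < cr := by linarith
  refine ⟨3 / 2 * c0 * cm * α ^ 4, 6 * c0 * cr * β ^ 4 + 2 * s0c γ * K * β ^ 2, by positivity, by positivity, ?_⟩
  intro δ3 hδ3
  obtain ⟨d3, M', L0, hM', hL0, hL01, HW2⟩ := HW (2 * δ3) ηm (by linarith) GX.hηm
  have hN : 0 < (3 * lam - 2) / 4 + 2 * (1 + ε) := by linarith
  refine ⟨L0 / 2, 2 * M' * β + c0 * M' * ((3 * lam - 2) / 4 + 2 * (1 + ε)) * β ^ 2 +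
    (6 * s0c γ * cr * β ^ 2 * K + 4 * s0c γ * M' * β ^ 2) +
    (s0c γ * K / α * K * β + 2 * s0c γ * (c0 * M' * ((3 * lam - 2) / 4 + 2 * (1 + ε))) * β ^ 3) + 6 * cr + 2, by linarith,
    by positivity, ?_⟩
  intro l hl hlL f HN H3
  obtain ⟨L, hlL', hL2, HH⟩ := WH.ofNozzle (σ := δ1 / 2 * cm / 80) hlam hδ1 hδ12 hδ3 (by positivity) hl HN H3
  obtain ⟨g, g1, E, E1, W, gr⟩ := HW2 L (hl.trans hlL') (by linarith) f HH
  obtain ⟨u, w, v, U, hv, hbd, hvT⟩ := W.exists_fix GX.gas hc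
  refine ⟨L, hlL', by linarith, _, _, _, _, _, _, Bun.toSol (c0 := c0) (ε := ε) (θ := θ) (cr := cr) (d2 := 2 * δ2) (d3 := d3) (K := K)
    (M' := M') (ηm := ηm) (s0 := s0c γ) (α := α) (β := β) (cm := cm) (g := g) (g1 := g1) (E := E) (E1 := E1) (s := s) (r := r)
    (qt := qt) (k := k) (Qf := Qf) (u := u) (w := w) (v := v) ?_ rfl ?_ ?_ ?_ ?_ ?_ ?_ ?_ ?_⟩
  · exact ⟨W, GX, U, hv, hbd, hvT, hlam, hα, hβ, hcm, hl.trans hlL', fun x hx => ⟨(gr x hx).1, (gr x hx).2.1, (gr x hx).2.2.1⟩⟩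
  all_goals
    have p1 : 0 < 2 * M' * β := by positivity
    have p2 : 0 < c0 * M' * ((3 * lam - 2) / 4 + 2 * (1 + ε)) * β ^ 2 := by positivity
    have p3 : 0 < 6 * s0c γ * cr * β ^ 2 * K + 4 * s0c γ * M' * β ^ 2 := by positivity
    have p4 : 0 < s0c γ * K / α * K * β + 2 * s0c γ * (c0 * M' * ((3 * lam - 2) / 4 + 2 * (1 + ε))) * β ^ 3 := by positivity
    have p5 : 0 < 6 * c0 * cr * β ^ 4 := by positivity
    have p6 : 0 < 2 * s0c γ * K * β ^ 2 := by positivity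
    linarith

end Nozzle

namespace Nozzle

/-- the differential with given partial derivatives -/
def Ln (a b : ℝ) : ℝ × ℝ →L[ℝ] ℝ := a • ContinuousLinearMap.fst ℝ ℝ ℝ + b • ContinuousLinearMap.snd ℝ ℝ ℝ

lemma Ln_apply (a b : ℝ) (p : ℝ × ℝ) : Ln a b p = a * p.1 + b * p.2 := by simp [Ln]

lemma Ln_norm (a b : ℝ) : ‖Ln a b‖ ≤ |a| + |b| := by
  refine ContinuousLinearMap.opNorm_le_bound _ (by positivity) fun p => ?_
  rw [Ln_apply, Real.norm_eq_abs]
  refine (abs_add_le _ _).trans ?_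
  rw [abs_mul, abs_mul, add_mul]
  have h1 : |p.1| ≤ ‖p‖ := norm_fst_le p
  have h2 : |p.2| ≤ ‖p‖ := norm_snd_le p
  gcongr

lemma Ln_sub (a b a' b' : ℝ) : Ln a b - Ln a' b' = Ln (a - a') (b - b') := by
  ext <;> simp [Ln]

lemma fd_of {a b Λ : ℝ} (hΛ : 0 ≤ Λ) {Q P R : ℝ → ℝ → ℝ}
    (dP : ∀ x ∈ Icc 0 a, ∀ y ∈ Icc 0 b, HasDerivWithinAt (fun x => Q x y) (P x y) (Icc 0 a) x)
    (dR : ∀ x ∈ Icc 0 a, ∀ y ∈ Icc 0 b, HasDerivWithinAt (Q x) (R x y) (Icc 0 b) y)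
    (lP : ∀ x ∈ Icc 0 a, ∀ y ∈ Icc 0 b, ∀ x' ∈ Icc 0 a, ∀ y' ∈ Icc 0 b, |P x' y' - P x y| ≤ Λ * (|x' - x| + |y' - y|))
    (lR : ∀ x ∈ Icc 0 a, ∀ y ∈ Icc 0 b, ∀ x' ∈ Icc 0 a, ∀ y' ∈ Icc 0 b, |R x' y' - R x y| ≤ Λ * (|x' - x| + |y' - y|))
    {p : ℝ × ℝ} (hp : p ∈ Icc 0 a ×ˢ Icc 0 b) :
    HasFDerivWithinAt (fun p : ℝ × ℝ => Q p.1 p.2) (Ln (P p.1 p.2) (R p.1 p.2)) (Icc 0 a ×ˢ Icc 0 b) p := by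
  have key : ∀ p' ∈ Icc 0 a ×ˢ Icc 0 b, |Q p'.1 p'.2 - Q p.1 p.2 - Ln (P p.1 p.2) (R p.1 p.2) (p' - p)| ≤ 3 * Λ * ‖p' - p‖ ^ 2 := by
    intro p' hp'
    have h1 := taylor1 (f := fun x => Q x p'.2) (h := fun x => P x p'.2) (Λ := Λ) (fun t ht => dP t ht _ hp'.2)
      (fun t ht t' ht' => by simpa using lP t ht _ hp'.2 t' ht' _ hp'.2) hp.1 hp'.1
    have h2 := taylor1 (f := fun y => Q p.1 y) (h := fun y => R p.1 y) (Λ := Λ) (fun t ht => dR _ hp.1 t ht)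
      (fun t ht t' ht' => by simpa using lR _ hp.1 t ht _ hp.1 t' ht') hp.2 hp'.2
    have h3 : |P p.1 p'.2 - P p.1 p.2| ≤ Λ * |p'.2 - p.2| := by simpa using lP _ hp.1 _ hp.2 _ hp.1 _ hp'.2
    have n1 : |p'.1 - p.1| ≤ ‖p' - p‖ := norm_fst_le (p' - p)
    have n2 : |p'.2 - p.2| ≤ ‖p' - p‖ := norm_snd_le (p' - p)
    have hn := norm_nonneg (p' - p)
    obtain ⟨N, hN⟩ : ∃ N, N = ‖p' - p‖ := ⟨_, rfl⟩
    rw [← hN] at n1 n2 hn ⊢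
    have k1 : Λ * |p'.1 - p.1| * |p'.1 - p.1| ≤ Λ * N ^ 2 := by
      calc _ ≤ Λ * N * N := by gcongr
        _ = _ := by ring
    have k2 : Λ * |p'.2 - p.2| * |p'.2 - p.2| ≤ Λ * N ^ 2 := by
      calc _ ≤ Λ * N * N := by gcongr
        _ = _ := by ring
    have k3 : |(P p.1 p'.2 - P p.1 p.2) * (p'.1 - p.1)| ≤ Λ * N ^ 2 := by
      rw [abs_mul]
      calc _ ≤ (Λ * N) * N := mul_le_mul (h3.trans (by gcongr)) n1 (abs_nonneg _) (by positivity)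
        _ = _ := by ring
    rw [Ln_apply]
    simp only [Prod.fst_sub, Prod.snd_sub]
    have e := abs_add_three (Q p'.1 p'.2 - Q p.1 p'.2 - P p.1 p'.2 * (p'.1 - p.1)) ((P p.1 p'.2 - P p.1 p.2) * (p'.1 - p.1))
      (Q p.1 p'.2 - Q p.1 p.2 - R p.1 p.2 * (p'.2 - p.2))
    refine le_trans (le_of_eq ?_) (e.trans ?_)
    · congr 1; ring
    · linarith
  rw [hasFDerivWithinAt_iff_isLittleO]
  have hO : (fun p' : ℝ × ℝ => Q p'.1 p'.2 - Q p.1 p.2 - Ln (P p.1 p.2) (R p.1 p.2) (p' - p)) =O[nhdsWithin p (Icc 0 a ×ˢ Icc 0 b)]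
      fun p' => ‖p' - p‖ ^ 2 := by
    refine Asymptotics.IsBigO.of_bound (3 * Λ) ?_
    filter_upwards [self_mem_nhdsWithin] with p' hp'
    rw [Real.norm_eq_abs, norm_pow, norm_norm]
    exact key p' hp'
  refine hO.trans_isLittleO ?_
  have h0 : Tendsto (fun p' : ℝ × ℝ => ‖p' - p‖) (nhdsWithin p (Icc 0 a ×ˢ Icc 0 b)) (nhds 0) := by
    have : Tendsto (fun p' : ℝ × ℝ => ‖p' - p‖) (nhds p) (nhds ‖p - p‖) := (by fun_prop : Continuous fun p' : ℝ × ℝ => ‖p' - p‖).tendsto p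
    rw [sub_self, norm_zero] at this
    exact this.mono_left nhdsWithin_le_nhds
  have h1 : (fun p' : ℝ × ℝ => ‖p' - p‖) =o[nhdsWithin p (Icc 0 a ×ˢ Icc 0 b)] fun _ => (1 : ℝ) :=
    (Asymptotics.isLittleO_one_iff ℝ).2 h0
  have h2 := h1.mul_isBigO (Asymptotics.isBigO_refl (fun p' : ℝ × ℝ => ‖p' - p‖) _)
  simp only [one_mul, ← pow_two] at h2
  exact h2.trans_isBigO (Asymptotics.isBigO_norm_left.2 (Asymptotics.isBigO_refl _ _))

lemma c11_of {a b Λ M : ℝ} (ha : 0 < a) (hb : 0 < b) (hΛ : 0 ≤ Λ) {Q P R : ℝ → ℝ → ℝ}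
    (dP : ∀ x ∈ Icc 0 a, ∀ y ∈ Icc 0 b, HasDerivWithinAt (fun x => Q x y) (P x y) (Icc 0 a) x)
    (dR : ∀ x ∈ Icc 0 a, ∀ y ∈ Icc 0 b, HasDerivWithinAt (Q x) (R x y) (Icc 0 b) y)
    (lP : ∀ x ∈ Icc 0 a, ∀ y ∈ Icc 0 b, ∀ x' ∈ Icc 0 a, ∀ y' ∈ Icc 0 b, |P x' y' - P x y| ≤ Λ * (|x' - x| + |y' - y|))
    (lR : ∀ x ∈ Icc 0 a, ∀ y ∈ Icc 0 b, ∀ x' ∈ Icc 0 a, ∀ y' ∈ Icc 0 b, |R x' y' - R x y| ≤ Λ * (|x' - x| + |y' - y|))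
    (hM : 0 ≤ M) (bP : ∀ x ∈ Icc 0 a, ∀ y ∈ Icc 0 b, |P x y| ≤ M) (bR : ∀ x ∈ Icc 0 a, ∀ y ∈ Icc 0 b, |R x y| ≤ M) :
    ContDiffOn ℝ 1 (fun p : ℝ × ℝ => Q p.1 p.2) (Icc 0 a ×ˢ Icc 0 b) ∧
    (∃ N : NNReal, LipschitzOnWith N (fun p => fderivWithin ℝ (fun p : ℝ × ℝ => Q p.1 p.2) (Icc 0 a ×ˢ Icc 0 b) p) (Icc 0 a ×ˢ Icc 0 b)) ∧
    ∃ N : NNReal, LipschitzOnWith N (fun p : ℝ × ℝ => Q p.1 p.2) (Icc 0 a ×ˢ Icc 0 b) := by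
  have hfd := fun (p : ℝ × ℝ) (hp : p ∈ Icc 0 a ×ˢ Icc 0 b) => fd_of hΛ dP dR lP lR hp
  have hU : UniqueDiffOn ℝ (Icc 0 a ×ˢ Icc 0 b : Set (ℝ × ℝ)) := (uniqueDiffOn_Icc ha).prod (uniqueDiffOn_Icc hb)
  have hfe := fun (p : ℝ × ℝ) (hp : p ∈ Icc 0 a ×ˢ Icc 0 b) => (hfd p hp).fderivWithin (hU p hp)
  have hLip : LipschitzOnWith (Real.toNNReal (4 * Λ)) (fun p => fderivWithin ℝ (fun p : ℝ × ℝ => Q p.1 p.2) (Icc 0 a ×ˢ Icc 0 b) p)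
      (Icc 0 a ×ˢ Icc 0 b) := by
    refine LipschitzOnWith.of_dist_le_mul fun p hp p' hp' => ?_
    rw [hfe p hp, hfe p' hp', dist_eq_norm, dist_eq_norm, Ln_sub, Real.coe_toNNReal _ (by linarith)]
    refine (Ln_norm _ _).trans ?_
    have h1 := lP _ hp'.1 _ hp'.2 _ hp.1 _ hp.2
    have h2 := lR _ hp'.1 _ hp'.2 _ hp.1 _ hp.2
    have n1 : |p.1 - p'.1| ≤ ‖p - p'‖ := norm_fst_le (p - p')
    have n2 : |p.2 - p'.2| ≤ ‖p - p'‖ := norm_snd_le (p - p')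
    have : Λ * (|p.1 - p'.1| + |p.2 - p'.2|) ≤ Λ * (‖p - p'‖ + ‖p - p'‖) := by gcongr
    linarith
  refine ⟨?_, ⟨_, hLip⟩, ⟨Real.toNNReal (2 * M), ?_⟩⟩
  · have h := (contDiffOn_succ_iff_fderivWithin (𝕜 := ℝ) (n := 0) (f := fun p : ℝ × ℝ => Q p.1 p.2) hU).2
      ⟨fun p hp => (hfd p hp).differentiableWithinAt, by simp, contDiffOn_zero.2 hLip.continuousOn⟩
    rwa [zero_add] at h
  · refine ((convex_Icc 0 a).prod (convex_Icc 0 b)).lipschitzOnWith_of_nnnorm_hasFDerivWithin_le hfd fun p hp => ?_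
    rw [← NNReal.coe_le_coe, Real.coe_toNNReal _ (by linarith), coe_nnnorm]
    refine (Ln_norm _ _).trans ?_
    linarith [bP _ hp.1 _ hp.2, bR _ hp.1 _ hp.2]

end Nozzle

namespace Nozzle

lemma xi_x {ξ : ℝ × ℝ → ℝ} (h : ContDiff ℝ 1 ξ) (p : ℝ × ℝ) :
    HasDerivAt (fun x => ξ (x, p.2)) (fderiv ℝ ξ p (1, 0)) p.1 := by
  have h1 := (h.differentiable (by norm_num) p).hasFDerivAt
  have h2 : HasDerivAt (fun x : ℝ => (x, p.2)) ((1 : ℝ), (0 : ℝ)) p.1 := (hasDerivAt_id p.1).prodMk (hasDerivAt_const p.1 p.2)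
  exact HasFDerivAt.comp_hasDerivAt (f := fun x : ℝ => (x, p.2)) p.1 h1 h2

lemma xi_y {ξ : ℝ × ℝ → ℝ} (h : ContDiff ℝ 1 ξ) (p : ℝ × ℝ) :
    HasDerivAt (fun y => ξ (p.1, y)) (fderiv ℝ ξ p (0, 1)) p.2 := by
  have h1 := (h.differentiable (by norm_num) p).hasFDerivAt
  have h2 : HasDerivAt (fun y : ℝ => (p.1, y)) ((0 : ℝ), (1 : ℝ)) p.2 := (hasDerivAt_const p.2 p.1).prodMk (hasDerivAt_id p.2)
  exact HasFDerivAt.comp_hasDerivAt (f := fun y : ℝ => (p.1, y)) p.2 h1 h2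

lemma c_pdx {ξ : ℝ × ℝ → ℝ} (h : ContDiff ℝ 1 ξ) : Continuous (pdx ξ) := by
  have : pdx ξ = fun p => fderiv ℝ ξ p (1, 0) := funext fun p => (xi_x h p).deriv
  rw [this]; exact (h.continuous_fderiv (by norm_num)).clm_apply continuous_const

lemma c_pdy {ξ : ℝ × ℝ → ℝ} (h : ContDiff ℝ 1 ξ) : Continuous (pdy ξ) := by
  have : pdy ξ = fun p => fderiv ℝ ξ p (0, 1) := funext fun p => (xi_y h p).deriv
  rw [this]; exact (h.continuous_fderiv (by norm_num)).clm_apply continuous_const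

lemma h_pdx {ξ : ℝ × ℝ → ℝ} (h : ContDiff ℝ 1 ξ) (x y : ℝ) : HasDerivAt (fun x => ξ (x, y)) (pdx ξ (x, y)) x := by
  have := xi_x h (x, y)
  rw [← this.deriv] at this; exact this

lemma h_pdy {ξ : ℝ × ℝ → ℝ} (h : ContDiff ℝ 1 ξ) (x y : ℝ) : HasDerivAt (fun y => ξ (x, y)) (pdy ξ (x, y)) y := by
  have := xi_y h (x, y)
  rw [← this.deriv] at this; exact this

lemma xi_bd {ξ : ℝ × ℝ → ℝ} (h : Continuous ξ) (a m : ℝ) : ∃ N, 0 ≤ N ∧ ∀ x ∈ Icc 0 a, ∀ y ∈ Icc 0 m, |ξ (x, y)| ≤ N := by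
  obtain ⟨N, hN⟩ := (isCompact_Icc.prod isCompact_Icc : IsCompact (Icc 0 a ×ˢ Icc 0 m)).exists_bound_of_continuousOn h.continuousOn
  exact ⟨max N 0, le_max_right _ _, fun x hx y hy => (hN (x, y) ⟨hx, hy⟩).trans (le_max_left _ _)⟩

/-- the divergence structure of the equation -/
structure Wk (a m M : ℝ) (θ A V : ℝ → ℝ → ℝ) : Prop where
  ha : 0 < a
  hm : 0 < m
  hM : 0 ≤ M
  dA : ∀ x ∈ Ioc 0 a, ∀ y ∈ Icc 0 m, HasDerivAt (fun x => θ x y) (A x y) x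
  dV : ∀ x ∈ Ioc 0 a, ∀ y ∈ Icc 0 m, HasDerivWithinAt (θ x) (V x y) (Icc 0 m) y
  cA : ContinuousOn (fun p : ℝ × ℝ => A p.1 p.2) (Ioc 0 a ×ˢ Icc 0 m)
  cV : ContinuousOn (fun p : ℝ × ℝ => V p.1 p.2) (Ioc 0 a ×ˢ Icc 0 m)
  bA : ∀ x ∈ Ioc 0 a, ∀ y ∈ Icc 0 m, |A x y| ≤ M
  bV : ∀ x ∈ Ioc 0 a, ∀ y ∈ Icc 0 m, |V x y| ≤ M
  bT : ∀ x ∈ Ioc 0 a, ∀ y ∈ Icc 0 m, |θ x y| ≤ M * x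
  T0 : ∀ x ∈ Ioc 0 a, θ x 0 = 0

variable {a m M : ℝ} {θ A V : ℝ → ℝ → ℝ}

lemma int_of {a C : ℝ} {F : ℝ → ℝ} (hc : ContinuousOn F (Ioo 0 a)) (hb : ∀ x ∈ Ioo 0 a, |F x| ≤ C) :
    IntegrableOn F (Ioo 0 a) := by
  refine IntegrableOn.of_bound (by simp) (hc.aestronglyMeasurable measurableSet_Ioo) C ?_
  filter_upwards [ae_restrict_mem measurableSet_Ioo] with x hx using hb x hx

lemma Wk.c1 {F : ℝ → ℝ → ℝ} (h : ContinuousOn (fun p : ℝ × ℝ => F p.1 p.2) (Ioc 0 a ×ˢ Icc 0 m)) {y : ℝ} (hy : y ∈ Icc 0 m) :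
    ContinuousOn (fun x => F x y) (Ioc 0 a) :=
  h.comp (f := fun x => (x, y)) (by fun_prop) fun _ hx => ⟨hx, hy⟩

/-- integration by parts in the first variable -/
lemma Wk.parts (H : Wk a m M θ A V) {ξ : ℝ × ℝ → ℝ} (hξ : ContDiff ℝ 1 ξ) {y y' : ℝ} (hy : y ∈ Icc 0 m) (hy' : y' ∈ Icc 0 m)
    (h0 : ξ (a, y) = 0) : ∫ x in Ioo 0 a, A x y' * ξ (x, y) = -∫ x in Ioo 0 a, θ x y' * pdx ξ (x, y) := by
  obtain ⟨N, hN0, hN⟩ := xi_bd hξ.continuous a m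
  obtain ⟨N1, hN10, hN1⟩ := xi_bd (c_pdx hξ) a m
  have ha := H.ha
  have hM := H.hM
  have cξ : Continuous fun x => ξ (x, y) := hξ.continuous.comp (by fun_prop)
  have cξ1 : Continuous fun x => pdx ξ (x, y) := (c_pdx hξ).comp (by fun_prop)
  have cθ : ContinuousOn (fun x => θ x y') (Ioc 0 a) := fun x hx => (H.dA x hx y' hy').continuousAt.continuousWithinAt
  have hI1 : IntegrableOn (fun x => A x y' * ξ (x, y)) (Ioo 0 a) := by
    refine int_of (C := M * N) (((Wk.c1 H.cA hy').mono Ioo_subset_Ioc_self).mul cξ.continuousOn) fun x hx => ?_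
    rw [abs_mul]
    exact mul_le_mul (H.bA x (Ioo_subset_Ioc_self hx) y' hy') (hN x (Ioo_subset_Icc_self hx) y hy) (abs_nonneg _) hM
  have hI2 : IntegrableOn (fun x => θ x y' * pdx ξ (x, y)) (Ioo 0 a) := by
    refine int_of (C := M * a * N1) ((cθ.mono Ioo_subset_Ioc_self).mul cξ1.continuousOn) fun x hx => ?_
    rw [abs_mul]
    exact mul_le_mul ((H.bT x (Ioo_subset_Ioc_self hx) y' hy').trans (mul_le_mul_of_nonneg_left hx.2.le hM))
      (hN1 x (Ioo_subset_Icc_self hx) y hy) (abs_nonneg _) (by positivity)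
  have key := intervalIntegral.integral_eq_sub_of_hasDerivAt_of_tendsto (a := 0) (b := a) ha (fa := 0) (fb := 0)
    (f := fun x => θ x y' * ξ (x, y)) (f' := fun x => A x y' * ξ (x, y) + θ x y' * pdx ξ (x, y))
    (fun x hx => (H.dA x (Ioo_subset_Ioc_self hx) y' hy').mul (h_pdx hξ x y)) ?_ ?_ ?_
  · rw [intervalIntegral.integral_of_le ha.le, integral_Ioc_eq_integral_Ioo, integral_add hI1 hI2] at key
    linarith
  · rw [intervalIntegrable_iff_integrableOn_Ioo_of_le ha.le]
    exact hI1.add hI2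
  · have h1 : Tendsto (fun x : ℝ => M * N * x) (nhdsWithin 0 (Ioi 0)) (nhds 0) := by
      have : Tendsto (fun x : ℝ => M * N * x) (nhds 0) (nhds (M * N * 0)) := (continuous_const.mul continuous_id).tendsto 0
      rw [mul_zero] at this
      exact this.mono_left nhdsWithin_le_nhds
    refine squeeze_zero_norm' ?_ h1
    filter_upwards [Ioo_mem_nhdsGT ha] with x hx
    rw [Real.norm_eq_abs, abs_mul]
    calc _ ≤ (M * x) * N := mul_le_mul (H.bT x (Ioo_subset_Ioc_self hx) y' hy') (hN x (Ioo_subset_Icc_self hx) y hy) (abs_nonneg _)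
            (mul_nonneg hM hx.1.le)
      _ = _ := by ring
  · have h1 : ContinuousAt (fun x => θ x y' * ξ (x, y)) a :=
      (H.dA a ⟨ha, le_rfl⟩ y' hy').continuousAt.mul cξ.continuousAt
    have h2 := h1.tendsto
    simp only [h0, mul_zero] at h2
    exact h2.mono_left nhdsWithin_le_nhds

/-- the flux function -/
def flux (a : ℝ) (A : ℝ → ℝ → ℝ) (ξ : ℝ × ℝ → ℝ) (y : ℝ) : ℝ := ∫ x in Ioo 0 a, A x y * ξ (x, y)

lemma Wk.flux_cont (H : Wk a m M θ A V) {ξ : ℝ × ℝ → ℝ} (hξ : ContDiff ℝ 1 ξ) : ContinuousOn (flux a A ξ) (Icc 0 m) := by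
  obtain ⟨N, hN0, hN⟩ := xi_bd hξ.continuous a m
  have hJ : ContinuousOn (fun p : ℝ × ℝ => A p.1 p.2 * ξ (p.1, p.2)) (Ioc 0 a ×ˢ Icc 0 m) := H.cA.mul hξ.continuous.continuousOn
  intro y hy
  refine continuousWithinAt_of_dominated (bound := fun _ => M * N) ?_ ?_ ?_ ?_
  · filter_upwards [self_mem_nhdsWithin] with z hz
    exact ((Wk.c1 (F := fun x y => A x y * ξ (x, y)) hJ hz).mono Ioo_subset_Ioc_self).aestronglyMeasurable measurableSet_Ioo
  · filter_upwards [self_mem_nhdsWithin] with z hz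
    filter_upwards [ae_restrict_mem measurableSet_Ioo] with x hx
    rw [Real.norm_eq_abs, abs_mul]
    exact mul_le_mul (H.bA x (Ioo_subset_Ioc_self hx) z hz) (hN x (Ioo_subset_Icc_self hx) z hz) (abs_nonneg _) H.hM
  · exact integrable_const _
  · filter_upwards [ae_restrict_mem measurableSet_Ioo] with x hx
    exact hJ.comp (f := fun y => (x, y)) (by fun_prop) (fun z hz => ⟨Ioo_subset_Ioc_self hx, hz⟩) y hy

lemma slope_bd {F F' : ℝ → ℝ} {m C : ℝ} (h : ∀ t ∈ Icc 0 m, HasDerivWithinAt F (F' t) (Icc 0 m) t) (hb : ∀ t ∈ Icc 0 m, |F' t| ≤ C)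
    {y z : ℝ} (hy : y ∈ Icc 0 m) (hz : z ∈ Icc 0 m) (hne : z ≠ y) : |slope F y z| ≤ C := by
  have := (convex_Icc 0 m).norm_image_sub_le_of_norm_hasDerivWithin_le h hb hy hz
  rw [slope_def_field, abs_div, div_le_iff₀ (abs_pos.2 (sub_ne_zero.2 hne))]
  simpa using this

lemma Wk.flux_deriv (H : Wk a m M θ A V) {ξ : ℝ × ℝ → ℝ} (hξ : ContDiff ℝ 1 ξ) (h0 : ∀ y ∈ Icc 0 m, ξ (a, y) = 0) {y : ℝ}
    (hy : y ∈ Ioo 0 m) : HasDerivAt (flux a A ξ) (∫ x in Ioo 0 a, (A x y * pdy ξ (x, y) - V x y * pdx ξ (x, y))) y := by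
  obtain ⟨N, hN0, hN⟩ := xi_bd hξ.continuous a m
  obtain ⟨N1, hN10, hN1⟩ := xi_bd (c_pdx hξ) a m
  obtain ⟨N2, hN20, hN2⟩ := xi_bd (c_pdy hξ) a m
  have hM := H.hM
  have ha := H.ha
  have hyc := Ioo_subset_Icc_self hy
  have cξ : ∀ z, Continuous fun x => ξ (x, z) := fun z => hξ.continuous.comp (by fun_prop)
  have cξ1 : ∀ z, Continuous fun x => pdx ξ (x, z) := fun z => (c_pdx hξ).comp (by fun_prop)
  have cθ : ∀ z ∈ Icc 0 m, ContinuousOn (fun x => θ x z) (Ioo 0 a) :=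
    fun z hz x hx => (H.dA x (Ioo_subset_Ioc_self hx) z hz).continuousAt.continuousWithinAt
  have cA : ∀ z ∈ Icc 0 m, ContinuousOn (fun x => A x z) (Ioo 0 a) := fun z hz => (Wk.c1 H.cA hz).mono Ioo_subset_Ioc_self
  have IA : ∀ z ∈ Icc 0 m, ∀ z' ∈ Icc 0 m, IntegrableOn (fun x => A x z * ξ (x, z')) (Ioo 0 a) := by
    intro z hz z' hz'
    refine int_of (C := M * N) ((cA z hz).mul (cξ z').continuousOn) fun x hx => ?_
    rw [abs_mul]
    exact mul_le_mul (H.bA x (Ioo_subset_Ioc_self hx) z hz) (hN x (Ioo_subset_Icc_self hx) z' hz') (abs_nonneg _) hM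
  have IT : ∀ z ∈ Icc 0 m, IntegrableOn (fun x => θ x z * pdx ξ (x, y)) (Ioo 0 a) := by
    intro z hz
    refine int_of (C := M * a * N1) ((cθ z hz).mul (cξ1 y).continuousOn) fun x hx => ?_
    rw [abs_mul]
    exact mul_le_mul ((H.bT x (Ioo_subset_Ioc_self hx) z hz).trans (mul_le_mul_of_nonneg_left hx.2.le hM))
      (hN1 x (Ioo_subset_Icc_self hx) y hyc) (abs_nonneg _) (by positivity)
  rw [hasDerivAt_iff_tendsto_slope]
  have hmem : ∀ᶠ z in nhdsWithin y {y}ᶜ, z ∈ Icc 0 m ∧ z ≠ y := by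
    have h1 : ∀ᶠ z in nhdsWithin y {y}ᶜ, z ∈ Icc 0 m := mem_nhdsWithin_of_mem_nhds (Icc_mem_nhds hy.1 hy.2)
    filter_upwards [h1, self_mem_nhdsWithin] with z hz hz' using ⟨hz, hz'⟩
  have hsl : ∀ᶠ z in nhdsWithin y {y}ᶜ, (∫ x in Ioo 0 a, (A x z * slope (fun t => ξ (x, t)) y z - slope (θ x) y z * pdx ξ (x, y))) =
      slope (flux a A ξ) y z := by
    filter_upwards [hmem] with z hz
    have h1 := H.parts hξ hyc hz.1 (h0 y hyc)
    have h2 := H.parts hξ hyc hyc (h0 y hyc)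
    rw [slope_def_field]
    have hzy : z - y ≠ 0 := sub_ne_zero.2 hz.2
    have e1 : (∫ x in Ioo 0 a, (A x z * slope (fun t => ξ (x, t)) y z - slope (θ x) y z * pdx ξ (x, y))) =
        ∫ x in Ioo 0 a, ((A x z * ξ (x, z) - A x z * ξ (x, y)) - (θ x z * pdx ξ (x, y) - θ x y * pdx ξ (x, y))) / (z - y) := by
      refine integral_congr_ae (ae_of_all _ fun x => ?_)
      simp only [slope_def_field]
      field_simp
    have e2 : (∫ x in Ioo 0 a, ((A x z * ξ (x, z) - A x z * ξ (x, y)) - (θ x z * pdx ξ (x, y) - θ x y * pdx ξ (x, y)))) =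
        flux a A ξ z - flux a A ξ y := by
      have hs1 : IntegrableOn (fun x => A x z * ξ (x, z) - A x z * ξ (x, y)) (Ioo 0 a) := (IA z hz.1 z hz.1).sub (IA z hz.1 y hyc)
      have hs2 : IntegrableOn (fun x => θ x z * pdx ξ (x, y) - θ x y * pdx ξ (x, y)) (Ioo 0 a) := (IT z hz.1).sub (IT y hyc)
      rw [integral_sub hs1 hs2, integral_sub (IA z hz.1 z hz.1) (IA z hz.1 y hyc), integral_sub (IT z hz.1) (IT y hyc)]
      unfold flux
      linarith
    rw [e1, integral_div, e2]
  refine Tendsto.congr' hsl ?_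
  refine tendsto_integral_filter_of_dominated_convergence (fun _ => M * N2 + M * N1) ?_ ?_ (integrable_const _) ?_
  · filter_upwards [hmem] with z hz
    refine ContinuousOn.aestronglyMeasurable ?_ measurableSet_Ioo
    simp only [slope_def_field]
    exact ((cA z hz.1).mul (((cξ z).sub (cξ y)).div_const _).continuousOn).sub
      ((((cθ z hz.1).sub (cθ y hyc)).div_const _).mul (cξ1 y).continuousOn)
  · filter_upwards [hmem] with z hz
    filter_upwards [ae_restrict_mem measurableSet_Ioo] with x hx
    have hx1 := Ioo_subset_Ioc_self hx
    have hx2 := Ioo_subset_Icc_self hx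
    have b1 : |A x z * slope (fun t => ξ (x, t)) y z| ≤ M * N2 := by
      rw [abs_mul]
      exact mul_le_mul (H.bA x hx1 z hz.1) (slope_bd (fun t _ => (h_pdy hξ x t).hasDerivWithinAt) (fun t ht => hN2 x hx2 t ht) hyc hz.1 hz.2)
        (abs_nonneg _) hM
    have b2 : |slope (θ x) y z * pdx ξ (x, y)| ≤ M * N1 := by
      rw [abs_mul]
      exact mul_le_mul (slope_bd (fun t ht => H.dV x hx1 t ht) (fun t ht => H.bV x hx1 t ht) hyc hz.1 hz.2) (hN1 x hx2 y hyc)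
        (abs_nonneg _) hM
    rw [Real.norm_eq_abs]
    exact (abs_sub _ _).trans (add_le_add b1 b2)
  · filter_upwards [ae_restrict_mem measurableSet_Ioo] with x hx
    have hx1 := Ioo_subset_Ioc_self hx
    have t1 : Tendsto (fun z => A x z) (nhdsWithin y {y}ᶜ) (nhds (A x y)) := by
      have : ContinuousOn (fun z => A x z) (Icc 0 m) := H.cA.comp (f := fun z => (x, z)) (by fun_prop) fun z hz => ⟨hx1, hz⟩
      exact (this.continuousAt (Icc_mem_nhds hy.1 hy.2)).tendsto.mono_left nhdsWithin_le_nhds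
    have t2 := hasDerivAt_iff_tendsto_slope.1 (h_pdy hξ x y)
    have t3 := hasDerivAt_iff_tendsto_slope.1 ((H.dV x hx1 y hyc).hasDerivAt (Icc_mem_nhds hy.1 hy.2))
    exact (t1.mul t2).sub (t3.mul_const _)

/-- the weak form -/
lemma Wk.weak (H : Wk a m M θ A V) {ξ : ℝ × ℝ → ℝ} (hξ : ContDiff ℝ 1 ξ) (h0 : ∀ y ∈ Ioo 0 m, ξ (a, y) = 0) :
    ∫ p in Ioo 0 a ×ˢ Ioo 0 m, (A p.1 p.2 * pdy ξ p - V p.1 p.2 * pdx ξ p) = ∫ x in Ioo 0 a, A x m * ξ (x, m) := by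
  obtain ⟨N1, hN10, hN1⟩ := xi_bd (c_pdx hξ) a m
  obtain ⟨N2, hN20, hN2⟩ := xi_bd (c_pdy hξ) a m
  have hM := H.hM
  have hm := H.hm
  have ha := H.ha
  have h0' : ∀ y ∈ Icc 0 m, ξ (a, y) = 0 := by
    intro y hy
    rw [← closure_Ioo hm.ne] at hy
    have hcl : IsClosed {y | ξ (a, y) = 0} := isClosed_eq (hξ.continuous.comp (by fun_prop)) continuous_const
    exact closure_minimal (show Ioo 0 m ⊆ {y | ξ (a, y) = 0} from h0) hcl hy
  have hsub : (Ioo 0 a ×ˢ Ioo 0 m : Set (ℝ × ℝ)) ⊆ Ioc 0 a ×ˢ Icc 0 m := prod_mono Ioo_subset_Ioc_self Ioo_subset_Icc_self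
  have hI : IntegrableOn (fun p : ℝ × ℝ => A p.1 p.2 * pdy ξ p - V p.1 p.2 * pdx ξ p) (Ioo 0 a ×ˢ Ioo 0 m) := by
    have hms : MeasurableSet (Ioo 0 a ×ˢ Ioo 0 m : Set (ℝ × ℝ)) := measurableSet_Ioo.prod measurableSet_Ioo
    refine IntegrableOn.of_bound ?_ (ContinuousOn.aestronglyMeasurable ?_ hms) (M * N2 + M * N1) ?_
    · rw [Measure.volume_eq_prod, Measure.prod_prod]
      simp only [Real.volume_Ioo]
      exact ENNReal.mul_lt_top ENNReal.ofReal_lt_top ENNReal.ofReal_lt_top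
    · exact ((H.cA.mono hsub).mul (c_pdy hξ).continuousOn).sub ((H.cV.mono hsub).mul (c_pdx hξ).continuousOn)
    · filter_upwards [ae_restrict_mem hms] with p hp
      have hp' := hsub hp
      rw [Real.norm_eq_abs]
      refine (abs_sub _ _).trans (add_le_add ?_ ?_)
      · rw [abs_mul]
        exact mul_le_mul (H.bA _ hp'.1 _ hp'.2) (hN2 _ (Ioc_subset_Icc_self hp'.1) _ hp'.2) (abs_nonneg _) hM
      · rw [abs_mul]
        exact mul_le_mul (H.bV _ hp'.1 _ hp'.2) (hN1 _ (Ioc_subset_Icc_self hp'.1) _ hp'.2) (abs_nonneg _) hM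
  rw [Measure.volume_eq_prod] at hI ⊢
  have hF := setIntegral_prod_swap (μ := volume) (ν := volume) (Ioo 0 a) (Ioo 0 m)
    (fun p : ℝ × ℝ => A p.1 p.2 * pdy ξ p - V p.1 p.2 * pdx ξ p)
  have hS : IntegrableOn (fun p : ℝ × ℝ => A p.2 p.1 * pdy ξ (p.2, p.1) - V p.2 p.1 * pdx ξ (p.2, p.1)) (Ioo 0 m ×ˢ Ioo 0 a)
      (volume.prod volume) := hI.swap
  rw [← hF]
  refine (setIntegral_prod _ hS).trans ?_
  have hS1 : IntegrableOn (fun y => ∫ x in Ioo 0 a, (A x y * pdy ξ (x, y) - V x y * pdx ξ (x, y))) (Ioo 0 m) := by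
    have : Integrable (fun p : ℝ × ℝ => A p.2 p.1 * pdy ξ (p.2, p.1) - V p.2 p.1 * pdx ξ (p.2, p.1))
        ((volume.restrict (Ioo 0 m)).prod (volume.restrict (Ioo 0 a))) := by
      rw [Measure.prod_restrict]; exact hS
    exact this.integral_prod_left
  have key := intervalIntegral.integral_eq_sub_of_hasDerivAt_of_le hm.le (H.flux_cont hξ)
    (fun y hy => H.flux_deriv hξ h0' hy) ((intervalIntegrable_iff_integrableOn_Ioo_of_le hm.le).2 hS1)
  rw [intervalIntegral.integral_of_le hm.le, integral_Ioc_eq_integral_Ioo] at key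
  rw [key]
  have hz : flux a A ξ 0 = 0 := by
    unfold flux
    refine (setIntegral_congr_fun (g := fun _ => (0 : ℝ)) measurableSet_Ioo fun x hx => ?_).trans (by simp)
    have h1 := H.dA x (Ioo_subset_Ioc_self hx) 0 ⟨le_rfl, hm.le⟩
    have h2 : HasDerivAt (fun x => θ x 0) 0 x := by
      refine (hasDerivAt_const x (0 : ℝ)).congr_of_eventuallyEq ?_
      filter_upwards [Ioo_mem_nhds hx.1 hx.2] with t ht using H.T0 t (Ioo_subset_Ioc_self ht)
    simp only [h1.unique h2, zero_mul]
  rw [hz, sub_zero]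
  rfl

end Nozzle

namespace Nozzle

/-- boundary speed extended by the sonic value -/
def Qpf (γ : ℝ) (qm : ℝ → ℝ) (x : ℝ) : ℝ := if x ≤ 0 then cstar γ else qm x

lemma Qpf_pos {γ x : ℝ} {qm : ℝ → ℝ} (hx : 0 < x) : Qpf γ qm x = qm x := by simp [Qpf, hx]

lemma Qpf_neg {γ x : ℝ} {qm : ℝ → ℝ} (hx : x ≤ 0) : Qpf γ qm x = cstar γ := by simp [Qpf, hx]

variable {γ lam L m a1 a2 K2 l : ℝ} {f qm : ℝ → ℝ} {q V R T Tx : ℝ → ℝ → ℝ}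

lemma Sol.c_Qpf (S : Sol γ lam L m a1 a2 K2 f qm q V R T Tx) : ContinuousOn (Qpf γ qm) (Iio L) := by
  intro x hx
  refine ContinuousAt.continuousWithinAt ?_
  rcases lt_trichotomy x 0 with h | h | h
  · refine continuousAt_const.congr (f := fun _ => cstar γ) ?_
    filter_upwards [Iio_mem_nhds h] with t ht using (Qpf_neg (le_of_lt ht)).symm
  · subst h
    rw [continuousAt_iff_continuous_left'_right']
    constructor
    · refine ContinuousWithinAt.congr (f := fun _ => cstar γ) continuousWithinAt_const (fun t ht => Qpf_neg (le_of_lt ht)) (Qpf_neg le_rfl)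
    · unfold ContinuousWithinAt
      rw [Qpf_neg le_rfl]
      refine S.qm0.congr' ?_
      filter_upwards [self_mem_nhdsWithin] with t ht using (Qpf_pos ht).symm
  · refine (S.cqm.continuousAt (Ioo_mem_nhds h hx)).congr ?_
    filter_upwards [Ioi_mem_nhds h] with t ht using (Qpf_pos ht).symm

lemma ThP_zero_aux (hf : deriv f 0 = 0) : ThP f 0 = 0 := by simp [ThP, hf]

/-- the density of the potential along the wall -/
lemma Sol.c_kap (S : Sol γ lam L m a1 a2 K2 f qm q V R T Tx) (hT : Continuous (ThP f)) :
    ContinuousOn (fun x => Qpf γ qm x / cos (ThP f x)) (Iio L) := by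
  refine S.c_Qpf.div (Real.continuous_cos.comp hT).continuousOn fun x _ => ?_
  exact (Real.cos_arctan_pos _).ne'

lemma Sol.kap_bd (S : Sol γ lam L m a1 a2 K2 f qm q V R T Tx) (hf : deriv f 0 = 0) (hc : 0 < cstar γ) {x : ℝ} (hx : x ∈ Ico 0 L) :
    cstar γ ≤ Qpf γ qm x / cos (ThP f x) ∧ Qpf γ qm x / cos (ThP f x) ≤ 2 * cstar γ := by
  rcases hx.1.eq_or_lt with h | h
  · rw [← h, Qpf_neg le_rfl, ThP_zero_aux hf, Real.cos_zero, div_one]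
    constructor <;> linarith
  · have hx' : x ∈ Ioo 0 L := ⟨h, hx.2⟩
    have h1 := S.qm_ge x hx'
    have h2 := S.qm_le' x hx'
    have h3 := S.cosT x hx'
    have h4 := Real.cos_le_one (ThP f x)
    rw [Qpf_pos h]
    constructor
    · rw [le_div_iff₀ (by linarith)]
      nlinarith
    · rw [div_le_iff₀ (by linarith)]
      nlinarith

lemma Sol.dPhi (S : Sol γ lam L m a1 a2 K2 f qm q V R T Tx) (hT : Continuous (ThP f)) {x : ℝ} (hx : x ∈ Ico 0 L) :
    HasDerivAt (PhiP f (Qpf γ qm)) (Qpf γ qm x / cos (ThP f x)) x := by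
  have hc := S.c_kap hT
  have hsub : uIcc 0 x ⊆ Iio L := by
    rw [uIcc_of_le hx.1]; exact fun t ht => ht.2.trans_lt hx.2
  refine intervalIntegral.integral_hasDerivAt_right ((hc.mono hsub).intervalIntegrable) ?_ (hc.continuousAt (Iio_mem_nhds hx.2))
  exact hc.stronglyMeasurableAtFilter isOpen_Iio x hx.2

/-- increments of the potential -/
lemma Sol.Phi_inc (S : Sol γ lam L m a1 a2 K2 f qm q V R T Tx) (hT : Continuous (ThP f)) (hf : deriv f 0 = 0) (hc : 0 < cstar γ)
    {x x' : ℝ} (hx : 0 ≤ x) (hxx : x ≤ x') (hx' : x' < L) :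
    cstar γ * (x' - x) ≤ PhiP f (Qpf γ qm) x' - PhiP f (Qpf γ qm) x ∧
    PhiP f (Qpf γ qm) x' - PhiP f (Qpf γ qm) x ≤ 2 * cstar γ * (x' - x) := by
  have hm : ∀ t ∈ Icc x x', t ∈ Ico 0 L := fun t ht => ⟨hx.trans ht.1, ht.2.trans_lt hx'⟩
  constructor
  · have := incr_le (f := fun t => cstar γ * t) (h := PhiP f (Qpf γ qm)) hxx
      (fun t ht => ((hasDerivAt_id t).const_mul (cstar γ)).hasDerivWithinAt) (fun t ht => (S.dPhi hT (hm t ht)).hasDerivWithinAt)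
      (fun t ht => by rw [mul_one]; exact (S.kap_bd hf hc (hm t ht)).1)
    linarith
  · have := incr_le (f := PhiP f (Qpf γ qm)) (h := fun t => 2 * cstar γ * t) hxx
      (fun t ht => (S.dPhi hT (hm t ht)).hasDerivWithinAt) (fun t ht => ((hasDerivAt_id t).const_mul (2 * cstar γ)).hasDerivWithinAt)
      (fun t ht => by rw [mul_one]; exact (S.kap_bd hf hc (hm t ht)).2)
    linarith

/-- properties of the inverse of the potential -/
structure Inv (γ L l ζ Z : ℝ) (f qm X : ℝ → ℝ) : Prop where
  hζ : 0 < ζ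
  hZ : ζ < Z
  hX : ∀ φ ∈ Ioo 0 Z, X φ ∈ Ioo 0 L
  dX : ∀ φ ∈ Ioo 0 Z, HasDerivAt X (cos (ThP f (X φ)) / qm (X φ)) φ
  X_le : ∀ φ ∈ Ioo 0 Z, cstar γ * X φ ≤ φ
  X_ge : ∀ φ ∈ Ioo 0 Z, φ ≤ 2 * cstar γ * X φ
  X_inc : ∀ φ ∈ Ioo 0 Z, ∀ φ' ∈ Ioo 0 Z, φ ≤ φ' → X φ ≤ X φ' ∧ cstar γ * (X φ' - X φ) ≤ φ' - φ
  XP_eq : ∀ φ ∈ Ioc 0 ζ, XP f (Qpf γ qm) l φ = X φ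
  X_Phi : ∀ x ∈ Ioc 0 l, X (PhiP f (Qpf γ qm) x) = x ∧ PhiP f (Qpf γ qm) x ∈ Ioc 0 ζ

lemma Sol.exists_X (S : Sol γ lam L m a1 a2 K2 f qm q V R T Tx) (hT : Continuous (ThP f)) (hf : deriv f 0 = 0) (hc : 0 < cstar γ)
    (hl : 0 < l) (hlL : l < L) : ∃ Z X, Inv γ L l (zetaP f (Qpf γ qm) l) Z f qm X := by
  obtain ⟨Φ, hΦ⟩ : ∃ Φ, Φ = PhiP f (Qpf γ qm) := ⟨_, rfl⟩
  have hζe : zetaP f (Qpf γ qm) l = Φ l := by rw [hΦ]; rfl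
  have Φ0 : Φ 0 = 0 := by rw [hΦ]; simp [PhiP]
  obtain ⟨b, hb⟩ : ∃ b, b = (l + L) / 2 := ⟨_, rfl⟩
  have hlb : l < b := by linarith
  have hbL : b < L := by linarith
  have hinc : ∀ x x', 0 ≤ x → x ≤ x' → x' < L → cstar γ * (x' - x) ≤ Φ x' - Φ x ∧ Φ x' - Φ x ≤ 2 * cstar γ * (x' - x) := by
    intro x x' h1 h2 h3; rw [hΦ]; exact S.Phi_inc hT hf hc h1 h2 h3
  have hmono : ∀ x x', 0 ≤ x → x < x' → x' < L → Φ x < Φ x' := by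
    intro x x' h1 h2 h3
    have h4 := (hinc x x' h1 h2.le h3).1
    have h5 : 0 < cstar γ * (x' - x) := mul_pos hc (by linarith)
    linarith
  have hmono' : ∀ x x', 0 ≤ x → x ≤ x' → x' < L → Φ x ≤ Φ x' := by
    intro x x' h1 h2 h3
    rcases h2.eq_or_lt with h | h
    · rw [h]
    · exact (hmono x x' h1 h h3).le
  have hrefl : ∀ x ∈ Icc 0 b, ∀ x' ∈ Icc 0 b, Φ x ≤ Φ x' → x ≤ x' := by
    intro x hx x' hx' h
    by_contra hcon
    exact absurd (hmono x' x hx'.1 (not_le.1 hcon) (hx.2.trans_lt hbL)) (not_lt.2 h)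
  have hcont : ∀ c, c < L → ContinuousOn Φ (Icc 0 c) := by
    intro c hcL x hx
    rw [hΦ]; exact (S.dPhi hT ⟨hx.1, hx.2.trans_lt hcL⟩).continuousAt.continuousWithinAt
  have hsurj : ∀ c, 0 ≤ c → c < L → ∀ φ ∈ Icc 0 (Φ c), ∃ x ∈ Icc 0 c, Φ x = φ := by
    intro c hc0 hcL φ hφ
    have := intermediate_value_Icc hc0 (hcont c hcL)
    rw [Φ0] at this
    exact this hφ
  have hex := fun φ hφ => hsurj b (hl.trans hlb).le hbL φ hφ
  obtain ⟨X, hXd⟩ : ∃ X, X = Function.invFunOn Φ (Icc 0 b) := ⟨_, rfl⟩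
  have Xmem : ∀ φ ∈ Icc 0 (Φ b), X φ ∈ Icc 0 b := fun φ hφ => by rw [hXd]; exact Function.invFunOn_mem (hex φ hφ)
  have Xeq : ∀ φ ∈ Icc 0 (Φ b), Φ (X φ) = φ := fun φ hφ => by rw [hXd]; exact Function.invFunOn_eq (hex φ hφ)
  have Xpos : ∀ φ ∈ Ioo 0 (Φ b), X φ ∈ Ioo 0 b := by
    intro φ hφ
    have hφ' := Ioo_subset_Icc_self hφ
    have h1 := Xmem φ hφ'
    have h2 := Xeq φ hφ'
    refine ⟨lt_of_le_of_ne h1.1 fun h => ?_, lt_of_le_of_ne h1.2 fun h => ?_⟩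
    · rw [← h, Φ0] at h2; exact hφ.1.ne h2
    · rw [h] at h2; exact hφ.2.ne h2.symm
  have Xinc : ∀ φ ∈ Ioo 0 (Φ b), ∀ φ' ∈ Ioo 0 (Φ b), φ ≤ φ' → X φ ≤ X φ' ∧ cstar γ * (X φ' - X φ) ≤ φ' - φ := by
    intro φ hφ φ' hφ' hh
    have e1 := Xeq φ (Ioo_subset_Icc_self hφ)
    have e2 := Xeq φ' (Ioo_subset_Icc_self hφ')
    have m1 := Xpos φ hφ
    have m2 := Xpos φ' hφ'
    have h3 : X φ ≤ X φ' := hrefl _ (Ioo_subset_Icc_self m1) _ (Ioo_subset_Icc_self m2) (by rw [e1, e2]; exact hh)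
    have h4 := (hinc _ _ m1.1.le h3 (m2.2.trans hbL)).1
    rw [e1, e2] at h4
    exact ⟨h3, h4⟩
  have hζ0 : 0 < Φ l := by rw [← Φ0]; exact hmono 0 l le_rfl hl hlL
  have hζZ : Φ l < Φ b := hmono l b hl.le hlb hbL
  refine ⟨Φ b, X, ?_⟩
  rw [hζe]
  refine ⟨hζ0, hζZ, fun φ hφ => ⟨(Xpos φ hφ).1, (Xpos φ hφ).2.trans hbL⟩, ?_, ?_, ?_, Xinc, ?_, ?_⟩
  · intro φ hφ
    have m1 := Xpos φ hφ
    have hXL : X φ ∈ Ioo 0 L := ⟨m1.1, m1.2.trans hbL⟩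
    have hd : HasDerivAt Φ (Qpf γ qm (X φ) / cos (ThP f (X φ))) (X φ) := by
      rw [hΦ]; exact S.dPhi hT ⟨m1.1.le, hXL.2⟩
    have hne : Qpf γ qm (X φ) / cos (ThP f (X φ)) ≠ 0 := (hc.trans_le (S.kap_bd hf hc ⟨hXL.1.le, hXL.2⟩).1).ne'
    have hXc : ContinuousAt X φ := by
      rw [Metric.continuousAt_iff]
      intro e he
      obtain ⟨d, hd, hdI⟩ := Metric.isOpen_iff.1 isOpen_Ioo φ hφ
      refine ⟨min d (cstar γ * e), lt_min hd (mul_pos hc he), fun {t} ht => ?_⟩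
      have htI := hdI (Metric.mem_ball.2 (ht.trans_le (min_le_left _ _)))
      have hts := ht.trans_le (min_le_right _ _)
      rw [Real.dist_eq] at hts ⊢
      rcases le_total φ t with h | h
      · have h5 := Xinc φ hφ t htI h
        rw [abs_of_nonneg (by linarith)] at hts ⊢
        exact lt_of_mul_lt_mul_left (h5.2.trans_lt hts) hc.le
      · have h5 := Xinc t htI φ hφ h
        rw [abs_sub_comm, abs_of_nonneg (by linarith)] at hts ⊢
        exact lt_of_mul_lt_mul_left (h5.2.trans_lt hts) hc.le
    have hfin := HasDerivAt.of_local_left_inverse hXc hd hne (by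
      filter_upwards [Ioo_mem_nhds hφ.1 hφ.2] with t ht using Xeq t (Ioo_subset_Icc_self ht))
    rw [Qpf_pos m1.1, inv_div] at hfin
    exact hfin
  · intro φ hφ
    have m1 := Xpos φ hφ
    have h := (hinc 0 (X φ) le_rfl m1.1.le (m1.2.trans hbL)).1
    rw [Φ0, Xeq φ (Ioo_subset_Icc_self hφ)] at h
    linarith
  · intro φ hφ
    have m1 := Xpos φ hφ
    have h := (hinc 0 (X φ) le_rfl m1.1.le (m1.2.trans hbL)).2
    rw [Φ0, Xeq φ (Ioo_subset_Icc_self hφ)] at h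
    linarith
  · intro φ hφ
    have hexl := hsurj l hl.le hlL φ ⟨hφ.1.le, hφ.2⟩
    have h1 : XP f (Qpf γ qm) l φ ∈ Icc 0 l := by
      unfold XP; rw [← hΦ]; exact Function.invFunOn_mem hexl
    have h2 : Φ (XP f (Qpf γ qm) l φ) = φ := by
      unfold XP; rw [← hΦ]; exact Function.invFunOn_eq hexl
    have hφ' : φ ∈ Icc 0 (Φ b) := ⟨hφ.1.le, hφ.2.trans hζZ.le⟩
    have h3 := Xeq φ hφ'
    have h4 := Xmem φ hφ'
    have h1' : XP f (Qpf γ qm) l φ ∈ Icc 0 b := ⟨h1.1, h1.2.trans hlb.le⟩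
    exact le_antisymm (hrefl _ h1' _ h4 (by rw [h2, h3])) (hrefl _ h4 _ h1' (by rw [h2, h3]))
  · intro x hx
    rw [← hΦ]
    have h1 : Φ x ∈ Ioc 0 (Φ l) := ⟨by have := hmono 0 x le_rfl hx.1 (hx.2.trans_lt hlL); rwa [Φ0] at this, hmono' x l hx.1.le hx.2 hlL⟩
    have hφ' : Φ x ∈ Icc 0 (Φ b) := ⟨h1.1.le, h1.2.trans hζZ.le⟩
    have h3 := Xeq _ hφ'
    have h4 := Xmem _ hφ'
    have h5 : x ∈ Icc 0 b := ⟨hx.1.le, hx.2.trans hlb.le⟩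
    exact ⟨le_antisymm (hrefl _ h4 _ h5 h3.le) (hrefl _ h5 _ h4 h3.ge), h1⟩

end Nozzle

namespace Nozzle

/-- extension by zero to nonpositive first argument -/
def Ze (F : ℝ → ℝ → ℝ) (x y : ℝ) : ℝ := if x ≤ 0 then 0 else F x y

lemma Ze_pos {F : ℝ → ℝ → ℝ} {x y : ℝ} (hx : 0 < x) : Ze F x y = F x y := by simp [Ze, hx]

lemma Ze_neg {F : ℝ → ℝ → ℝ} {x y : ℝ} (hx : x ≤ 0) : Ze F x y = 0 := by simp [Ze, hx]

/-- Lipschitz continuity of the extension -/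
lemma Ze_lip {a m Λ : ℝ} {F : ℝ → ℝ → ℝ} (hΛ : 0 ≤ Λ) (h0 : ∀ x ∈ Ioc 0 a, ∀ y ∈ Icc 0 m, |F x y| ≤ Λ * x)
    (h1 : ∀ x ∈ Ioc 0 a, ∀ x' ∈ Ioc 0 a, x ≤ x' → ∀ y ∈ Icc 0 m, |F x' y - F x y| ≤ Λ * (x' - x))
    (h2 : ∀ x ∈ Ioc 0 a, ∀ y ∈ Icc 0 m, ∀ y' ∈ Icc 0 m, |F x y' - F x y| ≤ Λ * |y' - y|) :
    ∀ x ∈ Icc 0 a, ∀ y ∈ Icc 0 m, ∀ x' ∈ Icc 0 a, ∀ y' ∈ Icc 0 m,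
      |Ze F x' y' - Ze F x y| ≤ Λ * (|x' - x| + |y' - y|) := by
  have g1 : ∀ x ∈ Icc 0 a, ∀ x' ∈ Icc 0 a, x ≤ x' → ∀ y ∈ Icc 0 m, |Ze F x' y - Ze F x y| ≤ Λ * (x' - x) := by
    intro x hx x' hx' hh y hy
    rcases hx.1.eq_or_lt with h | h
    · rw [← h, Ze_neg (x := 0) le_rfl]
      rcases hx'.1.eq_or_lt with h' | h'
      · rw [← h', Ze_neg (x := 0) le_rfl]; simp
      · rw [Ze_pos h', sub_zero, sub_zero]; exact h0 x' ⟨h', hx'.2⟩ y hy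
    · rw [Ze_pos h, Ze_pos (h.trans_le hh)]
      exact h1 x ⟨h, hx.2⟩ x' ⟨h.trans_le hh, hx'.2⟩ hh y hy
  intro x hx y hy x' hx' y' hy'
  have e1 : |Ze F x' y' - Ze F x' y| ≤ Λ * |y' - y| := by
    rcases hx'.1.eq_or_lt with h | h
    · rw [← h, Ze_neg (x := 0) le_rfl, Ze_neg (x := 0) le_rfl, sub_zero, abs_zero]; positivity
    · rw [Ze_pos h, Ze_pos h]; exact h2 x' ⟨h, hx'.2⟩ y hy y' hy'
  have e2 : |Ze F x' y - Ze F x y| ≤ Λ * |x' - x| := by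
    rcases le_total x x' with h | h
    · rw [abs_of_nonneg (sub_nonneg.2 h)]; exact g1 x hx x' hx' h y hy
    · rw [abs_sub_comm, abs_sub_comm x', abs_of_nonneg (sub_nonneg.2 h)]; exact g1 x' hx' x hx h y hy
  have := abs_sub_le (Ze F x' y') (Ze F x' y) (Ze F x y)
  linarith

/-- a one-sided Lipschitz bound controls the derivative -/
lemma deriv_bd {F c : ℝ → ℝ} {a b x : ℝ} (hx : x ∈ Ioo a b) (hc : ContinuousAt c x)
    (h : ∀ s ∈ Ioo a b, ∀ t ∈ Ioo a b, s ≤ t → |F t - F s| ≤ c t * (t - s)) : |deriv F x| ≤ c x := by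
  by_cases hd : DifferentiableAt ℝ F x
  · have ht := hd.hasDerivAt.hasDerivWithinAt (s := Ioi x)
    rw [hasDerivWithinAt_iff_tendsto_slope' (by simp)] at ht
    have h2 : Tendsto c (nhdsWithin x (Ioi x)) (nhds (c x)) := hc.tendsto.mono_left nhdsWithin_le_nhds
    refine le_of_tendsto_of_tendsto ht.abs h2 ?_
    filter_upwards [Ioo_mem_nhdsGT hx.2] with t ht
    have h3 := h x hx t ⟨hx.1.trans ht.1, ht.2⟩ ht.1.le
    have h4 : 0 < t - x := by linarith [ht.1]
    rw [slope_def_field, abs_div, abs_of_pos h4, div_le_iff₀ h4]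
    exact h3
  · rw [deriv_zero_of_not_differentiableAt hd, abs_zero]
    have h2 : Tendsto c (nhdsWithin x (Ioi x)) (nhds (c x)) := hc.tendsto.mono_left nhdsWithin_le_nhds
    refine ge_of_tendsto h2 ?_
    filter_upwards [Ioo_mem_nhdsGT hx.2] with t ht
    have h3 := (abs_nonneg _).trans (h x hx t ⟨hx.1.trans ht.1, ht.2⟩ ht.1.le)
    exact nonneg_of_mul_nonneg_left h3 (by linarith [ht.1])

/-- the flow in the potential plane -/
structure Flow (lam Z m b1 b2 K : ℝ) (Q V R : ℝ → ℝ → ℝ) : Prop where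
  dx : ∀ x ∈ Ioo 0 Z, ∀ ψ ∈ Icc 0 m, HasDerivAt (fun x => Q x ψ) (-(V x ψ)) x
  dy : ∀ x ∈ Ioo 0 Z, ∀ ψ ∈ Icc 0 m, HasDerivWithinAt (Q x) (R x ψ) (Icc 0 m) ψ
  q0 : ∀ ψ ∈ Icc 0 m, Tendsto (fun x => Q x ψ) (nhdsWithin 0 (Ioi 0)) (nhds 0)
  V_ge : ∀ x ∈ Ioo 0 Z, ∀ ψ ∈ Icc 0 m, b1 * x ^ (lam + 1) ≤ V x ψ
  V_le : ∀ x ∈ Ioo 0 Z, ∀ ψ ∈ Icc 0 m, V x ψ ≤ b2 * x ^ (lam + 1)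
  R_le : ∀ x ∈ Ioo 0 Z, ∀ ψ ∈ Icc 0 m, |R x ψ| ≤ b2 * x ^ (3 * lam / 2 + 1)
  Vx : ∀ x ∈ Ioo 0 Z, ∀ x' ∈ Ioo 0 Z, x ≤ x' → ∀ ψ ∈ Icc 0 m, |V x' ψ - V x ψ| ≤ K * x' ^ lam * (x' - x)
  Vy : ∀ x ∈ Ioo 0 Z, ∀ ψ ∈ Icc 0 m, ∀ ψ' ∈ Icc 0 m, |V x ψ' - V x ψ| ≤ K * x ^ (5 * lam / 4 + 1 / 2) * |ψ' - ψ|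
  Rx : ∀ x ∈ Ioo 0 Z, ∀ x' ∈ Ioo 0 Z, x ≤ x' → ∀ ψ ∈ Icc 0 m,
    |R x' ψ - R x ψ| ≤ K * x' ^ (5 * lam / 4 + 1 / 2) * (x' - x)
  Ry : ∀ x ∈ Ioo 0 Z, ∀ ψ ∈ Icc 0 m, ∀ ψ' ∈ Icc 0 m, |R x ψ' - R x ψ| ≤ K * x ^ (3 * lam / 2 + 1) * |ψ' - ψ|

variable {γ lam L l m a1 a2 K2 : ℝ} {f qm X : ℝ → ℝ} {q V R T Tx : ℝ → ℝ → ℝ}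

lemma pw_le {X x cs D p P : ℝ} (hcs : 0 < cs) (hX : 0 < X) (hXx : cs * X ≤ x) (hD : D = max 1 (1 / cs)) (hp : 0 ≤ p) (hpP : p ≤ P) :
    X ^ p ≤ D ^ P * x ^ p := by
  have hD1 : 1 ≤ D := hD ▸ le_max_left _ _
  have hD2 : 1 / cs ≤ D := hD ▸ le_max_right _ _
  have hx : 0 < x := lt_of_lt_of_le (mul_pos hcs hX) hXx
  have h1 : X ≤ D * x := by
    calc X ≤ x / cs := by rw [le_div_iff₀ hcs]; linarith
      _ = 1 / cs * x := by ring
      _ ≤ D * x := by gcongr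
  calc X ^ p ≤ (D * x) ^ p := rpow_le_rpow hX.le h1 hp
    _ = D ^ p * x ^ p := Real.mul_rpow (by linarith) hx.le
    _ ≤ D ^ P * x ^ p := by
      have := rpow_le_rpow_of_exponent_le hD1 hpP
      gcongr

lemma dif_le {u u' x x' cs D : ℝ} (hcs : 0 < cs) (hD : D = max 1 (1 / cs)) (hu : u ≤ u') (h : cs * (u' - u) ≤ x' - x) :
    u' - u ≤ D * (x' - x) := by
  have hD2 : 1 / cs ≤ D := hD ▸ le_max_right _ _
  have h0 : 0 ≤ x' - x := le_trans (mul_nonneg hcs.le (by linarith)) h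
  calc u' - u ≤ (x' - x) / cs := by rw [le_div_iff₀ hcs]; linarith
    _ = 1 / cs * (x' - x) := by ring
    _ ≤ D * (x' - x) := by gcongr

/-- the flow in the potential plane from the flow in the physical coordinate -/
lemma Sol.flow {ζ Z D : ℝ} (S : Sol γ lam L m a1 a2 K2 f qm q V R T Tx) (I : Inv γ L l ζ Z f qm X) (hc : 0 < cstar γ)
    (hlam : 2 < lam) (ha1 : 0 < a1) (ha2 : 0 < a2) (hK : 0 < K2) (hD : D = max 1 (1 / cstar γ)) :
    Flow lam Z m (a1 / (2 * cstar γ) ^ (lam + 1)) (a2 * D ^ (3 * lam / 2 + 2)) (K2 * D ^ (3 * lam / 2 + 2) * D)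
      (fun x => q (X x)) (fun x => V (X x)) (fun x => R (X x)) := by
  have hD1 : 1 ≤ D := hD ▸ le_max_left _ _
  have pw : ∀ x ∈ Ioo 0 Z, ∀ p, 0 ≤ p → p ≤ 3 * lam / 2 + 2 → (X x) ^ p ≤ D ^ (3 * lam / 2 + 2) * x ^ p :=
    fun x hx p h1 h2 => pw_le hc (I.hX x hx).1 (I.X_le x hx) hD h1 h2
  have lx : ∀ (p : ℝ), 0 ≤ p → p ≤ 3 * lam / 2 + 2 → ∀ G : ℝ → ℝ → ℝ,
      (∀ x ∈ Ioo 0 L, ∀ x' ∈ Ioo 0 L, x ≤ x' → ∀ ψ ∈ Icc 0 m, |G x' ψ - G x ψ| ≤ K2 * x' ^ p * (x' - x)) →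
      ∀ x ∈ Ioo 0 Z, ∀ x' ∈ Ioo 0 Z, x ≤ x' → ∀ ψ ∈ Icc 0 m,
      |G (X x') ψ - G (X x) ψ| ≤ K2 * D ^ (3 * lam / 2 + 2) * D * x' ^ p * (x' - x) := by
    intro p h1 h2 G hG x hx x' hx' hh ψ hψ
    obtain ⟨i1, i2⟩ := I.X_inc x hx x' hx' hh
    have i3 := dif_le hc hD i1 i2
    have i4 := pw x' hx' p h1 h2
    have h0 := (I.hX x' hx').1
    have h0' := hx'.1
    calc |G (X x') ψ - G (X x) ψ| ≤ K2 * (X x') ^ p * (X x' - X x) := hG _ (I.hX x hx) _ (I.hX x' hx') i1 ψ hψ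
      _ ≤ K2 * (D ^ (3 * lam / 2 + 2) * x' ^ p) * (D * (x' - x)) := by
        have : 0 ≤ X x' - X x := by linarith
        gcongr
      _ = _ := by ring
  have ly : ∀ (p : ℝ), 0 ≤ p → p ≤ 3 * lam / 2 + 2 → ∀ G : ℝ → ℝ → ℝ,
      (∀ x ∈ Ioo 0 L, ∀ ψ ∈ Icc 0 m, ∀ ψ' ∈ Icc 0 m, |G x ψ' - G x ψ| ≤ K2 * x ^ p * |ψ' - ψ|) →
      ∀ x ∈ Ioo 0 Z, ∀ ψ ∈ Icc 0 m, ∀ ψ' ∈ Icc 0 m,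
      |G (X x) ψ' - G (X x) ψ| ≤ K2 * D ^ (3 * lam / 2 + 2) * D * x ^ p * |ψ' - ψ| := by
    intro p h1 h2 G hG x hx ψ hψ ψ' hψ'
    have i4 := pw x hx p h1 h2
    have h0 := (I.hX x hx).1
    have h0' := hx.1
    calc |G (X x) ψ' - G (X x) ψ| ≤ K2 * (X x) ^ p * |ψ' - ψ| := hG _ (I.hX x hx) ψ hψ ψ' hψ'
      _ ≤ K2 * (D ^ (3 * lam / 2 + 2) * x ^ p) * |ψ' - ψ| := by gcongr
      _ = K2 * D ^ (3 * lam / 2 + 2) * 1 * x ^ p * |ψ' - ψ| := by ring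
      _ ≤ _ := by gcongr
  constructor
  · intro x hx ψ hψ
    have h := I.hX x hx
    have h1 := (S.dqx _ h ψ hψ).comp x (I.dX x hx)
    refine h1.congr_deriv ?_
    have : cos (ThP f (X x)) ≠ 0 := by have := S.cosT _ h; linarith
    have : qm (X x) ≠ 0 := by have := S.qm_ge _ h; linarith
    field_simp
  · exact fun x hx ψ hψ => S.dqy _ (I.hX x hx) ψ hψ
  · intro ψ hψ
    refine (S.q0 ψ hψ).comp ?_
    have hZ : 0 < Z := I.hζ.trans I.hZ
    refine tendsto_nhdsWithin_iff.2 ⟨?_, ?_⟩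
    · refine squeeze_zero' (g := fun x => D * x) ?_ ?_ ?_
      · filter_upwards [Ioo_mem_nhdsGT hZ] with x hx using (I.hX x hx).1.le
      · filter_upwards [Ioo_mem_nhdsGT hZ] with x hx
        have := dif_le (u := 0) (u' := X x) (x := 0) (x' := x) hc hD (I.hX x hx).1.le (by simpa using I.X_le x hx)
        simpa using this
      · have : Tendsto (fun x => D * x) (nhds 0) (nhds (D * 0)) := (continuous_const.mul continuous_id).tendsto 0
        rw [mul_zero] at this
        exact this.mono_left nhdsWithin_le_nhds
    · filter_upwards [Ioo_mem_nhdsGT hZ] with x hx using (I.hX x hx).1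
  · intro x hx ψ hψ
    have h0 := (I.hX x hx).1
    refine le_trans ?_ (S.V_ge _ (I.hX x hx) ψ hψ)
    have h1 : x ^ (lam + 1) ≤ (2 * cstar γ) ^ (lam + 1) * (X x) ^ (lam + 1) := by
      rw [← Real.mul_rpow (by linarith) h0.le]
      exact rpow_le_rpow hx.1.le (I.X_ge x hx) (by linarith)
    rw [div_mul_eq_mul_div, div_le_iff₀ (by positivity)]
    calc a1 * x ^ (lam + 1) ≤ a1 * ((2 * cstar γ) ^ (lam + 1) * (X x) ^ (lam + 1)) := by gcongr
      _ = _ := by ring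
  · intro x hx ψ hψ
    refine (S.V_le _ (I.hX x hx) ψ hψ).trans ?_
    have := pw x hx (lam + 1) (by linarith) (by linarith)
    calc _ ≤ a2 * (D ^ (3 * lam / 2 + 2) * x ^ (lam + 1)) := by gcongr
      _ = _ := by ring
  · intro x hx ψ hψ
    refine (S.R_le _ (I.hX x hx) ψ hψ).trans ?_
    have := pw x hx (3 * lam / 2 + 1) (by linarith) (by linarith)
    calc _ ≤ a2 * (D ^ (3 * lam / 2 + 2) * x ^ (3 * lam / 2 + 1)) := by gcongr
      _ = _ := by ring
  · exact lx lam (by linarith) (by linarith) V S.Vx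
  · exact ly _ (by linarith) (by linarith) V S.Vy
  · exact lx _ (by linarith) (by linarith) R S.Rx
  · exact ly _ (by linarith) (by linarith) R S.Ry

end Nozzle

namespace Nozzle

variable {lam Z m b1 b2 K ζ : ℝ} {Q V R : ℝ → ℝ → ℝ}

/-- a function is increasing if it starts from `0` and has nonnegative derivative -/
lemma nonneg_of_deriv {F F' : ℝ → ℝ} {Z x : ℝ} (hx : x ∈ Ioo 0 Z) (h0 : Tendsto F (nhdsWithin 0 (Ioi 0)) (nhds 0))
    (hd : ∀ t ∈ Ioo 0 Z, HasDerivAt F (F' t) t) (hn : ∀ t ∈ Ioo 0 Z, 0 ≤ F' t) : 0 ≤ F x := by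
  refine le_of_tendsto h0 ?_
  filter_upwards [Ioo_mem_nhdsGT hx.1] with s hs
  have hm : ∀ t ∈ Icc s x, t ∈ Ioo 0 Z := fun t ht => ⟨hs.1.trans_le ht.1, ht.2.trans_lt hx.2⟩
  have := incr_le (f := fun _ => (0 : ℝ)) (h := F) hs.2.le (fun t _ => hasDerivWithinAt_const _ _ _)
    (fun t ht => (hd t (hm t ht)).hasDerivWithinAt) (fun t ht => hn t (hm t ht))
  linarith

lemma pow0_tendsto {p c : ℝ} (hp : 0 < p) : Tendsto (fun x : ℝ => c * x ^ p) (nhdsWithin 0 (Ioi 0)) (nhds 0) := by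
  have h : Tendsto (fun x : ℝ => c * x ^ p) (nhds 0) (nhds (c * 0 ^ p)) :=
    ((Real.continuousAt_rpow_const 0 p (Or.inr hp.le)).const_mul c).tendsto
  rw [Real.zero_rpow hp.ne', mul_zero] at h
  exact h.mono_left nhdsWithin_le_nhds

lemma Flow.Q_bd (W : Flow lam Z m b1 b2 K Q V R) (hlam : 2 < lam) {x ψ : ℝ} (hx : x ∈ Ioo 0 Z) (hψ : ψ ∈ Icc 0 m) :
    -(b2 / (lam + 2)) * x ^ (lam + 2) ≤ Q x ψ ∧ Q x ψ ≤ -(b1 / (lam + 2)) * x ^ (lam + 2) := by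
  have hl : lam + 2 ≠ 0 := by linarith
  have dp : ∀ c : ℝ, ∀ t ∈ Ioo 0 Z, HasDerivAt (fun t : ℝ => c / (lam + 2) * t ^ (lam + 2)) (c * t ^ (lam + 1)) t := by
    intro c t ht
    refine ((Real.hasDerivAt_rpow_const (Or.inl ht.1.ne')).const_mul _).congr_deriv ?_
    rw [show lam + 2 - 1 = lam + 1 by ring]; field_simp
  constructor
  · have := nonneg_of_deriv (F := fun t => b2 / (lam + 2) * t ^ (lam + 2) + Q t ψ) hx
      (by simpa using (pow0_tendsto (by linarith)).add (W.q0 ψ hψ)) (fun t ht => (dp b2 t ht).add (W.dx t ht ψ hψ))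
      (fun t ht => by have := W.V_le t ht ψ hψ; linarith)
    linarith
  · have := nonneg_of_deriv (F := fun t => -(b1 / (lam + 2) * t ^ (lam + 2) + Q t ψ)) hx
      (by simpa using ((pow0_tendsto (by linarith)).add (W.q0 ψ hψ)).neg) (fun t ht => ((dp b1 t ht).add (W.dx t ht ψ hψ)).neg)
      (fun t ht => by have := W.V_ge t ht ψ hψ; linarith)
    linarith

lemma pw_split {x a p q : ℝ} (hx : x ∈ Ioc 0 a) (hq : 0 ≤ q) (hpq : p = q + 1) : x ^ p ≤ a ^ q * x := by
  rw [hpq, rpow_add hx.1, rpow_one]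
  have := rpow_le_rpow hx.1.le hx.2 hq
  have := hx.1
  gcongr

lemma Flow.V_abs (W : Flow lam Z m b1 b2 K Q V R) (hb1 : 0 < b1) {x ψ : ℝ} (hx : x ∈ Ioo 0 Z) (hψ : ψ ∈ Icc 0 m) :
    |V x ψ| ≤ b2 * x ^ (lam + 1) := by
  have h := W.V_ge x hx ψ hψ
  have h1 : 0 < b1 * x ^ (lam + 1) := mul_pos hb1 (rpow_pos_of_pos hx.1 _)
  rw [abs_of_pos (h1.trans_le h)]
  exact W.V_le x hx ψ hψ

lemma lip_cont {a m Λ : ℝ} {F : ℝ → ℝ → ℝ} (hΛ : 0 ≤ Λ)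
    (h : ∀ x ∈ Icc 0 a, ∀ y ∈ Icc 0 m, ∀ x' ∈ Icc 0 a, ∀ y' ∈ Icc 0 m, |F x' y' - F x y| ≤ Λ * (|x' - x| + |y' - y|)) :
    ContinuousOn (fun p : ℝ × ℝ => F p.1 p.2) (Icc 0 a ×ˢ Icc 0 m) := by
  refine (LipschitzOnWith.of_dist_le_mul (K := ⟨2 * Λ, by positivity⟩) fun p hp p' hp' => ?_).continuousOn
  have h1 := h p'.1 hp'.1 p'.2 hp'.2 p.1 hp.1 p.2 hp.2
  have h2 : |p.1 - p'.1| ≤ dist p p' := by rw [← Real.dist_eq]; exact le_max_left _ _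
  have h3 : |p.2 - p'.2| ≤ dist p p' := by rw [← Real.dist_eq]; exact le_max_right _ _
  rw [Real.dist_eq]
  calc _ ≤ Λ * (|p.1 - p'.1| + |p.2 - p'.2|) := h1
    _ ≤ Λ * (dist p p' + dist p p') := by gcongr
    _ = 2 * Λ * dist p p' := by ring

lemma Flow.c11 (W : Flow lam Z m b1 b2 K Q V R) (hm : 0 < m) (hlam : 2 < lam) (hb1 : 0 < b1) (hb2 : 0 < b2) (hK : 0 < K)
    (hζ : 0 < ζ) (hZ : ζ < Z) :
    ContinuousOn (fun p : ℝ × ℝ => Ze (fun x y => -(V x y)) p.1 p.2) (Icc 0 ζ ×ˢ Icc 0 m) ∧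
    ContDiffOn ℝ 1 (fun p : ℝ × ℝ => Ze Q p.1 p.2) (Icc 0 ζ ×ˢ Icc 0 m) ∧
    (∃ N, LipschitzOnWith N (fun p => fderivWithin ℝ (fun p : ℝ × ℝ => Ze Q p.1 p.2) (Icc 0 ζ ×ˢ Icc 0 m) p) (Icc 0 ζ ×ˢ Icc 0 m)) ∧
    ∃ N, LipschitzOnWith N (fun p : ℝ × ℝ => Ze Q p.1 p.2) (Icc 0 ζ ×ˢ Icc 0 m) := by
  have hsub : ∀ x ∈ Ioc 0 ζ, x ∈ Ioo 0 Z := fun x hx => ⟨hx.1, hx.2.trans_lt hZ⟩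
  obtain ⟨Λ, hΛd⟩ : ∃ Λ, Λ = b2 * ζ ^ lam + b2 * ζ ^ (3 * lam / 2) + K * ζ ^ lam + K * ζ ^ (5 * lam / 4 + 1 / 2) + K * ζ ^ (3 * lam / 2 + 1) := ⟨_, rfl⟩
  have p1 : 0 < b2 * ζ ^ lam := by positivity
  have p2 : 0 < b2 * ζ ^ (3 * lam / 2) := by positivity
  have p3 : 0 < K * ζ ^ lam := by positivity
  have p4 : 0 < K * ζ ^ (5 * lam / 4 + 1 / 2) := by positivity
  have p5 : 0 < K * ζ ^ (3 * lam / 2 + 1) := by positivity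
  have hΛ : 0 < Λ := by linarith
  have hVb : ∀ x ∈ Ioc 0 ζ, ∀ y ∈ Icc 0 m, |-(V x y)| ≤ Λ * x := by
    intro x hx y hy
    have hx0 := hx.1
    rw [abs_neg]
    calc |V x y| ≤ b2 * x ^ (lam + 1) := W.V_abs hb1 (hsub x hx) hy
      _ ≤ b2 * (ζ ^ lam * x) := by have := pw_split (p := lam + 1) hx (q := lam) (by linarith) rfl; gcongr
      _ = (b2 * ζ ^ lam) * x := by ring
      _ ≤ Λ * x := by gcongr; linarith
  have hRb : ∀ x ∈ Ioc 0 ζ, ∀ y ∈ Icc 0 m, |R x y| ≤ Λ * x := by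
    intro x hx y hy
    have hx0 := hx.1
    calc |R x y| ≤ b2 * x ^ (3 * lam / 2 + 1) := W.R_le x (hsub x hx) y hy
      _ ≤ b2 * (ζ ^ (3 * lam / 2) * x) := by have := pw_split (p := 3 * lam / 2 + 1) hx (q := 3 * lam / 2) (by linarith) rfl; gcongr
      _ = (b2 * ζ ^ (3 * lam / 2)) * x := by ring
      _ ≤ Λ * x := by gcongr; linarith
  have up : ∀ p : ℝ, 0 ≤ p → K * ζ ^ p ≤ Λ → ∀ x ∈ Ioc 0 ζ, ∀ d : ℝ, 0 ≤ d → K * x ^ p * d ≤ Λ * d := by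
    intro p hp h x hx d hd
    have := rpow_le_rpow hx.1.le hx.2 hp
    have : K * x ^ p ≤ Λ := le_trans (by gcongr) h
    gcongr
  have lV := Ze_lip (F := fun x y => -(V x y)) (m := m) (a := ζ) hΛ.le hVb (by
      intro x hx x' hx' hh y hy
      rw [show -(V x' y) - -(V x y) = -(V x' y - V x y) by ring, abs_neg]
      exact (W.Vx x (hsub x hx) x' (hsub x' hx') hh y hy).trans (up _ (by linarith) (by linarith) x' hx' _ (by linarith))) (by
      intro x hx y hy y' hy'
      rw [show -(V x y') - -(V x y) = -(V x y' - V x y) by ring, abs_neg]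
      exact (W.Vy x (hsub x hx) y hy y' hy').trans (up _ (by linarith) (by linarith) x hx _ (abs_nonneg _)))
  have lR := Ze_lip (F := R) (m := m) (a := ζ) hΛ.le hRb (by
      intro x hx x' hx' hh y hy
      exact (W.Rx x (hsub x hx) x' (hsub x' hx') hh y hy).trans (up _ (by linarith) (by linarith) x' hx' _ (by linarith))) (by
      intro x hx y hy y' hy'
      exact (W.Ry x (hsub x hx) y hy y' hy').trans (up _ (by linarith) (by linarith) x hx _ (abs_nonneg _)))
  have zb : ∀ F : ℝ → ℝ → ℝ, (∀ x ∈ Ioc 0 ζ, ∀ y ∈ Icc 0 m, |F x y| ≤ Λ * x) →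
      ∀ x ∈ Icc 0 ζ, ∀ y ∈ Icc 0 m, |Ze F x y| ≤ Λ * ζ := by
    intro F hF x hx y hy
    rcases hx.1.eq_or_lt with h | h
    · rw [← h, Ze_neg (x := 0) le_rfl, abs_zero]; positivity
    · rw [Ze_pos h]; exact (hF x ⟨h, hx.2⟩ y hy).trans (by have := hx.2; gcongr)
  refine ⟨lip_cont hΛ.le lV, ?_⟩
  refine c11_of (P := Ze fun x y => -(V x y)) (R := Ze R) hζ hm hΛ.le ?_ ?_ lV lR (M := Λ * ζ) (by positivity) (zb _ hVb) (zb _ hRb)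
  · intro x hx y hy
    rcases hx.1.eq_or_lt with h | h
    · rw [← h, Ze_neg (x := 0) le_rfl]
      have hO : (fun x => Ze Q x y) =O[nhdsWithin 0 (Icc 0 ζ)] fun x => |x| ^ (lam + 2) := by
        refine Asymptotics.IsBigO.of_bound ((b1 + b2) / (lam + 2)) ?_
        filter_upwards [self_mem_nhdsWithin] with t ht
        rw [Real.norm_eq_abs, Real.norm_eq_abs, abs_of_nonneg ht.1, abs_of_nonneg (rpow_nonneg ht.1 _)]
        rcases ht.1.eq_or_lt with h' | h'
        · rw [Ze_neg (by rw [← h']), abs_zero]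
          have := rpow_nonneg ht.1 (lam + 2)
          positivity
        · rw [Ze_pos h', abs_le]
          obtain ⟨e1, e2⟩ := W.Q_bd hlam (hsub t ⟨h', ht.2⟩) hy
          have q1 : 0 ≤ b1 / (lam + 2) * t ^ (lam + 2) := by positivity
          have q2 : 0 ≤ b2 / (lam + 2) * t ^ (lam + 2) := by positivity
          rw [add_div, add_mul]
          constructor <;> linarith
      have ho : (fun x : ℝ => |x| ^ (lam + 2)) =o[nhds 0] fun x => x - 0 := by
        have h1 : (fun x : ℝ => |x| ^ (lam + 2)) = fun x : ℝ => |x| ^ (lam + 1) * |x| := by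
          funext t
          rcases eq_or_ne t 0 with h | h
          · rw [h, abs_zero, Real.zero_rpow (by linarith), mul_zero]
          · rw [← rpow_add_one (abs_pos.2 h).ne']; congr 1; ring
        rw [h1]
        have h2 : (fun x : ℝ => |x| ^ (lam + 1)) =o[nhds 0] fun _ => (1 : ℝ) := by
          rw [Asymptotics.isLittleO_one_iff]
          have h3 : Tendsto (fun x : ℝ => |x| ^ (lam + 1)) (nhds 0) (nhds (|(0:ℝ)| ^ (lam + 1))) :=
            (continuous_abs.rpow_const (fun _ => Or.inr (by linarith))).tendsto 0
          rwa [abs_zero, Real.zero_rpow (by linarith)] at h3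
        have h4 := h2.mul_isBigO (Asymptotics.isBigO_refl (fun x : ℝ => |x|) (nhds 0))
        refine h4.trans_isBigO ?_
        refine Asymptotics.IsBigO.of_bound 1 (Eventually.of_forall fun t => ?_)
        simp
      refine (hasDerivWithinAt_iff_isLittleO).2 ?_
      have := hO.trans_isLittleO (ho.mono nhdsWithin_le_nhds)
      refine this.congr_left fun t => ?_
      simp [Ze]
    · rw [Ze_pos h]
      refine HasDerivAt.hasDerivWithinAt ((W.dx x (hsub x ⟨h, hx.2⟩) y hy).congr_of_eventuallyEq ?_)
      filter_upwards [Ioi_mem_nhds h] with t ht using Ze_pos ht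
  · intro x hx y hy
    rcases hx.1.eq_or_lt with h | h
    · rw [← h, Ze_neg (x := 0) le_rfl]
      exact (hasDerivWithinAt_const y _ (0 : ℝ)).congr (fun t _ => Ze_neg le_rfl) (Ze_neg le_rfl)
    · rw [Ze_pos h]
      exact (W.dy x (hsub x ⟨h, hx.2⟩) y hy).congr (fun t _ => Ze_pos h) (Ze_pos h)

lemma Flow.pdx_eq (W : Flow lam Z m b1 b2 K Q V R) {p : ℝ × ℝ} (hx : p.1 ∈ Ioo 0 Z) (hy : p.2 ∈ Icc 0 m) :
    pdx (fun p : ℝ × ℝ => Ze Q p.1 p.2) p = -(V p.1 p.2) := by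
  refine HasDerivAt.deriv ((W.dx p.1 hx p.2 hy).congr_of_eventuallyEq ?_)
  filter_upwards [Ioi_mem_nhds hx.1] with t ht using Ze_pos ht

lemma Flow.pdy_eq (W : Flow lam Z m b1 b2 K Q V R) {p : ℝ × ℝ} (hx : p.1 ∈ Ioo 0 Z) (hy : p.2 ∈ Ioo 0 m) :
    pdy (fun p : ℝ × ℝ => Ze Q p.1 p.2) p = R p.1 p.2 := by
  refine HasDerivAt.deriv (((W.dy p.1 hx p.2 (Ioo_subset_Icc_self hy)).hasDerivAt (Icc_mem_nhds hy.1 hy.2)).congr_of_eventuallyEq ?_)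
  exact Eventually.of_forall fun t => Ze_pos hx.1

lemma Flow.second (W : Flow lam Z m b1 b2 K Q V R) {p : ℝ × ℝ} (hx : p.1 ∈ Ioo 0 Z) (hy : p.2 ∈ Ioo 0 m) :
    |pdx (pdx fun p : ℝ × ℝ => Ze Q p.1 p.2) p| ≤ K * p.1 ^ lam ∧
    |pdx (pdy fun p : ℝ × ℝ => Ze Q p.1 p.2) p| ≤ K * p.1 ^ (5 * lam / 4 + 1 / 2) ∧
    |pdy (pdy fun p : ℝ × ℝ => Ze Q p.1 p.2) p| ≤ K * p.1 ^ (3 * lam / 2 + 1) := by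
  have hy' := Ioo_subset_Icc_self hy
  have cp : ∀ r : ℝ, ContinuousAt (fun t : ℝ => K * t ^ r) p.1 := fun r =>
    (Real.continuousAt_rpow_const _ r (Or.inl hx.1.ne')).const_mul K
  refine ⟨?_, ?_, ?_⟩
  · rw [show pdx (pdx fun p : ℝ × ℝ => Ze Q p.1 p.2) p = deriv (fun x => -(V x p.2)) p.1 from
      Filter.EventuallyEq.deriv_eq (by
        filter_upwards [Ioo_mem_nhds hx.1 hx.2] with t ht using W.pdx_eq (p := (t, p.2)) ht hy')]
    refine deriv_bd (c := fun t => K * t ^ lam) hx (cp _) fun s hs t ht hst => ?_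
    rw [show -(V t p.2) - -(V s p.2) = -(V t p.2 - V s p.2) by ring, abs_neg]
    exact W.Vx s hs t ht hst p.2 hy'
  · rw [show pdx (pdy fun p : ℝ × ℝ => Ze Q p.1 p.2) p = deriv (fun x => R x p.2) p.1 from
      Filter.EventuallyEq.deriv_eq (by
        filter_upwards [Ioo_mem_nhds hx.1 hx.2] with t ht using W.pdy_eq (p := (t, p.2)) ht hy)]
    exact deriv_bd (c := fun t => K * t ^ (5 * lam / 4 + 1 / 2)) hx (cp _) fun s hs t ht hst => W.Rx s hs t ht hst p.2 hy'
  · rw [show pdy (pdy fun p : ℝ × ℝ => Ze Q p.1 p.2) p = deriv (fun y => R p.1 y) p.2 from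
      Filter.EventuallyEq.deriv_eq (by
        filter_upwards [Ioo_mem_nhds hy.1 hy.2] with t ht using W.pdy_eq (p := (p.1, t)) hx ht)]
    refine deriv_bd (c := fun _ => K * p.1 ^ (3 * lam / 2 + 1)) hy continuousAt_const fun s hs t ht hst => ?_
    have := W.Ry p.1 hx s (Ioo_subset_Icc_self hs) t (Ioo_subset_Icc_self ht)
    rwa [abs_of_nonneg (sub_nonneg.2 hst)] at this

end Nozzle

namespace Nozzle

variable {γ lam L l m a1 a2 K2 ζ Z : ℝ} {f qm X : ℝ → ℝ} {q V R T Tx : ℝ → ℝ → ℝ}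

lemma Sol.wk (S : Sol γ lam L m a1 a2 K2 f qm q V R T Tx) (I : Inv γ L l ζ Z f qm X) (hc : 0 < cstar γ) (hT : Continuous (ThP f))
    (hL : L ≤ 1) (hm : 0 < m) (hlam : 2 < lam) (ha1 : 0 < a1) (ha2 : 0 < a2) (hK : 0 < K2)
    (hcV : ContinuousOn (fun p : ℝ × ℝ => Ze (fun x y => -(V (X x) y)) p.1 p.2) (Icc 0 ζ ×ˢ Icc 0 m)) :
    Wk ζ m (K2 / cstar γ + a2) (fun x y => T (X x) y)
      (fun x y => Tx (X x) y * (cos (ThP f (X x)) / qm (X x))) (fun x y => V (X x) y) := by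
  have hsub : ∀ x ∈ Ioc 0 ζ, x ∈ Ioo 0 Z := fun x hx => ⟨hx.1, hx.2.trans_lt I.hZ⟩
  have cX : ContinuousOn (fun p : ℝ × ℝ => X p.1) (Ioc 0 ζ ×ˢ Icc 0 m) := by
    have h : ContinuousOn X (Ioc 0 ζ) := fun x hx => (I.dX x (hsub x hx)).continuousAt.continuousWithinAt
    exact h.comp continuousOn_fst fun p hp => hp.1
  have hkb : ∀ x ∈ Ioc 0 ζ, |cos (ThP f (X x)) / qm (X x)| ≤ 1 / cstar γ := by
    intro x hx
    have h := I.hX x (hsub x hx)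
    have h1 := S.qm_ge _ h
    rw [abs_div, abs_of_pos (hc.trans_le h1)]
    exact div_le_div₀ zero_le_one (Real.abs_cos_le_one _) hc h1
  have h0 : 0 < K2 / cstar γ := by positivity
  constructor
  · exact I.hζ
  · exact hm
  · positivity
  · exact fun x hx y hy => (S.dTx _ (I.hX x (hsub x hx)) y hy).comp x (I.dX x (hsub x hx))
  · exact fun x hx y hy => S.dTy _ (I.hX x (hsub x hx)) y hy
  · refine ContinuousOn.mul ?_ (ContinuousOn.div ?_ ?_ ?_)
    · exact S.cTx.comp (f := fun p : ℝ × ℝ => (X p.1, p.2)) (cX.prodMk continuousOn_snd) fun p hp => ⟨I.hX _ (hsub _ hp.1), hp.2⟩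
    · exact (Real.continuous_cos.comp hT).comp_continuousOn cX
    · exact S.cqm.comp cX fun p hp => I.hX _ (hsub _ hp.1)
    · exact fun p hp => (hc.trans_le (S.qm_ge _ (I.hX _ (hsub _ hp.1)))).ne'
  · refine ((hcV.mono (prod_mono Ioc_subset_Icc_self le_rfl)).neg).congr fun p hp => ?_
    simp only [Pi.neg_apply]
    rw [Ze_pos hp.1.1, neg_neg]
  · intro x hx y hy
    have h := I.hX x (hsub x hx)
    rw [abs_mul]
    calc _ ≤ K2 * (1 / cstar γ) := mul_le_mul (S.Tx_le _ h y hy) (hkb x hx) (abs_nonneg _) hK.le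
      _ = K2 / cstar γ := by ring
      _ ≤ _ := by linarith
  · intro x hx y hy
    have h := I.hX x (hsub x hx)
    have h1 := S.V_ge _ h y hy
    have h2 : 0 < a1 * X x ^ (lam + 1) := mul_pos ha1 (rpow_pos_of_pos h.1 _)
    rw [abs_of_pos (h2.trans_le h1)]
    have h3 := S.V_le _ h y hy
    have h4 : X x ^ (lam + 1) ≤ 1 := rpow_le_one h.1.le (h.2.le.trans hL) (by linarith)
    nlinarith
  · intro x hx y hy
    have h := I.hX x (hsub x hx)
    have hx0 := hx.1
    have h1 : X x ≤ x / cstar γ := by rw [le_div_iff₀ hc]; linarith [I.X_le x (hsub x hx)]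
    calc _ ≤ K2 * X x := S.T_le _ h y hy
      _ ≤ K2 * (x / cstar γ) := by gcongr
      _ = K2 / cstar γ * x := by ring
      _ ≤ _ := by gcongr; linarith
  · exact fun x hx => S.T0 _ (I.hX x (hsub x hx))

lemma AplusInv_zero (hγ : 1 < γ) : AplusInv γ 0 = cstar γ := by
  obtain ⟨ηm, s, r, qt, k, Qf, G⟩ := exists_gas hγ one_pos
  have := G.inv 0 ⟨le_rfl, G.hηm⟩
  rwa [G.Q0, G.qt0] at this

/-- the weak formulation -/
lemma Sol.weak {b1 b2 K : ℝ} (S : Sol γ lam L m a1 a2 K2 f qm q V R T Tx) (I : Inv γ L l ζ Z f qm X)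
    (W : Flow lam Z m b1 b2 K (fun x => q (X x)) (fun x => V (X x)) (fun x => R (X x))) {M : ℝ}
    (H : Wk ζ m M (fun x y => T (X x) y) (fun x y => Tx (X x) y * (cos (ThP f (X x)) / qm (X x))) (fun x y => V (X x) y))
    (hm : 0 < m) {ξ : ℝ × ℝ → ℝ} (hξ : ContDiff ℝ 1 ξ) (h0 : ∀ y ∈ Ioo 0 m, ξ (ζ, y) = 0) :
    (∫ p in Ioo (0 : ℝ) ζ ×ˢ Ioo (0 : ℝ) m,
        (pdx (fun p : ℝ × ℝ => Ze (fun x => q (X x)) p.1 p.2) p * pdx ξ p -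
          bfun γ (Ze (fun x => q (X x)) p.1 p.2) * pdy (fun p : ℝ × ℝ => Ze (fun x => q (X x)) p.1 p.2) p * pdy ξ p))
    - (∫ φ in Ioo (0 : ℝ) ζ,
        deriv (ThP f) (XP f (Qpf γ qm) l φ) * cos (ThP f (XP f (Qpf γ qm) l φ)) /
          AplusInv γ (Ze (fun x => q (X x)) φ m) * ξ (φ, m)) = 0 := by
  have hsub : ∀ x ∈ Ioo 0 ζ, x ∈ Ioo 0 Z := fun x hx => ⟨hx.1, hx.2.trans I.hZ⟩
  rw [sub_eq_zero]
  refine Eq.trans (setIntegral_congr_fun (measurableSet_Ioo.prod measurableSet_Ioo) ?_)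
    ((H.weak hξ h0).trans (setIntegral_congr_fun measurableSet_Ioo ?_))
  · intro p hp
    have hx := hsub _ hp.1
    simp only []
    rw [W.pdx_eq hx (Ioo_subset_Icc_self hp.2), W.pdy_eq hx hp.2, Ze_pos hx.1, S.hb _ (I.hX _ hx) _ (Ioo_subset_Icc_self hp.2)]
    ring
  · intro x hx
    have hx' := hsub x hx
    have hX := I.hX x hx'
    simp only []
    rw [I.XP_eq x ⟨hx.1, hx.2.le⟩, Ze_pos hx.1, S.inv _ hX]
    have h1 : HasDerivAt (ThP f) (Tx (X x) m) (X x) := by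
      refine (S.dTx _ hX m ⟨hm.le, le_rfl⟩).congr_of_eventuallyEq ?_
      filter_upwards [Ioo_mem_nhds hX.1 hX.2] with t ht using (S.Tm t ht).symm
    rw [h1.deriv]
    ring

end Nozzle

open Nozzle

/-- existence of a `C^{1,1}` sonic–supersonic flow in the divergent
part of the nozzle (Theorem `rr-theorem`). -/
theorem stmt_6 (γ : ℝ) (hγ : 1 < γ) (m lamp δ1 δ2 : ℝ)
    (hm : 0 < m) (hlam : 2 < lamp) (hδ1 : 0 < δ1) (hδ12 : δ1 ≤ δ2) :
    ∃ C1 C2 : ℝ, 0 < C1 ∧ C1 ≤ C2 ∧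
    ∀ δ3 : ℝ, 0 < δ3 →
    ∃ δt0 C3 : ℝ, 0 < δt0 ∧ 0 < C3 ∧
    ∀ l : ℝ, 0 < l → l ≤ δt0 → l ≤ 1 →
    ∀ f : ℝ → ℝ, NozzlePlus lamp δ1 δ2 l f →
      f 0 * cstar γ ^ (1 + 2 / (γ - 1) : ℝ) = m →
      (∀ x ∈ Icc (0 : ℝ) l, |deriv (deriv (deriv f)) x| ≤ δ3 * x ^ (lamp - 1)) →
    ∃ Qp : ℝ → ℝ, ∃ Q : ℝ × ℝ → ℝ,
      ContinuousOn Qp (Icc 0 l) ∧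
      (∀ x ∈ Icc (0 : ℝ) l, cstar γ ≤ Qp x ∧ Qp x ≤ (cstar γ + qmaxF γ) / 2) ∧
      SupersonicWeakSol γ m l f Qp Q ∧
      (∀ x ∈ Icc (0 : ℝ) l, Qp x = AplusInv γ (Q (PhiP f Qp x, m))) ∧
      -- Q ∈ C^{1,1}([0,ζ₊]×[0,m])
      ContDiffOn ℝ 1 Q (Icc 0 (zetaP f Qp l) ×ˢ Icc 0 m) ∧
      (∃ L : NNReal, LipschitzOnWith L
        (fun p => fderivWithin ℝ Q (Icc 0 (zetaP f Qp l) ×ˢ Icc 0 m) p)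
        (Icc 0 (zetaP f Qp l) ×ˢ Icc 0 m)) ∧
      -- first-order bounds
      (∀ p ∈ Ioo (0 : ℝ) (zetaP f Qp l) ×ˢ Ioo (0 : ℝ) m,
        (-C2 * p.1 ^ (lamp + 2) ≤ Q p ∧ Q p ≤ -C1 * p.1 ^ (lamp + 2)) ∧
        (-C2 * p.1 ^ (lamp + 1) ≤ pdx Q p ∧ pdx Q p ≤ -C1 * p.1 ^ (lamp + 1)) ∧
        |pdy Q p| ≤ C2 * p.1 ^ (3 * lamp / 2 + 1)) ∧
      -- second-order bounds
      (∀ p ∈ Ioo (0 : ℝ) (zetaP f Qp l) ×ˢ Ioo (0 : ℝ) m,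
        |pdx (pdx Q) p| ≤ C3 * p.1 ^ lamp ∧
        |pdx (pdy Q) p| ≤ C3 * p.1 ^ (5 * lamp / 4 + 1 / 2) ∧
        |pdy (pdy Q) p| ≤ C3 * p.1 ^ (3 * lamp / 2 + 1)) := by
  have hc := cstar_pos hγ
  obtain ⟨a1, a2, ha1, ha2, H⟩ := exists_sol hγ hm hlam hδ1 hδ12
  obtain ⟨D, hD⟩ : ∃ D, D = max 1 (1 / cstar γ) := ⟨_, rfl⟩
  have hD0 : 0 < D := zero_lt_one.trans_le (hD ▸ le_max_left _ _)
  obtain ⟨b1, hb1d⟩ : ∃ b1, b1 = a1 / (2 * cstar γ) ^ (lamp + 1) := ⟨_, rfl⟩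
  obtain ⟨b2, hb2d⟩ : ∃ b2, b2 = a2 * D ^ (3 * lamp / 2 + 2) := ⟨_, rfl⟩
  have hb1 : 0 < b1 := by rw [hb1d]; positivity
  have hb2 : 0 < b2 := by rw [hb2d]; positivity
  have hb1l : b1 / (lamp + 2) ≤ b1 := div_le_self hb1.le (by linarith)
  have hb2l : b2 / (lamp + 2) ≤ b2 := div_le_self hb2.le (by linarith)
  refine ⟨b1 / (lamp + 2), b1 + b2, by positivity, by linarith, fun δ3 hδ3 => ?_⟩
  obtain ⟨L0, K2, hL0, hK2, H⟩ := H δ3 hδ3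
  obtain ⟨K, hKd⟩ : ∃ K, K = K2 * D ^ (3 * lamp / 2 + 2) * D := ⟨_, rfl⟩
  have hK : 0 < K := by rw [hKd]; positivity
  refine ⟨L0, K, hL0, hK, fun l hl hlL0 _ f hf _ h3 => ?_⟩
  obtain ⟨L, hlL, hL1, qm, q, V, R, T, Tx, S⟩ := H l hl hlL0 f hf h3
  have hT : Continuous (ThP f) := cThP hf.1
  obtain ⟨Z, X, I⟩ := S.exists_X hT hf.2.2.1 hc hl hlL
  have W := S.flow I hc hlam ha1 ha2 hK2 hD
  rw [← hb1d, ← hb2d, ← hKd] at W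
  obtain ⟨cV, cQ, lQ', lQ⟩ := W.c11 hm hlam hb1 hb2 hK I.hζ I.hZ
  have HW := S.wk I hc hT hL1 hm hlam ha1 ha2 hK2 cV
  have hsub : ∀ x ∈ Ioo 0 (zetaP f (Qpf γ qm) l), x ∈ Ioo 0 Z := fun x hx => ⟨hx.1, hx.2.trans I.hZ⟩
  have hA0 := AplusInv_zero hγ
  have hqm : cstar γ ≤ (cstar γ + qmaxF γ) / 2 := by
    have := cstar_lt hγ
    linarith
  refine ⟨Qpf γ qm, fun p => Ze (fun x => q (X x)) p.1 p.2, S.c_Qpf.mono fun x hx => hx.2.trans_lt hlL, ?_, ?_, ?_, cQ, lQ', ?_, ?_⟩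
  · intro x hx
    rcases hx.1.eq_or_lt with h | h
    · rw [← h, Qpf_neg le_rfl]; exact ⟨le_rfl, hqm⟩
    · rw [Qpf_pos h]; exact ⟨S.qm_ge x ⟨h, hx.2.trans_lt hlL⟩, S.qm_le x ⟨h, hx.2.trans_lt hlL⟩⟩
  · refine ⟨lQ, ?_, fun ψ _ => Ze_neg le_rfl, fun ξ hξ h0 => S.weak I W HW hm hξ h0⟩
    intro p hp
    rcases hp.1.1.eq_or_lt with h | h
    · exact (Ze_neg h.ge).le
    · refine le_of_eq_of_le (Ze_pos h) ?_; exact S.q_le _ (I.hX _ ⟨h, hp.1.2.trans_lt I.hZ⟩) _ hp.2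
  · intro x hx
    simp only []
    rcases hx.1.eq_or_lt with h | h
    · rw [← h, Qpf_neg le_rfl, Ze_neg (by simp [PhiP]), hA0]
    · obtain ⟨e1, e2⟩ := I.X_Phi x ⟨h, hx.2⟩
      rw [Qpf_pos h, Ze_pos e2.1, e1, S.inv x ⟨h, hx.2.trans_lt hlL⟩]
  · intro p hp
    have hx := hsub _ hp.1
    have hy := Ioo_subset_Icc_self hp.2
    obtain ⟨e1, e2⟩ := W.Q_bd hlam hx hy
    have e3 := W.V_ge _ hx _ hy
    have e4 := W.V_le _ hx _ hy
    have e5 := W.R_le _ hx _ hy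
    have p1 : 0 < p.1 ^ (lamp + 1) := Real.rpow_pos_of_pos hx.1 _
    have p2 : 0 < p.1 ^ (lamp + 2) := Real.rpow_pos_of_pos hx.1 _
    have p3 : 0 < p.1 ^ (3 * lamp / 2 + 1) := Real.rpow_pos_of_pos hx.1 _
    have q1 := mul_pos hb1 p1
    have q2 := mul_pos hb1 p2
    have q3 := mul_pos hb1 p3
    have r1 := mul_le_mul_of_nonneg_right hb1l p1.le
    have r2 := mul_le_mul_of_nonneg_right hb2l p2.le
    rw [W.pdx_eq hx hy, W.pdy_eq hx hp.2]
    simp only [Ze_pos hx.1]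
    refine ⟨⟨?_, ?_⟩, ⟨?_, ?_⟩, ?_⟩ <;> linarith
  · intro p hp
    exact W.second (hsub _ hp.1) hp.2
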